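/- (Carleman inequality for fractional Laplacians) Let n ≥ 3, 0 < α < n, and V ∈ 𝓛^{α,p} nonnegative with p > (n−1)/α. Then there exist a sequence t_m → ∞ (m = 0,1,2,...) and constants C, β > 0 independent of m and r such that for all f with f, (−Δ)^{α/2} f ∈ C_0^∞(ℝⁿ∖{0}) and all r > 0: ‖χ_{B(0,r)} |x|^{−t_m−(n−α)/2} f‖_{L²(V)} ≤ C ‖χ_{B(0,r)} V‖_{𝓛^{α,p}}^β ‖|x|^{−t_m−(n−α)/2} (−Δ)^{α/2} f‖_{L²(V^{−1})}. -/

import Mathlib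

open MeasureTheory ENNReal Metric Set Filter
open scoped FourierTransform
noncomputable section

abbrev Euc (n : ℕ) := EuclideanSpace ℝ (Fin n)

/-- The axis-parallel cube with corner `a` and side length `s`. -/
def cube {n : ℕ} (a : Fin n → ℝ) (s : ℝ) : Set (Euc n) :=
  {x | ∀ i, a i ≤ x i ∧ x i ≤ a i + s}

/-- The Morrey norm `‖V‖_{𝓛^{α,p}} = sup_Q |Q|^{α/n} ((1/|Q|)∫_Q V^p)^{1/p}`. -/
def morrey (n : ℕ) (α p : ℝ) (V : Euc n → ℝ) : ℝ≥0∞ :=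
  ⨆ (a : Fin n → ℝ) (s : ℝ) (_ : 0 < s),
    volume (cube a s) ^ (α / n) *
      ((volume (cube a s))⁻¹ * ∫⁻ y in cube a s, ENNReal.ofReal (V y ^ p)) ^ (1 / p)

def farC (γ s : ℝ) : ℝ := 2 ^ γ / (1 - 2 ^ (γ - s))
def nearC (γ s : ℝ) : ℝ := 2 ^ s / (1 - 2 ^ (s - γ))

lemma hasSum_geo2 {e : ℝ} (he : e < 0) (c : ℝ) :
    HasSum (fun j : ℕ => c * (2 : ℝ) ^ (j * e)) (c / (1 - 2 ^ e)) := by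
  have h1 : (2 : ℝ) ^ e < 1 := Real.rpow_lt_one_of_one_lt_of_neg (by norm_num) he
  have := (hasSum_geometric_of_lt_one (by positivity) h1).mul_left c
  simpa only [← Real.rpow_natCast, ← Real.rpow_mul (by norm_num : (0:ℝ) ≤ 2), mul_comm e,
    ← div_eq_mul_inv] using this

lemma far_lemma {X : Type*} [PseudoMetricSpace X] [MeasurableSpace X] [OpensMeasurableSpace X]
    (ρ : Measure X) (K : ℝ≥0∞) {γ s : ℝ} (h : γ < s) (hs : 0 ≤ s) (x : X)
    (hK : ∀ R : ℝ, 0 < R → ρ (ball x R) ≤ K * ENNReal.ofReal (R ^ γ)) {R : ℝ} (hR : 0 < R) :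
    ∫⁻ w, ENNReal.ofReal ((max R (dist w x)) ^ (-s)) ∂ρ
      ≤ K * ENNReal.ofReal (farC γ s * R ^ (γ - s)) := by
  have hpt : ∀ w, ENNReal.ofReal ((max R (dist w x)) ^ (-s)) ≤
      ∑' j : ℕ, (ball x (2 ^ (j + 1) * R)).indicator
        (fun _ => ENNReal.ofReal ((2 ^ j * R) ^ (-s))) w := by
    intro w
    obtain ⟨j, hj1, hj2⟩ : ∃ j : ℕ, w ∈ ball x (2 ^ (j + 1) * R) ∧ 2 ^ j * R ≤ max R (dist w x) := by
      have hex : ∃ j : ℕ, dist w x < 2 ^ (j + 1) * R := by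
        obtain ⟨j, hj⟩ := pow_unbounded_of_one_lt (dist w x / R) (by norm_num : (1:ℝ) < 2)
        refine ⟨j, ?_⟩
        rw [div_lt_iff₀ hR] at hj
        refine hj.trans_le ?_
        gcongr <;> first | norm_num | omega
      classical
      refine ⟨Nat.find hex, mem_ball.2 (Nat.find_spec hex), ?_⟩
      rcases Nat.eq_zero_or_pos (Nat.find hex) with h0 | h0
      · rw [h0]; simp
      · have := Nat.find_min hex (m := Nat.find hex - 1) (by omega)
        rw [not_lt, Nat.sub_add_cancel h0] at this
        exact this.trans (le_max_right _ _)
    refine le_trans ?_ (ENNReal.le_tsum j)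
    rw [indicator_of_mem hj1]
    apply ENNReal.ofReal_le_ofReal
    exact Real.rpow_le_rpow_of_nonpos (by positivity) hj2 (by linarith)
  calc _ ≤ ∫⁻ w, ∑' j : ℕ, (ball x (2 ^ (j + 1) * R)).indicator
        (fun _ => ENNReal.ofReal ((2 ^ j * R) ^ (-s))) w ∂ρ := lintegral_mono hpt
    _ = ∑' j : ℕ, ENNReal.ofReal ((2 ^ j * R) ^ (-s)) * ρ (ball x (2 ^ (j + 1) * R)) := by
        rw [lintegral_tsum fun j => (measurable_const.indicator measurableSet_ball).aemeasurable]
        congr 1; ext j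
        rw [lintegral_indicator_const measurableSet_ball]
    _ ≤ ∑' j : ℕ, K * ENNReal.ofReal (2 ^ γ * R ^ (γ - s) * 2 ^ (j * (γ - s))) := by
        refine ENNReal.tsum_le_tsum fun j => ?_
        refine (mul_le_mul_right (hK (2 ^ (j + 1) * R) (by positivity)) _).trans (le_of_eq ?_)
        rw [mul_left_comm, ← ENNReal.ofReal_mul (by positivity)]
        congr 2
        rw [Real.mul_rpow (by positivity) hR.le, Real.mul_rpow (by positivity) hR.le,
          ← Real.rpow_natCast, ← Real.rpow_natCast, ← Real.rpow_mul (by norm_num),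
          ← Real.rpow_mul (by norm_num), sub_eq_add_neg γ s, Real.rpow_add hR]
        have : (2:ℝ) ^ (((j + 1 : ℕ) : ℝ) * γ) * 2 ^ ((j:ℝ) * -s) = 2 ^ γ * 2 ^ (j * (γ + -s)) := by
          rw [← Real.rpow_add (by norm_num), ← Real.rpow_add (by norm_num)]
          congr 1; push_cast; ring
        linear_combination (R ^ γ * R ^ (-s)) * this
    _ = _ := by
        rw [ENNReal.tsum_mul_left]
        congr 1
        have hs := hasSum_geo2 (sub_neg.2 h) (2 ^ γ * R ^ (γ - s))
        rw [← ENNReal.ofReal_tsum_of_nonneg (fun j => by positivity) hs.summable, hs.tsum_eq, farC]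
        congr 1; ring

lemma near_lemma {X : Type*} [PseudoMetricSpace X] [MeasurableSpace X] [OpensMeasurableSpace X]
    (ρ : Measure X) (K : ℝ≥0∞) {γ s : ℝ} (h : s < γ) (hs : 0 ≤ s) (x : X)
    (hK : ∀ R : ℝ, 0 < R → ρ (ball x R) ≤ K * ENNReal.ofReal (R ^ γ)) {R : ℝ} (hR : 0 < R) :
    ∫⁻ w in ball x R, ENNReal.ofReal ((dist w x) ^ (-s)) ∂ρ
      ≤ K * ENNReal.ofReal (nearC γ s * R ^ (γ - s)) := by
  rw [← lintegral_indicator measurableSet_ball]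
  have hpt : ∀ w, (ball x R).indicator (fun w => ENNReal.ofReal ((dist w x) ^ (-s))) w ≤
      ∑' j : ℕ, (ball x ((2 ^ j)⁻¹ * R)).indicator
        (fun _ => ENNReal.ofReal (((2 ^ (j + 1))⁻¹ * R) ^ (-s))) w := by
    intro w
    by_cases hw : w ∈ ball x R
    swap
    · rw [indicator_of_notMem hw]; exact zero_le
    rw [indicator_of_mem hw]
    rcases eq_or_lt_of_le (dist_nonneg (x := w) (y := x)) with h0 | h0
    · rw [← h0]
      rcases eq_or_lt_of_le hs with h1 | h1
      · refine le_trans ?_ (ENNReal.le_tsum 0)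
        rw [← h1, indicator_of_mem (by simpa using hw)]; simp
      · rw [Real.zero_rpow (by linarith)]; simp
    obtain ⟨j, hj1, hj2⟩ : ∃ j : ℕ, w ∈ ball x ((2 ^ j)⁻¹ * R) ∧ (2 ^ (j + 1))⁻¹ * R ≤ dist w x := by
      have hex : ∃ j : ℕ, (2 ^ (j + 1))⁻¹ * R ≤ dist w x := by
        obtain ⟨j, hj⟩ := pow_unbounded_of_one_lt (R / dist w x) (by norm_num : (1:ℝ) < 2)
        refine ⟨j, ?_⟩
        rw [div_lt_iff₀ h0] at hj
        rw [inv_mul_le_iff₀ (by positivity)]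
        refine hj.le.trans ?_
        gcongr <;> first | norm_num | omega
      classical
      refine ⟨Nat.find hex, mem_ball.2 ?_, Nat.find_spec hex⟩
      rcases Nat.eq_zero_or_pos (Nat.find hex) with h0 | h0
      · rw [h0]; simpa using hw
      · have := Nat.find_min hex (m := Nat.find hex - 1) (by omega)
        rwa [not_le, Nat.sub_add_cancel h0] at this
    refine le_trans ?_ (ENNReal.le_tsum j)
    rw [indicator_of_mem hj1]
    apply ENNReal.ofReal_le_ofReal
    exact Real.rpow_le_rpow_of_nonpos (by positivity) hj2 (by linarith)
  calc _ ≤ ∫⁻ w, ∑' j : ℕ, (ball x ((2 ^ j)⁻¹ * R)).indicator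
        (fun _ => ENNReal.ofReal (((2 ^ (j + 1))⁻¹ * R) ^ (-s))) w ∂ρ := lintegral_mono hpt
    _ = ∑' j : ℕ, ENNReal.ofReal (((2 ^ (j + 1))⁻¹ * R) ^ (-s)) * ρ (ball x ((2 ^ j)⁻¹ * R)) := by
        rw [lintegral_tsum fun j => (measurable_const.indicator measurableSet_ball).aemeasurable]
        congr 1; ext j
        rw [lintegral_indicator_const measurableSet_ball]
    _ ≤ ∑' j : ℕ, K * ENNReal.ofReal (2 ^ s * R ^ (γ - s) * 2 ^ (j * (s - γ))) := by
        refine ENNReal.tsum_le_tsum fun j => ?_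
        refine (mul_le_mul_right (hK ((2 ^ j)⁻¹ * R) (by positivity)) _).trans (le_of_eq ?_)
        rw [mul_left_comm, ← ENNReal.ofReal_mul (by positivity)]
        congr 2
        rw [Real.mul_rpow (by positivity) hR.le, Real.mul_rpow (by positivity) hR.le,
          ← Real.rpow_natCast, ← Real.rpow_natCast, ← Real.rpow_neg (by norm_num),
          ← Real.rpow_neg (by norm_num), ← Real.rpow_mul (by norm_num),
          ← Real.rpow_mul (by norm_num), sub_eq_add_neg γ s, Real.rpow_add hR]
        have : (2:ℝ) ^ (-((j + 1 : ℕ) : ℝ) * -s) * 2 ^ (-(j:ℝ) * γ) = 2 ^ s * 2 ^ (j * (s - γ)) := by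
          rw [← Real.rpow_add (by norm_num), ← Real.rpow_add (by norm_num)]
          congr 1; push_cast; ring
        linear_combination (R ^ γ * R ^ (-s)) * this
    _ = _ := by
        rw [ENNReal.tsum_mul_left]
        congr 1
        have hs := hasSum_geo2 (sub_neg.2 h) (2 ^ s * R ^ (γ - s))
        rw [← ENNReal.ofReal_tsum_of_nonneg (fun j => by positivity) hs.summable, hs.tsum_eq, nearC]
        congr 1; ring

lemma cs_form {X Y : Type*} [MeasurableSpace X] [MeasurableSpace Y] (μ : Measure X) (ν : Measure Y)
    [SFinite μ] [SFinite ν] (p q : X × Y → ℝ≥0∞) (hp : Measurable p) (hq : Measurable q)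
    (φ : X → ℝ≥0∞) (ψ : Y → ℝ≥0∞) (hφ : Measurable φ) (hψ : Measurable ψ) (B : ℝ≥0∞)
    (h1 : ∀ᵐ x ∂μ, φ x ≠ 0 → ∫⁻ y, p (x, y) ∂ν ≤ B) (h2 : ∀ᵐ y ∂ν, ψ y ≠ 0 → ∫⁻ x, q (x, y) ∂μ ≤ B) :
    ∫⁻ z, (p z * q z) ^ (1 / 2 : ℝ) * (φ z.1 * ψ z.2) ∂(μ.prod ν) ≤
      B * ((∫⁻ x, φ x ^ (2:ℝ) ∂μ) ^ (1 / 2 : ℝ) * (∫⁻ y, ψ y ^ (2:ℝ) ∂ν) ^ (1 / 2 : ℝ)) := by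
  have e1 : ∫⁻ z, p z * φ z.1 ^ (2:ℝ) ∂(μ.prod ν) ≤ B * ∫⁻ x, φ x ^ (2:ℝ) ∂μ := by
    rw [lintegral_prod _ (by fun_prop), ← lintegral_const_mul _ (by fun_prop)]
    refine lintegral_mono_ae ?_
    filter_upwards [h1] with x hx
    by_cases h0 : φ x = 0
    · simp [h0]
    rw [lintegral_mul_const _ (by fun_prop)]
    exact mul_le_mul_left (hx h0) _
  have e2 : ∫⁻ z, q z * ψ z.2 ^ (2:ℝ) ∂(μ.prod ν) ≤ B * ∫⁻ y, ψ y ^ (2:ℝ) ∂ν := by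
    rw [lintegral_prod_symm _ (by fun_prop), ← lintegral_const_mul _ (by fun_prop)]
    refine lintegral_mono_ae ?_
    filter_upwards [h2] with x hx
    by_cases h0 : ψ x = 0
    · simp [h0]
    rw [lintegral_mul_const _ (by fun_prop)]
    exact mul_le_mul_left (hx h0) _
  have := ENNReal.lintegral_mul_le_Lp_mul_Lq (μ.prod ν) (p := 2) (q := 2) ⟨by norm_num, by norm_num, by norm_num⟩
    (f := fun z => p z ^ (1/2:ℝ) * φ z.1) (g := fun z => q z ^ (1/2:ℝ) * ψ z.2)
    (by fun_prop) (by fun_prop)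
  have hsq : ∀ a : ℝ≥0∞, (a ^ (1/2:ℝ)) ^ (2:ℝ) = a := fun a => by
    rw [← ENNReal.rpow_mul]; norm_num
  calc _ = ∫⁻ z, ((fun z => p z ^ (1/2:ℝ) * φ z.1) * fun z => q z ^ (1/2:ℝ) * ψ z.2) z ∂(μ.prod ν) := by
        congr 1; ext z
        simp only [Pi.mul_apply]
        rw [ENNReal.mul_rpow_of_nonneg _ _ (by norm_num)]; ring
    _ ≤ _ := this
    _ ≤ (B * ∫⁻ x, φ x ^ (2:ℝ) ∂μ) ^ (1/2:ℝ) * (B * ∫⁻ y, ψ y ^ (2:ℝ) ∂ν) ^ (1/2:ℝ) := by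
        simp only [ENNReal.mul_rpow_of_nonneg _ _ (by norm_num : (0:ℝ) ≤ 2), hsq]
        gcongr
    _ = _ := by
        simp only [ENNReal.mul_rpow_of_nonneg _ _ (by norm_num : (0:ℝ) ≤ 1/2)]
        have : B ^ (1/2:ℝ) * B ^ (1/2:ℝ) = B := by
          rw [← ENNReal.rpow_add_of_nonneg _ _ (by norm_num) (by norm_num)]; norm_num
        calc _ = (B ^ (1/2:ℝ) * B ^ (1/2:ℝ)) * ((∫⁻ x, φ x ^ (2:ℝ) ∂μ) ^ (1 / 2 : ℝ) * (∫⁻ y, ψ y ^ (2:ℝ) ∂ν) ^ (1 / 2 : ℝ)) := by ring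
          _ = _ := by rw [this]

lemma entire_int {X : Type*} [MeasurableSpace X] (μ : Measure X) (g : X → ℝ) (h : X → ℂ)
    (hg : Measurable g) (M : ℝ) (hb : ∀ x, h x ≠ 0 → |g x| ≤ M) (hh : Integrable h μ) :
    Differentiable ℂ (fun z : ℂ => ∫ x, Complex.exp (z * g x) * h x ∂μ) := by
  intro z
  have key : ∀ w ∈ ball z 1, ∀ x, ‖Complex.exp (w * g x) * h x‖ ≤ Real.exp ((‖z‖ + 1) * M) * ‖h x‖ := by
    intro w hw x
    by_cases h0 : h x = 0
    · simp [h0]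
    rw [norm_mul, Complex.norm_exp]
    gcongr
    calc (w * g x).re ≤ ‖w * (g x : ℂ)‖ := Complex.re_le_norm _
      _ = ‖w‖ * |g x| := by simp
      _ ≤ (‖z‖ + 1) * M := by
        gcongr
        · have := norm_sub_norm_le w z
          rw [mem_ball, dist_eq_norm] at hw; linarith
        · exact hb x h0
  have hm : ∀ w : ℂ, AEStronglyMeasurable (fun x => Complex.exp (w * g x) * h x) μ := fun w =>
    (by fun_prop : Measurable fun x => Complex.exp (w * g x)).aestronglyMeasurable.mul hh.1
  refine (hasDerivAt_integral_of_dominated_loc_of_deriv_le (F := fun z x => Complex.exp (z * g x) * h x)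
    (F' := fun z x => g x * (Complex.exp (z * g x) * h x)) (x₀ := z) (s := ball z 1)
    (bound := fun x => M * (Real.exp ((‖z‖ + 1) * M) * ‖h x‖)) (ball_mem_nhds z one_pos)
    (Eventually.of_forall hm) ?_ ?_ ?_ ?_ ?_).2.differentiableAt
  · exact (hh.norm.const_mul _).mono' (hm z) (Eventually.of_forall fun x => key z (mem_ball_self one_pos) x)
  · exact (by fun_prop : Measurable fun x => (g x : ℂ)).aestronglyMeasurable.mul (hm z)
  · refine Eventually.of_forall fun x w hw => ?_
    by_cases h0 : h x = 0
    · simp [h0]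
    rw [norm_mul]
    exact mul_le_mul (by simpa using hb x h0) (key w hw x) (norm_nonneg _) ((abs_nonneg _).trans (hb x h0))
  · exact (hh.norm.const_mul _).const_mul _
  · refine Eventually.of_forall fun x w hw => ?_
    have := (((hasDerivAt_id w).mul_const (g x : ℂ)).cexp).mul_const (h x)
    refine this.congr_deriv ?_
    simp; ring

def bb (l : ℂ) (a : ℕ) : ℂ := ∏ i ∈ Finset.range a, (l + i) / (i + 1)

lemma bb_zero (l : ℂ) : bb l 0 = 1 := by simp [bb]

lemma bb_succ (l : ℂ) (a : ℕ) : bb l (a + 1) = bb l a * ((l + a) / (a + 1)) := by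
  rw [bb, Finset.prod_range_succ, ← bb]

lemma bb_succ' (l : ℂ) (a : ℕ) : (a + 1) * bb l (a + 1) = bb l a * (l + a) := by
  rw [bb_succ]; field_simp

/-- bivariate version -/
def hu (l : ℂ) (q : ℕ) (u v : ℂ) : ℂ :=
  ∑ x ∈ Finset.HasAntidiagonal.antidiagonal q, (bb l x.1 * u ^ x.1) * (bb l x.2 * v ^ x.2)

def hh (l : ℂ) (q : ℕ) (ζ : ℂ) : ℂ := hu l q ζ (starRingEnd ℂ ζ)

lemma hu_smul (l : ℂ) (q : ℕ) (c u v : ℂ) : hu l q (c * u) (c * v) = c ^ q * hu l q u v := by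
  rw [hu, hu, Finset.mul_sum]
  refine Finset.sum_congr rfl fun x hx => ?_
  rw [← Finset.HasAntidiagonal.mem_antidiagonal.1 hx]; ring

lemma hh_smul (l : ℂ) (q : ℕ) (c : ℝ) (ζ : ℂ) : hh l q (c * ζ) = c ^ q * hh l q ζ := by
  simp [hh, hu_smul]

lemma hu_rec (l : ℂ) (q : ℕ) (u v : ℂ) :
    (q + 2) * hu l (q + 2) u v = (q + 1 + l) * (u + v) * hu l (q + 1) u v
      - (q + 2 * l) * (u * v) * hu l q u v := by
  let B : ℂ → PowerSeries ℂ := fun u => PowerSeries.mk fun a => bb l a * u ^ a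
  have hB : ∀ u, PowerSeries.derivative ℂ (B u) =
      PowerSeries.C u * (PowerSeries.X * PowerSeries.derivative ℂ (B u)) + PowerSeries.C (l * u) * B u := by
    intro u
    ext a
    rcases a with _ | a
    · simp [B, PowerSeries.coeff_derivative, bb]
    · simp only [map_add, PowerSeries.coeff_C_mul, PowerSeries.coeff_succ_X_mul,
        PowerSeries.coeff_derivative, B, PowerSeries.coeff_mk]
      have := bb_succ' l (a + 1)
      push_cast at this ⊢
      linear_combination u ^ (a + 1 + 1) * this
  set F := B u * B v with hF
  have hd : PowerSeries.derivative ℂ F = B u * PowerSeries.derivative ℂ (B v) + B v * PowerSeries.derivative ℂ (B u) := by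
    rw [hF, Derivation.leibniz]; simp [smul_eq_mul]
  have key : PowerSeries.derivative ℂ F = PowerSeries.C (u + v) * (PowerSeries.X * PowerSeries.derivative ℂ F)
      - PowerSeries.C (u * v) * (PowerSeries.X * (PowerSeries.X * PowerSeries.derivative ℂ F))
      + PowerSeries.C (l * (u + v)) * F - PowerSeries.C (2 * l * (u * v)) * (PowerSeries.X * F) := by
    have h1 := hB u
    have h2 := hB v
    rw [hd, hF]
    simp only [map_add, map_mul, map_ofNat] at h1 h2 ⊢
    linear_combination (B v * (1 - PowerSeries.C v * PowerSeries.X)) * h1 +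
      (B u * (1 - PowerSeries.C u * PowerSeries.X)) * h2
  have hc : ∀ q, PowerSeries.coeff q F = hu l q u v := by
    intro q
    rw [hF, PowerSeries.coeff_mul]; simp [B, hu]
  have := congrArg (PowerSeries.coeff (q + 1)) key
  rcases q with _ | q
  · rw [map_sub, map_add, map_sub] at this
    simp only [PowerSeries.coeff_C_mul, PowerSeries.coeff_succ_X_mul, PowerSeries.coeff_zero_X_mul,
      PowerSeries.coeff_derivative, hc] at this
    push_cast at this ⊢
    linear_combination this
  · rw [map_sub, map_add, map_sub] at this
    simp only [PowerSeries.coeff_C_mul, PowerSeries.coeff_succ_X_mul,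
      PowerSeries.coeff_derivative, hc] at this
    push_cast at this ⊢
    linear_combination this

lemma bb_eq_choose (l : ℂ) (a : ℕ) : Ring.choose (l + a - 1) a = bb l a := by
  have h1 : Ring.choose (l + a - 1) a = Ring.multichoose l a := by
    rw [Ring.choose]; congr 1; ring
  have h2 := Ring.factorial_nsmul_multichoose_eq_ascPochhammer l a
  rw [h1]
  have h3 : ((a.factorial : ℂ)) * bb l a = (ascPochhammer ℕ a).smeval l := by
    clear h1 h2
    induction a with
    | zero => simp [bb]
    | succ a ih =>
      rw [ascPochhammer_succ_right, mul_comm, Polynomial.smeval_mul, mul_comm, ← ih, bb_succ,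
        Nat.factorial_succ]
      simp [Polynomial.smeval_add, Polynomial.smeval_X, Polynomial.smeval_natCast]
      field_simp
  rw [← h3, nsmul_eq_mul] at h2
  exact mul_left_cancel₀ (by exact_mod_cast a.factorial_ne_zero) h2

lemma bb_hasSum (l : ℂ) {z : ℂ} (hz : ‖z‖ < 1) : HasSum (fun a => bb l a * z ^ a) (1 / (1 - z) ^ l) := by
  have := (Complex.one_div_one_sub_cpow_hasFPowerSeriesOnBall_zero l).hasSum (y := z) (by
    simpa [Metric.mem_eball, edist_zero_right] using (by
      rw [← ofReal_norm]; exact ENNReal.ofReal_lt_one.2 hz))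
  simp only [FormalMultilinearSeries.ofScalars_apply_eq, zero_add, smul_eq_mul, bb_eq_choose] at this
  exact this

lemma one_sub_arg {ζ : ℂ} (h : ‖ζ‖ < 1) : (1 - ζ).arg ≠ Real.pi := by
  have : 0 < (1 - ζ).re := by
    have := Complex.re_le_norm ζ; simp; linarith
  intro h0
  rw [Complex.arg_eq_pi_iff] at h0; linarith [h0.1]

lemma hh_summable (l : ℂ) {ζ : ℂ} (h : ‖ζ‖ < 1) : Summable fun q => ‖hh l q ζ‖ := by
  have h1 := (bb_hasSum l h).summable.norm
  have h2 := (bb_hasSum l (z := starRingEnd ℂ ζ) (by simpa using h)).summable.norm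
  have h3 := summable_norm_sum_mul_antidiagonal_of_summable_norm h1 h2
  simp only [hh, hu]
  exact h3

lemma hh_hasSum (l : ℝ) {ζ : ℂ} (h : ‖ζ‖ < 1) :
    HasSum (fun q => hh l q ζ) ((‖1 - ζ‖ ^ (-2 * l) : ℝ) : ℂ) := by
  have h1 := (bb_hasSum l h)
  have h2 := (bb_hasSum l (z := starRingEnd ℂ ζ) (by simpa using h))
  have h3 := tsum_mul_tsum_eq_tsum_sum_antidiagonal_of_summable_norm h1.summable.norm h2.summable.norm
  rw [h1.tsum_eq, h2.tsum_eq] at h3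
  have h4 := (hh_summable l h).of_norm.hasSum
  rw [show (∑' q, hh l q ζ) = _ from h3.symm] at h4
  suffices heq : ((‖1 - ζ‖ ^ (-2 * l) : ℝ) : ℂ) = 1 / (1 - ζ) ^ (l:ℂ) * (1 / (1 - starRingEnd ℂ ζ) ^ (l:ℂ)) by
    rw [heq]; exact h4
  have : 1 - starRingEnd ℂ ζ = starRingEnd ℂ (1 - ζ) := by simp
  have h5 : (starRingEnd ℂ (1 - ζ)) ^ (l:ℂ) = starRingEnd ℂ ((1 - ζ) ^ (l:ℂ)) := by
    rw [Complex.conj_cpow _ _ (one_sub_arg h)]; simp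
  rw [this, h5, div_mul_div_comm, one_mul, Complex.mul_conj, Complex.normSq_eq_norm_sq,
    Complex.norm_cpow_real, one_div, ← Complex.ofReal_inv]
  congr 1
  rw [← Real.rpow_natCast, ← Real.rpow_mul (norm_nonneg _), ← Real.rpow_neg (norm_nonneg _)]
  congr 1; push_cast; ring

lemma bb_real {l : ℝ} (hl : 0 ≤ l) (a : ℕ) : bb l a = (‖bb l a‖ : ℝ) := by
  have : bb l a = ((∏ i ∈ Finset.range a, (l + i) / (i + 1) : ℝ) : ℂ) := by simp [bb]
  rw [this, Complex.norm_real, Real.norm_of_nonneg]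
  exact Finset.prod_nonneg fun i _ => by positivity

lemma hh_sum_norm_le {l : ℝ} (hl : 0 ≤ l) {ζ : ℂ} {r : ℝ} (h : ‖ζ‖ ≤ r) (hr : r < 1) (s : Finset ℕ) :
    ∑ q ∈ s, ‖hh l q ζ‖ ≤ (1 - r) ^ (-2 * l) := by
  have hr0 : 0 ≤ r := (norm_nonneg _).trans h
  have h1 := hh_hasSum l (ζ := r) (by simpa [abs_of_nonneg hr0] using hr)
  have h2 := Complex.hasSum_re h1
  have e : ∀ q, (hh l q r).re = ∑ x ∈ Finset.HasAntidiagonal.antidiagonal q, ‖bb l x.1‖ * r ^ x.1 * (‖bb l x.2‖ * r ^ x.2) := by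
    intro q
    have : hh l q r = ((∑ x ∈ Finset.HasAntidiagonal.antidiagonal q, ‖bb l x.1‖ * r ^ x.1 * (‖bb l x.2‖ * r ^ x.2) : ℝ) : ℂ) := by
      rw [hh, hu]; push_cast
      refine Finset.sum_congr rfl fun x _ => ?_
      rw [← bb_real hl, ← bb_real hl, Complex.conj_ofReal]
    rw [this, Complex.ofReal_re]
  have h3 : ∑ q ∈ s, ‖hh l q ζ‖ ≤ ∑ q ∈ s, (hh l q r).re := by
    refine Finset.sum_le_sum fun q _ => ?_
    rw [e, hh, hu]
    refine (norm_sum_le _ _).trans (Finset.sum_le_sum fun x _ => ?_)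
    simp only [norm_mul, norm_pow, RCLike.norm_conj]
    gcongr
  refine h3.trans ((sum_le_hasSum s (fun q _ => ?_) h2).trans (le_of_eq ?_))
  · rw [e]; positivity
  · rw [Complex.ofReal_re, ← Complex.ofReal_one, ← Complex.ofReal_sub, Complex.norm_real,
      Real.norm_of_nonneg (by linarith)]

def kk (ν l : ℂ) (N : ℕ) : ℂ := ∏ i ∈ Finset.range N, (l + i) / (ν + 1 + i)

lemma kk_succ (ν l : ℂ) (N : ℕ) : kk ν l (N + 1) = kk ν l N * ((l + N) / (ν + 1 + N)) := by
  rw [kk, Finset.prod_range_succ, ← kk]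

def cz (ν u v : ℂ) (m : ℤ) : ℂ := if 0 ≤ m then hu ν m.toNat u v / ν else 0

lemma cz_rec {ν : ℂ} (hν : ν ≠ 0) (u v : ℂ) (m : ℤ) :
    (u + v) * ((m + ν) * cz ν u v m) =
      (m + 1) * cz ν u v (m + 1) + (m + 2 * ν - 1) * (u * v) * cz ν u v (m - 1) := by
  rcases lt_trichotomy m (-1) with h | h | h
  · simp [cz, show ¬ (0 ≤ m) by omega, show ¬ (0 ≤ m + 1) by omega, show ¬ (1 ≤ m) by omega]
  · subst h; simp [cz]
  · obtain ⟨k, rfl⟩ : ∃ k : ℕ, m = k := ⟨m.toNat, by omega⟩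
    rcases k with _ | k
    · simp [cz, hu, bb, Finset.Nat.antidiagonal_succ]; field_simp; ring
    · have := hu_rec ν k u v
      simp only [cz, show (0:ℤ) ≤ ((k + 1 : ℕ) : ℤ) by omega, show (0:ℤ) ≤ ((k + 1 : ℕ) : ℤ) + 1 by omega,
        show (0:ℤ) ≤ ((k + 1 : ℕ) : ℤ) - 1 by omega, if_true,
        show (((k + 1 : ℕ) : ℤ) + 1).toNat = k + 2 by omega, show (((k + 1 : ℕ) : ℤ) - 1).toNat = k by omega,
        Int.toNat_natCast]
      push_cast
      linear_combination (-1 / ν) * this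

def tt (ν l u v : ℂ) (q j : ℕ) : ℂ :=
  bb (l - ν) j * kk ν l (q - j) * (u * v) ^ j * ((((q:ℤ) - 2 * j : ℤ) + ν) * cz ν u v ((q:ℤ) - 2 * j))

lemma coef_id {ν : ℂ} (hν : ∀ i : ℕ, ν + i ≠ 0) (l : ℂ) (m j : ℕ) :
    (m + 2 * j + 2) * (bb (l - ν) (j + 1) * kk ν l (m + j + 1)) * (m + ν) =
      (m + 2 * j + 1 + l) * (bb (l - ν) (j + 1) * kk ν l (m + j) * m
        + bb (l - ν) j * kk ν l (m + j + 1) * (m + 2 * ν))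
      - (m + 2 * j + 2 * l) * (bb (l - ν) j * kk ν l (m + j)) * (m + ν) := by
  rw [kk_succ, bb_succ]
  have h1 : ν + 1 + ((m + j : ℕ) : ℂ) ≠ 0 := by
    have := hν (1 + (m + j)); push_cast at this ⊢; rwa [add_assoc]
  have h2 : (j : ℂ) + 1 ≠ 0 := by exact_mod_cast Nat.succ_ne_zero j
  push_cast at h1 ⊢
  field_simp
  ring

lemma connection {ν : ℂ} (hν : ∀ i : ℕ, ν + i ≠ 0) (l u v : ℂ) (q : ℕ) :
    hu l q u v = ∑ j ∈ Finset.range (q + 1), tt ν l u v q j := by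
  have h0 : ν ≠ 0 := by simpa using hν 0
  have h1 : ν + 1 ≠ 0 := by simpa using hν 1
  induction q using Nat.twoStepInduction with
  | zero => simp [tt, hu, bb, kk, cz, h0]
  | one =>
    simp [tt, hu, bb, kk, cz, Finset.sum_range_succ, Finset.Nat.antidiagonal_succ]
    field_simp; try ring
  | more q ih0 ih1 =>
    have hq : ((q:ℂ) + 2) ≠ 0 := by exact_mod_cast (Nat.succ_ne_zero (q + 1))
    refine mul_left_cancel₀ hq ?_
    rw [hu_rec, ih0, ih1]
    set c : ℤ → ℂ := cz ν u v with hc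
    have hneg : ∀ m : ℤ, m < 0 → c m = 0 := fun m hm => by simp [hc, cz, not_le.2 hm]
    let A : ℕ → ℂ := fun j => (q + 1 + l) * (bb (l - ν) j * kk ν l (q + 1 - j) * (u * v) ^ j *
      (((q:ℂ) + 2 - 2 * j) * c ((q:ℤ) + 2 - 2 * j)))
    let B : ℕ → ℂ := fun j => (q + 1 + l) * (bb (l - ν) j * kk ν l (q + 1 - j) * (u * v) ^ (j + 1) *
      (((q:ℂ) + 2 * ν - 2 * j) * c ((q:ℤ) - 2 * j)))
    let D : ℕ → ℂ := fun j => (q + 2 * l) * (bb (l - ν) j * kk ν l (q - j) * (u * v) ^ (j + 1) *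
      (((q:ℂ) - 2 * j + ν) * c ((q:ℤ) - 2 * j)))
    have e1 : (q + 1 + l) * (u + v) * ∑ j ∈ Finset.range (q + 1 + 1), tt ν l u v (q + 1) j =
        ∑ j ∈ Finset.range (q + 3), A j + ∑ j ∈ Finset.range (q + 2), B j := by
      have : A (q + 2) = 0 := by simp only [A]; rw [hneg _ (by push_cast; omega)]; ring
      rw [Finset.sum_range_succ A, this, add_zero, ← Finset.sum_add_distrib, Finset.mul_sum]
      refine Finset.sum_congr rfl fun j _ => ?_
      have := cz_rec h0 u v ((q:ℤ) + 1 - 2 * j)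
      rw [show (q:ℤ) + 1 - 2 * j + 1 = q + 2 - 2 * j by ring,
        show (q:ℤ) + 1 - 2 * j - 1 = q - 2 * j by ring] at this
      simp only [A, B, tt]
      push_cast at this ⊢
      linear_combination ((q + 1 + l) * (bb (l - ν) j * kk ν l (q + 1 - j) * (u * v) ^ j)) * this
    have e2 : (q + 2 * l) * (u * v) * ∑ j ∈ Finset.range (q + 1), tt ν l u v q j =
        ∑ j ∈ Finset.range (q + 2), D j := by
      have : D (q + 1) = 0 := by simp only [D]; rw [hneg _ (by push_cast; omega)]; ring
      rw [Finset.sum_range_succ D, this, add_zero, Finset.mul_sum]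
      refine Finset.sum_congr rfl fun j _ => ?_
      simp only [D, tt]; push_cast; ring
    rw [e1, e2, Finset.sum_range_succ', Finset.sum_range_succ' _ (q + 2), mul_add,
      add_right_comm, add_sub_right_comm, ← Finset.sum_add_distrib, ← Finset.sum_sub_distrib,
      Finset.mul_sum]
    congr 1
    · refine Finset.sum_congr rfl fun j _ => ?_
      by_cases hj : 2 * j ≤ q
      · obtain ⟨m, rfl⟩ := Nat.exists_eq_add_of_le' hj
        have := coef_id hν l m j
        simp only [A, B, D, tt]
        rw [show m + 2 * j + 1 - (j + 1) = m + j by omega, show m + 2 * j + 1 - j = m + j + 1 by omega,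
          show m + 2 * j - j = m + j by omega, show m + 2 * j + 2 - (j + 1) = m + j + 1 by omega]
        rw [show ((m + 2 * j : ℕ) : ℤ) + 2 - 2 * ((j + 1 : ℕ) : ℤ) = m by push_cast; ring,
          show ((m + 2 * j : ℕ) : ℤ) - 2 * (j : ℤ) = m by push_cast; ring,
          show ((m + 2 * j + 2 : ℕ) : ℤ) - 2 * ((j + 1 : ℕ) : ℤ) = m by push_cast; ring]
        push_cast
        linear_combination (-(u * v) ^ (j + 1) * c m) * this
      · simp only [A, B, D, tt, ← hc]
        rw [hneg _ (by push_cast; omega), hneg _ (by omega), hneg _ (by push_cast; omega)]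
        ring
    · simp only [A, tt, ← hc]
      rw [show q + 1 - 0 = q + 1 by omega, show q + 2 - 0 = q + 1 + 1 by omega, kk_succ ν l (q + 1)]
      have h2 : ν + 1 + ((q + 1 : ℕ) : ℂ) ≠ 0 := by
        have := hν (1 + (q + 1)); push_cast at this ⊢; rwa [add_assoc]
      rw [show ((q:ℤ) + 2 - 2 * ((0:ℕ):ℤ)) = ((q + 2 : ℕ) : ℤ) - 2 * ((0:ℕ):ℤ) by push_cast; ring]
      push_cast at h2 ⊢
      field_simp
      ring

lemma sum_inv_sq_le {s : ℝ} (hs : 1 / 4 ≤ s) (N : ℕ) : ∑ i ∈ Finset.range N, 1 / (s + i) ^ 2 ≤ 18 := by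
  have key : ∀ N : ℕ, ∑ i ∈ Finset.range (N + 1), (1:ℝ) / (s + i) ^ 2 ≤ (18:ℝ) - 2 / ((N:ℝ) + 1) := by
    intro N
    induction N with
    | zero =>
      have : (1:ℝ) / s ^ 2 ≤ 16 := by
        rw [div_le_iff₀ (by positivity)]; nlinarith
      simp at this ⊢; linarith
    | succ N ih =>
      rw [Finset.sum_range_succ]
      have : 1 / (s + (N + 1 : ℕ)) ^ 2 ≤ 2 / ((N:ℝ) + 1) - 2 / (N + 1 + 1) := by
        have h1 : (2:ℝ) / ((N:ℝ) + 1) - 2 / (N + 1 + 1) = 2 / (((N:ℝ) + 1) * (N + 2)) := by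
          field_simp; ring
        rw [h1, div_le_div_iff₀ (by positivity) (by positivity)]
        push_cast
        have hN : (0:ℝ) ≤ N := by positivity
        nlinarith
      push_cast at *; linarith
  rcases N with _ | N
  · simp
  · have := key N
    have h2 : (0:ℝ) ≤ 2 / (N + 1) := by positivity
    linarith

lemma prod_ratio_le {s : ℝ} (hs : 1 / 4 ≤ s) (η : ℝ) (N : ℕ) :
    ∏ i ∈ Finset.range N, ‖(s + η * Complex.I + i : ℂ)‖ / (s + i) ≤ Real.exp (9 * η ^ 2) := by
  calc _ ≤ ∏ i ∈ Finset.range N, Real.exp (η ^ 2 / 2 * (1 / (s + i) ^ 2)) := by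
        refine Finset.prod_le_prod (fun i _ => by positivity) fun i _ => ?_
        have hp : 0 < s + i := by positivity
        have e : ‖(s + η * Complex.I + i : ℂ)‖ ^ 2 = (s + i) ^ 2 + η ^ 2 := by
          rw [← Complex.normSq_eq_norm_sq, Complex.normSq_apply]; simp; ring
        rw [← sq_le_sq₀ (by positivity) (by positivity), div_pow, e, ← Real.exp_nat_mul]
        have := Real.add_one_le_exp (((2:ℕ):ℝ) * (η ^ 2 / 2 * (1 / (s + i) ^ 2)))
        refine le_trans (le_of_eq ?_) this
        field_simp; push_cast; ring
    _ = Real.exp (η ^ 2 / 2 * ∑ i ∈ Finset.range N, 1 / (s + i) ^ 2) := by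
        rw [← Real.exp_sum, Finset.mul_sum]
    _ ≤ _ := by
        apply Real.exp_le_exp.2
        nlinarith [sum_inv_sq_le hs N, sq_nonneg η]

lemma kk_bound {ν : ℝ} (hν : 0 ≤ ν) (η : ℝ) (N : ℕ) :
    ‖kk ν (ν + 1 + η * Complex.I) N‖ ≤ Real.exp (9 * η ^ 2) := by
  refine le_trans (le_of_eq ?_) (prod_ratio_le (s := ν + 1) (by linarith) η N)
  rw [kk, norm_prod]
  refine Finset.prod_congr rfl fun i _ => ?_
  have : (ν + 1 + i : ℂ) = ((ν + 1 + i : ℝ) : ℂ) := by push_cast; ring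
  rw [norm_div, this, Complex.norm_real, Real.norm_of_nonneg (by positivity)]
  push_cast; rfl

lemma bb_bound_mul {s : ℝ} (hs : 1 / 4 ≤ s) (η : ℝ) (a : ℕ) :
    ‖bb (s + η * Complex.I) a‖ ≤ Real.exp (9 * η ^ 2) * ‖bb s a‖ := by
  refine le_trans (le_of_eq ?_) (mul_le_mul_of_nonneg_right (prod_ratio_le hs η a) (norm_nonneg _))
  rw [bb, norm_prod, bb, norm_prod, ← Finset.prod_mul_distrib]
  refine Finset.prod_congr rfl fun i _ => ?_
  have : (s + i : ℂ) = ((s + i : ℝ) : ℂ) := by push_cast; ring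
  have hp : 0 < s + i := by positivity
  rw [norm_div, norm_div, this, Complex.norm_real, Real.norm_of_nonneg hp.le]
  field_simp

lemma bb_one (a : ℕ) : bb 1 a = 1 := by
  rw [bb]; refine Finset.prod_eq_one fun i _ => ?_
  have : (i:ℂ) + 1 ≠ 0 := by exact_mod_cast i.succ_ne_zero
  rw [add_comm]; field_simp

lemma bb_bound_one (η : ℝ) (a : ℕ) : ‖bb (1 + η * Complex.I) a‖ ≤ Real.exp (9 * η ^ 2) := by
  have := bb_bound_mul (s := 1) (by norm_num) η a
  simpa [bb_one] using this

lemma bb_crude (l : ℂ) (a : ℕ) : ‖bb l a‖ ≤ Real.exp (a * ‖l‖) := by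
  induction a with
  | zero => simp [bb]
  | succ a ih =>
    rw [bb_succ, norm_mul]
    push_cast
    rw [add_mul, Real.exp_add, one_mul]
    gcongr
    have h1 : ‖((a:ℂ) + 1)‖ = a + 1 := by
      have : ((a:ℂ) + 1) = ((a + 1 : ℕ) : ℂ) := by push_cast; ring
      rw [this, Complex.norm_natCast]; push_cast; ring
    rw [norm_div, h1, div_le_iff₀ (by positivity)]
    have h2 := Real.add_one_le_exp ‖l‖
    have h3 : ‖l + a‖ ≤ ‖l‖ + a := (norm_add_le _ _).trans (by simp)
    have h4 : (0:ℝ) ≤ a := by positivity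
    nlinarith [norm_nonneg l]

/-- `B σ a` : the real binomial coefficients -/
def rb (σ : ℝ) (a : ℕ) : ℝ := ‖bb σ a‖

lemma rb_nonneg (σ : ℝ) (a : ℕ) : 0 ≤ rb σ a := norm_nonneg _

lemma rb_succ {σ : ℝ} (hσ : 0 ≤ σ) (a : ℕ) : rb σ (a + 1) = rb σ a * ((σ + a) / (a + 1)) := by
  rw [rb, bb_succ, norm_mul, rb]
  congr 1
  have : ((σ + a) / (a + 1) : ℂ) = (((σ + a) / (a + 1) : ℝ) : ℂ) := by push_cast; ring
  rw [this, Complex.norm_real, Real.norm_of_nonneg (by positivity)]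

lemma rb_anti {σ : ℝ} (h0 : 0 ≤ σ) (h1 : σ ≤ 1) : Antitone (rb σ) := by
  refine antitone_nat_of_succ_le fun a => ?_
  rw [rb_succ h0]
  refine mul_le_of_le_one_right (rb_nonneg _ _) ?_
  rw [div_le_one (by positivity)]; linarith

lemma rb_le {σ : ℝ} (h0 : 0 ≤ σ) (h1 : σ ≤ 1) (a : ℕ) : rb σ a ≤ ((a:ℝ) + 1) ^ (σ - 1) := by
  induction a with
  | zero => simp [rb, bb]
  | succ a ih =>
    rw [rb_succ h0]
    have hb : (1 + 1 / ((a:ℝ) + 1)) ^ (1 - σ) ≤ 1 + (1 - σ) * (1 / (a + 1)) :=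
      rpow_one_add_le_one_add_mul_self (by
        have : (0:ℝ) ≤ 1 / ((a:ℝ) + 1) := by positivity
        linarith) (by linarith) (by linarith)
    have h3 : ((a + 1 : ℕ) + 1 : ℝ) = (a + 1) * (1 + 1 / (a + 1)) := by push_cast; field_simp
    have hp : (0:ℝ) < 1 + 1 / ((a:ℝ) + 1) := by positivity
    rw [h3, Real.mul_rpow (by positivity) hp.le]
    refine mul_le_mul ih ?_ (by positivity) (by positivity)
    rw [show σ - 1 = -(1 - σ) by ring, Real.rpow_neg hp.le]
    have hq : 0 < (1 + 1 / ((a:ℝ) + 1)) ^ (1 - σ) := by positivity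
    have h5 : (σ + a) / ((a:ℝ) + 1) ≤ (1 + (1 - σ) * (1 / ((a:ℝ) + 1)))⁻¹ := by
      have hpp : 0 < 1 + (1 - σ) * (1 / ((a:ℝ) + 1)) := by
        have : 0 ≤ (1 - σ) * (1 / ((a:ℝ) + 1)) := mul_nonneg (by linarith) (by positivity)
        linarith
      rw [← one_div, le_div_iff₀ hpp]
      have : (σ + a) / ((a:ℝ) + 1) = 1 - (1 - σ) * (1 / ((a:ℝ) + 1)) := by field_simp; ring
      rw [this]
      nlinarith [sq_nonneg ((1 - σ) * (1 / ((a:ℝ) + 1)))]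
    exact h5.trans (inv_anti₀ hq hb)

lemma rb_sum {σ : ℝ} (h0 : 0 ≤ σ) (N : ℕ) : σ * ∑ a ∈ Finset.range N, rb σ a = N * rb σ N := by
  induction N with
  | zero => simp
  | succ N ih =>
    rw [Finset.sum_range_succ, mul_add, ih, rb_succ h0]; push_cast; field_simp; ring

lemma rb_tele {σ : ℝ} (h0 : 0 ≤ σ) (h1 : σ ≤ 1 / 2) (c m : ℕ) :
    ∑ i ∈ Finset.range m, rb σ (c + i) / (c + i + 1) ≤ 2 * rb σ c := by
  have key : (1 - σ) * ∑ i ∈ Finset.range m, rb σ (c + i) / (c + i + 1) = rb σ c - rb σ (c + m) := by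
    induction m with
    | zero => simp
    | succ m ih =>
      rw [Finset.sum_range_succ, mul_add, ih, ← add_assoc, rb_succ h0]; push_cast; field_simp; ring
  have h2 : 0 ≤ ∑ i ∈ Finset.range m, rb σ (c + i) / (c + i + 1) :=
    Finset.sum_nonneg fun i _ => div_nonneg (rb_nonneg _ _) (by positivity)
  nlinarith [rb_nonneg σ (c + m)]

lemma abel_id (b : ℕ → ℂ) (z : ℂ) (c m : ℕ) :
    (1 - z) * ∑ i ∈ Finset.range (m + 1), b (c + i) * z ^ (c + i) = b c * z ^ c +
      ∑ i ∈ Finset.range m, (b (c + i + 1) - b (c + i)) * z ^ (c + i + 1) - b (c + m) * z ^ (c + m + 1) := by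
  induction m with
  | zero => simp; ring
  | succ m ih =>
    rw [Finset.sum_range_succ, mul_add, ih, Finset.sum_range_succ]
    simp only [← add_assoc]
    ring

lemma sumblk {σ : ℝ} (h0 : 1 / 4 ≤ σ) (h1 : σ ≤ 1 / 2) (η : ℝ) (z : ℂ) {ra X : ℝ} (hra : 0 ≤ ra) (hX : 0 ≤ X)
    (c0 c1 L : ℕ) (hL : c1 ≤ c0 + L) (hr : ∀ c ∈ Finset.Ico c0 c1, ra * ‖z‖ ^ c ≤ X) :
    (1 + L * ‖1 - z‖ / max 1 ‖z‖) * (ra * ‖∑ c ∈ Finset.Ico c0 c1, bb (σ + η * Complex.I) c * z ^ c‖) ≤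
      8 * Real.exp (10 * η ^ 2) * L * X * rb σ c0 := by
  rcases le_or_gt c1 c0 with h | h
  · rw [Finset.Ico_eq_empty (by omega)]
    simp; have := rb_nonneg σ c0; positivity
  obtain ⟨m, rfl⟩ : ∃ m, c1 = c0 + (m + 1) := ⟨c1 - c0 - 1, by omega⟩
  set l : ℂ := σ + η * Complex.I with hl
  set E := Real.exp (9 * η ^ 2) with hE
  have hE0 : 0 < E := Real.exp_pos _
  have hM1 : 1 ≤ max 1 ‖z‖ := le_max_left _ _
  have hM0 : 0 < max 1 ‖z‖ := by linarith
  have hb : ∀ c, ‖bb l c‖ ≤ E * rb σ c := fun c => bb_bound_mul h0 η c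
  have hb0 : ∀ c, c0 ≤ c → ‖bb l c‖ ≤ E * rb σ c0 := fun c hc =>
    (hb c).trans (mul_le_mul_of_nonneg_left (rb_anti (by linarith) (by linarith) hc) hE0.le)
  have hrb := rb_nonneg σ c0
  have hs : ∑ c ∈ Finset.Ico c0 (c0 + (m + 1)), bb l c * z ^ c =
      ∑ i ∈ Finset.range (m + 1), bb l (c0 + i) * z ^ (c0 + i) := by
    rw [Finset.sum_Ico_eq_sum_range]; congr 2; omega
  have hr' : ∀ i, i < m + 1 → ra * ‖z‖ ^ (c0 + i) ≤ X := fun i hi => hr _ (by rw [Finset.mem_Ico]; omega)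
  rw [hs]
  have hmL : ((m:ℝ) + 1) ≤ L := by
    have : m + 1 ≤ L := by omega
    exact_mod_cast this
  -- first bound
  have B1 : ra * ‖∑ i ∈ Finset.range (m + 1), bb l (c0 + i) * z ^ (c0 + i)‖ ≤ L * (E * rb σ c0 * X) := by
    calc _ ≤ ra * ∑ i ∈ Finset.range (m + 1), ‖bb l (c0 + i) * z ^ (c0 + i)‖ := by
          gcongr; exact norm_sum_le _ _
      _ = ∑ i ∈ Finset.range (m + 1), ‖bb l (c0 + i)‖ * (ra * ‖z‖ ^ (c0 + i)) := by
          rw [Finset.mul_sum]; refine Finset.sum_congr rfl fun i _ => ?_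
          rw [norm_mul, norm_pow]; ring
      _ ≤ ∑ i ∈ Finset.range (m + 1), (E * rb σ c0) * X := by
          refine Finset.sum_le_sum fun i hi => ?_
          refine mul_le_mul (hb0 _ (by omega)) (hr' i (Finset.mem_range.1 hi)) (by positivity) (by positivity)
      _ = ((m:ℝ) + 1) * (E * rb σ c0 * X) := by simp
      _ ≤ _ := by gcongr
  have hr2 : ∀ i, i < m + 1 → ra * ‖z‖ ^ (c0 + i + 1) ≤ X * max 1 ‖z‖ := by
    intro i hi
    rw [pow_succ, ← mul_assoc]
    exact mul_le_mul (hr' i hi) (le_max_right _ _) (norm_nonneg _) hX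
  have hdiff : ∀ i, ‖bb l (c0 + i + 1) - bb l (c0 + i)‖ ≤ (1 + |η|) * E * (rb σ (c0 + i) / (c0 + i + 1)) := by
    intro i
    have e : bb l (c0 + i + 1) - bb l (c0 + i) = bb l (c0 + i) * ((l - 1) / ((c0 + i + 1 : ℕ) : ℂ)) := by
      have : ((c0 + i + 1 : ℕ) : ℂ) ≠ 0 := Nat.cast_ne_zero.2 (by omega)
      rw [bb_succ]; push_cast at *; field_simp; ring
    rw [e, norm_mul, norm_div, Complex.norm_natCast]
    have hl1 : ‖l - 1‖ ≤ 1 + |η| := by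
      have : l - 1 = ((σ - 1 : ℝ) : ℂ) + η * Complex.I := by rw [hl]; push_cast; ring
      rw [this]
      refine (norm_add_le _ _).trans ?_
      rw [norm_mul, Complex.norm_real, Complex.norm_real, Complex.norm_I, Real.norm_eq_abs, Real.norm_eq_abs, mul_one]
      have : |σ - 1| ≤ 1 := by rw [abs_le]; constructor <;> linarith
      linarith
    calc _ ≤ (E * rb σ (c0 + i)) * ((1 + |η|) / ((c0 + i + 1 : ℕ) : ℝ)) := by
          have := rb_nonneg σ (c0 + i)
          exact mul_le_mul (hb _) (by gcongr) (by positivity) (by positivity)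
      _ = _ := by push_cast; ring
  have B2 : ‖1 - z‖ * (ra * ‖∑ i ∈ Finset.range (m + 1), bb l (c0 + i) * z ^ (c0 + i)‖) ≤
      (4 + 2 * |η|) * (E * rb σ c0 * X) * max 1 ‖z‖ := by
    have hn : ‖1 - z‖ * ‖∑ i ∈ Finset.range (m + 1), bb l (c0 + i) * z ^ (c0 + i)‖ ≤
        ‖bb l c0‖ * ‖z‖ ^ c0 + ∑ i ∈ Finset.range m, ‖bb l (c0 + i + 1) - bb l (c0 + i)‖ * ‖z‖ ^ (c0 + i + 1)
         + ‖bb l (c0 + m)‖ * ‖z‖ ^ (c0 + m + 1) := by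
      rw [← norm_mul, abel_id]
      refine (norm_sub_le _ _).trans ?_
      rw [norm_mul (bb l (c0 + m)), norm_pow]
      gcongr
      refine (norm_add_le _ _).trans ?_
      rw [norm_mul, norm_pow]
      gcongr
      refine (norm_sum_le _ _).trans (le_of_eq ?_)
      simp [norm_pow]
    calc _ = ra * (‖1 - z‖ * ‖∑ i ∈ Finset.range (m + 1), bb l (c0 + i) * z ^ (c0 + i)‖) := by ring
      _ ≤ _ := mul_le_mul_of_nonneg_left hn hra
      _ = ‖bb l c0‖ * (ra * ‖z‖ ^ c0) + ∑ i ∈ Finset.range m, ‖bb l (c0 + i + 1) - bb l (c0 + i)‖ * (ra * ‖z‖ ^ (c0 + i + 1))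
         + ‖bb l (c0 + m)‖ * (ra * ‖z‖ ^ (c0 + m + 1)) := by
          rw [mul_add, mul_add, Finset.mul_sum]
          congr 1
          · congr 1
            · ring
            · exact Finset.sum_congr rfl fun i _ => by ring
          · ring
      _ ≤ (E * rb σ c0) * (X * max 1 ‖z‖) + ∑ i ∈ Finset.range m, ((1 + |η|) * E * (rb σ (c0 + i) / (c0 + i + 1))) * (X * max 1 ‖z‖)
          + (E * rb σ c0) * (X * max 1 ‖z‖) := by
          have h00 : ra * ‖z‖ ^ c0 ≤ X * max 1 ‖z‖ := by
            have := hr' 0 (by omega)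
            simp only [add_zero] at this
            nlinarith
          refine add_le_add (add_le_add ?_ ?_) ?_
          · exact mul_le_mul (hb0 _ le_rfl) h00 (by positivity) (by positivity)
          · refine Finset.sum_le_sum fun i hi => ?_
            have := rb_nonneg σ (c0 + i)
            exact mul_le_mul (hdiff i) (hr2 i (by have := Finset.mem_range.1 hi; omega)) (by positivity) (by positivity)
          · exact mul_le_mul (hb0 _ (by omega)) (hr2 m (by omega)) (by positivity) (by positivity)
      _ = (2 * rb σ c0 + (1 + |η|) * ∑ i ∈ Finset.range m, (rb σ (c0 + i) / (c0 + i + 1))) * (E * (X * max 1 ‖z‖)) := by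
          rw [← Finset.sum_mul, ← Finset.mul_sum]; ring
      _ ≤ (2 * rb σ c0 + (1 + |η|) * (2 * rb σ c0)) * (E * (X * max 1 ‖z‖)) := by
          gcongr; exact rb_tele (by linarith) h1 c0 m
      _ = _ := by ring
  have hexp : 5 + 2 * |η| ≤ 8 * Real.exp (η ^ 2) := by
    have h1 := Real.add_one_le_exp (η ^ 2)
    have h2 : 2 * |η| ≤ 1 + η ^ 2 := by nlinarith [sq_abs η, sq_nonneg (|η| - 1)]
    nlinarith [sq_nonneg η]
  have hEE : Real.exp (10 * η ^ 2) = Real.exp (η ^ 2) * E := by rw [hE, ← Real.exp_add]; ring_nf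
  have hLX : 0 ≤ L * (E * rb σ c0 * X) := by positivity
  calc _ = ra * ‖∑ i ∈ Finset.range (m + 1), bb l (c0 + i) * z ^ (c0 + i)‖ + L / max 1 ‖z‖ *
        (‖1 - z‖ * (ra * ‖∑ i ∈ Finset.range (m + 1), bb l (c0 + i) * z ^ (c0 + i)‖)) := by ring
    _ ≤ L * (E * rb σ c0 * X) + L / max 1 ‖z‖ * ((4 + 2 * |η|) * (E * rb σ c0 * X) * max 1 ‖z‖) := by
        gcongr
    _ = (5 + 2 * |η|) * (L * (E * rb σ c0 * X)) := by field_simp; ring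
    _ ≤ 8 * Real.exp (η ^ 2) * (L * (E * rb σ c0 * X)) := by gcongr
    _ = _ := by rw [hEE]; ring

lemma block_rearr (F : ℕ → ℕ → ℂ) (A L : ℕ) (hL : L ≤ A + 1) :
    ∑ q ∈ Finset.Ico A (A + L), ∑ x ∈ Finset.HasAntidiagonal.antidiagonal q, F x.1 x.2 =
      ∑ a ∈ Finset.range (A + 1), ∑ c ∈ Finset.Ico (max a (A - a)) (A + L - a), F a c +
      ∑ c ∈ Finset.range (A + 1), ∑ a ∈ Finset.Ico (max (c + 1) (A - c)) (A + L - c), F a c := by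
  have h1 : ∀ q, ∑ x ∈ Finset.HasAntidiagonal.antidiagonal q, F x.1 x.2 =
      ∑ x ∈ (Finset.HasAntidiagonal.antidiagonal q).filter (fun x : ℕ × ℕ => x.1 ≤ x.2), F x.1 x.2 +
      ∑ x ∈ (Finset.HasAntidiagonal.antidiagonal q).filter (fun x : ℕ × ℕ => ¬ x.1 ≤ x.2), F x.1 x.2 :=
    fun q => (Finset.sum_filter_add_sum_filter_not _ _ _).symm
  simp_rw [h1]
  rw [Finset.sum_add_distrib]
  congr 1
  · rw [Finset.sum_sigma', Finset.sum_sigma']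
    refine Finset.sum_bij' (fun x _ => ⟨x.2.1, x.2.2⟩) (fun y _ => ⟨y.1 + y.2, (y.1, y.2)⟩) ?_ ?_ ?_ ?_ ?_
    · rintro ⟨q, a, c⟩ h
      simp only [Finset.mem_sigma, Finset.mem_filter, Finset.HasAntidiagonal.mem_antidiagonal, Finset.mem_Ico, Finset.mem_range] at *
      omega
    · rintro ⟨a, c⟩ h
      simp only [Finset.mem_sigma, Finset.mem_filter, Finset.HasAntidiagonal.mem_antidiagonal, Finset.mem_Ico, Finset.mem_range, max_le_iff] at *
      refine ⟨⟨?_, ?_⟩, trivial, ?_⟩ <;> omega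
    · rintro ⟨q, a, c⟩ h
      simp only [Finset.mem_sigma, Finset.mem_filter, Finset.HasAntidiagonal.mem_antidiagonal] at h
      simp [h.2.1]
    · rintro ⟨a, c⟩ h; rfl
    · rintro ⟨q, a, c⟩ h; rfl
  · rw [Finset.sum_sigma', Finset.sum_sigma']
    refine Finset.sum_bij' (fun x _ => ⟨x.2.2, x.2.1⟩) (fun y _ => ⟨y.2 + y.1, (y.2, y.1)⟩) ?_ ?_ ?_ ?_ ?_
    · rintro ⟨q, a, c⟩ h
      simp only [Finset.mem_sigma, Finset.mem_filter, Finset.HasAntidiagonal.mem_antidiagonal, Finset.mem_Ico, Finset.mem_range] at *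
      omega
    · rintro ⟨a, c⟩ h
      simp only [Finset.mem_sigma, Finset.mem_filter, Finset.HasAntidiagonal.mem_antidiagonal, Finset.mem_Ico, Finset.mem_range, max_le_iff] at *
      refine ⟨⟨?_, ?_⟩, trivial, ?_⟩ <;> omega
    · rintro ⟨q, a, c⟩ h
      simp only [Finset.mem_sigma, Finset.mem_filter, Finset.HasAntidiagonal.mem_antidiagonal] at h
      simp [h.2.1]
    · rintro ⟨a, c⟩ h; rfl
    · rintro ⟨q, a, c⟩ h; rfl

/-- pointwise block bound -/
lemma block_pt {σ : ℝ} (h0 : 1 / 4 ≤ σ) (h1 : σ ≤ 1 / 2) (η : ℝ) (ζ : ℂ) {X : ℝ} (hX : 0 ≤ X)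
    (A L : ℕ) (hL : L ≤ A + 1) (hr : ∀ q ∈ Finset.Ico A (A + L), ‖ζ‖ ^ q ≤ X) :
    (1 + L * ‖1 - ζ‖ / max 1 ‖ζ‖) * ‖∑ q ∈ Finset.Ico A (A + L), hh (σ + η * Complex.I) q ζ‖ ≤
      128 * Real.exp (19 * η ^ 2) * L * X * ((A:ℝ) + 1) ^ (2 * σ - 1) := by
  set l : ℂ := σ + η * Complex.I with hl
  set w := (1 + L * ‖1 - ζ‖ / max 1 ‖ζ‖) with hw
  have hw0 : 0 ≤ w := by positivity
  set E := Real.exp (9 * η ^ 2) with hE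
  have hE0 : 0 < E := Real.exp_pos _
  have hb : ∀ c, ‖bb l c‖ ≤ E * rb σ c := fun c => bb_bound_mul h0 η c
  have hrb0 : ∀ c : ℕ, A ≤ 2 * c → rb σ c ≤ 2 * ((A:ℝ) + 1) ^ (σ - 1) := by
    intro c hc
    have hc' : ((A:ℝ) + 1) / 2 ≤ c + 1 := by
      have : (A:ℝ) ≤ 2 * c := by exact_mod_cast hc
      linarith
    calc rb σ c ≤ ((c:ℝ) + 1) ^ (σ - 1) := rb_le (by linarith) (by linarith) c
      _ ≤ (((A:ℝ) + 1) / 2) ^ (σ - 1) := Real.rpow_le_rpow_of_nonpos (by positivity) hc' (by linarith)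
      _ = ((A:ℝ) + 1) ^ (σ - 1) * 2 ^ (1 - σ) := by
          rw [Real.div_rpow (by positivity) (by norm_num), show σ - 1 = -(1 - σ) by ring,
            Real.rpow_neg (by norm_num : (0:ℝ) ≤ 2)]; simp
      _ ≤ ((A:ℝ) + 1) ^ (σ - 1) * 2 := by
          gcongr
          calc (2:ℝ) ^ (1 - σ) ≤ 2 ^ (1:ℝ) := Real.rpow_le_rpow_of_exponent_le (by norm_num) (by linarith)
            _ = 2 := by simp
      _ = _ := by ring
  have hsum : ∑ a ∈ Finset.range (A + 1), rb σ a ≤ 4 * ((A:ℝ) + 1) ^ σ := by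
    have e := rb_sum (σ := σ) (by linarith) (A + 1)
    have e2 : ((A + 1 : ℕ):ℝ) * rb σ (A + 1) ≤ ((A:ℝ) + 1) ^ σ := by
      calc ((A + 1 : ℕ):ℝ) * rb σ (A + 1) ≤ ((A:ℝ) + 1) * rb σ A := by
            push_cast; gcongr; exact rb_anti (by linarith) (by linarith) (by omega)
        _ ≤ ((A:ℝ) + 1) * ((A:ℝ) + 1) ^ (σ - 1) := by
            gcongr; exact rb_le (by linarith) (by linarith) A
        _ = _ := by rw [Real.rpow_sub_one (by positivity)]; field_simp
    have : 0 ≤ ∑ a ∈ Finset.range (A + 1), rb σ a := Finset.sum_nonneg fun i _ => rb_nonneg _ _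
    nlinarith
  -- generic half
  have half : ∀ (u v : ℂ) (s : ℕ → ℕ), ‖u‖ = ‖ζ‖ → ‖v‖ = ‖ζ‖ → ‖1 - v‖ = ‖1 - ζ‖ → (∀ a, A - a ≤ s a) → (∀ a, a ≤ s a) →
      w * ‖∑ a ∈ Finset.range (A + 1), ∑ c ∈ Finset.Ico (s a) (A + L - a), (bb l a * u ^ a) * (bb l c * v ^ c)‖ ≤
        64 * Real.exp (19 * η ^ 2) * L * X * ((A:ℝ) + 1) ^ (2 * σ - 1) := by
    intro u v s hu hv hv1 hs1 hs2
    calc _ ≤ w * ∑ a ∈ Finset.range (A + 1), ‖∑ c ∈ Finset.Ico (s a) (A + L - a), (bb l a * u ^ a) * (bb l c * v ^ c)‖ := by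
          gcongr; exact norm_sum_le _ _
      _ = ∑ a ∈ Finset.range (A + 1), ‖bb l a‖ * (w * (‖ζ‖ ^ a * ‖∑ c ∈ Finset.Ico (s a) (A + L - a), (bb l c * v ^ c)‖)) := by
          rw [Finset.mul_sum]; refine Finset.sum_congr rfl fun a _ => ?_
          rw [← Finset.mul_sum, norm_mul, norm_mul, norm_pow, hu]; ring
      _ ≤ ∑ a ∈ Finset.range (A + 1), (E * rb σ a) * (8 * Real.exp (10 * η ^ 2) * L * X * (2 * ((A:ℝ) + 1) ^ (σ - 1))) := by
          refine Finset.sum_le_sum fun a ha => ?_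
          have haA : a ≤ A := by have := Finset.mem_range.1 ha; omega
          refine mul_le_mul (hb a) ?_ (by positivity) (by have := rb_nonneg σ a; positivity)
          have := sumblk h0 h1 η v (ra := ‖ζ‖ ^ a) (by positivity) hX (s a) (A + L - a) L
            (by have := hs1 a; omega) (by
              intro c hc
              rw [hv, ← pow_add]
              refine hr _ ?_
              have := hs1 a
              simp only [Finset.mem_Ico] at *; omega)
          rw [hv1, hv] at this
          refine this.trans ?_
          gcongr
          exact hrb0 _ (by have := hs1 a; have := hs2 a; omega)
      _ = (E * (8 * Real.exp (10 * η ^ 2) * L * X * (2 * ((A:ℝ) + 1) ^ (σ - 1)))) * ∑ a ∈ Finset.range (A + 1), rb σ a := by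
          rw [Finset.mul_sum]; exact Finset.sum_congr rfl fun _ _ => by ring
      _ ≤ (E * (8 * Real.exp (10 * η ^ 2) * L * X * (2 * ((A:ℝ) + 1) ^ (σ - 1)))) * (4 * ((A:ℝ) + 1) ^ σ) := by
          gcongr
      _ = 64 * (E * Real.exp (10 * η ^ 2)) * L * X * (((A:ℝ) + 1) ^ (σ - 1) * ((A:ℝ) + 1) ^ σ) := by ring
      _ = _ := by
          rw [hE, ← Real.exp_add, ← Real.rpow_add (by positivity)]; ring_nf
  have hcz : ‖(1:ℂ) - (starRingEnd ℂ) ζ‖ = ‖1 - ζ‖ := by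
    rw [← Complex.norm_conj (1 - ζ)]; simp
  have e := block_rearr (fun a c => (bb l a * ζ ^ a) * (bb l c * (starRingEnd ℂ ζ) ^ c)) A L hL
  have e' : ∑ q ∈ Finset.Ico A (A + L), hh l q ζ = _ := e
  rw [e']
  have H1 := half ζ (starRingEnd ℂ ζ) (fun a => max a (A - a)) rfl (Complex.norm_conj _) hcz
    (fun a => le_max_right _ _) (fun a => le_max_left _ _)
  have H2 := half (starRingEnd ℂ ζ) ζ (fun a => max (a + 1) (A - a)) (Complex.norm_conj _) rfl rfl
    (fun a => le_max_right _ _) (fun a => (Nat.le_succ a).trans (le_max_left _ _))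
  have H2' : ∑ c ∈ Finset.range (A + 1), ∑ a ∈ Finset.Ico (max (c + 1) (A - c)) (A + L - c),
      (bb l a * ζ ^ a) * (bb l c * (starRingEnd ℂ ζ) ^ c) = ∑ c ∈ Finset.range (A + 1), ∑ a ∈ Finset.Ico (max (c + 1) (A - c)) (A + L - c),
      (bb l c * (starRingEnd ℂ ζ) ^ c) * (bb l a * ζ ^ a) :=
    Finset.sum_congr rfl fun _ _ => Finset.sum_congr rfl fun _ _ => mul_comm _ _
  rw [H2']
  refine (mul_le_mul_of_nonneg_left (norm_add_le _ _) hw0).trans ?_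
  rw [mul_add]
  linarith

section fischer
open MvPolynomial

variable {n : ℕ}

lemma C_two' : (C 2 : MvPolynomial (Fin n) ℝ) = 2 := map_ofNat C 2
lemma C_three' : (C 3 : MvPolynomial (Fin n) ℝ) = 3 := map_ofNat C 3

def lin (y : Fin n → ℝ) : MvPolynomial (Fin n) ℝ := ∑ i, C (y i) * X i
def sqX (n : ℕ) : MvPolynomial (Fin n) ℝ := ∑ i, X i * X i
def sqC (y : Fin n → ℝ) : MvPolynomial (Fin n) ℝ := C (∑ i, y i * y i)
def DD (y : Fin n → ℝ) (p : MvPolynomial (Fin n) ℝ) : MvPolynomial (Fin n) ℝ := ∑ i, C (y i) * pderiv i p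
def lap (p : MvPolynomial (Fin n) ℝ) : MvPolynomial (Fin n) ℝ := ∑ i, pderiv i (pderiv i p)

def HH (ν : ℝ) (y : Fin n → ℝ) : ℕ → MvPolynomial (Fin n) ℝ
  | 0 => 1
  | 1 => C (2 * ν) * lin y
  | (l + 2) => C (1 / ((l:ℝ) + 2)) * (C (2 * (l + 1 + ν)) * (lin y * HH ν y (l + 1)) -
      C (l + 2 * ν) * (sqC y * (sqX n * HH ν y l)))

lemma HH_rec (ν : ℝ) (y : Fin n → ℝ) (l : ℕ) : ((l : MvPolynomial (Fin n) ℝ) + 2) * HH ν y (l + 2) =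
    2 * ((l : MvPolynomial (Fin n) ℝ) + 1 + C ν) * (lin y * HH ν y (l + 1)) - ((l : MvPolynomial (Fin n) ℝ) + 2 * C ν) * (sqC y * (sqX n * HH ν y l)) := by
  have h : ((l : MvPolynomial (Fin n) ℝ) + 2) * C (1 / ((l:ℝ) + 2)) = 1 := by
    have : ((l : MvPolynomial (Fin n) ℝ) + 2) = C ((l:ℝ) + 2) := by simp [C_two']
    rw [this, ← C_mul, mul_one_div_cancel (by positivity)]; simp
  rw [HH, ← mul_assoc, h]; simp [C_two']

lemma DD_mul (y : Fin n → ℝ) (p q : MvPolynomial (Fin n) ℝ) : DD y (p * q) = DD y p * q + p * DD y q := by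
  simp only [DD, pderiv_mul, Finset.sum_mul, Finset.mul_sum, ← Finset.sum_add_distrib]
  exact Finset.sum_congr rfl fun i _ => by ring

lemma pderiv_lin (y : Fin n → ℝ) (i : Fin n) : pderiv i (lin y) = C (y i) := by
  rw [lin, map_sum, Finset.sum_eq_single i]
  · simp [pderiv_mul]
  · intro j _ hj; simp [pderiv_mul, pderiv_X_of_ne hj]
  · simp

lemma pderiv_sqX (i : Fin n) : pderiv i (sqX n) = 2 * X i := by
  rw [sqX, map_sum, Finset.sum_eq_single i]
  · simp [pderiv_mul]; ring
  · intro j _ hj; simp [pderiv_mul, pderiv_X_of_ne hj]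
  · simp

lemma DD_lin (y : Fin n → ℝ) : DD y (lin y) = sqC y := by
  simp [DD, pderiv_lin, sqC]

lemma DD_sqX (y : Fin n → ℝ) : DD y (sqX n) = 2 * lin y := by
  simp only [DD, pderiv_sqX, lin, Finset.mul_sum]
  exact Finset.sum_congr rfl fun i _ => by ring

lemma DD_C_mul (y : Fin n → ℝ) (c : ℝ) (p : MvPolynomial (Fin n) ℝ) : DD y (C c * p) = C c * DD y p := by
  rw [DD_mul]; simp [DD]

lemma DD_sub (y : Fin n → ℝ) (p q : MvPolynomial (Fin n) ℝ) : DD y (p - q) = DD y p - DD y q := by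
  simp only [DD, map_sub, mul_sub, Finset.sum_sub_distrib]

lemma HH_hom (ν : ℝ) (y : Fin n → ℝ) : ∀ l, (HH ν y l).IsHomogeneous l
  | 0 => by rw [HH]; exact isHomogeneous_one _ _
  | 1 => by
    rw [HH]; refine IsHomogeneous.C_mul ?_ _
    exact IsHomogeneous.sum _ _ _ fun i _ => isHomogeneous_C_mul_X _ _
  | (l + 2) => by
    rw [HH]; refine IsHomogeneous.C_mul (IsHomogeneous.sub (IsHomogeneous.C_mul ?_ _) (IsHomogeneous.C_mul (IsHomogeneous.C_mul ?_ _) _)) _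
    · have : (lin y).IsHomogeneous 1 := IsHomogeneous.sum _ _ _ fun i _ => isHomogeneous_C_mul_X _ _
      have := this.mul (HH_hom ν y (l + 1))
      rwa [show 1 + (l + 1) = l + 2 by ring] at this
    · have : (sqX n).IsHomogeneous 2 := IsHomogeneous.sum _ _ _ fun i _ =>
        (isHomogeneous_X ℝ i).mul (isHomogeneous_X ℝ i)
      have := this.mul (HH_hom ν y l)
      rwa [show 2 + l = l + 2 by ring] at this

lemma HH_DD (ν : ℝ) (y : Fin n → ℝ) : ∀ l : ℕ,
    DD y (HH ν y (l + 1)) = ((l : MvPolynomial (Fin n) ℝ) + 2 * C ν) * (sqC y * HH ν y l)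
  | 0 => by
    rw [HH, HH, DD_C_mul, DD_lin]; simp [C_two']
  | 1 => by
    have h2 := congrArg (DD y) (HH_rec ν y 0)
    have e1 : (((0:ℕ) : MvPolynomial (Fin n) ℝ) + 2) = C 2 := by simp [C_two', C_three']
    have e2 : (2 * (((0:ℕ) : MvPolynomial (Fin n) ℝ) + 1 + C ν)) = C (2 * (1 + ν)) := by simp [C_two', C_three']
    have e3 : (((0:ℕ) : MvPolynomial (Fin n) ℝ) + 2 * C ν) = C (2 * ν) := by simp [C_two', C_three']
    have h0 := HH_DD ν y 0
    rw [e3] at h0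
    rw [e1, e2, e3, DD_sub, DD_C_mul, DD_C_mul, DD_C_mul, DD_mul, DD_lin, sqC, DD_C_mul, DD_mul, ← sqC, DD_sqX, h0] at h2
    simp only [zero_add, HH, one_add_one_eq_two] at h2 ⊢
    have hD1 : DD y (1 : MvPolynomial (Fin n) ℝ) = 0 := by simp [DD]
    rw [hD1] at h2
    have : (C 2 : MvPolynomial (Fin n) ℝ) ≠ 0 := by rw [Ne, C_eq_zero]; norm_num
    refine mul_left_cancel₀ this ?_
    simp only [C_mul, C_add, C_two', C_three', map_ofNat, map_one, HH, Nat.cast_one] at h2 ⊢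
    linear_combination h2
  | (l + 2) => by
    have h2 := congrArg (DD y) (HH_rec ν y (l + 1))
    have e1 : (((l + 1 : ℕ) : MvPolynomial (Fin n) ℝ) + 2) = C ((l:ℝ) + 3) := by simp [C_two', C_three']; ring
    have e2 : (2 * (((l + 1 : ℕ) : MvPolynomial (Fin n) ℝ) + 1 + C ν)) = C (2 * ((l:ℝ) + 2 + ν)) := by simp [C_two', C_three']; ring
    have e3 : (((l + 1 : ℕ) : MvPolynomial (Fin n) ℝ) + 2 * C ν) = C ((l:ℝ) + 1 + 2 * ν) := by simp [C_two', C_three']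
    have h0 := HH_DD ν y (l + 1)
    have h1 := HH_DD ν y l
    have hr := HH_rec ν y l
    rw [e1, e2, e3, DD_sub, DD_C_mul, DD_C_mul, DD_C_mul, DD_mul, DD_lin, sqC, DD_C_mul, DD_mul, ← sqC, DD_sqX, h0, h1] at h2
    have : (C ((l:ℝ) + 3) : MvPolynomial (Fin n) ℝ) ≠ 0 := by
      rw [Ne, C_eq_zero]; positivity
    refine mul_left_cancel₀ this ?_
    rw [show l + 2 + 1 = l + 1 + 2 by ring]
    rw [h2]
    simp only [C_mul, C_add, C_two', C_three', map_ofNat, map_one, map_natCast, Nat.cast_add, Nat.cast_one, Nat.cast_ofNat]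
    linear_combination (-(l + 1 + 2 * C ν)) * sqC y * hr

lemma lap_lin (y : Fin n → ℝ) (p : MvPolynomial (Fin n) ℝ) : lap (lin y * p) = lin y * lap p + 2 * DD y p := by
  simp only [lap, DD, pderiv_mul, pderiv_lin, map_add, pderiv_C_mul, pderiv_C, Finset.mul_sum, ← Finset.sum_add_distrib]
  exact Finset.sum_congr rfl fun i _ => by ring

lemma lap_sqX (p : MvPolynomial (Fin n) ℝ) {l : ℕ} (hp : p.IsHomogeneous l) :
    lap (sqX n * p) = sqX n * lap p + (4 * l + 2 * n) * p := by
  have he := hp.sum_X_mul_pderiv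
  have h2 : ∀ i : Fin n, pderiv i (2 : MvPolynomial (Fin n) ℝ) = 0 := fun i => by
    rw [← C_two', pderiv_C]
  have : lap (sqX n * p) = sqX n * lap p + 4 * (∑ i, X i * pderiv i p) + 2 * (∑ i : Fin n, p) := by
    simp only [lap, pderiv_mul, pderiv_sqX, map_add, pderiv_C, Finset.mul_sum, ← Finset.sum_add_distrib, pderiv_X_self, h2]
    exact Finset.sum_congr rfl fun i _ => by ring
  rw [this, he]; simp; ring

lemma lap_C_mul (c : ℝ) (p : MvPolynomial (Fin n) ℝ) : lap (C c * p) = C c * lap p := by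
  simp [lap, pderiv_C_mul, Finset.mul_sum]

lemma lap_sub (p q : MvPolynomial (Fin n) ℝ) : lap (p - q) = lap p - lap q := by
  simp only [lap, map_sub, Finset.sum_sub_distrib]

lemma HH_lap (ν : ℝ) (hν : (n:ℝ) = 2 * ν + 2) (y : Fin n → ℝ) : ∀ l : ℕ, lap (HH ν y l) = 0
  | 0 => by simp [HH, lap]
  | 1 => by
    rw [HH, lap_C_mul]; simp [lap, pderiv_lin]
  | (l + 2) => by
    rw [HH, lap_C_mul, lap_sub, lap_C_mul, lap_C_mul, lap_lin, sqC, lap_C_mul, ← sqC, lap_sqX _ (HH_hom ν y l), HH_lap ν hν y l,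
      HH_lap ν hν y (l + 1), HH_DD]
    have : ((n : ℕ) : MvPolynomial (Fin n) ℝ) = 2 * C ν + 2 := by
      rw [← map_natCast (C (σ := Fin n) (R := ℝ)) n, hν]; simp [C_two']
    simp only [C_mul, C_add, C_two', C_three', map_ofNat, map_one, map_natCast]
    rw [this]; ring

lemma HH_lead (ν : ℝ) (hν : 0 < ν) : ∀ l : ℕ, ∃ γ : ℝ, 0 < γ ∧ ∀ y : Fin n → ℝ,
    ∃ Q, HH ν y l = C γ * lin y ^ l + sqX n * Q := by
  have : ∀ l : ℕ, (∃ γ : ℝ, 0 < γ ∧ ∀ y : Fin n → ℝ, ∃ Q, HH ν y l = C γ * lin y ^ l + sqX n * Q) ∧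
      (∃ γ : ℝ, 0 < γ ∧ ∀ y : Fin n → ℝ, ∃ Q, HH ν y (l + 1) = C γ * lin y ^ (l + 1) + sqX n * Q) := by
    intro l
    induction l with
    | zero =>
      refine ⟨⟨1, one_pos, fun y => ⟨0, by simp [HH]⟩⟩, ⟨2 * ν, by positivity, fun y => ⟨0, by simp [HH]⟩⟩⟩
    | succ l ih =>
      refine ⟨ih.2, ?_⟩
      obtain ⟨γ, hγ, hQ⟩ := ih.2
      refine ⟨1 / ((l:ℝ) + 2) * (2 * (l + 1 + ν)) * γ, by positivity, fun y => ?_⟩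
      obtain ⟨Q, hQ⟩ := hQ y
      refine ⟨C (1 / ((l:ℝ) + 2)) * (C (2 * (l + 1 + ν)) * (lin y * Q) - C (l + 2 * ν) * (sqC y * HH ν y l)), ?_⟩
      rw [HH, hQ, C_mul (a' := γ), C_mul (a := 1 / ((l:ℝ) + 2))]; ring
  exact fun l => (this l).1

def mfac (s : Fin n →₀ ℕ) : ℝ := ∏ i, ((s i).factorial : ℝ)

lemma mfac_pos (s : Fin n →₀ ℕ) : 0 < mfac s := Finset.prod_pos fun i _ => by positivity

def fis (p q : MvPolynomial (Fin n) ℝ) : ℝ := ∑ s ∈ p.support, mfac s * p.coeff s * q.coeff s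

lemma fis_eq {p : MvPolynomial (Fin n) ℝ} (q : MvPolynomial (Fin n) ℝ) {T : Finset (Fin n →₀ ℕ)}
    (h : p.support ⊆ T) : fis p q = ∑ s ∈ T, mfac s * p.coeff s * q.coeff s := by
  rw [fis]
  refine Finset.sum_subset h fun s _ hs => ?_
  rw [notMem_support_iff.1 hs]; ring

lemma fis_add_right (p q q' : MvPolynomial (Fin n) ℝ) : fis p (q + q') = fis p q + fis p q' := by
  simp only [fis, coeff_add, mul_add, Finset.sum_add_distrib]

lemma fis_C_mul (p q : MvPolynomial (Fin n) ℝ) (c : ℝ) : fis p (C c * q) = c * fis p q := by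
  simp only [fis, coeff_C_mul, Finset.mul_sum]; exact Finset.sum_congr rfl fun i _ => by ring

lemma fis_C_mul_left (p q : MvPolynomial (Fin n) ℝ) (c : ℝ) : fis (C c * p) q = c * fis p q := by
  have : (C c * p).support ⊆ p.support := by
    intro s; simp only [mem_support_iff, coeff_C_mul]; exact fun h h' => h (by rw [h', mul_zero])
  rw [fis_eq q this, fis, Finset.mul_sum]
  exact Finset.sum_congr rfl fun i _ => by rw [coeff_C_mul]; ring

lemma fis_add_left (p p' q : MvPolynomial (Fin n) ℝ) : fis (p + p') q = fis p q + fis p' q := by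
  classical
  rw [fis_eq q (support_add (p := p) (q := p')), fis_eq q (p := p) Finset.subset_union_left,
    fis_eq q (p := p') Finset.subset_union_right, ← Finset.sum_add_distrib]
  exact Finset.sum_congr rfl fun i _ => by rw [coeff_add]; ring

lemma fis_sum_right {ι : Type*} (s : Finset ι) (p : MvPolynomial (Fin n) ℝ) (q : ι → MvPolynomial (Fin n) ℝ) :
    fis p (∑ i ∈ s, q i) = ∑ i ∈ s, fis p (q i) := by
  classical
  induction s using Finset.induction_on with
  | empty => simp [fis]
  | insert a s ha ih => rw [Finset.sum_insert ha, Finset.sum_insert ha, fis_add_right, ih]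

lemma fis_sum_left {ι : Type*} (s : Finset ι) (p : ι → MvPolynomial (Fin n) ℝ) (q : MvPolynomial (Fin n) ℝ) :
    fis (∑ i ∈ s, p i) q = ∑ i ∈ s, fis (p i) q := by
  classical
  induction s using Finset.induction_on with
  | empty => simp [fis]
  | insert a s ha ih => rw [Finset.sum_insert ha, Finset.sum_insert ha, fis_add_left, ih]

lemma fis_adj (i : Fin n) (p q : MvPolynomial (Fin n) ℝ) : fis p (X i * q) = fis (pderiv i p) q := by
  classical
  induction p using MvPolynomial.induction_on' generalizing q with
  | add p q' h h' => rw [fis_add_left, h, h', map_add, fis_add_left]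
  | monomial s a =>
    rw [pderiv_monomial, fis_eq (T := {s}) _ support_monomial_subset, fis_eq (T := {s - Finsupp.single i 1}) _ support_monomial_subset]
    simp only [Finset.sum_singleton, coeff_monomial, if_true, coeff_X_mul']
    by_cases hs : s i = 0
    · simp [hs]
    · have : i ∈ s.support := by simpa using hs
      rw [if_pos this]
      have hm : mfac s = mfac (s - Finsupp.single i 1) * s i := by
        rw [mfac, mfac, ← Finset.mul_prod_erase _ _ (Finset.mem_univ i), ← Finset.mul_prod_erase _ _ (Finset.mem_univ i)]
        have e1 : ∏ x ∈ Finset.univ.erase i, (((s - Finsupp.single i 1 : Fin n →₀ ℕ) x).factorial : ℝ) = ∏ x ∈ Finset.univ.erase i, ((s x).factorial : ℝ) := by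
          refine Finset.prod_congr rfl fun j hj => ?_
          have : i ≠ j := (Finset.ne_of_mem_erase hj).symm
          simp [Finsupp.tsub_apply, Finsupp.single_eq_of_ne' this]
        rw [e1]
        have e2 : ((s i).factorial : ℝ) = s i * (((s - Finsupp.single i 1 : Fin n →₀ ℕ) i).factorial : ℝ) := by
          simp only [Finsupp.tsub_apply, Finsupp.single_eq_same]
          exact_mod_cast (Nat.mul_factorial_pred hs).symm
        rw [e2]; ring
      rw [hm]; ring

lemma fis_lin (y : Fin n → ℝ) (p q : MvPolynomial (Fin n) ℝ) : fis p (lin y * q) = fis (DD y p) q := by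
  rw [lin, DD, Finset.sum_mul, fis_sum_right, fis_sum_left]
  refine Finset.sum_congr rfl fun i _ => ?_
  rw [mul_assoc, fis_C_mul, fis_adj, fis_C_mul_left]

lemma fis_sqX (p q : MvPolynomial (Fin n) ℝ) : fis p (sqX n * q) = fis (lap p) q := by
  rw [sqX, lap, Finset.sum_mul, fis_sum_right, fis_sum_left]
  refine Finset.sum_congr rfl fun i _ => ?_
  rw [mul_assoc, fis_adj, fis_adj]

lemma fis_pow (y : Fin n → ℝ) : ∀ (l : ℕ) (p : MvPolynomial (Fin n) ℝ), p.IsHomogeneous l →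
    fis p (lin y ^ l) = l.factorial * eval y p := by
  intro l
  induction l with
  | zero =>
    intro p hp
    have : p = C (coeff 0 p) := (totalDegree_eq_zero_iff_eq_C).1 (Nat.le_zero.1 hp.totalDegree_le)
    rw [this, fis_eq (T := {0}) _ (by simpa using support_monomial_subset (s := (0 : Fin n →₀ ℕ)) (a := coeff 0 p))]
    simp [mfac]
  | succ l ih =>
    intro p hp
    have h1 : (DD y p).IsHomogeneous l := IsHomogeneous.sum _ _ _ fun i _ => (hp.pderiv).C_mul _
    rw [pow_succ', fis_lin, ih _ h1]
    have := congrArg (eval y) hp.sum_X_mul_pderiv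
    simp only [map_sum, map_mul, eval_X, nsmul_eq_mul, map_natCast] at this
    simp only [DD, map_sum, map_mul, eval_C]
    rw [this, Nat.factorial_succ]; push_cast; ring

lemma HH_repr (ν : ℝ) (hν : (n:ℝ) = 2 * ν + 2) (hν0 : 0 < ν) (l : ℕ) : ∃ c : ℝ, 0 < c ∧ ∀ x y : Fin n → ℝ,
    eval y (HH ν x l) = ∑ s ∈ Finset.finsuppAntidiag Finset.univ l, (c * mfac s) * ((HH ν x l).coeff s * (HH ν y l).coeff s) := by
  obtain ⟨γ, hγ, hQ⟩ := HH_lead (n := n) ν hν0 l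
  refine ⟨(γ * l.factorial)⁻¹, by positivity, fun x y => ?_⟩
  obtain ⟨Q, hQ⟩ := hQ y
  have h1 : fis (HH ν x l) (HH ν y l) = γ * (l.factorial * eval y (HH ν x l)) := by
    rw [hQ, fis_add_right, fis_C_mul, fis_pow _ _ _ (HH_hom ν x l), fis_sqX, HH_lap ν hν]
    simp [fis]
  have h2 : (HH ν x l).support ⊆ Finset.finsuppAntidiag Finset.univ l := by
    intro s hs
    rw [Finset.mem_finsuppAntidiag]
    refine ⟨?_, by simp⟩
    have := HH_hom ν x l (mem_support_iff.1 hs)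
    rw [← this, Finsupp.weight_apply, Finsupp.sum_fintype _ _ (by simp)]
    simp
  rw [fis_eq _ h2] at h1
  have : ((l.factorial : ℝ)) ≠ 0 := by positivity
  have e : eval y (HH ν x l) = (γ * l.factorial)⁻¹ * (γ * (l.factorial * eval y (HH ν x l))) := by
    field_simp
  rw [e, ← h1, Finset.mul_sum]
  exact Finset.sum_congr rfl fun s _ => by ring

lemma cont_coeff_X {Y : Type*} [TopologicalSpace Y] {p : Y → MvPolynomial (Fin n) ℝ} (h : ∀ s, Continuous fun y => (p y).coeff s)
    (i : Fin n) (s : Fin n →₀ ℕ) : Continuous fun y => (X i * p y).coeff s := by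
  classical
  simp only [coeff_X_mul']
  split_ifs
  · exact h _
  · exact continuous_const

lemma cont_coeff_lin {p : (Fin n → ℝ) → MvPolynomial (Fin n) ℝ} (h : ∀ s, Continuous fun y => (p y).coeff s)
    (s : Fin n →₀ ℕ) : Continuous fun y => (lin y * p y).coeff s := by
  simp only [lin, Finset.sum_mul, coeff_sum, mul_assoc, coeff_C_mul]
  exact continuous_finsetSum _ fun i _ => (continuous_apply i).mul (cont_coeff_X h i s)

lemma cont_coeff_sq {p : (Fin n → ℝ) → MvPolynomial (Fin n) ℝ} (h : ∀ s, Continuous fun y => (p y).coeff s)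
    (s : Fin n →₀ ℕ) : Continuous fun y => (sqC y * (sqX n * p y)).coeff s := by
  simp only [sqC, coeff_C_mul]
  simp only [sqX, Finset.sum_mul _ _ (p _), coeff_sum, mul_assoc]
  have h1 : Continuous fun y : Fin n → ℝ => ∑ i, y i * y i := by fun_prop
  have h2 : Continuous fun y : Fin n → ℝ => ∑ i, coeff s (X i * (X i * p y)) :=
    continuous_finsetSum _ fun i _ => cont_coeff_X (fun s => cont_coeff_X h i s) i s
  exact h1.mul h2

lemma HH_cont (ν : ℝ) (l : ℕ) : ∀ (s : Fin n →₀ ℕ), Continuous fun y : Fin n → ℝ => (HH ν y l).coeff s := by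
  have : (∀ (s : Fin n →₀ ℕ), Continuous fun y : Fin n → ℝ => (HH ν y l).coeff s) ∧
      ∀ (s : Fin n →₀ ℕ), Continuous fun y : Fin n → ℝ => (HH ν y (l + 1)).coeff s := by
    induction l with
    | zero =>
      refine ⟨fun s => by simp only [HH]; exact continuous_const, fun s => ?_⟩
      have := cont_coeff_lin (n := n) (p := fun _ => 1) (fun s => continuous_const) s
      simp only [mul_one] at this
      simp only [zero_add, HH, coeff_C_mul]
      exact this.const_mul _
    | succ l ih =>
      refine ⟨ih.2, fun s => ?_⟩
      simp only [HH, coeff_C_mul, coeff_sub]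
      exact (((cont_coeff_lin ih.2 s).const_mul _).sub ((cont_coeff_sq ih.1 s).const_mul _)).const_mul _
  exact this.1

lemma HH_eval (ν : ℝ) (x y : Fin n → ℝ) (u v : ℂ) (h1 : u + v = 2 * (∑ i, x i * y i : ℝ))
    (h2 : u * v = ((∑ i, x i * x i) * (∑ i, y i * y i) : ℝ)) : ∀ l, hu ν l u v = (eval y (HH ν x l) : ℝ)
  | 0 => by simp [hu, HH, bb]
  | 1 => by
    simp only [hu, HH, lin, map_mul, eval_C, map_sum, eval_X]
    rw [Finset.Nat.antidiagonal_succ]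
    simp [bb]
    push_cast at h1
    linear_combination (ν:ℂ) * h1
  | (l + 2) => by
    have hr := hu_rec ν l u v
    have hr2 := congrArg (eval y) (HH_rec ν x l)
    rw [HH_eval ν x y u v h1 h2 l, HH_eval ν x y u v h1 h2 (l + 1), h1, h2] at hr
    simp only [map_mul, map_sub, map_add, map_natCast, map_ofNat, map_one, eval_C, lin, sqC, sqX, map_sum, eval_X] at hr2
    have h3 := congrArg (fun r : ℝ => (r : ℂ)) hr2
    have : ((l:ℂ) + 2) ≠ 0 := by exact_mod_cast (by omega : l + 2 ≠ 0)
    refine mul_left_cancel₀ this ?_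
    rw [hr]
    push_cast at h3 ⊢
    linear_combination -h3

end fischer

def zt {n : ℕ} (x y : Euc n) : ℂ :=
  ⟨inner ℝ x y / ‖y‖ ^ 2, √(‖x‖ ^ 2 * ‖y‖ ^ 2 - inner ℝ x y ^ 2) / ‖y‖ ^ 2⟩

lemma zt_add {n : ℕ} (x y : Euc n) : zt x y + starRingEnd ℂ (zt x y) = ((2 * (inner ℝ x y / ‖y‖ ^ 2) : ℝ) : ℂ) := by
  rw [Complex.add_conj]; rfl

lemma zt_normSq {n : ℕ} (x y : Euc n) : Complex.normSq (zt x y) = ‖x‖ ^ 2 / ‖y‖ ^ 2 := by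
  have h0 : inner ℝ x y ^ 2 ≤ ‖x‖ ^ 2 * ‖y‖ ^ 2 := by
    rw [← mul_pow, ← sq_abs]
    exact pow_le_pow_left₀ (abs_nonneg _) (abs_real_inner_le_norm x y) 2
  have h1 : √(‖x‖ ^ 2 * ‖y‖ ^ 2 - inner ℝ x y ^ 2) ^ 2 = ‖x‖ ^ 2 * ‖y‖ ^ 2 - inner ℝ x y ^ 2 :=
    Real.sq_sqrt (by linarith)
  rw [Complex.normSq_apply]
  simp only [zt]
  rcases eq_or_ne (‖y‖) 0 with h | h
  · simp [h]
  · field_simp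
    rw [mul_comm (‖y‖ ^ 2), h1]; ring

lemma zt_mul {n : ℕ} (x y : Euc n) : zt x y * starRingEnd ℂ (zt x y) = ((‖x‖ ^ 2 / ‖y‖ ^ 2 : ℝ) : ℂ) := by
  rw [Complex.mul_conj, zt_normSq]

lemma zt_norm {n : ℕ} (x y : Euc n) : ‖zt x y‖ = ‖x‖ / ‖y‖ := by
  rw [← sq_eq_sq₀ (norm_nonneg _) (by positivity), Complex.sq_norm, zt_normSq, div_pow]

lemma zt_one_sub {n : ℕ} (x y : Euc n) (hy : y ≠ 0) : ‖1 - zt x y‖ = ‖x - y‖ / ‖y‖ := by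
  have hy' : ‖y‖ ≠ 0 := norm_ne_zero_iff.2 hy
  rw [← sq_eq_sq₀ (norm_nonneg _) (by positivity), Complex.sq_norm, Complex.normSq_sub, zt_normSq, div_pow,
    norm_sub_sq_real]
  simp [zt]
  field_simp
  ring

lemma zt_smul {n : ℕ} (x y : Euc n) {a b : ℝ} (ha : 0 ≤ a) (hb : 0 < b) : zt (a • x) (b • y) = ((a / b : ℝ) : ℂ) * zt x y := by
  apply Complex.ext
  · simp [zt, inner_smul_left, inner_smul_right, norm_smul, mul_pow]
    field_simp
  · simp only [zt, inner_smul_left, inner_smul_right, norm_smul, Complex.re_ofReal_mul, Complex.im_ofReal_mul]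
    have : (‖a‖ * ‖x‖) ^ 2 * (‖b‖ * ‖y‖) ^ 2 - (b * ((starRingEnd ℝ) a * inner ℝ x y)) ^ 2
      = (a * b) ^ 2 * (‖x‖ ^ 2 * ‖y‖ ^ 2 - inner ℝ x y ^ 2) := by
      simp [mul_pow]; ring
    rw [this, Real.sqrt_mul (by positivity), Real.sqrt_sq (by positivity)]
    simp [mul_pow]
    field_simp

lemma zt_meas {n : ℕ} : Measurable fun z : Euc n × Euc n => zt z.1 z.2 := by
  have : (fun z : Euc n × Euc n => zt z.1 z.2) = fun z =>
      ((inner ℝ z.1 z.2 / ‖z.2‖ ^ 2 : ℝ) : ℂ) +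
       ((√(‖z.1‖ ^ 2 * ‖z.2‖ ^ 2 - inner ℝ z.1 z.2 ^ 2) / ‖z.2‖ ^ 2 : ℝ) : ℂ) * Complex.I := by
    funext z; exact (Complex.mk_eq_add_mul_I _ _)
  rw [this]
  fun_prop

lemma hh_cont (l : ℂ) (q : ℕ) : Continuous (hh l q) := by
  unfold hh hu; fun_prop

abbrev Sn (n : ℕ) := sphere (0 : Euc n) 1
abbrev sg (n : ℕ) : Measure (Sn n) := (volume : Measure (Euc n)).toSphere

open scoped Pointwise in
lemma cap_growth (n : ℕ) (hn : 1 ≤ n) : ∃ K : ℝ≥0∞, K ≠ ⊤ ∧ ∀ (x : Sn n) (R : ℝ), 0 < R →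
    sg n (ball x R) ≤ K * ENNReal.ofReal (R ^ ((n:ℝ) - 1)) := by
  have : NeZero n := ⟨by omega⟩
  set v := volume (ball (0 : Euc n) 1) with hv
  have hvt : v ≠ ⊤ := measure_ball_lt_top.ne
  have hball : ∀ (x : Euc n) (r : ℝ), 0 ≤ r → volume (ball x r) = ENNReal.ofReal (r ^ n) * v := by
    intro x r hr
    have := Measure.addHaar_ball (volume : Measure (Euc n)) x hr
    simpa using this
  refine ⟨n * (ENNReal.ofReal (3 * 2 ^ n) * v), ?_, fun x R hR => ?_⟩
  · exact ENNReal.mul_ne_top (by simp) (ENNReal.mul_ne_top ENNReal.ofReal_ne_top hvt)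
  rw [Measure.toSphere_apply' _ measurableSet_ball, finrank_euclideanSpace_fin, mul_assoc, mul_assoc]
  refine mul_le_mul_right ?_ _
  rcases le_or_gt R 1 with h1 | h1
  · have hsub : Ioo (0:ℝ) 1 • ((↑) '' (ball x R) : Set (Euc n)) ⊆
        ⋃ j ∈ Finset.range (⌊1 / R⌋₊ + 1), ball ((j * R : ℝ) • (x : Euc n)) (2 * R) := by
      rintro _ ⟨τ, hτ, _, ⟨w, hw, rfl⟩, rfl⟩
      simp only [mem_iUnion, Finset.mem_range]
      refine ⟨⌊τ / R⌋₊, ?_, ?_⟩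
      · exact Nat.lt_succ_of_le (Nat.floor_le_floor (by gcongr; exact hτ.2.le))
      · rw [mem_ball, dist_eq_norm]
        have e : τ • (w : Euc n) - (⌊τ / R⌋₊ * R : ℝ) • (x : Euc n) =
          τ • ((w : Euc n) - x) + (τ - ⌊τ / R⌋₊ * R) • (x : Euc n) := by
          rw [smul_sub, sub_smul]; abel
        have hx : ‖(x : Euc n)‖ = 1 := by simp
        have f1 := Nat.floor_le (div_nonneg hτ.1.le hR.le)
        have f2 := Nat.lt_floor_add_one (τ / R)
        rw [le_div_iff₀ hR] at f1
        rw [div_lt_iff₀ hR] at f2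
        have hw' : ‖(w : Euc n) - x‖ < R := by
          rw [← dist_eq_norm]; exact hw
        calc _ ≤ ‖τ • ((w : Euc n) - x)‖ + ‖(τ - ⌊τ / R⌋₊ * R) • (x : Euc n)‖ := by
              rw [e]; exact norm_add_le _ _
          _ = τ * ‖(w : Euc n) - x‖ + (τ - ⌊τ / R⌋₊ * R) := by
              rw [norm_smul, norm_smul, hx, Real.norm_of_nonneg hτ.1.le, Real.norm_of_nonneg (by linarith), mul_one]
          _ < 2 * R := by nlinarith [hτ.2, norm_nonneg ((w : Euc n) - x)]
    calc _ ≤ _ := measure_mono hsub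
      _ ≤ _ := measure_biUnion_finset_le _ _
      _ = ∑ j ∈ Finset.range (⌊1 / R⌋₊ + 1), ENNReal.ofReal ((2 * R) ^ n) * v := by
          refine Finset.sum_congr rfl fun j _ => hball _ _ (by positivity)
      _ = ENNReal.ofReal ((⌊1 / R⌋₊ + 1) * (2 * R) ^ n) * v := by
          rw [Finset.sum_const, Finset.card_range, nsmul_eq_mul, ENNReal.ofReal_mul (by positivity), mul_assoc]
          congr 1
          rw [← Nat.cast_succ, ENNReal.ofReal_natCast]
      _ ≤ ENNReal.ofReal (3 * 2 ^ n * R ^ ((n:ℝ) - 1)) * v := by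
          refine mul_le_mul_left (ENNReal.ofReal_le_ofReal ?_) _
          have f := Nat.floor_le (show 0 ≤ 1 / R by positivity)
          have : (⌊1 / R⌋₊ : ℝ) + 1 ≤ 3 / R := by
            have : 1 ≤ 1 / R := by rw [le_div_iff₀ hR]; linarith
            have e : 3 / R = 3 * (1 / R) := by ring
            linarith
          rw [Real.rpow_sub_one hR.ne', Real.rpow_natCast]
          calc _ ≤ 3 / R * (2 * R) ^ n := by gcongr
            _ = _ := by rw [mul_pow]; ring
      _ = _ := by rw [ENNReal.ofReal_mul (by positivity), mul_assoc, mul_comm v]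
  · have hsub : Ioo (0:ℝ) 1 • ((↑) '' (ball x R) : Set (Euc n)) ⊆ ball 0 1 := by
      rintro _ ⟨τ, hτ, _, ⟨w, hw, rfl⟩, rfl⟩
      simp [norm_smul, abs_of_pos hτ.1, hτ.2]
    refine (measure_mono hsub).trans ?_
    rw [← hv, mul_comm v, ← mul_assoc]
    refine le_mul_of_one_le_left zero_le ?_
    rw [← ENNReal.ofReal_mul (by positivity), ENNReal.one_le_ofReal]
    have : 1 ≤ R ^ ((n:ℝ) - 1) := Real.one_le_rpow h1.le (by
      have : (1:ℝ) ≤ n := by exact_mod_cast hn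
      linarith)
    have h2 : (1:ℝ) ≤ 2 ^ n := one_le_pow₀ (by norm_num)
    nlinarith

lemma Zrep (n : ℕ) (hn : 3 ≤ n) (m : ℕ) : ∃ (F : Finset (Fin n →₀ ℕ)) (D : (Fin n →₀ ℕ) → ℝ)
    (Y : (Fin n →₀ ℕ) → Sn n → ℝ), (∀ s, 0 ≤ D s) ∧ (∀ s, Continuous (Y s)) ∧ ∀ ω ω' : Sn n,
    ((m:ℂ) + ((n/2-1 : ℝ) : ℂ)) * (hu ((n/2-1 : ℝ) : ℂ) m (zt (ω : Euc n) ω') (starRingEnd ℂ (zt (ω : Euc n) ω')) / ((n/2-1 : ℝ) : ℂ)) =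
      ∑ s ∈ F, (D s : ℂ) * ((Y s ω : ℂ) * (Y s ω' : ℂ)) := by
  have hn' : (3:ℝ) ≤ n := by exact_mod_cast hn
  set ν : ℝ := n/2-1 with hν
  have hν0 : 0 < ν := by rw [hν]; linarith
  obtain ⟨c, hc, h⟩ := HH_repr (n := n) ν (by rw [hν]; ring) hν0 m
  refine ⟨Finset.finsuppAntidiag Finset.univ m, fun s => (m + ν) / ν * (c * mfac s),
    fun s ω => (HH ν (fun i => (ω : Euc n) i) m).coeff s, fun s => ?_, fun s => ?_, fun ω ω' => ?_⟩
  · have := mfac_pos s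
    positivity
  · exact (HH_cont ν m s).comp (by fun_prop)
  · have hs : ∀ x : Sn n, ∑ i, (x : Euc n) i * (x : Euc n) i = 1 := by
      intro x
      have : ‖(x : Euc n)‖ ^ 2 = 1 := by simp
      rw [EuclideanSpace.real_norm_sq_eq] at this
      simpa [pow_two] using this
    have hin : inner ℝ (ω : Euc n) ω' = ∑ i, (ω : Euc n) i * (ω' : Euc n) i := by
      simp [PiLp.inner_apply, mul_comm]
    rw [HH_eval ν (fun i => (ω : Euc n) i) (fun i => (ω' : Euc n) i) (zt (ω : Euc n) ω')
      (starRingEnd ℂ (zt (ω : Euc n) ω')) (by rw [zt_add, hin]; simp) (by rw [zt_mul, hs, hs]; simp), h]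
    push_cast
    rw [Finset.sum_div, Finset.mul_sum]
    refine Finset.sum_congr rfl fun s _ => ?_
    ring

/-- bounded measurable -/
def BM {X : Type*} [MeasurableSpace X] (f : X → ℂ) : Prop := Measurable f ∧ ∃ M : ℝ, ∀ x, ‖f x‖ ≤ M

lemma BM.int {X : Type*} [MeasurableSpace X] {f : X → ℂ} (h : BM f) (μ : Measure X) [IsFiniteMeasure μ] : Integrable f μ := by
  obtain ⟨hm, M, hM⟩ := h
  exact Integrable.of_bound hm.aestronglyMeasurable M (ae_of_all _ hM)

lemma BM.mul {X : Type*} [MeasurableSpace X] {f g : X → ℂ} (h : BM f) (h' : BM g) : BM fun x => f x * g x := by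
  obtain ⟨hm, M, hM⟩ := h
  obtain ⟨hm', M', hM'⟩ := h'
  refine ⟨hm.mul hm', M * M', fun x => ?_⟩
  rw [norm_mul]
  exact mul_le_mul (hM x) (hM' x) (norm_nonneg _) ((norm_nonneg _).trans (hM x))

lemma BM.sum {X ι : Type*} [MeasurableSpace X] (s : Finset ι) {f : ι → X → ℂ} (h : ∀ i ∈ s, BM (f i)) : BM fun x => ∑ i ∈ s, f i x := by
  choose! a M hM using h
  refine ⟨Finset.measurable_fun_sum _ a, ∑ i ∈ s, M i, fun x => (norm_sum_le _ _).trans (Finset.sum_le_sum fun i hi => hM i hi x)⟩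

lemma BM.cont {X : Type*} [TopologicalSpace X] [CompactSpace X] [MeasurableSpace X] [OpensMeasurableSpace X] {f : X → ℂ} (h : Continuous f) : BM f := by
  refine ⟨h.measurable, ?_⟩
  obtain ⟨C, hC⟩ := isCompact_univ.exists_bound_of_continuousOn h.continuousOn
  exact ⟨C, fun x => hC x (mem_univ _)⟩

lemma BM.conj {X : Type*} [MeasurableSpace X] {f : X → ℂ} (h : BM f) : BM fun x => starRingEnd ℂ (f x) := by
  obtain ⟨hm, M, hM⟩ := h
  exact ⟨by fun_prop, M, fun x => by simpa using hM x⟩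

lemma BM.const {X : Type*} [MeasurableSpace X] (c : ℂ) : BM fun _ : X => c := ⟨measurable_const, ‖c‖, fun _ => le_rfl⟩

section sph
variable {n : ℕ} (F : ℕ → Finset (Fin n →₀ ℕ)) (D : ℕ → (Fin n →₀ ℕ) → ℝ) (Y : ℕ → (Fin n →₀ ℕ) → Sn n → ℝ)

def Nn (m : ℕ) (f : Sn n → ℂ) : ℝ := ∑ s ∈ F m, D m s * ‖∫ ω, (Y m s ω : ℂ) * f ω ∂(sg n)‖ ^ 2

def Sq (q : ℕ) (f : Sn n → ℂ) : ℝ := ∑ j ∈ Finset.range (q + 1), if 2 * j ≤ q then Nn F D Y (q - 2 * j) f else 0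

lemma Nn_nonneg (hD : ∀ m s, 0 ≤ D m s) (m f) : 0 ≤ Nn F D Y m f :=
  Finset.sum_nonneg fun s _ => mul_nonneg (hD m s) (by positivity)

lemma Sq_mono (hD : ∀ m s, 0 ≤ D m s) (q f) : Sq F D Y q f ≤ Sq F D Y (q + 2) f := by
  have e0 := Finset.sum_range_succ' (fun j => if 2 * j ≤ q + 2 then Nn F D Y (q + 2 - 2 * j) f else 0) (q + 2)
  rw [Sq, Sq, e0, Finset.sum_range_succ _ (q + 1)]
  have : ∀ j, (if 2 * (j + 1) ≤ q + 2 then Nn F D Y (q + 2 - 2 * (j + 1)) f else 0) = if 2 * j ≤ q then Nn F D Y (q - 2 * j) f else 0 := by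
    intro j
    have e : q + 2 - 2 * (j + 1) = q - 2 * j := by omega
    rw [e]
    by_cases h : 2 * j ≤ q
    · rw [if_pos h, if_pos (by omega)]
    · rw [if_neg h, if_neg (by omega)]
  simp only [this]
  have h1 : 0 ≤ (if 2 * (q + 1) ≤ q then Nn F D Y (q - 2 * (q + 1)) f else 0) := by
    split_ifs
    · exact Nn_nonneg F D Y hD _ _
    · exact le_rfl
  have h2 : 0 ≤ (if 2 * 0 ≤ q + 2 then Nn F D Y (q + 2 - 2 * 0) f else 0) := by
    split_ifs
    · exact Nn_nonneg F D Y hD _ _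
    · exact le_rfl
  linarith

lemma Sq_nonneg (hD : ∀ m s, 0 ≤ D m s) (q f) : 0 ≤ Sq F D Y q f := by
  refine Finset.sum_nonneg fun j _ => ?_
  split_ifs
  · exact Nn_nonneg F D Y hD _ _
  · exact le_rfl

lemma form_exp (hY : ∀ m s, Continuous (Y m s)) (ν : ℝ) (hν : 0 < ν)
    (hZ : ∀ (m : ℕ) (ω ω' : Sn n), ((m:ℂ) + (ν : ℂ)) * (hu (ν : ℂ) m (zt (ω : Euc n) ω') (starRingEnd ℂ (zt (ω : Euc n) ω')) / (ν : ℂ)) =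
      ∑ s ∈ F m, (D m s : ℂ) * ((Y m s ω : ℂ) * (Y m s ω' : ℂ)))
    (l : ℂ) (q : ℕ) {f g : Sn n → ℂ} (hf : BM f) (hg : BM g) :
    ∫ ω : Sn n, ∫ ω' : Sn n, hh l q (zt (ω : Euc n) ω') * (f ω * g ω') ∂(sg n) ∂(sg n) =
    ∑ j ∈ Finset.range (q + 1), if 2 * j ≤ q then bb (l - ν) j * kk ν l (q - j) *
      ∑ s ∈ F (q - 2 * j), (D (q - 2 * j) s : ℂ) * ((∫ ω, (Y (q - 2 * j) s ω : ℂ) * f ω ∂(sg n)) * (∫ ω, (Y (q - 2 * j) s ω : ℂ) * g ω ∂(sg n))) else 0 := by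
  have hYb : ∀ m s, BM fun ω => (Y m s ω : ℂ) := fun m s => BM.cont (Complex.continuous_ofReal.comp (hY m s))
  have e1 : ∀ ω ω' : Sn n, hh l q (zt (ω : Euc n) ω') = ∑ j ∈ Finset.range (q + 1), if 2 * j ≤ q then bb (l - ν) j * kk ν l (q - j) *
      ∑ s ∈ F (q - 2 * j), (D (q - 2 * j) s : ℂ) * ((Y (q - 2 * j) s ω : ℂ) * (Y (q - 2 * j) s ω' : ℂ)) else 0 := by
    intro ω ω'
    rw [hh, connection (ν := (ν : ℂ)) (fun i => by
      have : (0:ℝ) < ν + i := by positivity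
      exact_mod_cast this.ne')]
    refine Finset.sum_congr rfl fun j _ => ?_
    rw [tt, zt_mul]
    by_cases h : 2 * j ≤ q
    · have e : ((q:ℤ) - 2 * j) = ((q - 2 * j : ℕ) : ℤ) := by push_cast [h]; ring
      rw [if_pos h, ← hZ, cz, e, if_pos (by positivity)]
      simp
    · rw [if_neg h, cz, if_neg (by omega)]; simp
  have e2 : ∀ ω : Sn n, ∫ ω' : Sn n, hh l q (zt (ω : Euc n) ω') * (f ω * g ω') ∂(sg n) =
      ∑ j ∈ Finset.range (q + 1), if 2 * j ≤ q then bb (l - ν) j * kk ν l (q - j) *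
      ∑ s ∈ F (q - 2 * j), (D (q - 2 * j) s : ℂ) * (((Y (q - 2 * j) s ω : ℂ) * f ω) * (∫ ω, (Y (q - 2 * j) s ω : ℂ) * g ω ∂(sg n))) else 0 := by
    intro ω
    simp only [e1, Finset.sum_mul]
    rw [integral_finsetSum]
    · refine Finset.sum_congr rfl fun j _ => ?_
      split_ifs
      · simp only [Finset.mul_sum, Finset.sum_mul]
        rw [integral_finsetSum]
        · refine Finset.sum_congr rfl fun s _ => ?_
          rw [← integral_const_mul, ← integral_const_mul, ← integral_const_mul]
          congr 1; funext ω'; ring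
        · intro s _
          exact ((((BM.const _).mul (((BM.const _).mul ((BM.const _).mul (hYb _ _)))))).mul ((BM.const _).mul hg)).int _
      · simp
    · intro j _
      split_ifs
      · exact (((BM.const _).mul (BM.sum _ fun s _ => (BM.const _).mul ((BM.const _).mul (hYb _ _)))).mul ((BM.const _).mul hg)).int _
      · simp
  simp only [e2]
  rw [integral_finsetSum]
  · refine Finset.sum_congr rfl fun j _ => ?_
    split_ifs
    · rw [integral_const_mul, integral_finsetSum]
      · congr 1
        refine Finset.sum_congr rfl fun s _ => ?_
        rw [integral_const_mul, integral_mul_const]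
      · intro s _
        exact ((BM.const _).mul (((hYb _ _).mul hf).mul (BM.const _))).int _
    · simp
  · intro j _
    split_ifs
    · exact ((BM.const _).mul (BM.sum _ fun s _ => (BM.const _).mul (((hYb _ _).mul hf).mul (BM.const _)))).int _
    · simp

lemma form_cs (hD : ∀ m s, 0 ≤ D m s) (q : ℕ) (c : ℕ → ℂ) (E : ℝ) (hc : ∀ j, ‖c j‖ ≤ E) (f g : Sn n → ℂ) :
    ‖∑ j ∈ Finset.range (q + 1), if 2 * j ≤ q then c j *
      ∑ s ∈ F (q - 2 * j), (D (q - 2 * j) s : ℂ) * ((∫ ω, (Y (q - 2 * j) s ω : ℂ) * f ω ∂(sg n)) * (∫ ω, (Y (q - 2 * j) s ω : ℂ) * g ω ∂(sg n))) else 0‖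
     ≤ E * (√(Sq F D Y q f) * √(Sq F D Y q g)) := by
  have hE : 0 ≤ E := (norm_nonneg _).trans (hc 0)
  have h1 : ∀ m, ‖∑ s ∈ F m, (D m s : ℂ) * ((∫ ω, (Y m s ω : ℂ) * f ω ∂(sg n)) * (∫ ω, (Y m s ω : ℂ) * g ω ∂(sg n)))‖ ≤
      √(Nn F D Y m f) * √(Nn F D Y m g) := by
    intro m
    have := Real.sum_mul_le_sqrt_mul_sqrt (F m) (fun s => √(D m s) * ‖∫ ω, (Y m s ω : ℂ) * f ω ∂(sg n)‖)
      (fun s => √(D m s) * ‖∫ ω, (Y m s ω : ℂ) * g ω ∂(sg n)‖)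
    simp only [mul_pow, Real.sq_sqrt (hD m _)] at this
    refine le_trans ?_ this
    refine (norm_sum_le _ _).trans (Finset.sum_le_sum fun s _ => le_of_eq ?_)
    rw [norm_mul, norm_mul, Complex.norm_real, Real.norm_of_nonneg (hD m s)]
    have := Real.mul_self_sqrt (hD m s)
    linear_combination (-(‖∫ ω, (Y m s ω : ℂ) * f ω ∂(sg n)‖ * ‖∫ ω, (Y m s ω : ℂ) * g ω ∂(sg n)‖)) * this
  have h2 := Real.sum_mul_le_sqrt_mul_sqrt (Finset.range (q + 1))
    (fun j => √(if 2 * j ≤ q then Nn F D Y (q - 2 * j) f else 0)) (fun j => √(if 2 * j ≤ q then Nn F D Y (q - 2 * j) g else 0))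
  have h3 : ∀ (f : Sn n → ℂ) j, √(if 2 * j ≤ q then Nn F D Y (q - 2 * j) f else 0) ^ 2 = if 2 * j ≤ q then Nn F D Y (q - 2 * j) f else 0 := by
    intro f j
    refine Real.sq_sqrt ?_
    split_ifs
    · exact Nn_nonneg F D Y hD _ _
    · exact le_rfl
  simp only [h3] at h2
  refine le_trans ?_ (mul_le_mul_of_nonneg_left h2 hE)
  rw [Finset.mul_sum]
  refine (norm_sum_le _ _).trans (Finset.sum_le_sum fun j _ => ?_)
  split_ifs
  · rw [norm_mul]
    exact mul_le_mul (hc j) (h1 _) (norm_nonneg _) hE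
  · simp

end sph

lemma kk_one (ν : ℂ) (hν : ∀ i : ℕ, ν + 1 + i ≠ 0) (N : ℕ) : kk ν (ν + 1) N = 1 := by
  rw [kk]; exact Finset.prod_eq_one fun i _ => div_self (hν i)

lemma Sq_eq {n : ℕ} (F : ℕ → Finset (Fin n →₀ ℕ)) (D : ℕ → (Fin n →₀ ℕ) → ℝ) (Y : ℕ → (Fin n →₀ ℕ) → Sn n → ℝ)
   (hY : ∀ m s, Continuous (Y m s)) (ν : ℝ) (hν : 0 < ν)
    (hZ : ∀ (m : ℕ) (ω ω' : Sn n), ((m:ℂ) + (ν : ℂ)) * (hu (ν : ℂ) m (zt (ω : Euc n) ω') (starRingEnd ℂ (zt (ω : Euc n) ω')) / (ν : ℂ)) =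
      ∑ s ∈ F m, (D m s : ℂ) * ((Y m s ω : ℂ) * (Y m s ω' : ℂ)))
    (q : ℕ) {f : Sn n → ℂ} (hf : BM f) :
    (Sq F D Y q f : ℂ) = ∫ ω : Sn n, ∫ ω' : Sn n, hh ((ν + 1 : ℝ) : ℂ) q (zt (ω : Euc n) ω') * (f ω * starRingEnd ℂ (f ω')) ∂(sg n) ∂(sg n) := by
  rw [form_exp F D Y hY ν hν hZ _ q hf hf.conj, Sq]
  push_cast
  refine Finset.sum_congr rfl fun j _ => ?_
  split_ifs
  · rw [kk_one _ (fun i => by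
      have : (0:ℝ) < ν + 1 + i := by positivity
      exact_mod_cast this.ne'), show (ν : ℂ) + 1 - ν = 1 by ring, bb_one, Nn]
    push_cast
    rw [one_mul, one_mul]
    refine Finset.sum_congr rfl fun s _ => ?_
    have : (∫ ω, (Y (q - 2 * j) s ω : ℂ) * starRingEnd ℂ (f ω) ∂(sg n)) = starRingEnd ℂ (∫ ω, (Y (q - 2 * j) s ω : ℂ) * f ω ∂(sg n)) := by
      rw [← integral_conj]
      congr 1; funext ω; simp
    rw [this, Complex.mul_conj, Complex.normSq_eq_norm_sq]
    push_cast; rfl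
  · simp

lemma sph_poisson (n : ℕ) (hn : 3 ≤ n) : ∃ C : ℝ≥0∞, C ≠ ⊤ ∧ ∀ ρ : ℝ, 0 ≤ ρ → ρ < 1 → ∀ f : Sn n → ℂ, Measurable f →
    ∫⁻ z : Sn n × Sn n, ENNReal.ofReal (‖1 - (ρ : ℂ) * zt (z.1 : Euc n) z.2‖ ^ (-(n:ℝ))) * (‖f z.1‖ₑ * ‖f z.2‖ₑ) ∂((sg n).prod (sg n))
     ≤ C * ENNReal.ofReal (1 / (1 - ρ)) * ∫⁻ x, ‖f x‖ₑ ^ (2:ℝ) ∂(sg n) := by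
  obtain ⟨K, hK, hcap⟩ := cap_growth n (by omega)
  refine ⟨ENNReal.ofReal (2 ^ (n:ℝ)) * (K * ENNReal.ofReal (farC ((n:ℝ) - 1) n)), ENNReal.mul_ne_top ENNReal.ofReal_ne_top (ENNReal.mul_ne_top hK ENNReal.ofReal_ne_top), fun ρ h0 h1 f hf => ?_⟩
  have h1' : 0 < 1 - ρ := by linarith
  have hfar : ∀ x : Sn n, ∫⁻ w, ENNReal.ofReal (2 ^ (n:ℝ)) * ENNReal.ofReal ((max (1 - ρ) (dist w x)) ^ (-(n:ℝ))) ∂(sg n)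
      ≤ ENNReal.ofReal (2 ^ (n:ℝ)) * (K * ENNReal.ofReal (farC ((n:ℝ) - 1) n)) * ENNReal.ofReal (1 / (1 - ρ)) := by
    intro x
    rw [lintegral_const_mul _ (by fun_prop), mul_assoc, mul_assoc]
    refine mul_le_mul_right ?_ _
    have := far_lemma (sg n) K (γ := (n:ℝ) - 1) (s := n) (by linarith) (by positivity) x (hcap x) h1'
    refine this.trans (le_of_eq ?_)
    rw [ENNReal.ofReal_mul]
    · congr 3
      rw [show (n:ℝ) - 1 - n = -1 by ring, Real.rpow_neg_one, one_div]
    · rw [farC, show (n:ℝ) - 1 - n = -1 by ring, Real.rpow_neg_one]; positivity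
  set p : Sn n × Sn n → ℝ≥0∞ := fun z => ENNReal.ofReal (2 ^ (n:ℝ)) * ENNReal.ofReal ((max (1 - ρ) (dist z.1 z.2)) ^ (-(n:ℝ))) with hp
  have hpm : Measurable p := by
    rw [hp]; fun_prop
  have hmain := cs_form (sg n) (sg n) p p hpm hpm (fun x => ‖f x‖ₑ) (fun x => ‖f x‖ₑ) (by fun_prop) (by fun_prop) _
    (ae_of_all _ fun x _ => by simpa only [hp, dist_comm x] using hfar x) (ae_of_all _ fun x _ => by simpa only [hp] using hfar x)
  refine (lintegral_mono fun z => ?_).trans (hmain.trans (le_of_eq ?_))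
  · have e : (p z * p z) ^ (1 / 2 : ℝ) = p z := by
      rw [← pow_two, ← ENNReal.rpow_natCast, ← ENNReal.rpow_mul]; norm_num
    simp only [e]
    refine mul_le_mul_left ?_ _
    rw [hp]
    simp only
    rw [← ENNReal.ofReal_mul (by positivity)]
    refine ENNReal.ofReal_le_ofReal ?_
    have hz : ‖1 - (ρ : ℂ) * zt (z.1 : Euc n) z.2‖ = ‖ρ • (z.1 : Euc n) - z.2‖ := by
      have := zt_smul (z.1 : Euc n) z.2 h0 one_pos
      rw [one_smul, div_one] at this
      rw [← this, zt_one_sub _ _ (by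
        intro h
        have := z.2.2
        rw [h] at this; simp at this)]
      simp
    have n1 : ‖(z.1 : Euc n)‖ = 1 := by simp
    have n2 : ‖(z.2 : Euc n)‖ = 1 := by simp
    have g1 : 1 - ρ ≤ ‖ρ • (z.1 : Euc n) - z.2‖ := by
      have := norm_sub_norm_le (z.2 : Euc n) (ρ • (z.1 : Euc n))
      rw [norm_smul, n1, n2, Real.norm_of_nonneg h0, mul_one, norm_sub_rev] at this
      exact this
    have g2 : dist z.1 z.2 ≤ 2 * ‖ρ • (z.1 : Euc n) - z.2‖ := by
      rw [Subtype.dist_eq, dist_eq_norm]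
      have e : (z.1 : Euc n) - z.2 = (1 - ρ) • (z.1 : Euc n) + (ρ • (z.1 : Euc n) - z.2) := by
        rw [sub_smul, one_smul]; abel
      rw [e]
      refine (norm_add_le _ _).trans ?_
      rw [norm_smul, n1, Real.norm_of_nonneg h1'.le]; linarith
    rw [hz]
    have hm : max (1 - ρ) (dist z.1 z.2) ≤ 2 * ‖ρ • (z.1 : Euc n) - z.2‖ := max_le (by linarith) g2
    have hm0 : 0 < max (1 - ρ) (dist z.1 z.2) := lt_max_of_lt_left h1'
    calc _ ≤ (max (1 - ρ) (dist z.1 z.2) / 2) ^ (-(n:ℝ)) :=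
          Real.rpow_le_rpow_of_nonpos (by positivity) (by linarith) (by simp)
      _ = _ := by
          rw [Real.div_rpow hm0.le (by norm_num), Real.rpow_neg (by norm_num : (0:ℝ) ≤ 2), div_inv_eq_mul, mul_comm]
  · rw [← ENNReal.rpow_add_of_nonneg _ _ (by norm_num) (by norm_num)]
    norm_num

set_option maxHeartbeats 1600000 in
lemma Sq_bound (n : ℕ) (hn : 3 ≤ n) : ∃ C : ℝ, 0 ≤ C ∧ ∀ (F : ℕ → Finset (Fin n →₀ ℕ)) (D : ℕ → (Fin n →₀ ℕ) → ℝ) (Y : ℕ → (Fin n →₀ ℕ) → Sn n → ℝ)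
   (_ : ∀ m s, 0 ≤ D m s) (_ : ∀ m s, Continuous (Y m s))
    (_ : ∀ (m : ℕ) (ω ω' : Sn n), ((m:ℂ) + ((n/2-1 : ℝ) : ℂ)) * (hu ((n/2-1 : ℝ) : ℂ) m (zt (ω : Euc n) ω') (starRingEnd ℂ (zt (ω : Euc n) ω')) / ((n/2-1 : ℝ) : ℂ)) =
      ∑ s ∈ F m, (D m s : ℂ) * ((Y m s ω : ℂ) * (Y m s ω' : ℂ)))
    (q : ℕ) (f : Sn n → ℂ) (_ : BM f), Sq F D Y q f ≤ C * ∫ x, ‖f x‖ ^ 2 ∂(sg n) := by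
  have hn' : (3:ℝ) ≤ n := by exact_mod_cast hn
  have hν0 : (0:ℝ) < n/2-1 := by linarith
  obtain ⟨C, hC, hP⟩ := sph_poisson n hn
  refine ⟨2 * Real.exp 3 * C.toReal, by positivity, fun F D Y hD hY hZ q f hf => ?_⟩
  obtain ⟨hfm, M, hM⟩ := hf
  have hM0 : 0 ≤ M ∨ IsEmpty (Sn n) := by
    rcases isEmpty_or_nonempty (Sn n) with h | ⟨⟨x⟩⟩
    · exact Or.inr h
    · exact Or.inl ((norm_nonneg _).trans (hM x))
  set I : ℝ := ∫ x, ‖f x‖ ^ 2 ∂(sg n) with hI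
  have hI0 : 0 ≤ I := integral_nonneg fun x => by positivity
  have hIe : ∫⁻ x, ‖f x‖ₑ ^ (2:ℝ) ∂(sg n) = ENNReal.ofReal I := by
    rw [hI, ofReal_integral_eq_lintegral_ofReal]
    · congr 1; funext x
      rw [← ofReal_norm, ENNReal.ofReal_rpow_of_nonneg (norm_nonneg _) (by norm_num)]
      norm_num
    · refine Integrable.of_bound (by fun_prop) (M ^ 2) (ae_of_all _ fun x => ?_)
      rw [Real.norm_of_nonneg (by positivity)]
      exact pow_le_pow_left₀ (norm_nonneg _) (hM x) 2
    · exact ae_of_all _ fun x => by positivity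
  -- partial sums
  have key : ∀ ρ : ℝ, 0 ≤ ρ → ρ < 1 → ∀ N, ∑ k ∈ Finset.range N, ρ ^ k * Sq F D Y k f ≤ C.toReal * (1 / (1 - ρ)) * I := by
    intro ρ h0 h1 N
    have hbd : ∀ z : Sn n × Sn n, ‖(ρ : ℂ) * zt (z.1 : Euc n) z.2‖ ≤ ρ := by
      intro z
      rw [norm_mul, zt_norm, Complex.norm_real, Real.norm_of_nonneg h0]; simp
    set G : ℕ → Sn n × Sn n → ℂ := fun N z => (∑ k ∈ Finset.range N, hh ((n/2-1 + 1 : ℝ) : ℂ) k ((ρ : ℂ) * zt (z.1 : Euc n) z.2)) * (f z.1 * starRingEnd ℂ (f z.2)) with hG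
    have hzm : Measurable fun z : Sn n × Sn n => zt (z.1 : Euc n) z.2 :=
      zt_meas.comp (by fun_prop : Measurable fun z : Sn n × Sn n => ((z.1 : Euc n), (z.2 : Euc n)))
    have hhm : ∀ l k, Measurable fun z : Sn n × Sn n => hh l k ((ρ : ℂ) * zt (z.1 : Euc n) z.2) := fun l k =>
      (hh_cont l k).measurable.comp (by fun_prop)
    have hGm : ∀ N, Measurable (G N) := by
      intro N; rw [hG]
      refine Measurable.mul (Finset.measurable_fun_sum _ fun k _ => hhm _ k) ?_
      fun_prop
    have hGb : ∀ N z, ‖G N z‖ ≤ (1 - ρ) ^ (-(n:ℝ)) * (M * M) := by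
      intro N z
      have hM1 : 0 ≤ M := (norm_nonneg _).trans (hM z.1)
      rw [hG]
      simp only [norm_mul, RCLike.norm_conj]
      refine mul_le_mul ?_ (mul_le_mul (hM _) (hM _) (norm_nonneg _) hM1) (by positivity) (Real.rpow_nonneg (by linarith) _)
      refine (norm_sum_le _ _).trans ((hh_sum_norm_le (by linarith) (hbd z) h1 _).trans (le_of_eq ?_))
      congr 1; ring
    have e1 : ∀ k, ((ρ ^ k * Sq F D Y k f : ℝ) : ℂ) = ∫ z, hh ((n/2-1 + 1 : ℝ) : ℂ) k ((ρ : ℂ) * zt (z.1 : Euc n) z.2) * (f z.1 * starRingEnd ℂ (f z.2)) ∂((sg n).prod (sg n)) := by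
      intro k
      push_cast
      rw [Sq_eq F D Y hY (n/2-1) hν0 hZ k ⟨hfm, M, hM⟩, ← integral_prod (fun z : Sn n × Sn n => hh ((n/2-1 + 1 : ℝ) : ℂ) k (zt (z.1 : Euc n) z.2) * (f z.1 * starRingEnd ℂ (f z.2))), ← integral_const_mul]
      · congr 1; funext z
        rw [hh_smul]; push_cast; ring
      · have b1 : BM fun z : Sn n × Sn n => f z.1 := ⟨by fun_prop, M, fun z => hM _⟩
        have b2 : BM fun z : Sn n × Sn n => f z.2 := ⟨by fun_prop, M, fun z => hM _⟩
        have b3 : BM fun z : Sn n × Sn n => hh ((n/2-1 + 1 : ℝ) : ℂ) k (zt (z.1 : Euc n) z.2) := by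
          obtain ⟨B, hB⟩ := (isCompact_closedBall (0:ℂ) 1).exists_bound_of_continuousOn (hh_cont ((n/2-1 + 1 : ℝ) : ℂ) k).continuousOn
          exact ⟨(hh_cont _ k).measurable.comp hzm, B, fun z => hB _ (by simp [zt_norm])⟩
        have b4 := b3.mul (b1.mul b2.conj)
        exact b4.int _
    have e2 : ∀ N, ((∑ k ∈ Finset.range N, ρ ^ k * Sq F D Y k f : ℝ) : ℂ) = ∫ z, G N z ∂((sg n).prod (sg n)) := by
      intro N
      rw [Complex.ofReal_sum, hG]
      simp only [Finset.sum_mul]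
      rw [integral_finsetSum]
      · exact Finset.sum_congr rfl fun k _ => e1 k
      · intro k _
        refine Integrable.of_bound (Measurable.aestronglyMeasurable ((hhm _ k).mul (by fun_prop))) ((1 - ρ) ^ (-(n:ℝ)) * (M * M)) (ae_of_all _ fun z => ?_)
        have hM1 : 0 ≤ M := (norm_nonneg _).trans (hM z.1)
        simp only [norm_mul, RCLike.norm_conj]
        refine mul_le_mul ?_ (mul_le_mul (hM _) (hM _) (norm_nonneg _) hM1) (by positivity) (Real.rpow_nonneg (by linarith) _)
        have := hh_sum_norm_le (l := n/2-1+1) (by linarith) (hbd z) h1 {k}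
        simp only [Finset.sum_singleton] at this
        refine this.trans (le_of_eq ?_)
        congr 1; ring
    have hlim : Tendsto (fun N => ∫ z, G N z ∂((sg n).prod (sg n))) atTop (nhds (∫ z : Sn n × Sn n, ((‖1 - (ρ : ℂ) * zt (z.1 : Euc n) z.2‖ ^ (-(n:ℝ)) : ℝ) : ℂ) * (f z.1 * starRingEnd ℂ (f z.2)) ∂((sg n).prod (sg n)))) := by
      refine tendsto_integral_of_dominated_convergence (fun _ => (1 - ρ) ^ (-(n:ℝ)) * (M * M)) (fun N => (hGm N).aestronglyMeasurable) (integrable_const _) (fun N => ae_of_all _ (hGb N)) (ae_of_all _ fun z => ?_)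
      rw [hG]
      refine Tendsto.mul_const _ ?_
      have := (hh_hasSum (n/2-1+1) (lt_of_le_of_lt (hbd z) h1)).tendsto_sum_nat
      rwa [show -2 * ((n:ℝ)/2-1+1) = -(n:ℝ) by ring] at this
    simp only [← e2] at hlim
    have hlim' := (Complex.continuous_re.tendsto _).comp hlim
    have hmono : Monotone fun N => ∑ k ∈ Finset.range N, ρ ^ k * Sq F D Y k f := by
      refine monotone_nat_of_le_succ fun N => ?_
      rw [Finset.sum_range_succ]
      have := Sq_nonneg F D Y hD N f
      have : 0 ≤ ρ ^ N * Sq F D Y N f := by positivity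
      linarith
    have hle := hmono.ge_of_tendsto (by simpa only [Function.comp_def, Complex.ofReal_re] using hlim') N
    refine hle.trans ((Complex.re_le_norm _).trans ?_)
    have hb := hP ρ h0 h1 f hfm
    rw [hIe] at hb
    have hb2 := (enorm_integral_le_lintegral_enorm (μ := (sg n).prod (sg n)) (fun z : Sn n × Sn n => ((‖1 - (ρ : ℂ) * zt (z.1 : Euc n) z.2‖ ^ (-(n:ℝ)) : ℝ) : ℂ) * (f z.1 * starRingEnd ℂ (f z.2)))).trans ((lintegral_mono fun z => by
      rw [enorm_mul, enorm_mul, ← ofReal_norm, Complex.norm_real, Real.norm_of_nonneg (by positivity), RCLike.enorm_conj]).trans hb)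
    rw [← ofReal_norm, ← ENNReal.ofReal_toReal hC, ← ENNReal.ofReal_mul (by positivity), ← ENNReal.ofReal_mul (by
      have : 0 < 1 - ρ := by linarith
      positivity)] at hb2
    exact (ENNReal.ofReal_le_ofReal_iff (by
      have : 0 < 1 - ρ := by linarith
      positivity)).1 hb2
  set N : ℕ := q + 1 with hN
  have hNp : (0:ℝ) < N := by rw [hN]; positivity
  set ρ : ℝ := N / (N + 1) with hρ
  have hρ0 : 0 < ρ := by positivity
  have hρ1 : ρ < 1 := by rw [hρ, div_lt_one (by positivity)]; linarith
  have hk := key ρ hρ0.le hρ1 (q + 2 * N)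
  have hmon : ∀ i, Sq F D Y q f ≤ Sq F D Y (q + 2 * i) f := by
    intro i
    induction i with
    | zero => simp
    | succ i ih => exact ih.trans (Sq_mono F D Y hD _ _)
  have hS0 := Sq_nonneg F D Y hD q f
  have hρe : Real.exp (-(1/N)) ≤ ρ := by
    rw [Real.exp_neg, inv_le_comm₀ (Real.exp_pos _) hρ0]
    have : ρ⁻¹ = 1 / N + 1 := by rw [hρ]; field_simp; try ring
    rw [this]; exact Real.add_one_le_exp _
  have hlow : (N:ℝ) * Real.exp (-3) * Sq F D Y q f ≤ ∑ k ∈ Finset.range (q + 2 * N), ρ ^ k * Sq F D Y k f := by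
    have hinj : Set.InjOn (fun i => q + 2 * i) (Finset.range N : Set ℕ) := fun a _ b _ h => by simpa using h
    calc _ = ∑ i ∈ Finset.range N, Real.exp (-3) * Sq F D Y q f := by simp [mul_assoc]
      _ ≤ ∑ i ∈ Finset.range N, ρ ^ (q + 2 * i) * Sq F D Y (q + 2 * i) f := by
        refine Finset.sum_le_sum fun i hi => mul_le_mul ?_ (hmon i) hS0 (by positivity)
        have hi' := Finset.mem_range.1 hi
        calc Real.exp (-3) = Real.exp (-(1/N)) ^ (3 * N) := by
              rw [← Real.exp_nat_mul]; congr 1; push_cast; field_simp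
          _ ≤ ρ ^ (3 * N) := pow_le_pow_left₀ (Real.exp_pos _).le hρe _
          _ ≤ _ := pow_le_pow_of_le_one hρ0.le hρ1.le (by omega)
      _ = ∑ k ∈ (Finset.range N).image (fun i => q + 2 * i), ρ ^ k * Sq F D Y k f := (Finset.sum_image (f := fun k => ρ ^ k * Sq F D Y k f) hinj).symm
      _ ≤ _ := by
        refine Finset.sum_le_sum_of_subset_of_nonneg ?_ fun k _ _ => mul_nonneg (by positivity) (Sq_nonneg F D Y hD k f)
        intro k hk
        simp only [Finset.mem_image, Finset.mem_range] at hk ⊢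
        omega
  have h1ρ : 1 / (1 - ρ) = N + 1 := by rw [hρ]; field_simp; ring
  rw [h1ρ] at hk
  have hfin := hlow.trans hk
  rw [Real.exp_neg] at hfin
  have he := Real.exp_pos 3
  have h2 : (N:ℝ) + 1 ≤ 2 * N := by
    have : (1:ℝ) ≤ N := by rw [hN]; push_cast; linarith [Nat.cast_nonneg (α := ℝ) q]
    linarith
  have h3 : C.toReal * (N + 1) * I ≤ C.toReal * (2 * N) * I := by gcongr
  have h4 := hfin.trans h3
  have h5 : (N:ℝ) * (Real.exp 3)⁻¹ * Sq F D Y q f = (N * (Real.exp 3)⁻¹) * Sq F D Y q f := rfl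
  rw [h5, ← le_div_iff₀' (by positivity)] at h4
  refine h4.trans (le_of_eq ?_)
  field_simp

/-- sphere bound -/
lemma SB (n : ℕ) (hn : 3 ≤ n) : ∃ C : ℝ, 0 ≤ C ∧ ∀ (η : ℝ) (q : ℕ) (f g : Sn n → ℂ), BM f → BM g →
    ‖∫ ω : Sn n, ∫ ω' : Sn n, hh ((n/2 : ℝ) + η * Complex.I) q (zt (ω : Euc n) ω') * (f ω * g ω') ∂(sg n) ∂(sg n)‖ ≤
      C * Real.exp (18 * η ^ 2) * (√(∫ x, ‖f x‖ ^ 2 ∂(sg n)) * √(∫ x, ‖g x‖ ^ 2 ∂(sg n))) := by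
  have hn' : (3:ℝ) ≤ n := by exact_mod_cast hn
  have hν0 : (0:ℝ) < n/2-1 := by linarith
  choose F D Y hD hY hZ using Zrep n hn
  obtain ⟨C, hC, hS⟩ := Sq_bound n hn
  refine ⟨C, hC, fun η q f g hf hg => ?_⟩
  rw [form_exp F D Y hY (n/2-1) hν0 hZ _ q hf hg]
  refine (form_cs F D Y hD q (fun j => bb ((n/2 : ℝ) + η * Complex.I - ((n/2-1 : ℝ) : ℂ)) j * kk ((n/2-1 : ℝ) : ℂ) ((n/2 : ℝ) + η * Complex.I) (q - j)) (Real.exp (18 * η ^ 2)) (fun j => ?_) f g).trans ?_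
  · have e1 : ((n/2 : ℝ) + η * Complex.I - ((n/2-1 : ℝ) : ℂ)) = 1 + η * Complex.I := by push_cast; ring
    have e2 : (((n/2 : ℝ) : ℂ) + η * Complex.I) = ((n/2-1 : ℝ) : ℂ) + 1 + η * Complex.I := by push_cast; ring
    rw [e1, e2, norm_mul, show 18 * η ^ 2 = 9 * η ^ 2 + 9 * η ^ 2 by ring, Real.exp_add]
    exact mul_le_mul (bb_bound_one η j) (kk_bound hν0.le η _) (norm_nonneg _) (Real.exp_pos _).le
  · have h1 := Real.sqrt_le_sqrt (hS F D Y hD hY hZ q f hf)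
    have h2 := Real.sqrt_le_sqrt (hS F D Y hD hY hZ q g hg)
    rw [Real.sqrt_mul hC] at h1 h2
    calc _ ≤ Real.exp (18 * η ^ 2) * ((√C * √(∫ x, ‖f x‖ ^ 2 ∂(sg n))) * (√C * √(∫ x, ‖g x‖ ^ 2 ∂(sg n)))) := by
          gcongr
      _ = (√C * √C) * Real.exp (18 * η ^ 2) * (√(∫ x, ‖f x‖ ^ 2 ∂(sg n)) * √(∫ x, ‖g x‖ ^ 2 ∂(sg n))) := by ring
      _ = _ := by rw [Real.mul_self_sqrt hC]

abbrev vI (n : ℕ) : Measure (Ioi (0:ℝ)) := Measure.volumeIoiPow (n - 1)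

lemma lint_vI (n : ℕ) (hn : 1 ≤ n) (g : ℝ → ℝ≥0∞) (hg : Measurable g) :
    ∫⁻ t : Ioi (0:ℝ), g t * ENNReal.ofReal ((t:ℝ) ^ (-(n:ℝ))) ∂(vI n) = ∫⁻ t in Ioi (0:ℝ), g t * ENNReal.ofReal (t ^ (-1 : ℝ)) := by
  rw [vI, Measure.volumeIoiPow, lintegral_withDensity_eq_lintegral_mul _ (by fun_prop) (by fun_prop)]
  rw [← lintegral_subtype_comap measurableSet_Ioi]
  refine lintegral_congr fun t => ?_
  have ht : (0:ℝ) < t := t.2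
  simp only [Pi.mul_apply]
  rw [mul_comm, mul_assoc, ← ENNReal.ofReal_mul (by positivity)]
  congr 2
  rw [← Real.rpow_natCast, ← Real.rpow_add ht, Nat.cast_sub hn]
  congr 1; push_cast; ring

lemma lint_rpow_Ioi {s e : ℝ} (hs : 0 < s) (he : 0 < e) : ∫⁻ t in Ioi s, ENNReal.ofReal (t ^ (-e - 1)) = ENNReal.ofReal (s ^ (-e) / e) := by
  rw [← ofReal_integral_eq_lintegral_ofReal (integrableOn_Ioi_rpow_of_lt (by linarith) hs)
    ((ae_restrict_iff' measurableSet_Ioi).2 (ae_of_all _ fun t ht => Real.rpow_nonneg (hs.trans ht).le _)),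
    integral_Ioi_rpow_of_lt (by linarith) hs]
  congr 1
  rw [sub_add_cancel, neg_div_neg_eq]

lemma lint_rpow_Ioc {s e : ℝ} (hs : 0 < s) (he : 0 < e) : ∫⁻ t in Ioc 0 s, ENNReal.ofReal (t ^ (e - 1)) = ENNReal.ofReal (s ^ e / e) := by
  have hi : IntervalIntegrable (fun t : ℝ => t ^ (e - 1)) volume 0 s := intervalIntegral.intervalIntegrable_rpow' (by linarith)
  rw [← ofReal_integral_eq_lintegral_ofReal ((intervalIntegrable_iff_integrableOn_Ioc_of_le hs.le).1 hi)
    ((ae_restrict_iff' measurableSet_Ioc).2 (ae_of_all _ fun t ht => Real.rpow_nonneg ht.1.le _)),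
    ← intervalIntegral.integral_of_le hs.le, integral_rpow (Or.inl (by linarith))]
  congr 1
  rw [sub_add_cancel, Real.zero_rpow he.ne', sub_zero]

lemma schur1 (n : ℕ) (hn : 1 ≤ n) {s ρ : ℝ} (hs : 0 < s) (hρ : 0 < ρ) :
    ∫⁻ t : Ioi (0:ℝ), ENNReal.ofReal (min (s / t) (t / s) ^ ρ) * ENNReal.ofReal ((t:ℝ) ^ (-(n:ℝ))) ∂(vI n) ≤ ENNReal.ofReal (2 / ρ) := by
  rw [lint_vI n hn (fun t => ENNReal.ofReal (min (s / t) (t / s) ^ ρ)) (by fun_prop), ← Ioc_union_Ioi_eq_Ioi hs.le]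
  refine (lintegral_union_le _ _ _).trans ?_
  have h1 : ∫⁻ t in Ioc 0 s, ENNReal.ofReal (min (s / t) (t / s) ^ ρ) * ENNReal.ofReal (t ^ (-1 : ℝ)) ≤ ENNReal.ofReal (1 / ρ) := by
    calc _ ≤ ∫⁻ t in Ioc 0 s, ENNReal.ofReal (s ^ (-ρ)) * ENNReal.ofReal (t ^ (ρ - 1)) := by
          refine setLIntegral_mono' measurableSet_Ioc fun t ht => ?_
          rw [← ENNReal.ofReal_mul (Real.rpow_nonneg (le_min (div_nonneg hs.le ht.1.le) (div_nonneg ht.1.le hs.le)) _), ← ENNReal.ofReal_mul (by positivity)]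
          refine ENNReal.ofReal_le_ofReal ?_
          have : min (s / t) (t / s) ^ ρ ≤ (t / s) ^ ρ := Real.rpow_le_rpow (le_min (div_nonneg hs.le ht.1.le) (div_nonneg ht.1.le hs.le)) (min_le_right _ _) hρ.le
          refine (mul_le_mul_of_nonneg_right this (Real.rpow_nonneg ht.1.le _)).trans (le_of_eq ?_)
          rw [Real.div_rpow ht.1.le hs.le, Real.rpow_neg hs.le, sub_eq_add_neg, Real.rpow_add ht.1]; ring
      _ = ENNReal.ofReal (1 / ρ) := by
          rw [lintegral_const_mul _ (by fun_prop), lint_rpow_Ioc hs hρ, ← ENNReal.ofReal_mul (by positivity)]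
          congr 1
          rw [Real.rpow_neg hs.le]; field_simp
  have h2 : ∫⁻ t in Ioi s, ENNReal.ofReal (min (s / t) (t / s) ^ ρ) * ENNReal.ofReal (t ^ (-1 : ℝ)) ≤ ENNReal.ofReal (1 / ρ) := by
    calc _ ≤ ∫⁻ t in Ioi s, ENNReal.ofReal (s ^ ρ) * ENNReal.ofReal (t ^ (-ρ - 1)) := by
          refine setLIntegral_mono' measurableSet_Ioi fun t ht => ?_
          have ht0 : 0 < t := hs.trans ht
          rw [← ENNReal.ofReal_mul (by positivity), ← ENNReal.ofReal_mul (by positivity)]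
          refine ENNReal.ofReal_le_ofReal ?_
          have : min (s / t) (t / s) ^ ρ ≤ (s / t) ^ ρ := Real.rpow_le_rpow (by positivity) (min_le_left _ _) hρ.le
          refine (mul_le_mul_of_nonneg_right this (by positivity)).trans (le_of_eq ?_)
          rw [Real.div_rpow hs.le ht0.le, sub_eq_add_neg, Real.rpow_add ht0, Real.rpow_neg ht0.le ρ]; ring
      _ = ENNReal.ofReal (1 / ρ) := by
          rw [lintegral_const_mul _ (by fun_prop), lint_rpow_Ioi hs hρ, ← ENNReal.ofReal_mul (by positivity)]
          congr 1
          rw [Real.rpow_neg hs.le]; field_simp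
  refine (add_le_add h1 h2).trans (le_of_eq ?_)
  rw [← ENNReal.ofReal_add (by positivity) (by positivity)]
  congr 1; ring

/-- polar map -/
def pol (n : ℕ) (z : Sn n × Ioi (0:ℝ)) : Euc n := (z.2 : ℝ) • (z.1 : Euc n)

lemma pol_emb (n : ℕ) : MeasurableEmbedding (pol n) := by
  have : pol n = Subtype.val ∘ (homeomorphUnitSphereProd (Euc n)).symm := by
    funext z; simp [pol, homeomorphUnitSphereProd]
  rw [this]
  exact (MeasurableEmbedding.subtype_coe (measurableSet_singleton _).compl).comp (Homeomorph.measurableEmbedding _)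

lemma pol_mp (n : ℕ) (hn : 1 ≤ n) : MeasurePreserving (pol n) ((sg n).prod (vI n)) volume := by
  have : NeZero n := ⟨by omega⟩
  have e : pol n = Subtype.val ∘ (homeomorphUnitSphereProd (Euc n)).symm := by
    funext z; simp [pol, homeomorphUnitSphereProd]
  rw [e]
  have h1 := Measure.measurePreserving_homeomorphUnitSphereProd (volume : Measure (Euc n))
  rw [finrank_euclideanSpace_fin] at h1
  have h2 := MeasurePreserving.symm (homeomorphUnitSphereProd (Euc n)).toMeasurableEquiv h1
  refine MeasurePreserving.comp ⟨measurable_subtype_coe, ?_⟩ h2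
  rw [(MeasurableEmbedding.subtype_coe (measurableSet_singleton (0 : Euc n)).compl).map_comap]
  simp only [Subtype.range_coe_subtype]
  refine Measure.restrict_eq_self_of_ae_mem ?_
  exact (measure_eq_zero_iff_ae_notMem.1 (measure_singleton (0 : Euc n)))

def four (A B : Type*) [MeasurableSpace A] [MeasurableSpace B] : ((A × A) × (B × B)) ≃ᵐ ((A × B) × (A × B)) where
  toFun z := ((z.1.1, z.2.1), (z.1.2, z.2.2))
  invFun z := ((z.1.1, z.2.1), (z.1.2, z.2.2))
  left_inv _ := rfl
  right_inv _ := rfl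
  measurable_toFun := by change Measurable fun z : (A × A) × (B × B) => ((z.1.1, z.2.1), (z.1.2, z.2.2)); fun_prop
  measurable_invFun := by change Measurable fun z : (A × B) × (A × B) => ((z.1.1, z.2.1), (z.1.2, z.2.2)); fun_prop

lemma four_mp {A B : Type*} [MeasurableSpace A] [MeasurableSpace B] (σ : Measure A) (τ : Measure B) [SFinite σ] [SFinite τ] :
    MeasurePreserving (four A B) ((σ.prod σ).prod (τ.prod τ)) ((σ.prod τ).prod (σ.prod τ)) := by
  refine ⟨(four A B).measurable, Measure.ext_of_lintegral _ fun f hf => ?_⟩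
  rw [lintegral_map hf (four A B).measurable]
  rw [lintegral_prod _ (by exact (hf.comp (four A B).measurable).aemeasurable)]
  have m1 : Measurable fun z : (A × A) × (B × B) => f (four A B z) := hf.comp (four A B).measurable
  rw [lintegral_prod (fun x => ∫⁻ y, f (four A B (x, y)) ∂(τ.prod τ)) (m1.lintegral_prod_right').aemeasurable,
    lintegral_prod _ hf.aemeasurable, lintegral_prod (fun x => ∫⁻ y, f (x, y) ∂(σ.prod τ)) (hf.lintegral_prod_right').aemeasurable]
  refine lintegral_congr fun a => ?_
  have e1 : ∀ a', ∫⁻ y, f (four A B ((a, a'), y)) ∂(τ.prod τ) = ∫⁻ b, ∫⁻ b', f ((a, b), (a', b')) ∂τ ∂τ := by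
    intro a'
    rw [lintegral_prod _ (by exact (hf.comp ((four A B).measurable.comp (by fun_prop : Measurable fun y : B × B => ((a, a'), y)))).aemeasurable)]
    rfl
  have e2 : ∀ b, ∫⁻ y, f ((a, b), y) ∂(σ.prod τ) = ∫⁻ a', ∫⁻ b', f ((a, b), (a', b')) ∂τ ∂σ := by
    intro b
    rw [lintegral_prod _ (by exact (hf.comp (by fun_prop : Measurable fun y : A × B => ((a, b), y))).aemeasurable)]
  simp only [e1, e2]
  rw [lintegral_lintegral_swap]
  have : Measurable fun w : (A × B) × B => f ((a, w.1.2), (w.1.1, w.2)) := hf.comp (by fun_prop)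
  exact (this.lintegral_prod_right' (ν := τ)).aemeasurable

/-- L2 norm -/
def L2n {n : ℕ} (φ : Euc n → ℂ) : ℝ≥0∞ := (∫⁻ x, ‖φ x‖ₑ ^ (2:ℝ)) ^ (1/2:ℝ)

/-- admissible functions -/
def Adm {n : ℕ} (φ : Euc n → ℂ) : Prop := BM φ ∧ ∃ k : ℝ, 1 ≤ k ∧ ∀ x, φ x ≠ 0 → 1 / k ≤ ‖x‖ ∧ ‖x‖ ≤ k

lemma Adm.fin {n : ℕ} {φ : Euc n → ℂ} (h : Adm φ) : Integrable φ := by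
  obtain ⟨⟨hm, M, hM⟩, k, hk, h⟩ := h
  have : φ = (closedBall (0 : Euc n) k).indicator φ := by
    symm; refine indicator_eq_self.2 fun x hx => ?_
    simpa using (h x hx).2
  rw [this]
  refine (integrable_indicator_iff measurableSet_closedBall).2 ?_
  exact IntegrableOn.of_bound measure_closedBall_lt_top hm.aestronglyMeasurable M (ae_of_all _ hM)

lemma sqrtL2 {X : Type*} [MeasurableSpace X] (μ : Measure X) [IsFiniteMeasure μ] {f : X → ℂ} (hf : BM f) :
    ENNReal.ofReal (√(∫ x, ‖f x‖ ^ 2 ∂μ)) = (∫⁻ x, ‖f x‖ₑ ^ (2:ℝ) ∂μ) ^ (1/2:ℝ) := by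
  obtain ⟨hfm, M, hM⟩ := hf
  rw [Real.sqrt_eq_rpow, ← ENNReal.ofReal_rpow_of_nonneg (integral_nonneg fun x => by positivity) (by norm_num)]
  congr 1
  rw [ofReal_integral_eq_lintegral_ofReal]
  · congr 1; funext x
    rw [← ofReal_norm, ENNReal.ofReal_rpow_of_nonneg (norm_nonneg _) (by norm_num)]
    norm_num
  · refine Integrable.of_bound (by fun_prop) (M ^ 2) (ae_of_all _ fun x => ?_)
    rw [Real.norm_of_nonneg (by positivity)]
    exact pow_le_pow_left₀ (norm_nonneg _) (hM x) 2
  · exact ae_of_all _ fun x => by positivity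

lemma hh_bdd (l : ℂ) (q : ℕ) : ∃ B : ℝ, 0 ≤ B ∧ ∀ ζ, ‖hh l q ζ‖ ≤ B * ‖ζ‖ ^ q := by
  obtain ⟨B, hB⟩ := (isCompact_closedBall (0:ℂ) 1).exists_bound_of_continuousOn (hh_cont l q).continuousOn
  refine ⟨B, (norm_nonneg _).trans (hB 0 (by simp)), fun ζ => ?_⟩
  by_cases h : ζ = 0
  · have h1 := hh_smul l q 0 1
    have h2 := hB 1 (by simp)
    rw [h]
    simp only [Complex.ofReal_zero, zero_mul] at h1
    rw [h1, norm_mul, norm_zero, mul_comm, norm_pow, norm_zero]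
    gcongr
  · have h1 := hh_smul l q ‖ζ‖ (ζ / ‖ζ‖)
    have hn : (‖ζ‖ : ℂ) ≠ 0 := by simpa using h
    rw [mul_div_cancel₀ _ hn] at h1
    rw [h1, norm_mul, mul_comm, norm_pow, Complex.norm_real, norm_norm]
    gcongr
    refine hB _ ?_
    have : ‖ζ‖ ≠ 0 := by simpa using h
    simp [this]

lemma SBe (n : ℕ) (hn : 3 ≤ n) : ∃ C : ℝ, 0 ≤ C ∧ ∀ (η : ℝ) (q : ℕ) (f g : Sn n → ℂ), BM f → BM g →
    ‖∫ z : Sn n × Sn n, hh ((n/2 : ℝ) + η * Complex.I) q (zt (z.1 : Euc n) z.2) * (f z.1 * g z.2) ∂((sg n).prod (sg n))‖ₑ ≤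
      ENNReal.ofReal (C * Real.exp (18 * η ^ 2)) * ((∫⁻ x, ‖f x‖ₑ ^ (2:ℝ) ∂(sg n)) ^ (1/2:ℝ) * (∫⁻ x, ‖g x‖ₑ ^ (2:ℝ) ∂(sg n)) ^ (1/2:ℝ)) := by
  obtain ⟨C, hC, h⟩ := SB n hn
  refine ⟨C, hC, fun η q f g hf hg => ?_⟩
  have hzm : Measurable fun z : Sn n × Sn n => zt (z.1 : Euc n) z.2 :=
      zt_meas.comp (by fun_prop : Measurable fun z : Sn n × Sn n => ((z.1 : Euc n), (z.2 : Euc n)))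
  rw [integral_prod]
  · rw [← sqrtL2 _ hf, ← sqrtL2 _ hg, ← ENNReal.ofReal_mul (by positivity), ← ENNReal.ofReal_mul (by positivity), ← ofReal_norm]
    exact ENNReal.ofReal_le_ofReal (h η q f g hf hg)
  · have b1 : BM fun z : Sn n × Sn n => f z.1 := ⟨by have := hf.1; fun_prop, hf.2.choose, fun z => hf.2.choose_spec _⟩
    have b2 : BM fun z : Sn n × Sn n => g z.2 := ⟨by have := hg.1; fun_prop, hg.2.choose, fun z => hg.2.choose_spec _⟩
    have b3 : BM fun z : Sn n × Sn n => hh ((n/2 : ℝ) + η * Complex.I) q (zt (z.1 : Euc n) z.2) := by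
      obtain ⟨B, hB0, hB⟩ := hh_bdd ((n/2 : ℝ) + η * Complex.I) q
      exact ⟨(hh_cont _ q).measurable.comp hzm, B, fun z => by simpa [zt_norm] using hB (zt (z.1 : Euc n) z.2)⟩
    exact (b3.mul (b1.mul b2)).int _

lemma kern_int {n : ℕ} {φ ψ : Euc n → ℂ} (hφ : Adm φ) (hψ : Adm ψ) (k : Euc n × Euc n → ℂ) (hk : Measurable k) (C : ℝ)
    (hC : ∀ z, φ z.1 ≠ 0 → ψ z.2 ≠ 0 → ‖k z‖ ≤ C) : Integrable (fun z : Euc n × Euc n => k z * (φ z.1 * ψ z.2)) (volume.prod volume) := by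
  have h := (hφ.fin.mul_prod hψ.fin).norm.const_mul C
  have h1 := hφ.1.1
  have h2 := hψ.1.1
  refine h.mono' (by fun_prop) (ae_of_all _ fun z => ?_)
  by_cases a : φ z.1 = 0
  · simp [a]
  by_cases b : ψ z.2 = 0
  · simp [b]
  rw [norm_mul]
  exact mul_le_mul_of_nonneg_right (hC z a b) (norm_nonneg _)

lemma Adm.pw {n : ℕ} {φ : Euc n → ℂ} (h : Adm φ) (e : ℝ) : ∃ B : ℝ, 0 ≤ B ∧ ∀ x, φ x ≠ 0 → ‖x‖ ^ e ≤ B := by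
  obtain ⟨_, k, hk, h⟩ := h
  refine ⟨k ^ e + (1 / k) ^ e, by positivity, fun x hx => ?_⟩
  obtain ⟨h1, h2⟩ := h x hx
  have h0 : 0 < 1 / k := by positivity
  rcases le_or_gt 0 e with he | he
  · have := Real.rpow_le_rpow (norm_nonneg x) h2 he
    have : 0 ≤ (1 / k) ^ e := by positivity
    linarith
  · have := Real.rpow_le_rpow_of_nonpos h0 h1 he.le
    have : 0 ≤ k ^ e := by positivity
    linarith

lemma Adm.ne {n : ℕ} {φ : Euc n → ℂ} (h : Adm φ) {x : Euc n} (hx : φ x ≠ 0) : 0 < ‖x‖ := by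
  obtain ⟨_, k, hk, h⟩ := h
  exact lt_of_lt_of_le (by positivity) (h x hx).1

lemma L2n_polar {n : ℕ} (hn : 1 ≤ n) {φ : Euc n → ℂ} (hφ : Measurable φ) :
    L2n φ = (∫⁻ s, ((∫⁻ ω, ‖φ (pol n (ω, s))‖ₑ ^ (2:ℝ) ∂(sg n)) ^ (1/2:ℝ)) ^ (2:ℝ) ∂(vI n)) ^ (1/2:ℝ) := by
  rw [L2n, ← (pol_mp n hn).lintegral_comp (f := fun x => ‖φ x‖ₑ ^ (2:ℝ)) (by fun_prop), lintegral_prod_symm']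
  · congr 2; funext s
    rw [← ENNReal.rpow_mul]; norm_num
  · have := (pol_emb n).measurable
    fun_prop

lemma L2end (n : ℕ) (hn : 3 ≤ n) : ∃ C : ℝ, 0 ≤ C ∧ ∀ (η : ℝ) (q : ℕ) (w : ℝ → ℝ) (G ρ : ℝ) (φ ψ : Euc n → ℂ), Measurable w → 0 < ρ → 0 ≤ G →
    (∀ r, 0 < r → |w r| * r ^ q ≤ G * min r (1 / r) ^ ρ) → Adm φ → Adm ψ →
    ‖∫ z : Euc n × Euc n, (w (‖z.1‖ / ‖z.2‖) * hh ((n/2 : ℝ) + η * Complex.I) q (zt z.1 z.2) * ((‖z.1‖ ^ (-(n/2:ℝ)) * ‖z.2‖ ^ (-(n/2:ℝ)) : ℝ) : ℂ)) * (φ z.1 * ψ z.2) ∂(volume.prod volume)‖ₑ ≤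
      ENNReal.ofReal (C * Real.exp (18 * η ^ 2) * (G / ρ)) * (L2n φ * L2n ψ) := by
  obtain ⟨C, hC, hS⟩ := SBe n hn
  refine ⟨2 * C, by positivity, fun η q w G ρ φ ψ hw hρ hG hwG hφ hψ => ?_⟩
  set l : ℂ := (n/2 : ℝ) + η * Complex.I with hl
  set k : Euc n × Euc n → ℂ := fun z => (w (‖z.1‖ / ‖z.2‖) * hh l q (zt z.1 z.2) * ((‖z.1‖ ^ (-(n/2:ℝ)) * ‖z.2‖ ^ (-(n/2:ℝ)) : ℝ) : ℂ)) with hk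
  have hφm := hφ.1.1
  have hψm := hψ.1.1
  have hmin : ∀ r : ℝ, 0 < r → min r (1 / r) ^ ρ ≤ 1 := by
    intro r hr
    refine Real.rpow_le_one (by positivity) ?_ hρ.le
    rcases le_or_gt r 1 with h | h
    · exact (min_le_left _ _).trans h
    · exact (min_le_right _ _).trans (by rw [div_le_one hr]; exact h.le)
  have hkm : Measurable k := by
    have h1 := (hh_cont l q).measurable.comp (zt_meas (n := n))
    rw [hk]
    refine (Measurable.mul (by fun_prop) h1).mul (by fun_prop)
  have hint : Integrable (fun z : Euc n × Euc n => k z * (φ z.1 * ψ z.2)) (volume.prod volume) := by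
    obtain ⟨B1, hB10, hB1⟩ := hφ.pw (-(n/2:ℝ))
    obtain ⟨B2, hB20, hB2⟩ := hψ.pw (-(n/2:ℝ))
    obtain ⟨B, hB0, hB⟩ := hh_bdd l q
    refine kern_int hφ hψ k hkm (B * G * (B1 * B2)) fun z h1 h2 => ?_
    have hr : 0 < ‖z.1‖ / ‖z.2‖ := div_pos (hφ.ne h1) (hψ.ne h2)
    rw [hk]
    simp only [norm_mul, Complex.norm_real, Real.norm_eq_abs]
    refine mul_le_mul ?_ ?_ (by positivity) (by positivity)
    · have e := hB (zt z.1 z.2)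
      rw [zt_norm] at e
      calc _ ≤ |w (‖z.1‖ / ‖z.2‖)| * (B * (‖z.1‖ / ‖z.2‖) ^ q) := mul_le_mul_of_nonneg_left e (abs_nonneg _)
        _ = B * (|w (‖z.1‖ / ‖z.2‖)| * (‖z.1‖ / ‖z.2‖) ^ q) := by ring
        _ ≤ B * (G * 1) := mul_le_mul_of_nonneg_left ((hwG _ hr).trans (mul_le_mul_of_nonneg_left (hmin _ hr) hG)) hB0
        _ = B * G := by ring
    · rw [abs_of_nonneg (by positivity), abs_of_nonneg (by positivity)]
      exact mul_le_mul (hB1 _ h1) (hB2 _ h2) (by positivity) hB10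
  have hP := (pol_mp n (by omega)).prod (pol_mp n (by omega))
  have hPe := (pol_emb n).prodMap (pol_emb n)
  have hT := four_mp (sg n) (vI n)
  have e1 := hP.integral_comp hPe (fun z : Euc n × Euc n => k z * (φ z.1 * ψ z.2))
  have e2 := hT.integral_comp (four (Sn n) (Ioi (0:ℝ))).measurableEmbedding (fun z => (k (Prod.map (pol n) (pol n) z) * (φ (Prod.map (pol n) (pol n) z).1 * ψ (Prod.map (pol n) (pol n) z).2)))
  have hint2 : Integrable (fun x => (fun z => (k (Prod.map (pol n) (pol n) z) * (φ (Prod.map (pol n) (pol n) z).1 * ψ (Prod.map (pol n) (pol n) z).2))) (four (Sn n) (Ioi (0:ℝ)) x)) (((sg n).prod (sg n)).prod ((vI n).prod (vI n))) := (hT.integrable_comp_emb (four (Sn n) (Ioi (0:ℝ))).measurableEmbedding).2 ((hP.integrable_comp_emb hPe).2 hint)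
  rw [← e1, ← e2, integral_prod_symm _ hint2]
  -- pointwise
  set c : Ioi (0:ℝ) × Ioi (0:ℝ) → ℝ := fun s => (w ((s.1:ℝ) / s.2) * ((s.1:ℝ) / s.2) ^ q * ((s.1:ℝ) ^ (-(n/2:ℝ)) * (s.2:ℝ) ^ (-(n/2:ℝ)))) with hc
  set Nφ : Ioi (0:ℝ) → ℝ≥0∞ := fun s => (∫⁻ ω, ‖φ (pol n (ω, s))‖ₑ ^ (2:ℝ) ∂(sg n)) ^ (1/2:ℝ) with hNφ
  set Nψ : Ioi (0:ℝ) → ℝ≥0∞ := fun s => (∫⁻ ω, ‖ψ (pol n (ω, s))‖ₑ ^ (2:ℝ) ∂(sg n)) ^ (1/2:ℝ) with hNψ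
  have hpm := (pol_emb n).measurable
  have hNφm : Measurable Nφ := by
    rw [hNφ]
    refine Measurable.pow_const (Measurable.lintegral_prod_left' (f := fun z : Sn n × Ioi (0:ℝ) => ‖φ (pol n z)‖ₑ ^ (2:ℝ)) (by fun_prop)) _
  have hNψm : Measurable Nψ := by
    rw [hNψ]
    refine Measurable.pow_const (Measurable.lintegral_prod_left' (f := fun z : Sn n × Ioi (0:ℝ) => ‖ψ (pol n z)‖ₑ ^ (2:ℝ)) (by fun_prop)) _
  have hin : ∀ s : Ioi (0:ℝ) × Ioi (0:ℝ), ‖∫ x, ((fun z => k (Prod.map (pol n) (pol n) z) * (φ (Prod.map (pol n) (pol n) z).1 * ψ (Prod.map (pol n) (pol n) z).2)) ((four (Sn n) (Ioi (0:ℝ))) (x, s))) ∂((sg n).prod (sg n))‖ₑ ≤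
      ENNReal.ofReal |c s| * (ENNReal.ofReal (C * Real.exp (18 * η ^ 2)) * (Nφ s.1 * Nψ s.2)) := by
    intro s
    have e3 : ∀ x : Sn n × Sn n, ((fun z => k (Prod.map (pol n) (pol n) z) * (φ (Prod.map (pol n) (pol n) z).1 * ψ (Prod.map (pol n) (pol n) z).2)) ((four (Sn n) (Ioi (0:ℝ))) (x, s))) =
        (c s : ℂ) * (hh l q (zt (x.1 : Euc n) x.2) * (φ (pol n (x.1, s.1)) * ψ (pol n (x.2, s.2)))) := by
      intro x
      have hs1 : (0:ℝ) < s.1 := s.1.2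
      have hs2 : (0:ℝ) < s.2 := s.2.2
      change k (pol n (x.1, s.1), pol n (x.2, s.2)) * (φ (pol n (x.1, s.1)) * ψ (pol n (x.2, s.2))) = _
      have n1 : ‖pol n (x.1, s.1)‖ = s.1 := by simp [pol, norm_smul, abs_of_pos hs1]
      have n2 : ‖pol n (x.2, s.2)‖ = s.2 := by simp [pol, norm_smul, abs_of_pos hs2]
      have n3 : zt (pol n (x.1, s.1)) (pol n (x.2, s.2)) = ((s.1 / s.2 : ℝ) : ℂ) * zt (x.1 : Euc n) x.2 := zt_smul _ _ hs1.le hs2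
      simp only [hk, n1, n2, n3, hh_smul, hc]
      push_cast; ring
    simp only [e3]
    rw [integral_const_mul, enorm_mul]
    refine mul_le_mul' (le_of_eq ?_) (hS η q (fun ω => φ (pol n (ω, s.1))) (fun ω => ψ (pol n (ω, s.2))) ⟨by fun_prop, hφ.1.2.choose, fun _ => hφ.1.2.choose_spec _⟩ ⟨by fun_prop, hψ.1.2.choose, fun _ => hψ.1.2.choose_spec _⟩)
    rw [← ofReal_norm, Complex.norm_real, Real.norm_eq_abs]
  refine (enorm_integral_le_lintegral_enorm _).trans ((lintegral_mono hin).trans ?_)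
  set p : Ioi (0:ℝ) × Ioi (0:ℝ) → ℝ≥0∞ := fun s => ENNReal.ofReal (min ((s.1:ℝ) / s.2) ((s.2:ℝ) / s.1) ^ ρ) * ENNReal.ofReal ((s.2:ℝ) ^ (-(n:ℝ))) with hp
  set p' : Ioi (0:ℝ) × Ioi (0:ℝ) → ℝ≥0∞ := fun s => ENNReal.ofReal (min ((s.2:ℝ) / s.1) ((s.1:ℝ) / s.2) ^ ρ) * ENNReal.ofReal ((s.1:ℝ) ^ (-(n:ℝ))) with hp'
  have hpm : Measurable p := by rw [hp]; fun_prop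
  have hpm' : Measurable p' := by rw [hp']; fun_prop
  have hmain := cs_form (vI n) (vI n) p p' hpm hpm' Nφ Nψ hNφm hNψm (ENNReal.ofReal (2 / ρ))
    (ae_of_all _ fun s _ => schur1 n (by omega) s.2 hρ) (ae_of_all _ fun s _ => schur1 n (by omega) s.2 hρ)
  rw [← L2n_polar (by omega) hφm, ← L2n_polar (by omega) hψm] at hmain
  calc _ ≤ ∫⁻ s, ENNReal.ofReal (C * Real.exp (18 * η ^ 2) * G) * ((p s * p' s) ^ (1/2:ℝ) * (Nφ s.1 * Nψ s.2)) ∂((vI n).prod (vI n)) := by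
        refine lintegral_mono fun s => ?_
        have hs1 : (0:ℝ) < s.1 := s.1.2
        have hs2 : (0:ℝ) < s.2 := s.2.2
        have e4 : (p s * p' s) ^ (1/2:ℝ) = ENNReal.ofReal (min ((s.1:ℝ) / s.2) (1 / ((s.1:ℝ) / s.2)) ^ ρ * ((s.1:ℝ) ^ (-(n/2:ℝ)) * (s.2:ℝ) ^ (-(n/2:ℝ)))) := by
          rw [hp, hp']
          simp only
          rw [min_comm ((s.2:ℝ) / s.1), one_div_div]
          set m := min ((s.1:ℝ) / s.2) ((s.2:ℝ) / s.1) ^ ρ with hm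
          have hm0 : 0 ≤ m := by positivity
          rw [← ENNReal.ofReal_mul hm0, ← ENNReal.ofReal_mul hm0, ← ENNReal.ofReal_mul (by positivity), ENNReal.ofReal_rpow_of_nonneg (by positivity) (by norm_num)]
          congr 1
          rw [show m * (s.2:ℝ) ^ (-(n:ℝ)) * (m * (s.1:ℝ) ^ (-(n:ℝ))) = (m * m) * ((s.1:ℝ) ^ (-(n:ℝ)) * (s.2:ℝ) ^ (-(n:ℝ))) by ring,
            Real.mul_rpow (mul_nonneg hm0 hm0) (by positivity), Real.mul_rpow (x := (s.1:ℝ) ^ (-(n:ℝ))) (by positivity) (by positivity), ← Real.rpow_mul hs1.le, ← Real.rpow_mul hs2.le, ← Real.sqrt_eq_rpow, Real.sqrt_mul_self hm0]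
          congr 3 <;> ring
        rw [e4, ← mul_assoc (ENNReal.ofReal |c s|), ← mul_assoc (ENNReal.ofReal (C * _ * G)), ← ENNReal.ofReal_mul (abs_nonneg _), ← ENNReal.ofReal_mul (by positivity)]
        refine mul_le_mul_left (ENNReal.ofReal_le_ofReal ?_) _
        have hh1 := hwG ((s.1:ℝ) / s.2) (by positivity)
        have e5 : |c s| = |w ((s.1:ℝ) / s.2)| * ((s.1:ℝ) / s.2) ^ q * ((s.1:ℝ) ^ (-(n/2:ℝ)) * (s.2:ℝ) ^ (-(n/2:ℝ))) := by
          rw [hc]; simp only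
          rw [abs_mul, abs_mul, abs_of_nonneg (by positivity : 0 ≤ ((s.1:ℝ) / s.2) ^ q), abs_of_nonneg (by positivity : 0 ≤ ((s.1:ℝ) ^ (-(n/2:ℝ)) * (s.2:ℝ) ^ (-(n/2:ℝ))))]
        rw [e5]
        calc _ ≤ G * min ((s.1:ℝ) / s.2) (1 / ((s.1:ℝ) / s.2)) ^ ρ * ((s.1:ℝ) ^ (-(n/2:ℝ)) * (s.2:ℝ) ^ (-(n/2:ℝ))) * (C * Real.exp (18 * η ^ 2)) := by gcongr
          _ = _ := by ring
    _ ≤ _ := by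
        rw [lintegral_const_mul _ (by fun_prop)]
        refine (mul_le_mul_right hmain _).trans (le_of_eq ?_)
        rw [← mul_assoc, ← ENNReal.ofReal_mul (by positivity)]
        congr 2; ring

def CS (γ : ℝ) : ℝ := 4 * farC γ 1 + 3 * nearC γ (γ - 1/2) + 3 * farC γ (γ + 1/2)

lemma farC_nonneg {γ s : ℝ} (h : γ < s) : 0 ≤ farC γ s := by
  have : (2:ℝ) ^ (γ - s) < 1 := Real.rpow_lt_one_of_one_lt_of_neg (by norm_num) (by linarith)
  unfold farC
  exact div_nonneg (by positivity) (by linarith)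

lemma nearC_nonneg {γ s : ℝ} (h : s < γ) : 0 ≤ nearC γ s := by
  have : (2:ℝ) ^ (s - γ) < 1 := Real.rpow_lt_one_of_one_lt_of_neg (by norm_num) (by linarith)
  unfold nearC
  exact div_nonneg (by positivity) (by linarith)

lemma CS_nonneg {γ : ℝ} (h1 : γ < 1) : 0 ≤ CS γ := by
  have := farC_nonneg h1
  have := farC_nonneg (show γ < γ + 1/2 by linarith)
  have := nearC_nonneg (show γ - 1/2 < γ by linarith)
  unfold CS; positivity

def kd {n : ℕ} (L : ℝ) (x y : Euc n) : ℝ :=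
  min (‖x‖ / ‖y‖) (‖y‖ / ‖x‖) ^ (1/2:ℝ) * (1 + L * (‖x - y‖ / max ‖x‖ ‖y‖))⁻¹

lemma kd_comm {n : ℕ} (L : ℝ) (x y : Euc n) : kd L x y = kd L y x := by
  unfold kd; rw [min_comm, norm_sub_rev, max_comm]

lemma kd_nonneg {n : ℕ} {L : ℝ} (hL : 0 ≤ L) (x y : Euc n) : 0 ≤ kd L x y := by
  unfold kd; positivity

lemma schur2 {n : ℕ} (ρ : Measure (Euc n)) {γ : ℝ} (h0 : 1/2 ≤ γ) (h1 : γ < 1)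
    (hK : ∀ (x : Euc n) (R : ℝ), 0 < R → ρ (ball x R) ≤ ENNReal.ofReal (R ^ γ)) {L : ℝ} (hL : 1 ≤ L)
    (y : Euc n) (hy : 0 < ‖y‖) :
    ∫⁻ x, ENNReal.ofReal (kd L x y * ‖x‖ ^ (-γ)) ∂ρ ≤ ENNReal.ofReal (CS γ * L ^ (-γ)) := by
  set R := ‖y‖ with hR
  have hK' : ∀ (x : Euc n) (R : ℝ), 0 < R → ρ (ball x R) ≤ 1 * ENNReal.ofReal (R ^ γ) := by simpa using hK
  have f1 := far_lemma ρ 1 h1 zero_le_one y (hK' y) (show 0 < R / L by positivity)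
  have f2 := near_lemma ρ 1 (show γ - 1/2 < γ by linarith) (by linarith) 0 (hK' 0) hy
  have f3 := far_lemma ρ 1 (show γ < γ + 1/2 by linarith) (by linarith) 0 (hK' 0) hy
  rw [one_mul] at f1 f2 f3
  rw [← lintegral_indicator measurableSet_ball] at f2
  have hLg : 1 / L ≤ L ^ (-γ) := by
    rw [one_div, ← Real.rpow_neg_one]
    exact Real.rpow_le_rpow_of_exponent_le hL (by linarith)
  have hpt : ∀ x : Euc n, ENNReal.ofReal (kd L x y * ‖x‖ ^ (-γ)) ≤
      ENNReal.ofReal (4 * R ^ (1 - γ) / L) * ENNReal.ofReal ((max (R / L) (dist x y)) ^ (-1:ℝ)) +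
      (ENNReal.ofReal (3 / L * R ^ (-(1/2):ℝ)) * (ball (0:Euc n) R).indicator (fun x => ENNReal.ofReal (dist x 0 ^ (-(γ - 1/2)))) x +
      ENNReal.ofReal (3 / L * R ^ (1/2:ℝ)) * ENNReal.ofReal ((max R (dist x 0)) ^ (-(γ + 1/2)))) := by
    intro x
    rcases (norm_nonneg x).eq_or_lt with hx | hx
    · unfold kd
      rw [← hx]; simp
    have hm1 : min (‖x‖ / R) (R / ‖x‖) ^ (1/2:ℝ) ≤ 1 := by
      refine Real.rpow_le_one (by positivity) ?_ (by norm_num)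
      rcases le_or_gt ‖x‖ R with h | h
      · exact (min_le_left _ _).trans (by rw [div_le_one hy]; exact h)
      · exact (min_le_right _ _).trans (by rw [div_le_one hx]; exact h.le)
    have htri : ‖x‖ ≤ ‖x - y‖ + R := by simpa using norm_add_le (x - y) y
    have htri2 : R ≤ ‖x - y‖ + ‖x‖ := by
      have := norm_add_le (y - x) x
      rw [norm_sub_rev] at this; simpa using this
    rcases lt_or_ge ‖x - y‖ (R / 2) with hc | hc
    · refine le_trans ?_ le_self_add
      rw [← ENNReal.ofReal_mul (by positivity)]
      refine ENNReal.ofReal_le_ofReal ?_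
      have hmx : 0 < max (R / L) (dist x y) := lt_max_of_lt_left (by positivity)
      have a1 : (1 + L * (‖x - y‖ / max ‖x‖ R))⁻¹ ≤ 2 * R / L * max (R / L) (dist x y) ^ (-1:ℝ) := by
        rw [Real.rpow_neg_one, ← div_eq_mul_inv, inv_le_iff_one_le_mul₀ (by positivity), mul_comm, ← mul_div_assoc, le_div_iff₀ hmx, one_mul, dist_eq_norm]
        have hM : max ‖x‖ R ≤ 2 * R := max_le (by linarith) (by linarith)
        have hM0 : 0 < max ‖x‖ R := lt_max_of_lt_right hy
        have a2 : ‖x - y‖ / (2 * R) ≤ ‖x - y‖ / max ‖x‖ R := by gcongr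
        have a3 : 2 * R / L + ‖x - y‖ ≤ (1 + L * (‖x - y‖ / max ‖x‖ R)) * (2 * R / L) := by
          calc _ = (1 + L * (‖x - y‖ / (2 * R))) * (2 * R / L) := by field_simp
            _ ≤ _ := by gcongr
        have : R / L ≤ 2 * R / L := by gcongr; linarith
        have : 0 ≤ 2 * R / L := by positivity
        refine max_le ?_ ?_ <;> linarith [norm_nonneg (x - y)]
      have a4 : ‖x‖ ^ (-γ) ≤ 2 * R ^ (-γ) := by
        calc ‖x‖ ^ (-γ) ≤ (R / 2) ^ (-γ) := Real.rpow_le_rpow_of_nonpos (by positivity) (by linarith) (by linarith)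
          _ = R ^ (-γ) * 2 ^ γ := by rw [Real.div_rpow hy.le (by norm_num), Real.rpow_neg (by norm_num : (0:ℝ) ≤ 2), div_inv_eq_mul]
          _ ≤ R ^ (-γ) * 2 ^ (1:ℝ) := by gcongr; norm_num
          _ = _ := by norm_num; ring
      unfold kd
      calc _ ≤ 1 * (2 * R / L * max (R / L) (dist x y) ^ (-1:ℝ)) * (2 * R ^ (-γ)) := by
            refine mul_le_mul (mul_le_mul hm1 a1 (by positivity) zero_le_one) a4 (by positivity) (by positivity)
        _ = _ := by
            rw [show R ^ (1 - γ) = R * R ^ (-γ) by rw [sub_eq_add_neg, Real.rpow_add hy, Real.rpow_one]]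
            ring
    · refine le_trans ?_ le_add_self
      have hM0 : 0 < max ‖x‖ R := lt_max_of_lt_right hy
      have a1 : (1 + L * (‖x - y‖ / max ‖x‖ R))⁻¹ ≤ 3 / L := by
        have hM : max ‖x‖ R ≤ 3 * ‖x - y‖ := max_le (by linarith) (by linarith)
        have : 1 / 3 ≤ ‖x - y‖ / max ‖x‖ R := by rw [le_div_iff₀ hM0]; linarith
        rw [inv_le_comm₀ (by positivity) (by positivity), inv_div]
        nlinarith
      rcases lt_or_ge ‖x‖ R with hr | hr
      · refine le_trans ?_ le_self_add
        rw [indicator_of_mem (by simpa using hr), ← ENNReal.ofReal_mul (by positivity)]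
        refine ENNReal.ofReal_le_ofReal ?_
        unfold kd
        calc _ ≤ (‖x‖ / R) ^ (1/2:ℝ) * (3 / L) * ‖x‖ ^ (-γ) := by
              gcongr; exact min_le_left _ _
          _ = _ := by
              rw [Real.div_rpow hx.le hy.le, dist_zero_right, neg_sub, sub_eq_add_neg, Real.rpow_add hx, Real.rpow_neg hy.le]
              ring
      · refine le_trans ?_ le_add_self
        rw [← ENNReal.ofReal_mul (by positivity)]
        refine ENNReal.ofReal_le_ofReal ?_
        unfold kd
        calc _ ≤ (R / ‖x‖) ^ (1/2:ℝ) * (3 / L) * ‖x‖ ^ (-γ) := by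
              gcongr; exact min_le_right _ _
          _ = _ := by
              rw [dist_zero_right, max_eq_right hr, Real.div_rpow hy.le hx.le, neg_add, Real.rpow_add hx, Real.rpow_neg hx.le (1/2)]
              ring
  refine (lintegral_mono hpt).trans ?_
  have m1 : Measurable fun x : Euc n => (ball (0:Euc n) R).indicator (fun x => ENNReal.ofReal (dist x 0 ^ (-(γ - 1/2)))) x :=
    Measurable.indicator (by fun_prop) measurableSet_ball
  rw [lintegral_add_left (by fun_prop), lintegral_add_left (by fun_prop), lintegral_const_mul _ (by fun_prop), lintegral_const_mul _ m1, lintegral_const_mul _ (by fun_prop)]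
  have c1 := farC_nonneg h1
  have c2 := farC_nonneg (show γ < γ + 1/2 by linarith)
  have c3 := nearC_nonneg (show γ - 1/2 < γ by linarith)
  refine (add_le_add (mul_le_mul_right f1 _) (add_le_add (mul_le_mul_right f2 _) (mul_le_mul_right f3 _))).trans ?_
  rw [← ENNReal.ofReal_mul (by positivity), ← ENNReal.ofReal_mul (by positivity), ← ENNReal.ofReal_mul (by positivity), ← ENNReal.ofReal_add (by positivity) (by positivity), ← ENNReal.ofReal_add (by positivity) (by positivity)]
  refine ENNReal.ofReal_le_ofReal ?_
  have e1 : 4 * R ^ (1 - γ) / L * (farC γ 1 * (R / L) ^ (γ - 1)) = 4 * farC γ 1 * L ^ (-γ) := by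
    have : R ^ (1 - γ) * R ^ (γ - 1) = 1 := by rw [← Real.rpow_add hy]; norm_num
    have h2 : L ^ (-γ) = L⁻¹ / L ^ (γ - 1) := by
      rw [← Real.rpow_neg_one, ← Real.rpow_sub (by linarith)]; congr 1; ring
    rw [Real.div_rpow hy.le (by linarith), h2]
    linear_combination (4 * farC γ 1 / L / L ^ (γ - 1)) * this
  have e2 : 3 / L * R ^ (-(1/2):ℝ) * (nearC γ (γ - 1/2) * R ^ (γ - (γ - 1/2))) = 3 * nearC γ (γ - 1/2) * (1 / L) := by
    have : R ^ (-(1/2):ℝ) * R ^ (γ - (γ - 1/2)) = 1 := by rw [← Real.rpow_add hy]; norm_num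
    linear_combination (3 / L * nearC γ (γ - 1/2)) * this
  have e3 : 3 / L * R ^ (1/2:ℝ) * (farC γ (γ + 1/2) * R ^ (γ - (γ + 1/2))) = 3 * farC γ (γ + 1/2) * (1 / L) := by
    have : R ^ (1/2:ℝ) * R ^ (γ - (γ + 1/2)) = 1 := by rw [← Real.rpow_add hy]; norm_num
    linear_combination (3 / L * farC γ (γ + 1/2)) * this
  rw [e1, e2, e3]
  unfold CS
  have := mul_le_mul_of_nonneg_left hLg c2
  have := mul_le_mul_of_nonneg_left hLg c3
  linarith

lemma kd_meas {n : ℕ} (L : ℝ) : Measurable fun z : Euc n × Euc n => kd L z.1 z.2 := by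
  unfold kd; fun_prop

lemma schur2' {n : ℕ} {u : Euc n → ℝ≥0∞} (hu : Measurable u) {γ : ℝ} (h0 : 1/2 ≤ γ) (h1 : γ < 1)
    (hK : ∀ (x : Euc n) (R : ℝ), 0 < R → ∫⁻ y in ball x R, u y ≤ ENNReal.ofReal (R ^ γ)) {L : ℝ} (hL : 1 ≤ L)
    (y : Euc n) (hy : 0 < ‖y‖) :
    ∫⁻ x, ENNReal.ofReal (kd L x y * ‖x‖ ^ (-γ)) * u x ≤ ENNReal.ofReal (CS γ * L ^ (-γ)) := by
  have hm : Measurable fun x : Euc n => ENNReal.ofReal (kd L x y * ‖x‖ ^ (-γ)) := by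
    have := (kd_meas (n := n) L).comp (measurable_id.prodMk (measurable_const (a := y)))
    exact ((this.mul (by fun_prop : Measurable fun x : Euc n => ‖x‖ ^ (-γ)))).ennreal_ofReal
  have := schur2 (volume.withDensity u) h0 h1 (fun x R hR => by
    rw [withDensity_apply _ measurableSet_ball]; exact hK x R hR) hL y hy
  rw [lintegral_withDensity_eq_lintegral_mul _ hu hm] at this
  simpa only [Pi.mul_apply, mul_comm (u _)] using this

set_option maxHeartbeats 800000 in
lemma pt_end {n : ℕ} {u : Euc n → ℝ≥0∞} (hu : Measurable u) {γ : ℝ} (h0 : 1/2 ≤ γ) (h1 : γ < 1)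
    (hK : ∀ (x : Euc n) (R : ℝ), 0 < R → ∫⁻ y in ball x R, u y ≤ ENNReal.ofReal (R ^ γ))
    (η : ℝ) (A L : ℕ) (hL1 : 1 ≤ L) (hLA : L ≤ A + 1) (w : ℝ → ℝ) {G ϱ : ℝ} (hG : 0 ≤ G) (hϱ : 1/2 ≤ ϱ)
    (hw : ∀ q ∈ Finset.Ico A (A + L), ∀ r, 0 < r → |w r| * r ^ q ≤ G * min r (1 / r) ^ ϱ)
    (a : Euc n → ℝ≥0∞) {φ ψ : Euc n → ℂ} (hφ : Adm φ) (hψ : Adm ψ)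
    (haφ : ∀ x, φ x ≠ 0 → a x ^ (2:ℝ) ≤ ENNReal.ofReal (‖x‖ ^ (-γ)) * u x)
    (haψ : ∀ x, ψ x ≠ 0 → a x ^ (2:ℝ) ≤ ENNReal.ofReal (‖x‖ ^ (-γ)) * u x) :
    ∫⁻ z : Euc n × Euc n, ‖(w (‖z.1‖ / ‖z.2‖) : ℂ) * ∑ q ∈ Finset.Ico A (A + L), hh ((γ/2 : ℝ) + η * Complex.I) q (zt z.1 z.2)‖ₑ *
      (a z.1 * a z.2) * (‖φ z.1‖ₑ * ‖ψ z.2‖ₑ) ∂(volume.prod volume) ≤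
      ENNReal.ofReal (128 * CS γ * Real.exp (19 * η ^ 2) * G * (L / ((A:ℝ) + 1)) ^ (1 - γ)) * (L2n φ * L2n ψ) := by
  set B : ℝ := 128 * Real.exp (19 * η ^ 2) * G * L * ((A:ℝ) + 1) ^ (γ - 1) with hB
  have hB0 : 0 ≤ B := by positivity
  have hL : (1:ℝ) ≤ L := by exact_mod_cast hL1
  obtain ⟨p, hp⟩ : ∃ p : Euc n × Euc n → ℝ≥0∞, p = fun z => ENNReal.ofReal (kd L z.2 z.1 * ‖z.2‖ ^ (-γ)) * u z.2 := ⟨_, rfl⟩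
  obtain ⟨q, hq⟩ : ∃ q : Euc n × Euc n → ℝ≥0∞, q = fun z => ENNReal.ofReal (kd L z.1 z.2 * ‖z.1‖ ^ (-γ)) * u z.1 := ⟨_, rfl⟩
  have k1 := kd_meas (n := n) L
  have hqm : Measurable q := by
    rw [hq]
    exact ((k1.mul (by fun_prop : Measurable fun z : Euc n × Euc n => ‖z.1‖ ^ (-γ)))).ennreal_ofReal.mul (by fun_prop)
  have hpm : Measurable p := by
    have := hqm.comp measurable_swap
    rw [hq] at this; rw [hp]; exact this
  have hφm := hφ.1.1
  have hψm := hψ.1.1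
  have hcs := cs_form volume volume p q hpm hqm (fun x => ‖φ x‖ₑ) (fun x => ‖ψ x‖ₑ) (by fun_prop) (by fun_prop) (ENNReal.ofReal (CS γ * L ^ (-γ)))
    (ae_of_all _ fun x hx => by
      simp only [hp, hq]
      exact schur2' hu h0 h1 hK hL x (hφ.ne (by simpa using hx)))
    (ae_of_all _ fun x hx => by
      simp only [hp, hq]
      exact schur2' hu h0 h1 hK hL x (hψ.ne (by simpa using hx)))
  calc _ ≤ ∫⁻ z, ENNReal.ofReal B * ((p z * q z) ^ (1/2:ℝ) * (‖φ z.1‖ₑ * ‖ψ z.2‖ₑ)) ∂(volume.prod volume) := by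
        refine lintegral_mono fun z => ?_
        by_cases hz1 : φ z.1 = 0
        · simp [hz1]
        by_cases hz2 : ψ z.2 = 0
        · simp [hz2]
        have hx := hφ.ne hz1
        have hy := hψ.ne hz2
        set r := ‖z.1‖ / ‖z.2‖ with hr
        have hr0 : 0 < r := div_pos hx hy
        have hmm : min r (1 / r) ^ ϱ ≤ min (‖z.1‖ / ‖z.2‖) (‖z.2‖ / ‖z.1‖) ^ (1/2:ℝ) := by
          rw [hr, one_div_div]
          refine Real.rpow_le_rpow_of_exponent_ge (lt_min (by positivity) (by positivity)) ?_ hϱ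
          rcases le_or_gt ‖z.1‖ ‖z.2‖ with h | h
          · exact (min_le_left _ _).trans (by rw [div_le_one hy]; exact h)
          · exact (min_le_right _ _).trans (by rw [div_le_one hx]; exact h.le)
        have e1 : 1 + (L:ℝ) * ‖1 - zt z.1 z.2‖ / max 1 ‖zt z.1 z.2‖ = 1 + L * (‖z.1 - z.2‖ / max ‖z.1‖ ‖z.2‖) := by
          rw [zt_one_sub _ _ (norm_pos_iff.1 hy), zt_norm, show max 1 (‖z.1‖ / ‖z.2‖) = max ‖z.1‖ ‖z.2‖ / ‖z.2‖ by
            rw [max_comm, ← max_div_div_right hy.le, div_self hy.ne']]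
          congr 1; field_simp
        have hpt : ‖(w r : ℂ) * ∑ q ∈ Finset.Ico A (A + L), hh ((γ/2 : ℝ) + η * Complex.I) q (zt z.1 z.2)‖ ≤ B * kd L z.1 z.2 := by
          rw [norm_mul, Complex.norm_real, Real.norm_eq_abs]
          rcases eq_or_ne (w r) 0 with h | h
          · rw [h, abs_zero, zero_mul]; exact mul_nonneg hB0 (kd_nonneg (by positivity) _ _)
          have hwp : 0 < |w r| := abs_pos.2 h
          have := block_pt (σ := γ/2) (by linarith) (by linarith) η (zt z.1 z.2) (X := G * min r (1 / r) ^ ϱ / |w r|) (by positivity) A L hLA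
            (fun q hq => by rw [zt_norm, le_div_iff₀ hwp, mul_comm]; exact hw q hq _ hr0)
          rw [e1] at this
          have hD : 0 < 1 + (L:ℝ) * (‖z.1 - z.2‖ / max ‖z.1‖ ‖z.2‖) := by positivity
          rw [← le_div_iff₀' hD] at this
          calc _ ≤ |w r| * _ := mul_le_mul_of_nonneg_left this hwp.le
            _ = B * (min r (1 / r) ^ ϱ * (1 + (L:ℝ) * (‖z.1 - z.2‖ / max ‖z.1‖ ‖z.2‖))⁻¹) := by
              rw [hB, show 2 * (γ / 2) - 1 = γ - 1 by ring]; field_simp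
            _ ≤ B * kd L z.1 z.2 := by unfold kd; gcongr
        have hk0 := kd_nonneg (L := (L:ℝ)) (by positivity) z.1 z.2
        have e2 : ENNReal.ofReal (kd L z.1 z.2) * (a z.1 * a z.2) ≤ (p z * q z) ^ (1/2:ℝ) := by
          have : ENNReal.ofReal (kd L z.1 z.2) * (a z.1 * a z.2) = ((ENNReal.ofReal (kd L z.1 z.2) * (a z.1 * a z.2)) ^ (2:ℝ)) ^ (1/2:ℝ) := by
            rw [← ENNReal.rpow_mul]; norm_num
          rw [this]
          refine ENNReal.rpow_le_rpow ?_ (by norm_num)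
          rw [ENNReal.mul_rpow_of_nonneg _ _ (by norm_num), ENNReal.mul_rpow_of_nonneg _ _ (by norm_num)]
          refine (mul_le_mul_right (mul_le_mul' (haφ _ hz1) (haψ _ hz2)) _).trans (le_of_eq ?_)
          simp only [hp, hq]
          rw [kd_comm _ z.2, ENNReal.ofReal_mul hk0, ENNReal.ofReal_mul hk0, show (2:ℝ) = ((2:ℕ):ℝ) by norm_num, ENNReal.rpow_natCast]
          ring
        rw [← mul_assoc (ENNReal.ofReal B)]
        refine mul_le_mul_left ?_ _
        calc _ ≤ ENNReal.ofReal (B * kd L z.1 z.2) * (a z.1 * a z.2) := by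
              refine mul_le_mul_left ?_ _
              rw [← ofReal_norm]; exact ENNReal.ofReal_le_ofReal hpt
          _ = ENNReal.ofReal B * (ENNReal.ofReal (kd L z.1 z.2) * (a z.1 * a z.2)) := by rw [ENNReal.ofReal_mul hB0, mul_assoc]
          _ ≤ _ := mul_le_mul_right e2 _
    _ ≤ _ := by
        rw [lintegral_const_mul _ (by fun_prop)]
        refine (mul_le_mul_right hcs _).trans ?_
        rw [← mul_assoc, ← ENNReal.ofReal_mul hB0]
        refine mul_le_mul_left (ENNReal.ofReal_le_ofReal (le_of_eq ?_)) _
        rw [hB, Real.div_rpow (by positivity) (by positivity), show (1:ℝ) - γ = 1 + -γ by ring, Real.rpow_add (x := (L:ℝ)) (by positivity), Real.rpow_one,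
          show γ - 1 = -(1 + -γ) by ring, Real.rpow_neg (by positivity)]
        ring

def GE (f : ℂ → ℂ) : Prop := Differentiable ℂ f ∧ ∃ B D : ℝ, 0 ≤ B ∧ 0 ≤ D ∧ ∀ z, ‖f z‖ ≤ B * Real.exp (D * ‖z‖)

lemma GE.mul {f g : ℂ → ℂ} (hf : GE f) (hg : GE g) : GE fun z => f z * g z := by
  obtain ⟨h1, B, D, hB, hD, h⟩ := hf
  obtain ⟨h1', B', D', hB', hD', h'⟩ := hg
  refine ⟨h1.mul h1', B * B', D + D', by positivity, by positivity, fun z => ?_⟩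
  rw [norm_mul, add_mul, Real.exp_add]
  calc _ ≤ _ := mul_le_mul (h z) (h' z) (norm_nonneg _) (by positivity)
    _ = _ := by ring

lemma GE.sum {ι : Type*} (s : Finset ι) {f : ι → ℂ → ℂ} (hf : ∀ i ∈ s, GE (f i)) : GE fun z => ∑ i ∈ s, f i z := by
  classical
  induction s using Finset.induction_on with
  | empty => exact ⟨by simp, 0, 0, le_rfl, le_rfl, by simp⟩
  | insert a s ha ih =>
    obtain ⟨h1, B, D, hB, hD, h⟩ := hf a (Finset.mem_insert_self _ _)
    obtain ⟨h1', B', D', hB', hD', h'⟩ := ih fun i hi => hf i (Finset.mem_insert_of_mem hi)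
    simp only [Finset.sum_insert ha]
    refine ⟨h1.add h1', B + B', D + D', by positivity, by positivity, fun z => ?_⟩
    refine (norm_add_le _ _).trans ?_
    rw [add_mul]
    refine add_le_add ((h z).trans ?_) ((h' z).trans ?_) <;> gcongr <;> linarith

lemma GE.bb (c d : ℝ) (a : ℕ) : GE fun z => bb (c - z * d) a := by
  refine ⟨?_, Real.exp (a * |c|), a * |d|, by positivity, by positivity, fun z => (bb_crude _ _).trans ?_⟩
  · unfold _root_.bb; fun_prop
  · rw [← Real.exp_add]
    gcongr
    have : ‖(c:ℂ) - z * d‖ ≤ |c| + ‖z‖ * |d| := by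
      refine (norm_sub_le _ _).trans ?_
      simp
    calc _ ≤ (a:ℝ) * (|c| + ‖z‖ * |d|) := by gcongr
      _ = _ := by ring

lemma GE.int {X : Type*} [MeasurableSpace X] (μ : Measure X) (g : X → ℝ) (h : X → ℂ)
    (hg : Measurable g) (M : ℝ) (hb : ∀ x, h x ≠ 0 → |g x| ≤ M) (hh : Integrable h μ) :
    GE (fun z : ℂ => ∫ x, Complex.exp (z * g x) * h x ∂μ) := by
  refine ⟨entire_int μ g h hg M hb hh, ∫ x, ‖h x‖ ∂μ, |M|, by positivity, abs_nonneg _, fun z => ?_⟩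
  rw [← integral_mul_const]
  refine norm_integral_le_of_norm_le (hh.norm.mul_const _) (ae_of_all _ fun x => ?_)
  rw [norm_mul, mul_comm]
  rcases eq_or_ne (h x) 0 with h0 | h0
  · simp [h0]
  gcongr
  rw [Complex.norm_exp]
  gcongr
  calc (z * g x).re ≤ ‖z * g x‖ := Complex.re_le_norm _
    _ = |g x| * ‖z‖ := by rw [norm_mul, Complex.norm_real, Real.norm_eq_abs, mul_comm]
    _ ≤ |M| * ‖z‖ := mul_le_mul_of_nonneg_right ((hb x h0).trans (le_abs_self _)) (norm_nonneg _)

lemma three_gauss {f : ℂ → ℂ} (hf : GE f) {s M0 M1 θ : ℝ} (hs : 1 ≤ s) (hM1 : 0 ≤ M1)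
    (h0 : 0 ≤ θ) (h1 : θ ≤ 1) (ha : ∀ η : ℝ, ‖f (η * Complex.I)‖ ≤ M0 * Real.exp (s * η ^ 2))
    (hb : ∀ η : ℝ, ‖f (1 + η * Complex.I)‖ ≤ M1 * Real.exp (s * η ^ 2)) :
    ‖f θ‖ ≤ M0 ^ (1 - θ) * (Real.exp s * M1) ^ θ := by
  obtain ⟨hd, B, D, hB, hD, hg⟩ := hf
  have hn : ∀ z : ℂ, ‖Complex.exp (s * z ^ 2)‖ = Real.exp (s * (z.re ^ 2 - z.im ^ 2)) := by
    intro z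
    rw [Complex.norm_exp]; congr 1
    simp [pow_two]
  have key := Complex.HadamardThreeLines.norm_le_interp_of_mem_verticalClosedStrip₀₁' (fun z => Complex.exp (s * z ^ 2) * f z) (z := (θ:ℂ)) (a := M0) (b := Real.exp s * M1) ?_ ?_ ?_ ?_ ?_
  · rw [Complex.ofReal_re] at key
    refine le_trans ?_ key
    rw [norm_mul, hn]
    simp only [Complex.ofReal_re, Complex.ofReal_im]
    refine le_mul_of_one_le_left (norm_nonneg _) (Real.one_le_exp ?_)
    have := sq_nonneg θ
    nlinarith
  · simp only [Complex.HadamardThreeLines.verticalClosedStrip, mem_preimage, Complex.ofReal_re]; exact ⟨h0, h1⟩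
  · exact (Differentiable.mul (by fun_prop) hd).diffContOnCl
  · refine ⟨B * Real.exp (s + D + D ^ 2), ?_⟩
    rintro _ ⟨z, ⟨hz0, hz1⟩, rfl⟩
    simp only [Function.comp_apply]
    rw [norm_mul, hn]
    have hz : ‖z‖ ≤ 1 + |z.im| := by
      refine (Complex.norm_le_abs_re_add_abs_im z).trans ?_
      rw [abs_of_nonneg hz0]; linarith
    calc _ ≤ Real.exp (s * (z.re ^ 2 - z.im ^ 2)) * (B * Real.exp (D * (1 + |z.im|))) := by
          refine mul_le_mul_of_nonneg_left ((hg z).trans ?_) (by positivity)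
          gcongr
      _ = B * Real.exp (s * (z.re ^ 2 - z.im ^ 2) + D * (1 + |z.im|)) := by rw [Real.exp_add]; ring
      _ ≤ _ := by
          refine mul_le_mul_of_nonneg_left (Real.exp_le_exp.2 ?_) hB
          have q1 : z.re ^ 2 ≤ 1 := by nlinarith
          have q2 : D * |z.im| ≤ D ^ 2 + |z.im| ^ 2 := by nlinarith [sq_nonneg (D - |z.im|), sq_nonneg D, sq_nonneg |z.im|]
          have q3 : z.im ^ 2 ≤ s * z.im ^ 2 := le_mul_of_one_le_left (sq_nonneg _) hs
          rw [sq_abs] at q2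
          nlinarith
  · intro z hz
    have hz' : z = (z.im : ℂ) * Complex.I := by
      apply Complex.ext <;> simp; exact hz
    have hz0 : z.re = 0 := hz
    have := ha z.im
    rw [← hz'] at this
    rw [norm_mul, hn, hz0]
    calc _ ≤ Real.exp (s * (0 ^ 2 - z.im ^ 2)) * (M0 * Real.exp (s * z.im ^ 2)) := by gcongr
      _ = M0 * Real.exp (s * (0 ^ 2 - z.im ^ 2) + s * z.im ^ 2) := by rw [Real.exp_add]; ring
      _ = M0 := by rw [show s * (0 ^ 2 - z.im ^ 2) + s * z.im ^ 2 = 0 by ring, Real.exp_zero, mul_one]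
  · intro z hz
    have hz0 : z.re = 1 := hz
    have hz' : z = 1 + (z.im : ℂ) * Complex.I := by
      apply Complex.ext <;> simp; exact hz
    have := hb z.im
    rw [← hz'] at this
    rw [norm_mul, hn, hz0]
    calc _ ≤ Real.exp (s * (1 ^ 2 - z.im ^ 2)) * (M1 * Real.exp (s * z.im ^ 2)) := by gcongr
      _ = M1 * Real.exp (s * (1 ^ 2 - z.im ^ 2) + s * z.im ^ 2) := by rw [Real.exp_add]; ring
      _ = Real.exp s * M1 := by rw [show s * (1 ^ 2 - z.im ^ 2) + s * z.im ^ 2 = s by ring, mul_comm]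

lemma Adm.twist {n : ℕ} {φ : Euc n → ℂ} (h : Adm φ) {c : Euc n → ℂ} (hc : Measurable c) {M : ℝ} (hM : ∀ x, φ x ≠ 0 → ‖c x‖ ≤ M) :
    Adm fun x => c x * φ x := by
  obtain ⟨⟨hm, B, hB⟩, k, hk, hs⟩ := h
  refine ⟨⟨by fun_prop, |M| * B, fun x => ?_⟩, k, hk, fun x hx => hs x (right_ne_zero_of_mul hx)⟩
  rw [norm_mul]
  rcases eq_or_ne (φ x) 0 with h0 | h0
  · rw [h0]; simp; exact mul_nonneg (abs_nonneg _) ((norm_nonneg _).trans (hB x))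
  · exact mul_le_mul ((hM x h0).trans (le_abs_self _)) (hB x) (norm_nonneg _) (abs_nonneg _)

lemma Adm.L2_lt {n : ℕ} {φ : Euc n → ℂ} (h : Adm φ) : L2n φ ≠ ⊤ := by
  have hf := h.fin
  obtain ⟨⟨hm, B, hB⟩, k, hk, hs⟩ := h
  unfold L2n
  refine ENNReal.rpow_ne_top_of_nonneg (by norm_num) (ne_of_lt ?_)
  calc ∫⁻ x, ‖φ x‖ₑ ^ (2:ℝ) ≤ ∫⁻ x, ENNReal.ofReal B * ‖φ x‖ₑ := by
        refine lintegral_mono fun x => ?_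
        rw [show (2:ℝ) = ((2:ℕ):ℝ) by norm_num, ENNReal.rpow_natCast, pow_two]
        gcongr
        rw [← ofReal_norm]; exact ENNReal.ofReal_le_ofReal (hB x)
    _ = ENNReal.ofReal B * ∫⁻ x, ‖φ x‖ₑ := lintegral_const_mul _ (by fun_prop)
    _ < ⊤ := ENNReal.mul_lt_top ENNReal.ofReal_lt_top hf.2

def kr {n : ℕ} (w : ℝ → ℝ) (A L : ℕ) (l : ℂ) (z : Euc n × Euc n) : ℂ :=
  (w (‖z.1‖ / ‖z.2‖) : ℂ) * ∑ q ∈ Finset.Ico A (A + L), hh l q (zt z.1 z.2)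

lemma min_rpow_le_one {r ρ : ℝ} (hr : 0 < r) (hρ : 0 ≤ ρ) : min r (1 / r) ^ ρ ≤ 1 := by
  refine Real.rpow_le_one (by positivity) ?_ hρ
  rcases le_or_gt r 1 with h | h
  · exact (min_le_left _ _).trans h
  · exact (min_le_right _ _).trans (by rw [div_le_one hr]; exact h.le)

def wt {n : ℕ} (z : Euc n × Euc n) : ℂ := ((‖z.1‖ ^ (-(n/2:ℝ)) * ‖z.2‖ ^ (-(n/2:ℝ)) : ℝ) : ℂ)

lemma wt_meas {n : ℕ} : Measurable (wt : Euc n × Euc n → ℂ) := by unfold wt; fun_prop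

/-- homogeneous kernels give integrable forms -/
lemma hom_int {n : ℕ} {w : ℝ → ℝ} (hwm : Measurable w) {q : ℕ} {G ϱ : ℝ} (hG : 0 ≤ G) (hϱ : 0 ≤ ϱ)
    (hw : ∀ r, 0 < r → |w r| * r ^ q ≤ G * min r (1 / r) ^ ϱ) {k : ℂ → ℂ} (hkm : Measurable k) {B : ℝ} (hB0 : 0 ≤ B)
    (hk : ∀ ζ, ‖k ζ‖ ≤ B * ‖ζ‖ ^ q) {φ ψ : Euc n → ℂ} (hφ : Adm φ) (hψ : Adm ψ) :
    Integrable (fun z : Euc n × Euc n => (w (‖z.1‖ / ‖z.2‖) * k (zt z.1 z.2) * wt z) * (φ z.1 * ψ z.2)) (volume.prod volume) := by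
  obtain ⟨B1, hB10, hB1⟩ := hφ.pw (-(n/2:ℝ))
  obtain ⟨B2, hB20, hB2⟩ := hψ.pw (-(n/2:ℝ))
  have h1 := hkm.comp (zt_meas (n := n))
  refine kern_int hφ hψ (fun z => (w (‖z.1‖ / ‖z.2‖) * k (zt z.1 z.2) * wt z)) ((Measurable.mul (by fun_prop) h1).mul wt_meas) (B * G * (B1 * B2)) fun z h1 h2 => ?_
  have hr : 0 < ‖z.1‖ / ‖z.2‖ := div_pos (hφ.ne h1) (hψ.ne h2)
  simp only [norm_mul, wt, Complex.norm_real, Real.norm_eq_abs]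
  refine mul_le_mul ?_ ?_ (by positivity) (by positivity)
  · have e := hk (zt z.1 z.2)
    rw [zt_norm] at e
    calc _ ≤ |w (‖z.1‖ / ‖z.2‖)| * (B * (‖z.1‖ / ‖z.2‖) ^ q) := mul_le_mul_of_nonneg_left e (abs_nonneg _)
      _ = B * (|w (‖z.1‖ / ‖z.2‖)| * (‖z.1‖ / ‖z.2‖) ^ q) := by ring
      _ ≤ B * (G * 1) := mul_le_mul_of_nonneg_left ((hw _ hr).trans (mul_le_mul_of_nonneg_left (min_rpow_le_one hr hϱ) hG)) hB0
      _ = B * G := by ring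
  · rw [abs_of_nonneg (by positivity), abs_of_nonneg (by positivity)]
    exact mul_le_mul (hB1 _ h1) (hB2 _ h2) (by positivity) hB10

lemma exp_int {X : Type*} [MeasurableSpace X] {μ : Measure X} {g : X → ℝ} {h : X → ℂ}
    (hg : Measurable g) {M : ℝ} (hb : ∀ x, h x ≠ 0 → |g x| ≤ M) (hh : Integrable h μ) (z : ℂ) :
    Integrable (fun x => Complex.exp (z * g x) * h x) μ := by
  refine (hh.norm.const_mul (Real.exp (‖z‖ * M))).mono' ((by fun_prop : AEStronglyMeasurable (fun x => Complex.exp (z * g x)) μ).mul hh.1) (ae_of_all _ fun x => ?_)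
  rw [norm_mul]
  rcases eq_or_ne (h x) 0 with h0 | h0
  · simp [h0]
  gcongr
  rw [Complex.norm_exp]
  gcongr
  calc (z * g x).re ≤ ‖z * g x‖ := Complex.re_le_norm _
    _ = ‖z‖ * |g x| := by rw [norm_mul, Complex.norm_real, Real.norm_eq_abs]
    _ ≤ ‖z‖ * M := mul_le_mul_of_nonneg_left (hb x h0) (norm_nonneg _)

lemma GE_q {n : ℕ} {w : ℝ → ℝ} (hwm : Measurable w) {q : ℕ} {G ϱ : ℝ} (hG : 0 ≤ G) (hϱ : 0 ≤ ϱ)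
    (hw : ∀ r, 0 < r → |w r| * r ^ q ≤ G * min r (1 / r) ^ ϱ) (c d : ℝ) {ω : Euc n → ℝ} (hω : Measurable ω) {M : ℝ}
    {φ ψ : Euc n → ℂ} (hφ : Adm φ) (hψ : Adm ψ) (hφM : ∀ x, φ x ≠ 0 → |ω x| ≤ M) (hψM : ∀ x, ψ x ≠ 0 → |ω x| ≤ M) :
    GE fun z => ∫ p : Euc n × Euc n, (w (‖p.1‖ / ‖p.2‖) * hh (c - z * d) q (zt p.1 p.2) * wt p) *
      ((Complex.exp (z * ω p.1) * φ p.1) * (Complex.exp (z * ω p.2) * ψ p.2)) ∂(volume.prod volume) := by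
  set g : Euc n × Euc n → ℝ := fun p => ω p.1 + ω p.2 with hg
  have hgm : Measurable g := by rw [hg]; fun_prop
  set h : ℕ × ℕ → Euc n × Euc n → ℂ := fun x p => (w (‖p.1‖ / ‖p.2‖) * (zt p.1 p.2 ^ x.1 * starRingEnd ℂ (zt p.1 p.2) ^ x.2) * wt p) * (φ p.1 * ψ p.2) with hh'
  have hi : ∀ x ∈ Finset.HasAntidiagonal.antidiagonal q, Integrable (h x) (volume.prod volume) := by
    intro x hx
    refine hom_int hwm hG hϱ hw (k := fun ζ => ζ ^ x.1 * starRingEnd ℂ ζ ^ x.2) (by fun_prop) zero_le_one (fun ζ => ?_) hφ hψ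
    rw [norm_mul, norm_pow, norm_pow, RCLike.norm_conj, ← pow_add, Finset.HasAntidiagonal.mem_antidiagonal.1 hx, one_mul]
  have hb : ∀ x p, h x p ≠ 0 → |g p| ≤ M + M := by
    intro x p hp
    have h2 := right_ne_zero_of_mul hp
    exact (abs_add_le _ _).trans (add_le_add (hφM _ (left_ne_zero_of_mul h2)) (hψM _ (right_ne_zero_of_mul h2)))
  have hfin : GE fun z => ∑ x ∈ Finset.HasAntidiagonal.antidiagonal q, (bb (c - z * d) x.1 * bb (c - z * d) x.2) * ∫ p, Complex.exp (z * g p) * h x p ∂(volume.prod volume) :=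
    GE.sum _ fun x hx => ((GE.bb c d x.1).mul (GE.bb c d x.2)).mul (GE.int _ g (h x) hgm _ (hb x) (hi x hx))
  convert hfin using 2 with z
  simp only [← integral_const_mul]
  rw [← integral_finsetSum _ fun x hx => (exp_int hgm (hb x) (hi x hx) z).const_mul _]
  congr 1; funext p
  simp only [hh', hg, hh, hu, Finset.mul_sum, Finset.sum_mul]
  refine Finset.sum_congr rfl fun x _ => ?_
  push_cast
  rw [mul_add, Complex.exp_add]; ring

lemma L2n_twist {n : ℕ} (φ : Euc n → ℂ) (ω : Euc n → ℝ) (η : ℝ) :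
    L2n (fun x => Complex.exp (η * Complex.I * ω x) * φ x) = L2n φ := by
  unfold L2n
  congr 2; funext x
  rw [enorm_mul, ← ofReal_norm (Complex.exp _), Complex.norm_exp]
  simp

set_option maxHeartbeats 800000 in
lemma block {n : ℕ} (hn : 3 ≤ n) {γ : ℝ} (h0 : 1/2 ≤ γ) (h1 : γ < 1) : ∃ C : ℝ, 0 ≤ C ∧ ∀ (u : Euc n → ℝ≥0∞), Measurable u →
    (∀ (x : Euc n) (R : ℝ), 0 < R → ∫⁻ y in ball x R, u y ≤ ENNReal.ofReal (R ^ γ)) →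
    ∀ (ω : Euc n → ℝ) (M : ℝ) (φ ψ : Euc n → ℂ), Measurable ω → Adm φ → Adm ψ →
    (∀ x, φ x ≠ 0 → |ω x| ≤ M) → (∀ x, ψ x ≠ 0 → |ω x| ≤ M) →
    (∀ x, φ x ≠ 0 → ENNReal.ofReal (Real.exp (ω x) * ‖x‖ ^ (-(n/2:ℝ))) ^ (2:ℝ) ≤ ENNReal.ofReal (‖x‖ ^ (-γ)) * u x) →
    (∀ x, ψ x ≠ 0 → ENNReal.ofReal (Real.exp (ω x) * ‖x‖ ^ (-(n/2:ℝ))) ^ (2:ℝ) ≤ ENNReal.ofReal (‖x‖ ^ (-γ)) * u x) →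
    ∀ (θ : ℝ), 0 ≤ θ → θ ≤ 1 → ∀ (A L : ℕ), 1 ≤ L → L ≤ A + 1 → ∀ (w : ℝ → ℝ) (G ϱ : ℝ), Measurable w → 0 ≤ G → 1/2 ≤ ϱ →
    (∀ q ∈ Finset.Ico A (A + L), ∀ r, 0 < r → |w r| * r ^ q ≤ G * min r (1 / r) ^ ϱ) →
    ‖∫ p : Euc n × Euc n, kr w A L ((n/2:ℝ) - θ * ((n - γ)/2:ℝ)) p * wt p *
      ((Complex.exp (θ * ω p.1) * φ p.1) * (Complex.exp (θ * ω p.2) * ψ p.2)) ∂(volume.prod volume)‖ₑ ≤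
      ENNReal.ofReal (C * (G * (L / ϱ) ^ (1 - θ) * (L / ((A:ℝ) + 1)) ^ ((1 - γ) * θ))) * (L2n φ * L2n ψ) := by
  obtain ⟨C0, hC0, hL2⟩ := L2end n hn
  set s : ℝ := 5 * n ^ 2 with hs
  have hn3 : (3:ℝ) ≤ n := by exact_mod_cast hn
  have hs1 : 1 ≤ s := by rw [hs]; nlinarith
  have hCS := CS_nonneg h1
  set C1 : ℝ := Real.exp s * (128 * CS γ) with hC1
  have hC10 : 0 ≤ C1 := by positivity
  refine ⟨C0 + C1, by positivity, fun u hu hK ω M φ ψ hω hφ hψ hφM hψM haφ haψ θ hθ0 hθ1 A L hL1 hLA w G ϱ hwm hG hϱ hw => ?_⟩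
  set d : ℝ := (n - γ)/2 with hd
  have hd0 : 0 ≤ d := by rw [hd]; linarith
  have hdn : d ≤ n / 2 := by rw [hd]; linarith
  have hdd : ∀ η : ℝ, 19 * (-(η * d)) ^ 2 ≤ s * η ^ 2 := by
    intro η
    rw [hs]
    have : d ^ 2 ≤ (n/2:ℝ) ^ 2 := by gcongr
    have := mul_le_mul_of_nonneg_left this (sq_nonneg η)
    nlinarith [mul_nonneg (sq_nonneg η) (sq_nonneg (n:ℝ))]
  have hφt : ∀ z : ℂ, Adm fun x => Complex.exp (z * ω x) * φ x := fun z => hφ.twist (M := Real.exp (‖z‖ * M)) (by fun_prop) fun x hx => by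
    rw [Complex.norm_exp]; gcongr
    calc (z * ω x).re ≤ ‖z * ω x‖ := Complex.re_le_norm _
      _ = ‖z‖ * |ω x| := by rw [norm_mul, Complex.norm_real, Real.norm_eq_abs]
      _ ≤ _ := mul_le_mul_of_nonneg_left (hφM x hx) (norm_nonneg _)
  have hψt : ∀ z : ℂ, Adm fun x => Complex.exp (z * ω x) * ψ x := fun z => hψ.twist (M := Real.exp (‖z‖ * M)) (by fun_prop) fun x hx => by
    rw [Complex.norm_exp]; gcongr
    calc (z * ω x).re ≤ ‖z * ω x‖ := Complex.re_le_norm _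
      _ = ‖z‖ * |ω x| := by rw [norm_mul, Complex.norm_real, Real.norm_eq_abs]
      _ ≤ _ := mul_le_mul_of_nonneg_left (hψM x hx) (norm_nonneg _)
  obtain ⟨F, hF⟩ : ∃ F : ℂ → ℂ, F = fun z => ∑ q ∈ Finset.Ico A (A + L), ∫ p : Euc n × Euc n, (w (‖p.1‖ / ‖p.2‖) * hh ((n/2:ℝ) - z * d) q (zt p.1 p.2) * wt p) *
      ((Complex.exp (z * ω p.1) * φ p.1) * (Complex.exp (z * ω p.2) * ψ p.2)) ∂(volume.prod volume) := ⟨_, rfl⟩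
  have hGE : GE F := by
    rw [hF]
    exact GE.sum _ fun q hq => GE_q hwm hG (by linarith) (hw q hq) (n/2) d hω hφ hψ hφM hψM
  have hFk : ∀ z, F z = ∫ p : Euc n × Euc n, kr w A L ((n/2:ℝ) - z * d) p * wt p *
      ((Complex.exp (z * ω p.1) * φ p.1) * (Complex.exp (z * ω p.2) * ψ p.2)) ∂(volume.prod volume) := by
    intro z
    rw [hF]; simp only
    rw [← integral_finsetSum]
    · congr 1; funext p
      simp only [kr, Finset.mul_sum, Finset.sum_mul]
    · intro q hq
      obtain ⟨B, hB0, hB⟩ := hh_bdd ((n/2:ℝ) - z * d) q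
      exact hom_int (φ := fun x => Complex.exp (z * ω x) * φ x) (ψ := fun x => Complex.exp (z * ω x) * ψ x) hwm hG (by linarith) (hw q hq) (k := hh ((n/2:ℝ) - z * d) q) (hh_cont _ q).measurable hB0 hB (hφt z) (hψt z)
  have hN1 := hφ.L2_lt
  have hN2 := hψ.L2_lt
  obtain ⟨N, hN0, hN⟩ : ∃ N : ℝ, 0 ≤ N ∧ L2n φ * L2n ψ = ENNReal.ofReal N :=
    ⟨_, ENNReal.toReal_nonneg, (ENNReal.ofReal_toReal (ENNReal.mul_ne_top hN1 hN2)).symm⟩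
  have ha : ∀ η : ℝ, ‖F (η * Complex.I)‖ ≤ (C0 * G * (L / ϱ) * N) * Real.exp (s * η ^ 2) := by
    intro η
    have e1 : ‖F (η * Complex.I)‖ₑ ≤ ENNReal.ofReal ((C0 * G * (L / ϱ) * N) * Real.exp (s * η ^ 2)) := by
      rw [hF]; simp only
      refine (enorm_sum_le _ _).trans ?_
      have hq : ∀ q ∈ Finset.Ico A (A + L), ‖∫ p : Euc n × Euc n, (w (‖p.1‖ / ‖p.2‖) * hh ((n/2:ℝ) - η * Complex.I * d) q (zt p.1 p.2) * wt p) *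
          ((Complex.exp (η * Complex.I * ω p.1) * φ p.1) * (Complex.exp (η * Complex.I * ω p.2) * ψ p.2)) ∂(volume.prod volume)‖ₑ ≤
          ENNReal.ofReal (C0 * Real.exp (s * η ^ 2) * (G / ϱ) * N) := by
        intro q hq
        have := hL2 (-(η * d)) q w G ϱ (fun x => Complex.exp (η * Complex.I * ω x) * φ x) (fun x => Complex.exp (η * Complex.I * ω x) * ψ x) hwm (by linarith) hG (hw q hq) (hφt (η * Complex.I)) (hψt (η * Complex.I))
        rw [L2n_twist, L2n_twist, hN, ← ENNReal.ofReal_mul (by positivity)] at this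
        rw [show ((n/2:ℝ):ℂ) - η * Complex.I * d = (n/2:ℝ) + ((-(η * d) : ℝ) : ℂ) * Complex.I by push_cast; ring]
        refine this.trans (ENNReal.ofReal_le_ofReal ?_)
        have q1 : Real.exp (18 * (-(η * d)) ^ 2) ≤ Real.exp (s * η ^ 2) := Real.exp_le_exp.2 (by linarith [hdd η, sq_nonneg (-(η * d))])
        gcongr
      refine (Finset.sum_le_sum hq).trans (le_of_eq ?_)
      rw [Finset.sum_const, Nat.card_Ico, add_tsub_cancel_left, nsmul_eq_mul, ← ENNReal.ofReal_natCast, ← ENNReal.ofReal_mul (by positivity)]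
      congr 1; ring
    rw [← ofReal_norm] at e1
    exact (ENNReal.ofReal_le_ofReal_iff (by positivity)).1 e1
  have hb : ∀ η : ℝ, ‖F (1 + η * Complex.I)‖ ≤ (128 * CS γ * G * (L / ((A:ℝ) + 1)) ^ (1 - γ) * N) * Real.exp (s * η ^ 2) := by
    intro η
    have e1 : ‖F (1 + η * Complex.I)‖ₑ ≤ ENNReal.ofReal ((128 * CS γ * G * (L / ((A:ℝ) + 1)) ^ (1 - γ) * N) * Real.exp (s * η ^ 2)) := by
      rw [hFk]
      refine (enorm_integral_le_lintegral_enorm _).trans ?_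
      have := pt_end hu h0 h1 hK (-(η * d)) A L hL1 hLA w hG hϱ hw (fun x => ENNReal.ofReal (Real.exp (ω x) * ‖x‖ ^ (-(n/2:ℝ)))) hφ hψ haφ haψ
      rw [hN, ← ENNReal.ofReal_mul (by positivity)] at this
      have hle : ENNReal.ofReal (128 * CS γ * Real.exp (19 * (-(η * d)) ^ 2) * G * (L / ((A:ℝ) + 1)) ^ (1 - γ) * N) ≤ ENNReal.ofReal ((128 * CS γ * G * (L / ((A:ℝ) + 1)) ^ (1 - γ) * N) * Real.exp (s * η ^ 2)) := by
        refine ENNReal.ofReal_le_ofReal ?_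
        have q1 : Real.exp (19 * (-(η * d)) ^ 2) ≤ Real.exp (s * η ^ 2) := Real.exp_le_exp.2 (hdd η)
        have := mul_le_mul_of_nonneg_left q1 (show 0 ≤ 128 * CS γ * G * (L / ((A:ℝ) + 1)) ^ (1 - γ) * N by positivity)
        linarith
      refine le_trans (le_of_eq ?_) (this.trans hle)
      refine lintegral_congr fun p => ?_
      have e2 : ((n/2:ℝ):ℂ) - (1 + η * Complex.I) * d = (γ/2:ℝ) + ((-(η * d) : ℝ) : ℂ) * Complex.I := by
        rw [hd]; push_cast; ring
      have e3 : ∀ x, ‖Complex.exp ((1 + η * Complex.I) * ω x)‖ₑ = ENNReal.ofReal (Real.exp (ω x)) := by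
        intro x
        rw [← ofReal_norm, Complex.norm_exp]; simp
      simp only [enorm_mul, e2, e3, kr]
      have e4 : ‖wt p‖ₑ = ENNReal.ofReal (‖p.1‖ ^ (-(n/2:ℝ))) * ENNReal.ofReal (‖p.2‖ ^ (-(n/2:ℝ))) := by
        rw [wt, ← ofReal_norm, Complex.norm_real, Real.norm_of_nonneg (by positivity), ENNReal.ofReal_mul (by positivity)]
      rw [e4, ENNReal.ofReal_mul (Real.exp_nonneg _), ENNReal.ofReal_mul (Real.exp_nonneg _)]
      ring
    rw [← ofReal_norm] at e1
    exact (ENNReal.ofReal_le_ofReal_iff (by positivity)).1 e1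
  have hfin := three_gauss hGE hs1 (by positivity) hθ0 hθ1 ha hb
  rw [hFk] at hfin
  rw [hN, ← ENNReal.ofReal_mul (by positivity), ← ofReal_norm]
  refine ENNReal.ofReal_le_ofReal (hfin.trans ?_)
  calc _ ≤ ((C0 + C1) * (G * (L / ϱ) * N)) ^ (1 - θ) * ((C0 + C1) * (G * (L / ((A:ℝ) + 1)) ^ (1 - γ) * N)) ^ θ := by
        refine mul_le_mul (Real.rpow_le_rpow (by positivity) ?_ (by linarith)) (Real.rpow_le_rpow (by positivity) ?_ hθ0) (by positivity) (by positivity)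
        · have : 0 ≤ C1 * (G * (L / ϱ) * N) := by positivity
          linarith
        · have : 0 ≤ C0 * (G * (L / ((A:ℝ) + 1)) ^ (1 - γ) * N) := by positivity
          rw [hC1]; linarith
    _ = _ := by
        have t : ∀ x : ℝ, 0 ≤ x → x ^ (1 - θ) * x ^ θ = x := fun x hx => by
          rw [← Real.rpow_add_of_nonneg hx (by linarith) hθ0, sub_add_cancel, Real.rpow_one]
        have hLA0 : (0:ℝ) ≤ L / ((A:ℝ) + 1) := by positivity
        have hLϱ : (0:ℝ) ≤ L / ϱ := by positivity
        rw [Real.mul_rpow (by positivity) (by positivity), Real.mul_rpow (by positivity) hN0, Real.mul_rpow hG hLϱ,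
          Real.mul_rpow (x := C0 + C1) (y := G * (L / ((A:ℝ) + 1)) ^ (1 - γ) * N) (by positivity) (by positivity), Real.mul_rpow (y := N) (by positivity) hN0, Real.mul_rpow hG (by positivity), ← Real.rpow_mul hLA0]
        calc _ = ((C0 + C1) ^ (1 - θ) * (C0 + C1) ^ θ) * (G ^ (1 - θ) * G ^ θ) * (N ^ (1 - θ) * N ^ θ) * (L / ϱ) ^ (1 - θ) * (L / ((A:ℝ) + 1)) ^ ((1 - γ) * θ) := by ring
          _ = _ := by rw [t _ (by positivity), t _ hG, t _ hN0]; ring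

def rz {n : ℕ} (s : ℝ) (x y : Euc n) : ℝ≥0∞ := ENNReal.ofReal (dist x y ^ (-s))

lemma rz_comm {n : ℕ} (s : ℝ) (x y : Euc n) : rz s x y = rz s y x := by rw [rz, rz, dist_comm]

@[fun_prop]
lemma rz_meas {n : ℕ} {X : Type*} [MeasurableSpace X] (s : ℝ) {f g : X → Euc n} (hf : Measurable f) (hg : Measurable g) : Measurable fun z => rz s (f z) (g z) := by
  unfold rz; fun_prop

lemma vol_growth {n : ℕ} (x : Euc n) (R : ℝ) (hR : 0 < R) : volume (ball x R) ≤ volume (ball (0 : Euc n) 1) * ENNReal.ofReal (R ^ (n:ℝ)) := by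
  rw [Measure.addHaar_ball_of_pos _ _ hR, finrank_euclideanSpace_fin, Real.rpow_natCast, mul_comm]

lemma riesz_comp {n : ℕ} {c τ : ℝ} (hc : 0 < c) (hcτ : c < τ) (hτ : τ < n) : ∃ C : ℝ≥0∞, C ≠ ⊤ ∧ ∀ x w : Euc n, x ≠ w →
    ∫⁻ y, rz (n - c) x y * rz τ y w ≤ C * rz (τ - c) x w := by
  set K := volume (ball (0 : Euc n) 1) with hKd
  have hKt : K ≠ ⊤ := measure_ball_lt_top.ne
  refine ⟨ENNReal.ofReal (2 ^ (τ - c)) * (K * ENNReal.ofReal (nearC n (n - c)) + K * ENNReal.ofReal (nearC n τ) + ENNReal.ofReal (3 ^ τ) * (K * ENNReal.ofReal (farC n (n - c + τ)))),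
    by finiteness, fun x w hxw => ?_⟩
  set d := dist x w / 2 with hd
  have hd0 : 0 < d := by have := dist_pos.2 hxw; positivity
  have hpt : ∀ y, rz (n - c) x y * rz τ y w ≤ ENNReal.ofReal (d ^ (-τ)) * (ball x d).indicator (fun y => ENNReal.ofReal (dist y x ^ (-(n - c)))) y +
      ENNReal.ofReal (d ^ (-(n - c))) * (ball w d).indicator (fun y => ENNReal.ofReal (dist y w ^ (-τ))) y +
      ENNReal.ofReal (3 ^ τ) * ENNReal.ofReal ((max d (dist y x)) ^ (-(n - c + τ))) := by
    intro y
    have htri := dist_triangle x y w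
    have hdw : dist x w = 2 * d := by rw [hd]; ring
    by_cases h1 : dist y x < d
    · refine le_trans ?_ (le_trans le_self_add le_self_add)
      rw [indicator_of_mem (mem_ball.2 h1), mul_comm, rz, rz, dist_comm y x]
      gcongr ?_ * _
      refine ENNReal.ofReal_le_ofReal (Real.rpow_le_rpow_of_nonpos hd0 ?_ (by linarith))
      rw [dist_comm] at h1; linarith
    by_cases h2 : dist y w < d
    · refine le_trans ?_ (le_trans le_add_self le_self_add)
      rw [indicator_of_mem (mem_ball.2 h2), rz, rz]
      gcongr ?_ * _
      refine ENNReal.ofReal_le_ofReal (Real.rpow_le_rpow_of_nonpos hd0 ?_ (by linarith))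
      linarith
    · refine le_trans ?_ le_add_self
      rw [not_lt] at h1 h2
      rw [rz, rz, max_eq_right h1, ← ENNReal.ofReal_mul (by positivity), ← ENNReal.ofReal_mul (by positivity)]
      refine ENNReal.ofReal_le_ofReal ?_
      have h0 : 0 < dist y x := by linarith
      rw [neg_add, Real.rpow_add h0, dist_comm x y]
      have : dist y w ^ (-τ) ≤ 3 ^ τ * dist y x ^ (-τ) := by
        have h5 : 0 < dist y w := by linarith
        rw [Real.rpow_neg h0.le, Real.rpow_neg dist_nonneg, ← div_eq_mul_inv, le_div_iff₀ (by positivity), inv_mul_le_iff₀ (by positivity), ← Real.mul_rpow dist_nonneg (by norm_num)]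
        refine Real.rpow_le_rpow dist_nonneg ?_ (by linarith)
        have := dist_triangle y w x; rw [dist_comm w x] at this; linarith
      have h3 : 0 ≤ dist y x ^ (-((n:ℝ) - c)) := by positivity
      nlinarith
  refine (lintegral_mono hpt).trans ?_
  have m1 : ∀ (z : Euc n) (s : ℝ), Measurable fun y : Euc n => (ball z d).indicator (fun y => ENNReal.ofReal (dist y z ^ (-s))) y :=
    fun z s => Measurable.indicator (by fun_prop) measurableSet_ball
  have m2 := m1 x (n - c)
  have m3 := m1 w τ
  rw [lintegral_add_left (by fun_prop), lintegral_add_left ((m1 _ _).const_mul _), lintegral_const_mul _ (m1 _ _), lintegral_const_mul _ (m1 _ _),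
    lintegral_const_mul _ (by fun_prop), lintegral_indicator measurableSet_ball, lintegral_indicator measurableSet_ball]
  have a1 := near_lemma volume K (γ := n) (s := n - c) (by linarith) (by linarith) x (vol_growth x) hd0
  have a2 := near_lemma volume K (γ := n) (s := τ) hτ (by linarith) w (vol_growth w) hd0
  have a3 := far_lemma volume K (γ := n) (s := n - c + τ) (by linarith) (by linarith) x (vol_growth x) hd0
  refine (add_le_add (add_le_add (mul_le_mul_right a1 _) (mul_le_mul_right a2 _)) (mul_le_mul_right a3 _)).trans (le_of_eq ?_)
  have e : rz (τ - c) x w = ENNReal.ofReal (2 ^ (-(τ - c))) * ENNReal.ofReal (d ^ (c - τ)) := by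
    rw [rz, ← ENNReal.ofReal_mul (by positivity), show dist x w = 2 * d by rw [hd]; ring, Real.mul_rpow (by norm_num) hd0.le, neg_sub]
  have e2 : ENNReal.ofReal (2 ^ (τ - c)) * ENNReal.ofReal (2 ^ (-(τ - c))) = 1 := by
    rw [← ENNReal.ofReal_mul (by positivity), ← Real.rpow_add (by norm_num)]; simp
  have e3 : ∀ p q k : ℝ, p + q = c - τ → 0 ≤ k → ENNReal.ofReal (d ^ p) * (K * ENNReal.ofReal (k * d ^ q)) = K * ENNReal.ofReal k * ENNReal.ofReal (d ^ (c - τ)) := by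
    intro p q k h hk
    rw [ENNReal.ofReal_mul hk, ← h, Real.rpow_add hd0, ENNReal.ofReal_mul (by positivity)]; ring
  rw [e3 _ _ _ (by ring) (nearC_nonneg (by linarith)), e3 _ _ _ (by ring) (nearC_nonneg (by linarith)), ENNReal.ofReal_mul (p := farC _ _) (farC_nonneg (by linarith)), e,
    show (n:ℝ) - (n - c + τ) = c - τ by ring]
  calc _ = 1 * (K * ENNReal.ofReal (nearC n (n - c)) + K * ENNReal.ofReal (nearC n τ) + ENNReal.ofReal (3 ^ τ) * (K * ENNReal.ofReal (farC n (n - c + τ)))) * ENNReal.ofReal (d ^ (c - τ)) := by ring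
    _ = _ := by rw [← e2]; ring

/-- Hedberg type inequality -/
lemma hedberg {n : ℕ} {γ s : ℝ} (h0 : 0 ≤ γ) (hs : γ < s) (hs1 : s ≤ γ + 1) (g : Euc n → ℝ≥0∞) (hg : Measurable g)
    (hK : ∀ (x : Euc n) (R : ℝ), 0 < R → ∫⁻ y in ball x R, g y ≤ ENNReal.ofReal (R ^ γ)) (x : Euc n)
    {I : ℝ} (hI0 : 0 < I) (hI : ∫⁻ y, rz (γ + 1) x y * g y = ENNReal.ofReal I) :
    ∫⁻ y, rz s x y * g y ≤ ENNReal.ofReal (1 + farC γ s) * ENNReal.ofReal (I ^ (s - γ)) := by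
  set R := I⁻¹ with hR
  have hR0 : 0 < R := by positivity
  have hpt : ∀ y, rz s x y * g y ≤ ENNReal.ofReal (R ^ (γ + 1 - s)) * (rz (γ + 1) x y * g y) + g y * ENNReal.ofReal ((max R (dist y x)) ^ (-s)) := by
    intro y
    rcases lt_or_ge (dist y x) R with h | h
    · refine le_trans ?_ le_self_add
      rw [← mul_assoc]; gcongr
      rw [rz, rz, ← ENNReal.ofReal_mul (by positivity)]
      refine ENNReal.ofReal_le_ofReal ?_
      rw [dist_comm x y]
      rcases eq_or_lt_of_le (dist_nonneg (x := y) (y := x)) with h2 | h2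
      · rw [← h2, Real.zero_rpow (by linarith)]; positivity
      · rw [show -s = (γ + 1 - s) + -(γ + 1) by ring, Real.rpow_add h2]
        gcongr
    · refine le_trans (le_of_eq ?_) le_add_self
      rw [max_eq_right h, mul_comm, rz, dist_comm]
  refine (lintegral_mono hpt).trans ?_
  rw [lintegral_add_left (by fun_prop), lintegral_const_mul _ (by fun_prop), hI, show (fun a => g a * ENNReal.ofReal (max R (dist a x) ^ (-s))) = g * fun a => ENNReal.ofReal (max R (dist a x) ^ (-s)) from rfl, ← lintegral_withDensity_eq_lintegral_mul _ hg (by fun_prop)]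
  have a3 := far_lemma (volume.withDensity g) 1 hs (by linarith) x (fun R hR => by
    rw [withDensity_apply _ measurableSet_ball, one_mul]; exact hK x R hR) hR0
  refine (add_le_add le_rfl a3).trans (le_of_eq ?_)
  rw [one_mul, ENNReal.ofReal_mul (farC_nonneg hs), ENNReal.ofReal_add zero_le_one (farC_nonneg hs), add_mul, ENNReal.ofReal_one, one_mul, ← ENNReal.ofReal_mul (by positivity), hR,
    Real.inv_rpow hI0.le, Real.inv_rpow hI0.le, ← Real.rpow_neg hI0.le, ← Real.rpow_neg hI0.le]
  congr 2
  · nth_rw 2 [← Real.rpow_one I]; rw [← Real.rpow_add hI0]; ring_nf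
  · ring_nf

lemma FP {n : ℕ} {γ P : ℝ} (h0 : 0 ≤ γ) (hγ : γ + 1 < n) (hP : 1 < P) : ∃ C : ℝ≥0∞, C ≠ ⊤ ∧ ∀ (g : Euc n → ℝ≥0∞), Measurable g →
    (∀ (x : Euc n) (R : ℝ), 0 < R → ∫⁻ y in ball x R, g y ≤ ENNReal.ofReal (R ^ γ)) →
    ∀ (φ ψ : Euc n → ℝ≥0∞) (M : ℝ≥0∞) (k : ℝ), M ≠ ⊤ → Measurable φ → Measurable ψ → (∀ x, φ x ≠ 0 → g x ≤ M ∧ ‖x‖ ≤ k) → (∀ x, ψ x ≠ 0 → g x ≤ M ∧ ‖x‖ ≤ k) →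
    ∫⁻ z : Euc n × Euc n, (rz (n - (n - γ) / P) z.1 z.2 * (g z.1 ^ (1/P/2) * g z.2 ^ (1/P/2))) * (φ z.1 * ψ z.2) ∂(volume.prod volume) ≤
      C * ((∫⁻ x, φ x ^ (2:ℝ)) ^ (1 / 2 : ℝ) * (∫⁻ y, ψ y ^ (2:ℝ)) ^ (1 / 2 : ℝ)) := by
  have hP0 : 0 < P := by linarith
  obtain ⟨c, hc⟩ : ∃ c : ℝ, c = 1 / (P + 1) := ⟨_, rfl⟩
  have hc0 : 0 < c := by rw [hc]; positivity
  have hc1 : c < 1 := by rw [hc, div_lt_one (by positivity)]; linarith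
  have hcP : c * (P - 1) ≤ 1 := by rw [hc, one_div, inv_mul_le_iff₀ (by positivity)]; linarith
  have hcP0 : 0 < c * (P - 1) := mul_pos hc0 (by linarith)
  obtain ⟨C1, hC1, hcomp⟩ := riesz_comp (n := n) hc0 (τ := γ + 1) (by linarith) hγ
  obtain ⟨Q, hQ⟩ : ∃ Q : ℝ, Q = P / (P - 1) := ⟨_, rfl⟩
  have hPQ : P.HolderConjugate Q := by rw [hQ]; exact Real.HolderConjugate.conjExponent hP
  have hQP : 1 / Q = 1 - 1 / P := by have := hPQ.inv_add_inv_eq_one; simp only [one_div]; linarith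
  have hQ0 : 0 < 1 / Q := by have := hPQ.symm.pos; positivity
  obtain ⟨C3, hC3⟩ : ∃ C3, C3 = ENNReal.ofReal (1 + farC γ (γ + c * (P - 1))) := ⟨_, rfl⟩
  obtain ⟨C2, hC2⟩ : ∃ C2, C2 = ENNReal.ofReal (1 + farC γ (γ + 1 - c)) := ⟨_, rfl⟩
  refine ⟨C3 ^ (1/P) * (C1 * C2) ^ (1/Q), by rw [hC3, hC2]; finiteness, fun g' hg' hK' φ ψ M k hM hφ hψ hφs hψs => ?_⟩
  obtain ⟨S, hS⟩ : ∃ S : Set (Euc n), S = {x | g' x ≤ M ∧ ‖x‖ ≤ k} := ⟨_, rfl⟩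
  have hSm : MeasurableSet S := by
    rw [hS]; exact (measurableSet_le hg' measurable_const).inter (measurableSet_le measurable_norm measurable_const)
  obtain ⟨g, hgd⟩ : ∃ g : Euc n → ℝ≥0∞, g = S.indicator g' := ⟨_, rfl⟩
  have hg : Measurable g := hgd ▸ hg'.indicator hSm
  have hgle : ∀ x, g x ≤ g' x := fun x => hgd ▸ indicator_le_self _ _ x
  have hK : ∀ (x : Euc n) (R : ℝ), 0 < R → ∫⁻ y in ball x R, g y ≤ ENNReal.ofReal (R ^ γ) := fun x R hR => (lintegral_mono hgle).trans (hK' x R hR)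
  have hrep : ∀ z : Euc n × Euc n, (rz (n - (n - γ) / P) z.1 z.2 * (g' z.1 ^ (1/P/2) * g' z.2 ^ (1/P/2))) * (φ z.1 * ψ z.2) =
      (rz (n - (n - γ) / P) z.1 z.2 * (g z.1 ^ (1/P/2) * g z.2 ^ (1/P/2))) * (φ z.1 * ψ z.2) := by
    intro z
    by_cases h1 : φ z.1 = 0
    · simp [h1]
    by_cases h2 : ψ z.2 = 0
    · simp [h2]
    rw [hgd, indicator_of_mem (hS ▸ hφs _ h1), indicator_of_mem (hS ▸ hψs _ h2)]
  simp_rw [hrep]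
  obtain ⟨J, hJ⟩ : ∃ J : Euc n → ℝ≥0∞, J = fun x => ∫⁻ y, rz (γ + 1) x y * g y := ⟨_, rfl⟩
  have hJm : Measurable J := by
    rw [hJ]; exact Measurable.lintegral_prod_right' (f := fun z : Euc n × Euc n => rz (γ + 1) z.1 z.2 * g z.2) (by fun_prop)
  have hJt : ∀ x, J x ≠ ⊤ := by
    intro x
    have hle : J x ≤ M * ∫⁻ y in ball x (|k| + ‖x‖ + 1), ENNReal.ofReal (dist y x ^ (-(γ + 1))) := by
      rw [hJ, ← lintegral_indicator measurableSet_ball, ← lintegral_const_mul _ (Measurable.indicator (by fun_prop) measurableSet_ball)]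
      refine lintegral_mono fun y => ?_
      by_cases hy : y ∈ S
      · rw [hgd, indicator_of_mem hy, mul_comm, rz, dist_comm, indicator_of_mem]
        · rw [hS] at hy; gcongr; exact hy.1
        · rw [hS] at hy; rw [mem_ball, dist_eq_norm]
          have := norm_sub_le y x; have := hy.2; have := le_abs_self k; linarith
      · rw [hgd, indicator_of_notMem hy, mul_zero]; exact zero_le
    refine (hle.trans_lt ?_).ne
    refine ENNReal.mul_lt_top hM.lt_top ((near_lemma volume _ (γ := n) hγ (by linarith) x (vol_growth x) (by positivity)).trans_lt ?_)
    have : volume (ball (0 : Euc n) 1) ≠ ⊤ := measure_ball_lt_top.ne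
    finiteness
  by_cases hz : ∃ x, J x = 0
  · obtain ⟨x, hx⟩ := hz
    rw [hJ] at hx; simp only at hx
    rw [lintegral_eq_zero_iff (by fun_prop)] at hx
    have hg0 : ∀ᵐ y : Euc n, g y = 0 := by
      have : ∀ᵐ y : Euc n, y ≠ x := by rcases n with _ | n; · norm_num at hγ; linarith
                                       exact Measure.ae_ne volume x
      filter_upwards [hx, this] with y hy hyx
      rcases mul_eq_zero.1 hy with h | h
      · rw [rz, ENNReal.ofReal_eq_zero] at h
        have : 0 < dist x y := dist_pos.2 hyx.symm
        have := Real.rpow_pos_of_pos this (-(γ + 1)); linarith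
      · exact h
    refine le_trans (le_of_eq ?_) zero_le
    rw [lintegral_eq_zero_iff (by fun_prop)]
    have := (Measure.quasiMeasurePreserving_fst (μ := (volume : Measure (Euc n))) (ν := (volume : Measure (Euc n)))).ae hg0
    filter_upwards [this] with z hz
    simp only [hz, Pi.zero_apply]
    rw [ENNReal.zero_rpow_of_pos (by positivity)]; simp
  push Not at hz
  obtain ⟨h, hh⟩ : ∃ h : Euc n → ℝ≥0∞, h = fun x => J x ^ (1/Q) := ⟨_, rfl⟩
  have hhm : Measurable h := by rw [hh]; fun_prop
  have key : ∀ x, ∫⁻ y, rz (n - (n - γ) / P) x y * (g y ^ (1/P) * h y) ≤ C3 ^ (1/P) * (C1 * C2) ^ (1/Q) * h x := by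
    intro x
    obtain ⟨I, hI0, hI⟩ : ∃ I : ℝ, 0 < I ∧ J x = ENNReal.ofReal I := ⟨_, ENNReal.toReal_pos (hz x) (hJt x), (ENNReal.ofReal_toReal (hJt x)).symm⟩
    have hI' := hI; rw [hJ] at hI'
    have a1 := hedberg h0 (s := γ + c * (P - 1)) (by linarith) (by linarith) g hg hK x hI0 hI'
    have a2 := hedberg h0 (s := γ + 1 - c) (by linarith) (by linarith) g hg hK x hI0 hI'
    rw [← hC3] at a1
    rw [← hC2] at a2
    have a3 : ∫⁻ y, rz (n - c) x y * J y ≤ C1 * (C2 * ENNReal.ofReal (I ^ (γ + 1 - c - γ))) := by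
      calc ∫⁻ y, rz (n - c) x y * J y = ∫⁻ y, ∫⁻ w, rz (n - c) x y * (rz (γ + 1) y w * g w) := by
            refine lintegral_congr fun y => ?_
            rw [hJ, lintegral_const_mul _ (by fun_prop)]
        _ = ∫⁻ w, ∫⁻ y, rz (n - c) x y * (rz (γ + 1) y w * g w) := lintegral_lintegral_swap (by fun_prop)
        _ ≤ ∫⁻ w, C1 * (rz (γ + 1 - c) x w * g w) := by
            refine lintegral_mono_ae ?_
            have : ∀ᵐ y : Euc n, y ≠ x := by rcases n with _ | n; · norm_num at hγ; linarith
                                             exact Measure.ae_ne volume x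
            filter_upwards [this] with w hw
            simp_rw [← mul_assoc]
            rw [lintegral_mul_const _ (by fun_prop)]
            exact mul_le_mul_left (hcomp x w hw.symm) _
        _ ≤ _ := by rw [lintegral_const_mul _ (by fun_prop)]; gcongr
    have hol := ENNReal.lintegral_mul_le_Lp_mul_Lq volume hPQ (f := fun y => (rz (γ + c * (P - 1)) x y * g y) ^ (1/P)) (g := fun y => (rz (n - c) x y * J y) ^ (1/Q)) (by fun_prop) (by fun_prop)
    simp only [← ENNReal.rpow_mul, one_div_mul_cancel hPQ.ne_zero, one_div_mul_cancel hPQ.symm.ne_zero, ENNReal.rpow_one] at hol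
    calc _ = ∫⁻ y, ((fun y => (rz (γ + c * (P - 1)) x y * g y) ^ (1/P)) * fun y => (rz (n - c) x y * J y) ^ (1/Q)) y := by
          refine lintegral_congr fun y => ?_
          simp only [Pi.mul_apply]
          rw [ENNReal.mul_rpow_of_nonneg _ _ (by positivity), ENNReal.mul_rpow_of_nonneg _ _ hQ0.le, hh]
          have : rz (n - (n - γ) / P) x y = rz (γ + c * (P - 1)) x y ^ (1/P) * rz (n - c) x y ^ (1/Q) := by
            rw [rz, rz, rz, ENNReal.ofReal_rpow_of_nonneg (by positivity) (by positivity), ENNReal.ofReal_rpow_of_nonneg (by positivity) hQ0.le, ← ENNReal.ofReal_mul (by positivity),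
              ← Real.rpow_mul dist_nonneg, ← Real.rpow_mul dist_nonneg]
            have e : -(n - (n - γ) / P) = -(γ + c * (P - 1)) * (1/P) + -(n - c) * (1/Q) := by
              rw [hQP]; field_simp; ring
            have n1 : -(γ + c * (P - 1)) * (1/P) < 0 := mul_neg_of_neg_of_pos (by linarith) (by positivity)
            have n2 : -((n:ℝ) - c) * (1/Q) < 0 := mul_neg_of_neg_of_pos (by linarith) hQ0
            rcases eq_or_lt_of_le (dist_nonneg (x := x) (y := y)) with h2 | h2
            · rw [← h2, Real.zero_rpow n1.ne, zero_mul, Real.zero_rpow (by rw [e]; linarith)]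
            · rw [e, Real.rpow_add h2]
          rw [this]; ring
      _ ≤ _ := hol
      _ ≤ (C3 * ENNReal.ofReal (I ^ (γ + c * (P - 1) - γ))) ^ (1/P) * (C1 * (C2 * ENNReal.ofReal (I ^ (γ + 1 - c - γ)))) ^ (1/Q) := by
          gcongr
      _ = _ := by
          rw [hh]; simp only
          rw [hI, ← mul_assoc C1, ENNReal.mul_rpow_of_nonneg _ _ (by positivity), ENNReal.mul_rpow_of_nonneg _ _ hQ0.le, ENNReal.ofReal_rpow_of_pos (by positivity), ENNReal.ofReal_rpow_of_pos (by positivity),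
            ENNReal.ofReal_rpow_of_pos hI0, ← Real.rpow_mul hI0.le, ← Real.rpow_mul hI0.le, mul_mul_mul_comm, ← ENNReal.ofReal_mul (by positivity), ← Real.rpow_add hI0, hQP]
          congr 3
          field_simp; ring
  have hh0 : ∀ x, h x ≠ 0 := fun x => by rw [hh]; exact (ENNReal.rpow_pos (pos_iff_ne_zero.2 (hz x)) (hJt x)).ne'
  have hht : ∀ x, h x ≠ ⊤ := fun x => by rw [hh]; exact ENNReal.rpow_ne_top_of_nonneg hQ0.le (hJt x)
  have hcs := cs_form volume volume (fun z : Euc n × Euc n => (rz (n - (n - γ) / P) z.1 z.2 * (g z.2 ^ (1/P) * h z.2)) * (h z.1)⁻¹) (fun z => (rz (n - (n - γ) / P) z.2 z.1 * (g z.1 ^ (1/P) * h z.1)) * (h z.2)⁻¹)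
    (by fun_prop) (by fun_prop) φ ψ hφ hψ (C3 ^ (1/P) * (C1 * C2) ^ (1/Q))
    (ae_of_all _ fun x _ => by
      simp only
      rw [lintegral_mul_const _ (by fun_prop)]
      refine (mul_le_mul_left (key x) _).trans (le_of_eq ?_)
      rw [mul_assoc, ENNReal.mul_inv_cancel (hh0 x) (hht x), mul_one])
    (ae_of_all _ fun x _ => by
      simp only
      rw [lintegral_mul_const _ (by fun_prop)]
      refine (mul_le_mul_left (key x) _).trans (le_of_eq ?_)
      rw [mul_assoc, ENNReal.mul_inv_cancel (hh0 x) (hht x), mul_one])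
  refine le_trans (le_of_eq ?_) hcs
  refine lintegral_congr fun z => ?_
  congr 1
  have sq : ∀ a : ℝ≥0∞, (a * a) ^ (1/2:ℝ) = a := fun a => by
    rw [ENNReal.mul_rpow_of_nonneg _ _ (by norm_num), ← ENNReal.rpow_add_of_nonneg _ _ (by norm_num) (by norm_num)]; norm_num
  have e3 : ∀ a : ℝ≥0∞, a ^ (1/P/2) * a ^ (1/P/2) = a ^ (1/P) := fun a => by
    rw [← ENNReal.rpow_add_of_nonneg _ _ (by positivity) (by positivity)]; congr 1; ring
  rw [rz_comm _ z.2 z.1]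
  rw [← sq (rz (n - (n - γ) / P) z.1 z.2 * (g z.1 ^ (1/P/2) * g z.2 ^ (1/P/2)))]
  congr 1
  calc _ = rz (n - (n - γ) / P) z.1 z.2 * rz (n - (n - γ) / P) z.1 z.2 * ((g z.1 ^ (1/P/2) * g z.1 ^ (1/P/2)) * (g z.2 ^ (1/P/2) * g z.2 ^ (1/P/2))) := by ring
    _ = rz (n - (n - γ) / P) z.1 z.2 * rz (n - (n - γ) / P) z.1 z.2 * (g z.1 ^ (1/P) * g z.2 ^ (1/P)) * (h z.1 * (h z.1)⁻¹) * (h z.2 * (h z.2)⁻¹) := by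
        rw [e3, e3, ENNReal.mul_inv_cancel (hh0 _) (hht _), ENNReal.mul_inv_cancel (hh0 _) (hht _)]; ring
    _ = _ := by ring

lemma geo_le {x : ℝ} (h0 : 0 ≤ x) (h1 : x < 1) (k : ℕ) : ∑ i ∈ Finset.range k, x ^ i ≤ (1 - x)⁻¹ := by
  rw [← tsum_geometric_of_lt_one h0 h1]
  exact (summable_geometric_of_lt_one h0 h1).sum_le_tsum _ fun i _ => by positivity

lemma geo_le' {x : ℝ} (h0 : 0 ≤ x) (h1 : x < 1) (k : ℕ) : ∑ i ∈ Finset.range k, x ^ (k - i) ≤ (1 - x)⁻¹ := by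
  refine le_trans ?_ (geo_le h0 h1 k)
  rw [← Finset.sum_range_reflect]
  refine Finset.sum_le_sum fun i hi => ?_
  rw [Finset.mem_range] at hi
  exact pow_le_pow_of_le_one h0 h1.le (by omega)

lemma low_sum (ι : ℕ → ℂ) (k : ℕ) : ‖∑ q ∈ Finset.range (2 ^ (k+1) - 1), ι q‖ ≤ ∑ j ∈ Finset.range k, ‖∑ q ∈ Finset.Ico (2 ^ j - 1) (2 ^ j - 1 + 2 ^ j), ι q‖ +
    (∑ i ∈ Finset.range k, ‖∑ q ∈ Finset.Ico (2 ^ (k+1) - 1 - 2 ^ (i+1)) (2 ^ (k+1) - 1 - 2 ^ (i+1) + 2 ^ i), ι q‖ + ‖∑ q ∈ Finset.Ico (2 ^ (k+1) - 2) (2 ^ (k+1) - 2 + 1), ι q‖) := by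
  have h1 : ∀ j : ℕ, ‖∑ q ∈ Finset.range (2 ^ j - 1), ι q‖ ≤ ∑ j ∈ Finset.range j, ‖∑ q ∈ Finset.Ico (2 ^ j - 1) (2 ^ j - 1 + 2 ^ j), ι q‖ := by
    intro j
    induction j with
    | zero => simp
    | succ j ih =>
      have : 1 ≤ 2 ^ j := Nat.one_le_two_pow
      rw [Finset.sum_range_succ, Finset.range_eq_Ico, show 2 ^ (j+1) - 1 = 2 ^ j - 1 + 2 ^ j by rw [pow_succ]; omega, ← Finset.sum_Ico_consecutive _ (Nat.zero_le _) (Nat.le_add_right (2 ^ j - 1) (2 ^ j)), ← Finset.range_eq_Ico]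
      exact (norm_add_le _ _).trans (by gcongr)
  have h2 : ∀ i : ℕ, i ≤ k → ‖∑ q ∈ Finset.Ico (2 ^ (k+1) - 1 - 2 ^ i) (2 ^ (k+1) - 1), ι q‖ ≤ ∑ i ∈ Finset.range i, ‖∑ q ∈ Finset.Ico (2 ^ (k+1) - 1 - 2 ^ (i+1)) (2 ^ (k+1) - 1 - 2 ^ (i+1) + 2 ^ i), ι q‖ + ‖∑ q ∈ Finset.Ico (2 ^ (k+1) - 2) (2 ^ (k+1) - 2 + 1), ι q‖ := by
    intro i
    induction i with
    | zero =>
      intro _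
      have : 1 ≤ 2 ^ k := Nat.one_le_two_pow
      have : 2 ≤ 2 ^ (k+1) := by rw [pow_succ]; omega
      simp only [Finset.range_zero, Finset.sum_empty, zero_add, pow_zero]
      rw [show 2 ^ (k+1) - 1 - 1 = 2 ^ (k+1) - 2 by omega, show 2 ^ (k+1) - 2 + 1 = 2 ^ (k+1) - 1 by omega]
    | succ i ih =>
      intro hi
      have e1 : 1 ≤ 2 ^ i := Nat.one_le_two_pow
      have e2 : 2 ^ (i+1) ≤ 2 ^ k := Nat.pow_le_pow_right (by norm_num) hi
      have e3 : 2 ^ (i+1) = 2 * 2 ^ i := by rw [pow_succ]; ring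
      have e4 : 2 ^ (k+1) = 2 * 2 ^ k := by rw [pow_succ]; ring
      rw [Finset.sum_range_succ, ← Finset.sum_Ico_consecutive _ (show 2 ^ (k+1) - 1 - 2 ^ (i+1) ≤ 2 ^ (k+1) - 1 - 2 ^ (i+1) + 2 ^ i by omega) (show 2 ^ (k+1) - 1 - 2 ^ (i+1) + 2 ^ i ≤ 2 ^ (k+1) - 1 by omega)]
      refine (norm_add_le _ _).trans ?_
      have := ih (by omega)
      rw [show 2 ^ (k+1) - 1 - 2 ^ i = 2 ^ (k+1) - 1 - 2 ^ (i+1) + 2 ^ i by omega] at this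
      linarith
  have e1 : 1 ≤ 2 ^ k := Nat.one_le_two_pow
  have e4 : 2 ^ (k+1) = 2 * 2 ^ k := by rw [pow_succ]; ring
  have h3 := h2 k le_rfl
  rw [show 2 ^ (k+1) - 1 - 2 ^ k = 2 ^ k - 1 by omega] at h3
  rw [Finset.range_eq_Ico, ← Finset.sum_Ico_consecutive _ (Nat.zero_le _) (show 2 ^ k - 1 ≤ 2 ^ (k+1) - 1 by omega), ← Finset.range_eq_Ico]
  exact (norm_add_le _ _).trans (add_le_add (h1 k) h3)

lemma up_sum (ι : ℕ → ℂ) (M J : ℕ) : ‖∑ q ∈ Finset.Ico M (M + 2 ^ J), ι q‖ ≤ ‖∑ q ∈ Finset.Ico M (M + 1), ι q‖ + ∑ i ∈ Finset.range J, ‖∑ q ∈ Finset.Ico (M + 2 ^ i) (M + 2 ^ i + 2 ^ i), ι q‖ := by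
  induction J with
  | zero => simp
  | succ J ih =>
    rw [Finset.sum_range_succ, ← Finset.sum_Ico_consecutive _ (Nat.le_add_right M (2 ^ J)) (show M + 2 ^ J ≤ M + 2 ^ (J+1) by rw [pow_succ]; omega), show M + 2 ^ (J+1) = M + 2 ^ J + 2 ^ J by rw [pow_succ]; ring]
    refine (norm_add_le _ _).trans ?_
    linarith

lemma val_le {θ s δ G a b : ℝ} (hθ : 0 ≤ 1 - θ) (hs : 0 ≤ s) (h1 : δ ≤ 1 - θ) (h2 : δ ≤ s) (ha : 0 ≤ a) (hb : 0 ≤ b) (hG : 0 ≤ G) {m : ℕ} {c : ℝ} (hc1 : 1 ≤ c)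
    (h : (a ≤ 2⁻¹ ^ m ∧ b ≤ 1 ∧ G ≤ c) ∨ (a ≤ 2 ∧ b ≤ 2⁻¹ ^ m ∧ G ≤ c) ∨ (a ≤ 2 ∧ b ≤ 1 ∧ G ≤ c * 2⁻¹ ^ m ∧ s ≤ 1)) : G * a ^ (1 - θ) * b ^ s ≤ c * 2 ^ (1 - θ) * ((2:ℝ) ^ (-δ)) ^ m := by
  have key : ∀ e : ℝ, δ ≤ e → ((2:ℝ)⁻¹ ^ m) ^ e ≤ ((2:ℝ) ^ (-δ)) ^ m := by
    intro e he
    rw [← Real.rpow_natCast, ← Real.rpow_natCast, ← Real.rpow_mul (by norm_num), ← Real.rpow_mul (by norm_num), Real.inv_rpow (by norm_num), ← Real.rpow_neg (by norm_num)]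
    refine Real.rpow_le_rpow_of_exponent_le (by norm_num) ?_
    have : (0:ℝ) ≤ m := by positivity
    nlinarith
  have hc0 : 0 ≤ c := by linarith
  have h21 : (1:ℝ) ≤ 2 ^ (1 - θ) := Real.one_le_rpow (by norm_num) hθ
  rcases h with ⟨ha1, hb1, hG1⟩ | ⟨ha1, hb1, hG1⟩ | ⟨ha1, hb1, hG1, hs1⟩
  · calc G * a ^ (1 - θ) * b ^ s ≤ c * ((2:ℝ) ^ (-δ)) ^ m * 1 := by
          gcongr
          · exact (Real.rpow_le_rpow ha ha1 hθ).trans (key _ h1)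
          · exact Real.rpow_le_one hb hb1 hs
      _ ≤ _ := by
        have : 0 ≤ c * ((2:ℝ) ^ (-δ)) ^ m := by positivity
        nlinarith
  · gcongr
    exact (Real.rpow_le_rpow hb hb1 hs).trans (key _ h2)
  · calc G * a ^ (1 - θ) * b ^ s ≤ (c * ((2:ℝ) ^ (-δ)) ^ m) * 2 ^ (1 - θ) * 1 := by
          gcongr
          · refine hG1.trans ?_
            refine mul_le_mul_of_nonneg_left ?_ hc0
            have := key 1 (by linarith); rwa [Real.rpow_one] at this
          · exact Real.rpow_le_one hb hb1 hs
      _ = _ := by ring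

lemma low_num {θ s : ℝ} (hθ : θ < 1) (hs : 0 < s) : ∃ D : ℝ, 0 ≤ D ∧ ∀ (k : ℕ) (ι : ℕ → ℂ) (B : ℝ), 0 ≤ B →
    (∀ (A L : ℕ) (ϱ : ℝ), 1 ≤ L → L ≤ A + 1 → 1/2 ≤ ϱ → (A:ℝ) + L - 1 + ϱ ≤ 2 ^ (k+1) - 3/2 → ‖∑ q ∈ Finset.Ico A (A + L), ι q‖ ≤ B * (1 * (L / ϱ) ^ (1 - θ) * (L / ((A:ℝ) + 1)) ^ s)) →
    ‖∑ q ∈ Finset.range (2 ^ (k+1) - 1), ι q‖ ≤ D * B := by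
  set δ := min (1 - θ) s with hδ
  have hδ0 : 0 < δ := lt_min (by linarith) hs
  set x := (2:ℝ) ^ (-δ) with hx
  have hx0 : 0 ≤ x := by positivity
  have hx1 : x < 1 := Real.rpow_lt_one_of_one_lt_of_neg (by norm_num) (by linarith)
  have hx2 := sub_pos.2 hx1
  refine ⟨2 ^ (1 - θ) * (2 * (1 - x)⁻¹ + 1), by positivity, fun k ι B hB h => ?_⟩
  have e1 : 1 ≤ 2 ^ k := Nat.one_le_two_pow
  have e4 : 2 ^ (k+1) = 2 * 2 ^ k := by rw [pow_succ]; ring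
  have r1 : (1:ℝ) ≤ 2 ^ k := one_le_pow₀ (by norm_num)
  have r4 : (2:ℝ) ^ (k+1) = 2 * 2 ^ k := by rw [pow_succ]; ring
  have hv := fun (a b : ℝ) (ha : 0 ≤ a) (hb : 0 ≤ b) m h => val_le (θ := θ) (s := s) (δ := δ) (G := 1) (c := 1) (a := a) (b := b) (m := m) (by linarith) hs.le (min_le_left _ _) (min_le_right _ _) ha hb zero_le_one le_rfl h
  have c1 : ∀ j ∈ Finset.range k, ‖∑ q ∈ Finset.Ico (2 ^ j - 1) (2 ^ j - 1 + 2 ^ j), ι q‖ ≤ B * (2 ^ (1 - θ) * x ^ (k - j)) := by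
    intro j hj
    rw [Finset.mem_range] at hj
    have q1 : 1 ≤ 2 ^ j := Nat.one_le_two_pow
    have q2 : (2:ℝ) ^ (j+1) ≤ 2 ^ k := pow_le_pow_right₀ (by norm_num) hj
    have q3 : (2:ℝ) ^ (j+1) = 2 * 2 ^ j := by rw [pow_succ]; ring
    have q5 : (((2 ^ j - 1 : ℕ) : ℝ)) = 2 ^ j - 1 := by push_cast [Nat.cast_sub q1]; ring
    refine (h _ _ (2 ^ k) q1 (by omega) (by linarith) (by rw [q5]; push_cast; linarith)).trans ?_
    refine mul_le_mul_of_nonneg_left ?_ hB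
    rw [q5]
    refine (hv _ _ (by positivity) (by push_cast; simp) (k - j) (Or.inl ⟨?_, by push_cast; simp, le_rfl⟩)).trans (by rw [one_mul])
    rw [div_le_iff₀ (by positivity), inv_pow, inv_mul_eq_div, le_div_iff₀ (by positivity)]
    push_cast
    rw [← pow_add, show j + (k - j) = k by omega]
  have c2 : ∀ i ∈ Finset.range k, ‖∑ q ∈ Finset.Ico (2 ^ (k+1) - 1 - 2 ^ (i+1)) (2 ^ (k+1) - 1 - 2 ^ (i+1) + 2 ^ i), ι q‖ ≤ B * (2 ^ (1 - θ) * x ^ (k - i)) := by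
    intro i hi
    rw [Finset.mem_range] at hi
    have q1 : 1 ≤ 2 ^ i := Nat.one_le_two_pow
    have q3 : 2 ^ (i+1) = 2 * 2 ^ i := by rw [pow_succ]; ring
    have q2 : 2 ^ (i+1) ≤ 2 ^ k := Nat.pow_le_pow_right (by norm_num) hi
    have p2 : (2:ℝ) ^ (i+1) ≤ 2 ^ k := pow_le_pow_right₀ (by norm_num) hi
    have p3 : (2:ℝ) ^ (i+1) = 2 * 2 ^ i := by rw [pow_succ]; ring
    have p1 : (1:ℝ) ≤ 2 ^ i := one_le_pow₀ (by norm_num)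
    have q5 : (((2 ^ (k+1) - 1 - 2 ^ (i+1) : ℕ) : ℝ)) = 2 ^ (k+1) - 1 - 2 ^ (i+1) := by
      rw [Nat.cast_sub (by omega), Nat.cast_sub (by omega)]; push_cast; ring
    refine (h _ _ (2 ^ i) q1 (by omega) (by linarith) (by rw [q5]; push_cast; linarith)).trans ?_
    refine mul_le_mul_of_nonneg_left ?_ hB
    rw [q5]
    refine (hv _ _ (by positivity) (div_nonneg (by positivity) (by linarith)) (k - i) (Or.inr (Or.inl ⟨?_, ?_, le_rfl⟩))).trans (by rw [one_mul])
    · push_cast; rw [div_self (by positivity)]; norm_num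
    rw [div_le_iff₀ (by linarith), inv_pow, inv_mul_eq_div, le_div_iff₀ (by positivity)]
    push_cast
    rw [← pow_add, show i + (k - i) = k by omega]; linarith
  have c3 : ‖∑ q ∈ Finset.Ico (2 ^ (k+1) - 2) (2 ^ (k+1) - 2 + 1), ι q‖ ≤ B * (2 ^ (1 - θ)) := by
    have q5 : (((2 ^ (k+1) - 2 : ℕ) : ℝ)) = 2 ^ (k+1) - 2 := by rw [Nat.cast_sub (by omega)]; push_cast; ring
    refine (h _ 1 (1/2) le_rfl (by omega) le_rfl (by rw [q5]; push_cast; linarith)).trans ?_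
    refine mul_le_mul_of_nonneg_left ?_ hB
    rw [q5]
    refine (hv _ _ (by positivity) (div_nonneg (by positivity) (by linarith)) 0 (Or.inr (Or.inl ⟨by norm_num, ?_, le_rfl⟩))).trans (by rw [one_mul, pow_zero, mul_one])
    rw [div_le_iff₀ (by linarith)]; push_cast; linarith
  refine (low_sum ι k).trans ((add_le_add (Finset.sum_le_sum c1) (add_le_add (Finset.sum_le_sum c2) c3)).trans ?_)
  simp only [← Finset.mul_sum]
  have := mul_le_mul_of_nonneg_left (geo_le' hx0 hx1 k) (show 0 ≤ B * 2 ^ (1 - θ) by positivity)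
  linarith

lemma up_num {θ s : ℝ} (hθ : θ < 1) (hs : 0 < s) (hs1 : s ≤ 1) : ∃ D : ℝ, 0 ≤ D ∧ ∀ (k J : ℕ) (ι : ℕ → ℂ) (B : ℝ), 0 ≤ B →
    (∀ (A L : ℕ) (ϱ G : ℝ), 1 ≤ L → L ≤ A + 1 → 1/2 ≤ ϱ → 2 ^ (k+1) - 1 ≤ A → 
      ((ϱ ≤ A - (2 ^ (k+1) - 3/2) ∧ G = 1) ∨ (ϱ = (A - (2 ^ (k+1) - 3/2)) / 2 ∧ G = 4 * (2 ^ (k+1) - 3/2) / (A - (2 ^ (k+1) - 3/2)))) →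
      ‖∑ q ∈ Finset.Ico A (A + L), ι q‖ ≤ B * (G * (L / ϱ) ^ (1 - θ) * (L / ((A:ℝ) + 1)) ^ s)) →
    ‖∑ q ∈ Finset.Ico (2 ^ (k+1) - 1) (2 ^ (k+1) - 1 + 2 ^ (k + 1 + J)), ι q‖ ≤ D * B := by
  set δ := min (1 - θ) s with hδ
  have hδ0 : 0 < δ := lt_min (by linarith) hs
  set x := (2:ℝ) ^ (-δ) with hx
  have hx0 : 0 ≤ x := by positivity
  have hx1 : x < 1 := Real.rpow_lt_one_of_one_lt_of_neg (by norm_num) (by linarith)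
  have hx2 := sub_pos.2 hx1
  refine ⟨4 * 2 ^ (1 - θ) * (2 * (1 - x)⁻¹ + 1), by positivity, fun k J ι B hB h => ?_⟩
  set M := 2 ^ (k+1) - 1 with hM
  have e1 : 1 ≤ 2 ^ k := Nat.one_le_two_pow
  have e4 : 2 ^ (k+1) = 2 * 2 ^ k := by rw [pow_succ]; ring
  have r1 : (1:ℝ) ≤ 2 ^ k := one_le_pow₀ (by norm_num)
  have r4 : (2:ℝ) ^ (k+1) = 2 * 2 ^ k := by rw [pow_succ]; ring
  have hMr : (M:ℝ) = 2 ^ (k+1) - 1 := by rw [hM, Nat.cast_sub (by omega)]; push_cast; ring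
  have hv := fun (G a b : ℝ) (hG : 0 ≤ G) (ha : 0 ≤ a) (hb : 0 ≤ b) m h => val_le (θ := θ) (s := s) (δ := δ) (G := G) (c := 4) (a := a) (b := b) (m := m) (by linarith) hs.le (min_le_left _ _) (min_le_right _ _) ha hb hG (by norm_num) h
  have c0 : ‖∑ q ∈ Finset.Ico M (M + 1), ι q‖ ≤ B * (4 * 2 ^ (1 - θ)) := by
    refine (h M 1 (1/2) 1 le_rfl (by omega) le_rfl le_rfl (Or.inl ⟨by rw [hMr]; linarith, rfl⟩)).trans ?_
    refine mul_le_mul_of_nonneg_left ?_ hB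
    rw [hMr]
    refine (hv _ _ _ zero_le_one (by positivity) (div_nonneg (by positivity) (by linarith)) 0 (Or.inr (Or.inl ⟨by norm_num, ?_, by norm_num⟩))).trans (by rw [pow_zero, mul_one])
    rw [div_le_iff₀ (by linarith)]; push_cast; linarith
  have cc : ∀ i : ℕ, ∀ G : ℝ, 0 ≤ G → (G = 1 ∨ G = 4 * (2 ^ (k+1) - 3/2) / (2 ^ i + 1/2)) → ∀ m : ℕ, (((2:ℝ) ^ i / (2 ^ (k+1) + 2 ^ i) ≤ 2⁻¹ ^ m ∧ G ≤ 4) ∨ G ≤ 4 * 2⁻¹ ^ m) →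
      ‖∑ q ∈ Finset.Ico (M + 2 ^ i) (M + 2 ^ i + 2 ^ i), ι q‖ ≤ B * (4 * 2 ^ (1 - θ) * x ^ m) := by
    intro i G hG0 hG m hm
    have p1 : (1:ℝ) ≤ 2 ^ i := one_le_pow₀ (by norm_num)
    have q5 : ((M + 2 ^ i : ℕ) : ℝ) = 2 ^ (k+1) - 1 + 2 ^ i := by push_cast; rw [hMr]
    refine (h (M + 2 ^ i) (2 ^ i) ((2 ^ i + 1/2) / 2) G Nat.one_le_two_pow (by omega) (by linarith) (Nat.le_add_right _ _) ?_).trans ?_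
    · rw [q5, show (2:ℝ) ^ (k+1) - 1 + 2 ^ i - (2 ^ (k+1) - 3/2) = 2 ^ i + 1/2 by ring]
      rcases hG with h | h
      · exact Or.inl ⟨by linarith, h⟩
      · exact Or.inr ⟨rfl, h⟩
    refine mul_le_mul_of_nonneg_left ?_ hB
    rw [q5]
    have a1 : (((2 ^ i : ℕ) : ℝ)) / ((2 ^ i + 1/2) / 2) ≤ 2 := by rw [div_le_iff₀ (by positivity)]; push_cast; linarith
    have b0 : (((2 ^ i : ℕ) : ℝ)) / (2 ^ (k+1) - 1 + 2 ^ i + 1) = (2:ℝ) ^ i / (2 ^ (k+1) + 2 ^ i) := by push_cast; congr 1; ring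
    rw [b0]
    refine hv _ _ _ hG0 (by positivity) (by positivity) m ?_
    rcases hm with h | h
    · exact Or.inr (Or.inl ⟨a1, h.1, h.2⟩)
    · exact Or.inr (Or.inr ⟨a1, by rw [div_le_one (by positivity)]; linarith, h, hs1⟩)
  refine (up_sum ι M (k + 1 + J)).trans ?_
  rw [Finset.sum_range_add]
  have c1 : ∀ i ∈ Finset.range (k+1), ‖∑ q ∈ Finset.Ico (M + 2 ^ i) (M + 2 ^ i + 2 ^ i), ι q‖ ≤ B * (4 * 2 ^ (1 - θ) * x ^ (k + 1 - i)) := by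
    intro i hi
    rw [Finset.mem_range] at hi
    refine cc i 1 zero_le_one (Or.inl rfl) _ (Or.inl ⟨?_, by norm_num⟩)
    rw [div_le_iff₀ (by positivity), inv_pow, inv_mul_eq_div, le_div_iff₀ (by positivity), ← pow_add, show i + (k + 1 - i) = k + 1 by omega]
    have : (0:ℝ) ≤ 2 ^ i := by positivity
    linarith
  have c2 : ∀ i ∈ Finset.range J, ‖∑ q ∈ Finset.Ico (M + 2 ^ (k+1+i)) (M + 2 ^ (k+1+i) + 2 ^ (k+1+i)), ι q‖ ≤ B * (4 * 2 ^ (1 - θ) * x ^ i) := by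
    intro i hi
    refine cc (k+1+i) _ (div_nonneg (by linarith) (by positivity)) (Or.inr rfl) _ (Or.inr ?_)
    rw [div_le_iff₀ (by positivity), inv_pow, mul_assoc, inv_mul_eq_div, pow_add _ (k+1)]
    gcongr
    rw [le_div_iff₀ (by positivity)]
    have : (0:ℝ) ≤ 2 ^ i := by positivity
    linarith
  refine (add_le_add c0 (add_le_add (Finset.sum_le_sum c1) (Finset.sum_le_sum c2))).trans ?_
  simp only [← Finset.mul_sum]
  have z1 := mul_le_mul_of_nonneg_left (geo_le' hx0 hx1 (k+1)) (show 0 ≤ B * (4 * 2 ^ (1 - θ)) by positivity)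
  have z2 := mul_le_mul_of_nonneg_left (geo_le hx0 hx1 J) (show 0 ≤ B * (4 * 2 ^ (1 - θ)) by positivity)
  linarith

lemma min_pos' {r : ℝ} (hr : 0 < r) : 0 < min r (1 / r) := by positivity
lemma min_le1 {r : ℝ} (hr : 0 < r) : min r (1 / r) ≤ 1 := by simpa using min_rpow_le_one hr zero_le_one

lemma min_l {r : ℝ} (hr : 0 < r) (h : r ≤ 1) : min r (1 / r) = r := min_eq_left (by rw [le_div_iff₀ hr]; nlinarith)
lemma min_r {r : ℝ} (hr : 0 < r) (h : 1 ≤ r) : min r (1 / r) = 1 / r := min_eq_right (by rw [div_le_iff₀ hr]; nlinarith)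

lemma wlow {r ϱ t : ℝ} {q : ℕ} (hr : 0 < r) (h : q + ϱ ≤ t) : |min r (1 / r) ^ t| * r ^ q ≤ 1 * min r (1 / r) ^ ϱ := by
  have h0 := min_pos' hr
  have h2 : min r (1 / r) ^ t ≤ min r (1 / r) ^ ((q:ℝ) + ϱ) := Real.rpow_le_rpow_of_exponent_ge h0 (min_le1 hr) h
  rw [Real.rpow_add h0, Real.rpow_natCast] at h2
  have h3 : min r (1 / r) ^ q * r ^ q ≤ 1 := by
    rw [← mul_pow]
    refine pow_le_one₀ (by positivity) ?_
    calc _ ≤ 1 / r * r := by gcongr; exact min_le_right _ _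
      _ = 1 := by field_simp
  rw [abs_of_pos (by positivity)]
  have h4 : 0 < min r (1 / r) ^ ϱ := by positivity
  calc _ ≤ min r (1 / r) ^ q * min r (1 / r) ^ ϱ * r ^ q := by gcongr
    _ = (min r (1 / r) ^ q * r ^ q) * min r (1 / r) ^ ϱ := by ring
    _ ≤ _ := by gcongr

lemma wup {r ϱ t G : ℝ} {A q : ℕ} (hr : 0 < r) (h1 : r < 1) (hq : A ≤ q) (ht : 0 < t) (hA : t < A)
    (h : (ϱ ≤ A - t ∧ G = 1) ∨ (ϱ = (A - t) / 2 ∧ G = 4 * t / (A - t))) : |r ^ (-t) - r ^ t| * r ^ q ≤ G * r ^ ϱ := by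
  have hd := sub_pos.2 hA
  have e0 : r ^ t ≤ r ^ (-t) := Real.rpow_le_rpow_of_exponent_ge hr h1.le (by linarith)
  have e1 : r ^ (-t) - r ^ t = r ^ (-t) * (1 - r ^ (2 * t)) := by
    rw [mul_sub, ← Real.rpow_add hr]; ring_nf
  have e2 : 0 ≤ 1 - r ^ (2 * t) := sub_nonneg.2 (Real.rpow_le_one hr.le h1.le (by linarith))
  have e3 : r ^ q ≤ r ^ (A:ℝ) := by rw [Real.rpow_natCast]; exact pow_le_pow_of_le_one hr.le h1.le hq
  have e4 : r ^ (-t) * r ^ (A:ℝ) = r ^ (A - t) := by rw [← Real.rpow_add hr]; ring_nf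
  rw [abs_of_nonneg (by linarith), e1]
  have e5 : r ^ (-t) * (1 - r ^ (2 * t)) * r ^ q ≤ r ^ (A - t) * (1 - r ^ (2 * t)) := by
    rw [← e4]
    calc _ ≤ r ^ (-t) * (1 - r ^ (2 * t)) * r ^ (A:ℝ) := by gcongr
      _ = _ := by ring
  refine e5.trans ?_
  have p0 : 0 < r ^ (A - t) := by positivity
  rcases h with ⟨h, rfl⟩ | ⟨rfl, rfl⟩
  · have : 0 < r ^ (2 * t) := by positivity
    have := Real.rpow_le_rpow_of_exponent_ge hr h1.le h
    nlinarith
  have l1 : 1 - r ^ (2 * t) ≤ 2 * t * (-Real.log r) := by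
    rw [Real.rpow_def_of_pos hr]
    have := Real.add_one_le_exp (Real.log r * (2 * t))
    linarith
  have y0 : 0 < r ^ ((A - t) / 2) := by positivity
  have l2 := Real.one_sub_inv_le_log_of_pos y0
  rw [Real.log_rpow hr] at l2
  have l3 : r ^ ((A - t) / 2) * (-Real.log r) ≤ 2 / (A - t) := by
    rw [le_div_iff₀ hd]
    have := mul_le_mul_of_nonneg_left l2 y0.le
    rw [mul_sub, mul_inv_cancel₀ y0.ne'] at this
    linarith
  have l4 : r ^ (A - t) = r ^ ((A - t) / 2) * r ^ ((A - t) / 2) := by rw [← Real.rpow_add hr]; ring_nf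
  rw [l4]
  calc _ ≤ r ^ ((A - t) / 2) * r ^ ((A - t) / 2) * (2 * t * (-Real.log r)) := by gcongr
    _ = 2 * t * (r ^ ((A - t) / 2) * (-Real.log r)) * r ^ ((A - t) / 2) := by ring
    _ ≤ 2 * t * (2 / (A - t)) * r ^ ((A - t) / 2) := by gcongr
    _ = _ := by ring

lemma tw_le {n : ℕ} {γ P l ω : ℝ} {u : ℝ≥0∞} {x : Euc n} (hP : 1 < P) (hl : l = n/2 - 1/P * ((n - γ)/2)) (hx : 0 < ‖x‖)
    (h : ENNReal.ofReal (Real.exp ω * ‖x‖ ^ (-(n/2:ℝ))) ^ (2:ℝ) ≤ ENNReal.ofReal (‖x‖ ^ (-γ)) * u) :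
    ENNReal.ofReal (Real.exp (1/P * ω) * ‖x‖ ^ (-(n/2:ℝ))) ≤ ENNReal.ofReal (‖x‖ ^ (-l)) * u ^ (1/P/2) := by
  have hP0 : 0 < P := by linarith
  have h2 := ENNReal.rpow_le_rpow h (show 0 ≤ 1/P/2 by positivity)
  rw [← ENNReal.rpow_mul, ENNReal.mul_rpow_of_nonneg _ _ (by positivity), ENNReal.ofReal_rpow_of_pos (by positivity), ENNReal.ofReal_rpow_of_pos (by positivity),
    Real.mul_rpow (by positivity) (by positivity), ← Real.exp_mul, ← Real.rpow_mul hx.le, ← Real.rpow_mul hx.le] at h2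
  have h3 := mul_le_mul_left h2 (ENNReal.ofReal (‖x‖ ^ (-(n/2:ℝ) - -(n/2:ℝ) * (2 * (1/P/2)))))
  rw [← ENNReal.ofReal_mul (by positivity), mul_right_comm _ (u ^ _), ← ENNReal.ofReal_mul (by positivity), mul_assoc, ← Real.rpow_add hx, ← Real.rpow_add hx] at h3
  convert h3 using 4 <;> (try rw [hl]) <;> ring_nf

def Kt {n : ℕ} (l t : ℝ) (M : ℕ) (z : Euc n × Euc n) : ℂ :=
  (((‖z.1‖ / ‖z.2‖) ^ (-t) : ℝ) : ℂ) * (((‖1 - zt z.1 z.2‖ ^ (-2 * l) : ℝ) : ℂ) - ∑ q ∈ Finset.range M, hh l q (zt z.1 z.2))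

set_option maxHeartbeats 1000000 in
lemma FB {n : ℕ} (hn : 3 ≤ n) {γ P l : ℝ} (h0 : 1/2 ≤ γ) (h1 : γ < 1) (hP : 1 < P) (hl : l = n/2 - 1/P * ((n - γ)/2)) :
    ∃ C : ℝ≥0∞, C ≠ ⊤ ∧ ∀ (u : Euc n → ℝ≥0∞), Measurable u →
    (∀ (x : Euc n) (R : ℝ), 0 < R → ∫⁻ y in ball x R, u y ≤ ENNReal.ofReal (R ^ γ)) →
    ∀ (ω : Euc n → ℝ) (M : ℝ) (φ ψ : Euc n → ℂ), Measurable ω → Adm φ → Adm ψ →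
    (∀ x, φ x ≠ 0 → |ω x| ≤ M ∧ u x ≤ ENNReal.ofReal M) → (∀ x, ψ x ≠ 0 → |ω x| ≤ M ∧ u x ≤ ENNReal.ofReal M) →
    (∀ x, φ x ≠ 0 → ENNReal.ofReal (Real.exp (ω x) * ‖x‖ ^ (-(n/2:ℝ))) ^ (2:ℝ) ≤ ENNReal.ofReal (‖x‖ ^ (-γ)) * u x) →
    (∀ x, ψ x ≠ 0 → ENNReal.ofReal (Real.exp (ω x) * ‖x‖ ^ (-(n/2:ℝ))) ^ (2:ℝ) ≤ ENNReal.ofReal (‖x‖ ^ (-γ)) * u x) →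
    ∀ k : ℕ, l ≤ 2 ^ (k+1) - 3/2 →
    ‖∫ p : Euc n × Euc n, Kt l (2 ^ (k+1) - 3/2) (2 ^ (k+1) - 1) p * wt p *
      ((Complex.exp ((1/P:ℝ) * ω p.1) * φ p.1) * (Complex.exp ((1/P:ℝ) * ω p.2) * ψ p.2)) ∂(volume.prod volume)‖ₑ ≤ C * (L2n φ * L2n ψ) := by
  have hn3 : (3:ℝ) ≤ n := by exact_mod_cast hn
  have hP0 : 0 < P := by linarith
  have hθ1 : 1/P < 1 := by rw [div_lt_one hP0]; exact hP
  have hθ0 : 0 < 1/P := by positivity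
  obtain ⟨Cb, hCb, hblk⟩ := block hn h0 h1
  obtain ⟨Cf, hCf, hFP⟩ := FP (n := n) (γ := γ) (P := P) (by linarith) (by linarith) hP
  obtain ⟨D1, hD1, hlow⟩ := low_num (θ := 1/P) (s := (1 - γ) * (1/P)) hθ1 (mul_pos (by linarith) hθ0)
  obtain ⟨D2, hD2, hup⟩ := up_num (θ := 1/P) (s := (1 - γ) * (1/P)) hθ1 (mul_pos (by linarith) hθ0) (by nlinarith)
  refine ⟨Cf + ENNReal.ofReal (D1 * Cb) + ENNReal.ofReal (D2 * Cb), by finiteness, fun u hu hK ω M φ ψ hω hφ hψ hφM hψM haφ haψ k hk => ?_⟩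
  have hl0 : 0 ≤ l := by rw [hl]; nlinarith
  have hlc : ((n/2:ℝ):ℂ) - (1/P:ℝ) * ((n - γ)/2:ℝ) = l := by rw [hl]; push_cast; ring
  obtain ⟨Φ, hΦ⟩ : ∃ Φ : Euc n → ℂ, Φ = fun x => Complex.exp ((1/P:ℝ) * ω x) * φ x := ⟨_, rfl⟩
  obtain ⟨Ψ, hΨ⟩ : ∃ Ψ : Euc n → ℂ, Ψ = fun x => Complex.exp ((1/P:ℝ) * ω x) * ψ x := ⟨_, rfl⟩
  have htw : ∀ χ : Euc n → ℂ, Adm χ → (∀ x, χ x ≠ 0 → |ω x| ≤ M ∧ u x ≤ ENNReal.ofReal M) → Adm fun x => Complex.exp ((1/P:ℝ) * ω x) * χ x := fun χ hχ hM => hχ.twist (M := Real.exp (1/P * M)) (by fun_prop) fun x hx => by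
    rw [Complex.norm_exp, ← Complex.ofReal_mul, Complex.ofReal_re]; gcongr
    exact (le_abs_self _).trans (hM x hx).1
  have hΦA : Adm Φ := hΦ ▸ htw φ hφ hφM
  have hΨA : Adm Ψ := hΨ ▸ htw ψ hψ hψM
  have hΦm := hΦA.1.1
  have hΨm := hΨA.1.1
  obtain ⟨t, ht⟩ : ∃ t : ℝ, t = 2 ^ (k+1) - 3/2 := ⟨_, rfl⟩
  have p2 : (2:ℝ) ≤ 2 ^ (k+1) := by rw [pow_succ]; have : (1:ℝ) ≤ 2 ^ k := one_le_pow₀ (by norm_num); linarith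
  have ht0 : 0 < t := by rw [ht]; linarith
  have hMr : (((2 ^ (k+1) - 1 : ℕ)) : ℝ) = t + 1/2 := by rw [ht, Nat.cast_sub Nat.one_le_two_pow]; push_cast; ring
  rw [← ht] at hk ⊢
  replace hlow := hlow k
  replace hup := hup k
  simp only [← ht] at hlow hup
  obtain ⟨N, hN0, hN⟩ : ∃ N : ℝ, 0 ≤ N ∧ L2n φ * L2n ψ = ENNReal.ofReal N :=
    ⟨_, ENNReal.toReal_nonneg, (ENNReal.ofReal_toReal (ENNReal.mul_ne_top hφ.L2_lt hψ.L2_lt)).symm⟩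
  have hztm := zt_meas (n := n)
  have hwtm := wt_meas (n := n)
  have hhm : ∀ q, Measurable fun z : Euc n × Euc n => hh l q (zt z.1 z.2) := fun q => (hh_cont _ q).measurable.comp hztm
  obtain ⟨D, hD⟩ : ∃ D : Euc n × Euc n → ℂ, D = fun z => wt z * (Φ z.1 * Ψ z.2) := ⟨_, rfl⟩
  have hDm : Measurable D := by rw [hD]; fun_prop
  obtain ⟨ρ, hρ⟩ : ∃ ρ : Euc n × Euc n → ℝ, ρ = fun z => ‖z.1‖ / ‖z.2‖ := ⟨_, rfl⟩
  have hρm : Measurable ρ := by rw [hρ]; fun_prop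
  have hDρ : ∀ z, D z ≠ 0 → 0 < ρ z := by
    intro z hz
    rw [hD] at hz
    have h1 := hΦA.ne (left_ne_zero_of_mul (right_ne_zero_of_mul hz))
    have h2 := hΨA.ne (right_ne_zero_of_mul (right_ne_zero_of_mul hz))
    rw [hρ]; positivity
  obtain ⟨Hq, hHq⟩ : ∃ Hq : ℕ → Euc n × Euc n → ℂ, Hq = fun q z => hh l q (zt z.1 z.2) := ⟨_, rfl⟩
  have hHm : ∀ q, Measurable (Hq q) := by rw [hHq]; exact hhm
  obtain ⟨I, hI⟩ : ∃ I : (ℝ → ℝ) → ℕ → ℂ, I = fun w q => ∫ z, (w (ρ z) : ℂ) * Hq q z * D z ∂(volume.prod volume) := ⟨_, rfl⟩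
  have hint : ∀ w, Measurable w → ∀ (q : ℕ) (G ϱ : ℝ), 0 ≤ G → 0 ≤ ϱ → (∀ r : ℝ, 0 < r → |w r| * r ^ q ≤ G * min r (1 / r) ^ ϱ) →
      Integrable (fun z => (w (ρ z) : ℂ) * Hq q z * D z) (volume.prod volume) := by
    intro w hw q G ϱ hG hϱ h
    obtain ⟨B, hB0, hB⟩ := hh_bdd l q
    have := hom_int hw hG hϱ h (k := hh l q) (hh_cont _ q).measurable hB0 hB hΦA hΨA
    rw [hD, hHq, hρ]
    exact this.congr (ae_of_all _ fun z => by simp only; ring)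
  have HB : ∀ (w : ℝ → ℝ), Measurable w → ∀ (A L : ℕ) (ϱ G : ℝ), 1 ≤ L → L ≤ A + 1 → 1/2 ≤ ϱ → 0 ≤ G →
      (∀ q ∈ Finset.Ico A (A + L), ∀ r, 0 < r → |w r| * r ^ q ≤ G * min r (1 / r) ^ ϱ) →
      ‖∑ q ∈ Finset.Ico A (A + L), I w q‖ ≤ (Cb * N) * (G * (L / ϱ) ^ (1 - 1/P) * (L / ((A:ℝ) + 1)) ^ ((1 - γ) * (1/P))) := by
    intro w hw A L ϱ G hL hLA hϱ hG h
    have := hblk u hu hK ω M φ ψ hω hφ hψ (fun x hx => (hφM x hx).1) (fun x hx => (hψM x hx).1) haφ haψ (1/P) hθ0.le hθ1.le A L hL hLA w G ϱ hw hG hϱ h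
    rw [hlc, hN, ← ENNReal.ofReal_mul (by positivity), ← ofReal_norm, ENNReal.ofReal_le_ofReal_iff (by positivity)] at this
    rw [hI]; simp only
    rw [← integral_finsetSum _ fun q hq => hint w hw q G ϱ hG (by linarith) (h q hq)]
    refine le_trans (le_of_eq ?_) (this.trans (le_of_eq (by ring)))
    congr 2; funext z
    simp only [kr, hD, hHq, hρ, hΦ, hΨ, Finset.mul_sum, Finset.sum_mul]
    exact Finset.sum_congr rfl fun q _ => by ring
  obtain ⟨Fz, hFz⟩ : ∃ Fz : Euc n × Euc n → ℂ, Fz = fun z => ((‖1 - zt z.1 z.2‖ ^ (-2 * l) : ℝ) : ℂ) := ⟨_, rfl⟩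
  have hFm : Measurable Fz := by rw [hFz]; fun_prop
  obtain ⟨w0, hw0⟩ : ∃ w0 : ℝ → ℝ, w0 = fun r => min r (1 / r) ^ t := ⟨_, rfl⟩
  have hw0m : Measurable w0 := by rw [hw0]; fun_prop
  -- local part
  have hN1 : ∫⁻ z, ‖(w0 (ρ z) : ℂ) * Fz z * D z‖ₑ ∂(volume.prod volume) ≤ Cf * (L2n φ * L2n ψ) := by
    obtain ⟨k1, hk1, hs1⟩ := hφ.2
    obtain ⟨k2, hk2, hs2⟩ := hψ.2
    have hφm := hφ.1.1
    have hψm := hψ.1.1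
    have := hFP u hu hK (fun x => ‖φ x‖ₑ) (fun x => ‖ψ x‖ₑ) (ENNReal.ofReal M) (max k1 k2) (by finiteness) (by fun_prop) (by fun_prop)
      (fun x hx => ⟨(hφM x (by simpa using hx)).2, (hs1 x (by simpa using hx)).2.trans (le_max_left _ _)⟩)
      (fun x hx => ⟨(hψM x (by simpa using hx)).2, (hs2 x (by simpa using hx)).2.trans (le_max_right _ _)⟩)
    refine le_trans (lintegral_mono fun z => ?_) this
    obtain ⟨x, y⟩ := z
    simp only [hD, hΦ, hΨ, hρ, hFz, hw0]
    by_cases hx : φ x = 0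
    · simp [hx]
    by_cases hy : ψ y = 0
    · simp [hy]
    have nx := hφ.ne hx
    have ny := hψ.ne hy
    have e1 := tw_le hP hl nx (haφ x hx)
    have e2 := tw_le hP hl ny (haψ y hy)
    have hr : 0 < ‖x‖ / ‖y‖ := by positivity
    have m1 : min (‖x‖ / ‖y‖) (1 / (‖x‖ / ‖y‖)) ^ t ≤ ‖x‖ ^ l * ‖y‖ ^ (-l) := by
      refine (Real.rpow_le_rpow_of_exponent_ge (min_pos' hr) (min_le1 hr) hk).trans ?_
      refine (Real.rpow_le_rpow (min_pos' hr).le (min_le_left _ _) hl0).trans (le_of_eq ?_)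
      rw [Real.div_rpow nx.le ny.le, Real.rpow_neg ny.le, div_eq_mul_inv]
    have m2 : ‖1 - zt x y‖ ^ (-2 * l) = dist x y ^ (-(n - (n - γ) / P)) * ‖y‖ ^ (2 * l) := by
      rw [zt_one_sub x y (norm_pos_iff.1 ny), ← dist_eq_norm, Real.div_rpow dist_nonneg ny.le, div_eq_mul_inv, ← Real.rpow_neg ny.le]
      congr 2 <;> rw [hl] <;> ring
    have e3 : ∀ x, ‖Complex.exp ((1/P:ℝ) * ω x)‖ₑ = ENNReal.ofReal (Real.exp (1/P * ω x)) := by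
      intro x
      rw [← ofReal_norm, Complex.norm_exp, ← Complex.ofReal_mul, Complex.ofReal_re]
    have er : ∀ a : ℝ, 0 ≤ a → ‖(a:ℂ)‖ₑ = ENNReal.ofReal a := fun a ha => by
      rw [← ofReal_norm, Complex.norm_real, Real.norm_of_nonneg ha]
    rw [enorm_mul, enorm_mul, enorm_mul, enorm_mul, enorm_mul, enorm_mul, e3, e3, wt, er _ (by positivity), er _ (by positivity), er _ (by positivity), ENNReal.ofReal_mul (by positivity), rz, m2]
    rw [ENNReal.ofReal_mul (by positivity)] at e1 e2
    calc _ = ENNReal.ofReal (min (‖x‖ / ‖y‖) (1 / (‖x‖ / ‖y‖)) ^ t) * ENNReal.ofReal (dist x y ^ (-(n - (n - γ) / P)) * ‖y‖ ^ (2 * l)) * ((ENNReal.ofReal (Real.exp (1/P * ω x)) * ENNReal.ofReal (‖x‖ ^ (-(n/2:ℝ)))) * (ENNReal.ofReal (Real.exp (1/P * ω y)) * ENNReal.ofReal (‖y‖ ^ (-(n/2:ℝ)))) * (‖φ x‖ₑ * ‖ψ y‖ₑ)) := by ring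
      _ ≤ ENNReal.ofReal (‖x‖ ^ l * ‖y‖ ^ (-l)) * ENNReal.ofReal (dist x y ^ (-(n - (n - γ) / P)) * ‖y‖ ^ (2 * l)) * ((ENNReal.ofReal (‖x‖ ^ (-l)) * u x ^ (1/P/2)) * (ENNReal.ofReal (‖y‖ ^ (-l)) * u y ^ (1/P/2)) * (‖φ x‖ₑ * ‖ψ y‖ₑ)) := by gcongr
      _ = ENNReal.ofReal (dist x y ^ (-(n - (n - γ) / P))) * (ENNReal.ofReal (‖x‖ ^ l * ‖y‖ ^ (-l)) * ENNReal.ofReal (‖y‖ ^ (2 * l)) * ENNReal.ofReal (‖x‖ ^ (-l)) * ENNReal.ofReal (‖y‖ ^ (-l))) * (u x ^ (1/P/2) * u y ^ (1/P/2)) * (‖φ x‖ₑ * ‖ψ y‖ₑ) := by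
          rw [ENNReal.ofReal_mul (by positivity) (p := dist x y ^ _)]; ring
      _ = _ := by
          rw [← ENNReal.ofReal_mul (by positivity), ← ENNReal.ofReal_mul (by positivity), ← ENNReal.ofReal_mul (by positivity)]
          have : ‖x‖ ^ l * ‖y‖ ^ (-l) * ‖y‖ ^ (2 * l) * ‖x‖ ^ (-l) * ‖y‖ ^ (-l) = 1 := by
            rw [show ‖x‖ ^ l * ‖y‖ ^ (-l) * ‖y‖ ^ (2 * l) * ‖x‖ ^ (-l) * ‖y‖ ^ (-l) = (‖x‖ ^ l * ‖x‖ ^ (-l)) * (‖y‖ ^ (-l) * ‖y‖ ^ (2 * l) * ‖y‖ ^ (-l)) by ring,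
              ← Real.rpow_add nx, ← Real.rpow_add ny, ← Real.rpow_add ny]
            ring_nf; simp
          rw [this, ENNReal.ofReal_one, mul_one, mul_assoc]
  obtain ⟨Mn, hMn⟩ : ∃ Mn : ℕ, Mn = 2 ^ (k+1) - 1 := ⟨_, rfl⟩
  rw [← hMn] at hlow hup hMr ⊢
  have hNi : Integrable (fun z => (w0 (ρ z) : ℂ) * Fz z * D z) (volume.prod volume) :=
    ⟨by fun_prop, lt_of_le_of_lt hN1 (by rw [hN]; finiteness)⟩
  have hLi : ∀ q ∈ Finset.range Mn, Integrable (fun z => (w0 (ρ z) : ℂ) * Hq q z * D z) (volume.prod volume) := fun q hq =>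
    hint w0 hw0m q 1 (1/2) zero_le_one (by norm_num) fun r hr => by
      rw [hw0]
      have : (q:ℝ) + 1 ≤ Mn := by exact_mod_cast Finset.mem_range.1 hq
      exact wlow hr (by linarith)
  have hLOW : ‖∑ q ∈ Finset.range Mn, I w0 q‖ ≤ D1 * (Cb * N) := hlow (I w0) _ (by positivity) fun A L ϱ h1 h2 h3 h4 =>
    HB w0 hw0m A L ϱ 1 h1 h2 h3 zero_le_one fun q hq r hr => by
      rw [hw0]
      have : (q:ℝ) + 1 ≤ A + L := by exact_mod_cast (Finset.mem_Ico.1 hq).2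
      exact wlow hr (by linarith)
  have hgoal : (fun p : Euc n × Euc n => Kt l t Mn p * wt p * ((Complex.exp ((1/P:ℝ) * ω p.1) * φ p.1) * (Complex.exp ((1/P:ℝ) * ω p.2) * ψ p.2))) = fun p => Kt l t Mn p * D p := by
    funext p; rw [hD, hΦ, hΨ]; simp only; ring
  rw [hgoal]
  by_cases hKi : Integrable (fun p => Kt l t Mn p * D p) (volume.prod volume)
  swap
  · rw [integral_undef hKi]; simp
  obtain ⟨U, hU⟩ : ∃ U : Euc n × Euc n → ℂ, U = fun z => Kt l t Mn z * D z - (w0 (ρ z) : ℂ) * Fz z * D z + ∑ q ∈ Finset.range Mn, (w0 (ρ z) : ℂ) * Hq q z * D z := ⟨_, rfl⟩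
  have hLs := integrable_finsetSum _ hLi
  have hUi : Integrable U (volume.prod volume) := by rw [hU]; exact (hKi.sub hNi).add hLs
  have hUp : ∀ z, U z = ((ρ z ^ (-t) - w0 (ρ z) : ℝ) : ℂ) * (Fz z - ∑ q ∈ Finset.range Mn, Hq q z) * D z := by
    intro z
    simp only [hU, Kt, hFz, hHq, hρ, ← Finset.sum_mul, ← Finset.mul_sum]
    push_cast; ring
  have hUb : ‖∫ z, U z ∂(volume.prod volume)‖ ≤ D2 * (Cb * N) := by
    obtain ⟨wj, hwj⟩ : ∃ wj : ℕ → ℝ → ℝ, wj = fun (j : ℕ) r => if r < 1 - 1 / ((j:ℝ) + 2) then r ^ (-t) - r ^ t else 0 := ⟨_, rfl⟩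
    have hwjm : ∀ j, Measurable (wj j) := fun j => by
      rw [hwj]; exact Measurable.ite measurableSet_Iio (by fun_prop) measurable_const
    have hη : ∀ j : ℕ, 0 < 1 / ((j:ℝ) + 2) := fun j => by positivity
    have hwb : ∀ j (A q : ℕ) (ϱ G : ℝ), Mn ≤ A → A ≤ q → 0 ≤ G → ((ϱ ≤ A - t ∧ G = 1) ∨ (ϱ = (A - t) / 2 ∧ G = 4 * t / (A - t))) → ∀ r : ℝ, 0 < r → |wj j r| * r ^ q ≤ G * min r (1 / r) ^ ϱ := by
      intro j A q ϱ G h1 h2 h3 h4 r hr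
      have hMA : (Mn:ℝ) ≤ A := by exact_mod_cast h1
      rw [hwj]; simp only
      split_ifs with h5
      · have hr1 : r < 1 := by linarith [hη j]
        rw [min_l hr hr1.le]
        exact wup hr hr1 h2 ht0 (by linarith) h4
      · have := min_pos' hr
        rw [abs_zero, zero_mul]; positivity
    have hj : ∀ j, ‖∫ z, (wj j (ρ z) : ℂ) * (Fz z - ∑ q ∈ Finset.range Mn, Hq q z) * D z ∂(volume.prod volume)‖ ≤ D2 * (Cb * N) := by
      intro j
      have hWi : Integrable (fun z => (wj j (ρ z) : ℂ) * D z) (volume.prod volume) := by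
        obtain ⟨B1, hB10, hB1⟩ := hΦA.pw (-(n/2:ℝ))
        obtain ⟨B2, hB20, hB2⟩ := hΨA.pw (-(n/2:ℝ))
        obtain ⟨B3, hB30, hB3⟩ := hΦA.pw (-t)
        obtain ⟨B4, hB40, hB4⟩ := hΨA.pw t
        have := hwjm j
        have := kern_int hΦA hΨA (fun z => (wj j (ρ z) : ℂ) * wt z) (by fun_prop) (B3 * B4 * (B1 * B2)) (fun z hx hy => by
          have nx := hΦA.ne hx
          have ny := hΨA.ne hy
          rw [norm_mul, wt, Complex.norm_real, Complex.norm_real, Real.norm_of_nonneg (by positivity : 0 ≤ ‖z.1‖ ^ (-(n/2:ℝ)) * ‖z.2‖ ^ (-(n/2:ℝ)))]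
          refine mul_le_mul ?_ (mul_le_mul (hB1 _ hx) (hB2 _ hy) (by positivity) hB10) (by positivity) (by positivity)
          refine le_trans ?_ (mul_le_mul (hB3 _ hx) (hB4 _ hy) (by positivity) hB30)
          have e : ‖z.1‖ ^ (-t) * ‖z.2‖ ^ t = ρ z ^ (-t) := by
            rw [hρ]; simp only
            rw [Real.div_rpow nx.le ny.le, Real.rpow_neg ny.le, div_inv_eq_mul]
          have hr : 0 < ρ z := by rw [hρ]; positivity
          rw [e, hwj]; simp only
          split_ifs with h5
          · have : ρ z ^ t ≤ ρ z ^ (-t) := Real.rpow_le_rpow_of_exponent_ge hr (by linarith [hη j]) (by linarith)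
            have := Real.rpow_pos_of_pos hr t
            rw [Real.norm_of_nonneg (by linarith)]; linarith
          · rw [norm_zero]; positivity)
        exact this.congr (ae_of_all _ fun z => by simp only [hD]; ring)
      have hJ : Tendsto (fun J : ℕ => Mn + 2 ^ (k+1+J)) atTop atTop :=
        tendsto_atTop_mono (fun J => show J ≤ _ by have := Nat.lt_two_pow_self (n := k+1+J); omega) tendsto_id
      refine le_of_tendsto (tendsto_integral_of_dominated_convergence (F := fun J : ℕ => fun z => (wj j (ρ z) : ℂ) * (∑ q ∈ Finset.Ico Mn (Mn + 2 ^ (k+1+J)), Hq q z) * D z)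
        (fun z => (1 / ((j:ℝ) + 2)) ^ (-2 * l) * ‖(wj j (ρ z) : ℂ) * D z‖) (fun J => ?_) (hWi.norm.const_mul _) (fun J => ae_of_all _ fun z => ?_) (ae_of_all _ fun z => ?_)).norm
        (Eventually.of_forall fun J => ?_)
      · have := hwjm j
        have : Measurable fun z => ∑ q ∈ Finset.Ico Mn (Mn + 2 ^ (k+1+J)), Hq q z := Finset.measurable_fun_sum _ fun q _ => hHm q
        fun_prop
      · rw [mul_right_comm, norm_mul, mul_comm]
        rw [hwj]; simp only
        split_ifs with h5
        · refine mul_le_mul_of_nonneg_right ((norm_sum_le _ _).trans ?_) (norm_nonneg _)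
          rw [hHq]
          refine (hh_sum_norm_le hl0 (r := 1 - 1 / ((j:ℝ) + 2)) ?_ (by linarith [hη j]) _).trans (le_of_eq (by congr 1; ring))
          rw [zt_norm]; rw [hρ] at h5; exact h5.le
        · simp
      · by_cases h5 : ρ z < 1 - 1 / ((j:ℝ) + 2)
        · refine ((Filter.Tendsto.const_mul _ ?_).mul_const _)
          simp only [Finset.sum_Ico_eq_sub _ (Nat.le_add_right _ _)]
          refine Filter.Tendsto.sub_const ?_ _
          have hz1 : ‖zt z.1 z.2‖ < 1 := by rw [zt_norm]; rw [hρ] at h5; linarith [hη j]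
          have := (hh_hasSum l hz1).tendsto_sum_nat.comp hJ
          rw [hHq, hFz]; exact this
        · rw [hwj]; simp only [if_neg h5]; simp
      · have e : ∫ z, (wj j (ρ z) : ℂ) * (∑ q ∈ Finset.Ico Mn (Mn + 2 ^ (k+1+J)), Hq q z) * D z ∂(volume.prod volume) = ∑ q ∈ Finset.Ico Mn (Mn + 2 ^ (k+1+J)), I (wj j) q := by
          rw [hI]; simp only
          rw [← integral_finsetSum _ fun q hq => hint (wj j) (hwjm j) q 1 (1/2) zero_le_one (by norm_num) (hwb j Mn q (1/2) 1 le_rfl (Finset.mem_Ico.1 hq).1 zero_le_one (Or.inl ⟨by rw [hMr]; linarith, rfl⟩))]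
          congr 1; funext z
          rw [Finset.mul_sum, Finset.sum_mul]
        rw [e]
        refine hup J (I (wj j)) _ (by positivity) fun A L ϱ G h1 h2 h3 h4 h6 => ?_
        have hMA : (Mn:ℝ) ≤ A := by exact_mod_cast h4
        have hG : 0 ≤ G := by
          rcases h6 with ⟨_, rfl⟩ | ⟨_, rfl⟩
          · exact zero_le_one
          · exact div_nonneg (by linarith) (by linarith)
        exact HB (wj j) (hwjm j) A L ϱ G h1 h2 h3 hG fun q hq r hr => hwb j A q ϱ G h4 (Finset.mem_Ico.1 hq).1 hG h6 r hr
    have hgU : ∀ j z, 0 < ρ z → (wj j (ρ z) : ℂ) * (Fz z - ∑ q ∈ Finset.range Mn, Hq q z) * D z = if ρ z < 1 - 1 / ((j:ℝ) + 2) then U z else 0 := by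
      intro j z hr
      rw [hwj]; simp only
      split_ifs with h5
      · rw [hUp, hw0]; simp only
        rw [min_l hr (by linarith [hη j])]
      · simp
    have hD0 : ∀ z, ¬ 0 < ρ z → D z = 0 := fun z h => by by_contra h2; exact h (hDρ z h2)
    refine le_of_tendsto (tendsto_integral_of_dominated_convergence (F := fun j : ℕ => fun z => (wj j (ρ z) : ℂ) * (Fz z - ∑ q ∈ Finset.range Mn, Hq q z) * D z) (fun z => ‖U z‖)
        (fun j => ?_) hUi.norm (fun j => ae_of_all _ fun z => ?_) (ae_of_all _ fun z => ?_)).norm (Eventually.of_forall hj)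
    · have := hwjm j
      have : Measurable fun z => ∑ q ∈ Finset.range Mn, Hq q z := Finset.measurable_fun_sum _ fun q _ => hHm q
      fun_prop
    · by_cases hr : 0 < ρ z
      · rw [hgU j z hr]; split_ifs <;> simp
      · simp [hD0 z hr]
    · by_cases hr : 0 < ρ z
      · simp only [hgU _ z hr]
        rcases lt_or_ge (ρ z) 1 with h1 | h1
        · have e : Tendsto (fun j : ℕ => 1 - 1 / ((j:ℝ) + 2)) atTop (nhds (1 - 0)) := by
            refine Filter.Tendsto.const_sub _ ?_
            exact tendsto_const_nhds.div_atTop (tendsto_atTop_add_const_right _ _ tendsto_natCast_atTop_atTop)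
          rw [sub_zero] at e
          refine tendsto_const_nhds.congr' ?_
          filter_upwards [e.eventually (lt_mem_nhds h1)] with j hj
          rw [if_pos hj]
        · have : U z = 0 := by
            rw [hUp, hw0]; simp only
            rw [min_r hr h1, one_div, Real.inv_rpow hr.le, ← Real.rpow_neg hr.le]; simp
          simp [this]
      · simp [hUp, hD0 z hr]
  have hdec : ∫ z, Kt l t Mn z * D z ∂(volume.prod volume) = ∫ z, (w0 (ρ z) : ℂ) * Fz z * D z ∂(volume.prod volume) - ∑ q ∈ Finset.range Mn, I w0 q + ∫ z, U z ∂(volume.prod volume) := by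
    rw [hI]; simp only
    rw [← integral_finsetSum _ hLi, ← integral_sub hNi hLs]
    have := integral_add (hNi.sub hLs) hUi
    simp only [Pi.sub_apply] at this
    rw [← this]
    congr 1; funext z; rw [hU]; simp only; ring
  have eb : ∀ (c : ℂ) (E : ℝ), ‖c‖ ≤ E * (Cb * N) → ‖c‖ₑ ≤ ENNReal.ofReal (E * Cb) * ENNReal.ofReal N := fun c E h => by
    rw [← ENNReal.ofReal_mul' hN0, ← ofReal_norm, mul_assoc]; exact ENNReal.ofReal_le_ofReal h
  rw [hdec]
  refine (enorm_add_le _ _).trans ((add_le_add (enorm_sub_le.trans (add_le_add ((enorm_integral_le_lintegral_enorm _).trans hN1) (eb _ _ hLOW))) (eb _ _ hUb)).trans (le_of_eq ?_))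
  rw [hN]; ring

lemma gam1 {a b : ℝ} (ha : 0 < a) (hb : 0 < b) : ∫ s in Ioi (0:ℝ), s ^ (a - 1) * Real.exp (-(b * s)) = Real.Gamma a * b ^ (-a) := by
  rw [Real.integral_rpow_mul_exp_neg_mul_Ioi ha hb, Real.rpow_neg hb.le, one_div, Real.inv_rpow hb.le, mul_comm]

lemma gam2 {a b : ℝ} (ha : 0 < a) (hb : 0 < b) : ∫ s in Ioi (0:ℝ), s ^ (-a - 1) * Real.exp (-(b / s)) = Real.Gamma a * b ^ (-a) := by
  rw [← gam1 ha hb, ← integral_comp_rpow_Ioi _ (show (-1:ℝ) ≠ 0 by norm_num)]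
  refine setIntegral_congr_fun measurableSet_Ioi fun s (hs : 0 < s) => ?_
  simp only [Real.rpow_neg_one, smul_eq_mul, abs_neg, abs_one, one_mul]
  rw [← mul_assoc, Real.inv_rpow hs.le, ← Real.rpow_neg hs.le, ← Real.rpow_add hs, div_eq_mul_inv]
  simp only [inv_inv]; congr 2; ring

lemma subF {n : ℕ} {w : ℝ → Euc n → ℝ} {A : Euc n → ℝ} {g : Euc n → ℂ} (hw : Measurable (Function.uncurry w)) (h0 : ∀ s, 0 < s → ∀ y, 0 ≤ w s y)
    (hA : ∀ᵐ y, ∫ s in Ioi (0:ℝ), w s y = A y ∧ 0 < A y) (hg : AEStronglyMeasurable g) (hi : Integrable fun y => (A y : ℂ) * g y) :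
    ∫ s in Ioi (0:ℝ), ∫ y, (w s y : ℂ) * g y = ∫ y, (A y : ℂ) * g y := by
  have hI : ∀ᵐ y, Integrable (fun s => w s y) (volume.restrict (Ioi 0)) := by
    filter_upwards [hA] with y hy
    by_contra h
    rw [integral_undef h] at hy
    linarith [hy.1, hy.2]
  rw [integral_integral_swap]
  · refine integral_congr_ae ?_
    filter_upwards [hA] with y hy
    rw [integral_mul_const, ← hy.1, integral_complex_ofReal]
  · rw [integrable_prod_iff' (by
      refine AEStronglyMeasurable.mul ?_ hg.comp_snd
      exact (Complex.measurable_ofReal.comp hw).aestronglyMeasurable)]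
    refine ⟨?_, ?_⟩
    · filter_upwards [hI] with y hy
      exact hy.ofReal.mul_const (g y)
    · refine hi.norm.congr ?_
      filter_upwards [hA] with y hy
      simp only [Function.uncurry, norm_mul, Complex.norm_real]
      rw [integral_mul_const, Real.norm_of_nonneg hy.2.le, ← hy.1]
      congr 1
      exact setIntegral_congr_fun measurableSet_Ioi fun s hs => (Real.norm_of_nonneg (h0 s hs y)).symm

lemma inner_gauss {n : ℕ} {s : ℝ} (hs : 0 < s) (x : Euc n) {g : Euc n → ℂ} (hg : Integrable g) :
    ∫ ξ, (Real.exp (-(Real.pi * ‖ξ‖ ^ 2 * s)) : ℂ) * (Complex.exp (2 * Real.pi * Complex.I * (inner ℝ x ξ : ℝ)) * 𝓕 g ξ) =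
    ∫ y, ((s ^ (-(n / 2 : ℝ)) * Real.exp (-(Real.pi * ‖x - y‖ ^ 2 / s)) : ℝ) : ℂ) * g y := by
  have hb : 0 < ((Real.pi * s : ℝ) : ℂ).re := by rw [Complex.ofReal_re]; positivity
  have J := GaussianFourier.integrable_cexp_neg_mul_sq_norm_add (V := Euc n) hb (2 * Real.pi * Complex.I) x
  have h := VectorFourier.integral_fourierIntegral_smul_eq_flip (L := innerₗ (Euc n)) Real.continuous_fourierChar continuous_inner J hg
  have h2 : ∫ w, 𝓕 (fun v : Euc n => Complex.exp (-((Real.pi * s : ℝ) : ℂ) * ‖v‖ ^ 2 + 2 * Real.pi * Complex.I * (inner ℝ x v : ℝ))) w • g w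
      = ∫ ξ, Complex.exp (-((Real.pi * s : ℝ) : ℂ) * ‖ξ‖ ^ 2 + 2 * Real.pi * Complex.I * (inner ℝ x ξ : ℝ)) • 𝓕 g ξ := by simpa using! h
  refine Eq.trans ?_ (h2.symm.trans ?_)
  · refine integral_congr_ae (.of_forall fun ξ => ?_)
    simp only [smul_eq_mul]
    rw [← mul_assoc, Complex.ofReal_exp, ← Complex.exp_add]
    congr 3; push_cast; ring
  · refine integral_congr_ae (.of_forall fun y => ?_)
    simp only [smul_eq_mul]
    rw [fourier_gaussian_innerProductSpace' hb]
    congr 1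
    have hp := Real.pi_pos
    rw [finrank_euclideanSpace_fin, show ((Real.pi:ℂ) / ((Real.pi * s : ℝ) : ℂ)) = ((s⁻¹ : ℝ) : ℂ) by
      push_cast; field_simp, show ((n:ℂ) / 2) = ((n / 2 : ℝ) : ℂ) by push_cast; rfl, ← Complex.ofReal_cpow (by positivity),
      Real.inv_rpow hs.le, Real.rpow_neg hs.le]
    push_cast
    congr 2
    have : (s:ℂ) ≠ 0 := by exact_mod_cast hs.ne'
    field_simp

lemma loc_int {n : ℕ} {e : ℝ} (he : 0 < e) (hen : e < n) (x : Euc n) {g : Euc n → ℂ} (hg : Continuous g) (hc : HasCompactSupport g) :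
    Integrable fun y => ((‖x - y‖ ^ (-e) : ℝ) : ℂ) * g y := by
  obtain ⟨B, hB⟩ := hc.exists_bound_of_continuous hg
  obtain ⟨R, hR⟩ := hc.isCompact.isBounded.subset_ball x
  refine ⟨(Complex.measurable_ofReal.comp (by fun_prop)).aestronglyMeasurable.mul hg.aestronglyMeasurable, ?_⟩
  have hR' : ball x R ⊆ ball x (max R 1) := ball_subset_ball (le_max_left _ _)
  have hN := near_lemma (volume : Measure (Euc n)) (volume (ball (0 : Euc n) 1)) hen he.le x (fun R hR => vol_growth x R hR) (R := max R 1) (by positivity)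
  refine lt_of_le_of_lt ?_ (ENNReal.mul_lt_top (ENNReal.ofReal_lt_top (r := B)) (lt_of_le_of_lt hN (ENNReal.mul_lt_top measure_ball_lt_top ENNReal.ofReal_lt_top)))
  rw [← lintegral_const_mul _ (by fun_prop), ← lintegral_indicator measurableSet_ball]
  refine lintegral_mono fun y => ?_
  by_cases hy : g y = 0
  · simp [hy]
  rw [indicator_of_mem (hR' (hR (subset_tsupport _ hy))), enorm_mul, mul_comm]
  refine mul_le_mul' ?_ ?_
  · rw [← ofReal_norm]; exact ENNReal.ofReal_le_ofReal (hB y)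
  · rw [← ofReal_norm, Complex.norm_real, Real.norm_of_nonneg (by positivity), dist_comm, dist_eq_norm]

lemma schw {n : ℕ} {f : Euc n → ℂ} (h1 : ContDiff ℝ (⊤ : ℕ∞) f) (h2 : HasCompactSupport f) : Integrable f ∧ Integrable (𝓕 f) ∧ 𝓕⁻ (𝓕 f) = f := by
  have hf : Integrable f := (h2.toSchwartzMap h1).integrable
  have hF : Integrable (𝓕 f) := (𝓕 (h2.toSchwartzMap h1)).integrable
  exact ⟨hf, hF, h1.continuous.fourierInv_fourier_eq hf hF⟩

lemma rep0 {n : ℕ} {α : ℝ} (h0 : 0 < α) (hn : α < n) : ∃ c : ℂ, c ≠ 0 ∧ ∀ f Lf : Euc n → ℂ, ContDiff ℝ (⊤ : ℕ∞) f → HasCompactSupport f →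
    ContDiff ℝ (⊤ : ℕ∞) Lf → HasCompactSupport Lf → (∀ ξ : Euc n, 𝓕 Lf ξ = (‖ξ‖ ^ α : ℝ) • 𝓕 f ξ) →
    ∀ x, ∫ y, ((‖x - y‖ ^ (-(n - α)) : ℝ) : ℂ) * Lf y = c * f x := by
  have hp := Real.pi_pos
  have hn0 : Nontrivial (Euc n) := by
    have : 0 < n := by by_contra h; simp at h; subst h; norm_num at hn; linarith
    have : Nonempty (Fin n) := ⟨⟨0, this⟩⟩
    infer_instance
  have g1 := Real.Gamma_pos_of_pos (show 0 < α / 2 by positivity)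
  have g2 := Real.Gamma_pos_of_pos (show 0 < (n - α) / 2 by linarith)
  obtain ⟨c1, hc1⟩ : ∃ c : ℝ, c = Real.Gamma (α / 2) * Real.pi ^ (-(α / 2)) := ⟨_, rfl⟩
  obtain ⟨c2, hc2⟩ : ∃ c : ℝ, c = Real.Gamma ((n - α) / 2) * Real.pi ^ (-((n - α) / 2)) := ⟨_, rfl⟩
  have h1 : 0 < c1 := by rw [hc1]; positivity
  have h2 : 0 < c2 := by rw [hc2]; positivity
  have pw : ∀ (d a : ℝ), 0 < d → (Real.pi * d ^ 2) ^ (-(a / 2)) = Real.pi ^ (-(a / 2)) * d ^ (-a) := fun d a hd => by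
    rw [Real.mul_rpow hp.le (by positivity), ← Real.rpow_natCast, ← Real.rpow_mul hd.le]; congr 2; push_cast; ring
  refine ⟨c1 / c2, by norm_cast; positivity, fun f Lf f1 f2 l1 l2 hL x => ?_⟩
  obtain ⟨fi, fF, finv⟩ := schw f1 f2
  obtain ⟨li, lF, -⟩ := schw l1 l2
  have hne : ∀ᵐ ξ : Euc n, ξ ≠ 0 := Measure.ae_ne volume 0
  obtain ⟨g, hg⟩ : ∃ g : Euc n → ℂ, g = fun ξ => Complex.exp (2 * Real.pi * Complex.I * (inner ℝ x ξ : ℝ)) * 𝓕 Lf ξ := ⟨_, rfl⟩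
  obtain ⟨g', hg'⟩ : ∃ g : Euc n → ℂ, g = fun ξ => Complex.exp (2 * Real.pi * Complex.I * (inner ℝ x ξ : ℝ)) * 𝓕 f ξ := ⟨_, rfl⟩
  have gi' : Integrable g' := by
    rw [hg']
    refine fF.bdd_mul (c := 1) (Continuous.aestronglyMeasurable (by fun_prop)) (.of_forall fun ξ => ?_)
    rw [mul_right_comm, show (2 * Real.pi * (inner ℝ x ξ : ℝ) * Complex.I : ℂ) = ((2 * Real.pi * inner ℝ x ξ : ℝ) : ℂ) * Complex.I by push_cast; ring, Complex.norm_exp_ofReal_mul_I]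
  have key : (fun ξ => ((c1 * ‖ξ‖ ^ (-α) : ℝ) : ℂ) * g ξ) =ᵐ[volume] fun ξ => (c1 : ℂ) * g' ξ := by
    filter_upwards [hne] with ξ hξ
    have : 0 < ‖ξ‖ := norm_pos_iff.2 hξ
    rw [hg, hg']
    simp only [hL, Complex.real_smul]
    have : ((‖ξ‖ ^ (-α) : ℝ) : ℂ) * ((‖ξ‖ ^ α : ℝ) : ℂ) = 1 := by rw [← Complex.ofReal_mul, ← Real.rpow_add this]; simp
    push_cast at this ⊢
    linear_combination (c1 * Complex.exp (2 * Real.pi * Complex.I * (inner ℝ x ξ : ℝ)) * 𝓕 f ξ) * this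
  have e1 := subF (w := fun s (ξ : Euc n) => s ^ (α / 2 - 1) * Real.exp (-(Real.pi * ‖ξ‖ ^ 2 * s))) (A := fun ξ => c1 * ‖ξ‖ ^ (-α)) (g := g)
    (by unfold Function.uncurry; fun_prop) (fun s hs y => by positivity)
    (by
      filter_upwards [hne] with ξ hξ
      have : 0 < ‖ξ‖ := norm_pos_iff.2 hξ
      rw [gam1 (by positivity) (by positivity), pw _ _ this, hc1]
      exact ⟨by ring, by positivity⟩)
    (by rw [hg]; exact (Continuous.aestronglyMeasurable (by fun_prop)).mul lF.1) ((integrable_congr key).2 (gi'.const_mul _))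
  have hxy : ∀ᵐ y : Euc n, y ≠ x := Measure.ae_ne volume x
  have e2 := subF (w := fun s (y : Euc n) => s ^ (-((n - α) / 2) - 1) * Real.exp (-(Real.pi * ‖x - y‖ ^ 2 / s))) (A := fun y => c2 * ‖x - y‖ ^ (-(n - α))) (g := Lf)
    (by unfold Function.uncurry; fun_prop) (fun s hs y => by positivity)
    (by
      filter_upwards [hxy] with y hy
      have : 0 < ‖x - y‖ := norm_pos_iff.2 (sub_ne_zero.2 hy.symm)
      rw [gam2 (by linarith) (by positivity), pw _ _ this, hc2]
      exact ⟨by ring, by positivity⟩)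
    li.1 (by simpa [mul_assoc] using (loc_int (show 0 < n - α by linarith) (by linarith) x l1.continuous l2).const_mul (c2 : ℂ))
  have e3 : ∫ s in Ioi (0:ℝ), ∫ ξ, ((s ^ (α / 2 - 1) * Real.exp (-(Real.pi * ‖ξ‖ ^ 2 * s)) : ℝ) : ℂ) * g ξ =
      ∫ s in Ioi (0:ℝ), ∫ y, ((s ^ (-((n - α) / 2) - 1) * Real.exp (-(Real.pi * ‖x - y‖ ^ 2 / s)) : ℝ) : ℂ) * Lf y := by
    refine setIntegral_congr_fun measurableSet_Ioi fun s (hs : 0 < s) => ?_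
    have := congrArg (fun z => ((s ^ (α / 2 - 1) : ℝ) : ℂ) * z) (inner_gauss hs x li)
    simp only [← integral_const_mul, ← mul_assoc] at this
    rw [hg]
    simp only [← mul_assoc, Complex.ofReal_mul]
    refine Eq.trans (by simp only [Complex.ofReal_exp]) (this.trans ?_)
    refine integral_congr_ae (.of_forall fun y => ?_)
    simp only
    rw [← Complex.ofReal_mul, ← Complex.ofReal_mul, ← mul_assoc, ← Real.rpow_add hs]
    congr 4; ring
  have e4 := congrFun finv x
  rw [Real.fourierInv_eq'] at e4
  have e5 : ∫ ξ, g' ξ = f x := by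
    rw [← e4, hg']
    refine integral_congr_ae (.of_forall fun ξ => ?_)
    simp only [smul_eq_mul, real_inner_comm]
    congr 2; push_cast; ring
  have e6 := e2.symm.trans (e3.symm.trans (e1.trans (integral_congr_ae key)))
  rw [integral_const_mul, e5] at e6
  simp only [Complex.ofReal_mul, mul_assoc] at e6
  rw [integral_const_mul] at e6
  have : (c2 : ℂ) ≠ 0 := by exact_mod_cast h2.ne'
  field_simp
  linear_combination e6

lemma ps_zero {m : ℕ → ℂ} {G : ℝ → ℂ} {s1 : ℝ} (h1 : 0 < s1) (hs : ∀ s, |s| < s1 → HasSum (fun q => ((s:ℂ) ^ q) * m q) (G s))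
    (hz : ∀ s, 0 < s → s < s1 → G s = 0) (q : ℕ) : m q = 0 := by
  have hp : HasFPowerSeriesAt G (fun q => ContinuousMultilinearMap.mkPiRing ℝ (Fin q) (m q) : FormalMultilinearSeries ℝ ℝ ℂ) 0 := by
    refine hasFPowerSeriesAt_iff.2 ?_
    filter_upwards [ball_mem_nhds (0:ℝ) h1] with s h
    have := hs s (by simpa using h)
    simp only [zero_add, FormalMultilinearSeries.coeff, Complex.real_smul]
    simpa using this
  have hf : ∃ᶠ z in nhdsWithin (0:ℝ) {0}ᶜ, G z = 0 := by
    refine Frequently.filter_mono (f := nhdsWithin (0:ℝ) (Ioi 0)) (Eventually.frequently ?_) (nhdsWithin_mono _ fun x hx => ne_of_gt hx)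
    filter_upwards [Ioo_mem_nhdsGT h1] with s h using hz s h.1 h.2
  have h0 := hp.eq_zero_of_eventually (hp.analyticAt.frequently_zero_iff_eventually_zero.1 hf)
  have := congrArg (fun p : FormalMultilinearSeries ℝ ℝ ℂ => p.coeff q) h0
  simpa [FormalMultilinearSeries.coeff] using this

lemma far0 {n : ℕ} {f : Euc n → ℂ} (h : tsupport f ⊆ {x | x ≠ 0}) : ∃ δ > 0, ∀ x, ‖x‖ < δ → f x = 0 := by
  obtain ⟨δ, h0, h1⟩ := Metric.isOpen_iff.1 (isClosed_tsupport f).isOpen_compl 0 fun h' => h h' rfl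
  exact ⟨δ, h0, fun x hx => image_eq_zero_of_notMem_tsupport (h1 (by simpa using hx))⟩

lemma rep {n : ℕ} {α l : ℝ} (h0 : 0 < α) (hn : α < n) (hl : l = (n - α) / 2) : ∃ c : ℂ, c ≠ 0 ∧ ∀ f Lf : Euc n → ℂ, ContDiff ℝ (⊤ : ℕ∞) f → HasCompactSupport f →
    tsupport f ⊆ {x | x ≠ 0} → ContDiff ℝ (⊤ : ℕ∞) Lf → HasCompactSupport Lf → tsupport Lf ⊆ {x | x ≠ 0} → (∀ ξ : Euc n, 𝓕 Lf ξ = (‖ξ‖ ^ α : ℝ) • 𝓕 f ξ) →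
    ∀ (t : ℝ) M x, x ≠ 0 → Integrable (fun y => Kt l t M (x, y) * ((‖y‖ ^ (-2 * l - t) : ℝ) * Lf y)) ∧
      ∫ y, Kt l t M (x, y) * ((‖y‖ ^ (-2 * l - t) : ℝ) * Lf y) = c * (((‖x‖ ^ (-t) : ℝ) : ℂ) * f x) := by
  obtain ⟨c, hc, H⟩ := rep0 h0 hn
  refine ⟨c, hc, fun f Lf f1 f2 f3 l1 l2 l3 hL t M x hx => ?_⟩
  have hl0 : 0 < l := by rw [hl]; linarith
  have H := H f Lf f1 f2 l1 l2 hL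
  obtain ⟨δf, df0, df⟩ := far0 f3
  obtain ⟨δ, d0, d⟩ := far0 l3
  obtain ⟨a, ha⟩ : ∃ a : Euc n → ℂ, a = fun y => ((‖y‖ ^ (-2 * l) : ℝ) : ℂ) * Lf y := ⟨_, rfl⟩
  have hx0 : 0 < ‖x‖ := norm_pos_iff.2 hx
  have hd : ∀ y, Lf y ≠ 0 → δ ≤ ‖y‖ ∧ y ≠ 0 := fun y hy => by
    have : δ ≤ ‖y‖ := by by_contra h; exact hy (d y (not_le.1 h))
    exact ⟨this, norm_pos_iff.1 (by linarith)⟩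
  have ai : Integrable a := by
    have := loc_int (show 0 < n - α by linarith) (by linarith) 0 l1.continuous l2
    rw [ha]; simpa [hl, mul_div_cancel₀] using this
  have hzm : Measurable fun y : Euc n => zt x y := zt_meas.comp (by fun_prop : Measurable fun y : Euc n => (x, y))
  have hFi : ∀ q (s : ℝ), Integrable fun y => a y * hh l q ((s:ℂ) * zt x y) := fun q s => by
    obtain ⟨B, hB0, hB⟩ := hh_bdd l q
    refine Integrable.mono' (g := fun y => (B * (|s| * (‖x‖ / δ)) ^ q) * ‖a y‖) (ai.norm.const_mul _) (ai.1.mul ((hh_cont l q).measurable.comp (hzm.const_mul _)).aestronglyMeasurable) (.of_forall fun y => ?_)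
    by_cases hy : Lf y = 0
    · simp [ha, hy]
    rw [norm_mul, mul_comm]
    refine mul_le_mul_of_nonneg_right ((hB _).trans (mul_le_mul_of_nonneg_left ?_ hB0)) (norm_nonneg _)
    rw [norm_mul, zt_norm, Complex.norm_real, Real.norm_eq_abs]
    have := (hd y hy).1
    gcongr
  have hmz : ∀ q, ∫ y, a y * hh l q (zt x y) = 0 := by
    have hs1 : 0 < min (1 / (4 * (‖x‖ / δ))) (δf / ‖x‖) := by positivity
    refine ps_zero (m := fun q => ∫ y, a y * hh l q (zt x y)) (G := fun s => ∫ y, a y * ((‖1 - (s:ℂ) * zt x y‖ ^ (-2 * l) : ℝ) : ℂ)) hs1 (fun s hs => ?_) (fun s s0 hs => ?_)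
    · have hz : ∀ y, Lf y ≠ 0 → ‖((2 * s : ℝ) : ℂ) * zt x y‖ ≤ 1 / 2 := fun y hy => by
        rw [norm_mul, zt_norm, Complex.norm_real, Real.norm_eq_abs, abs_mul, abs_two]
        have h1 := (lt_min_iff.1 hs).1
        rw [lt_div_iff₀ (by positivity)] at h1
        have : ‖x‖ / ‖y‖ ≤ ‖x‖ / δ := by have := (hd y hy).1; gcongr
        nlinarith [abs_nonneg s]
      have e : ∀ q, ((s:ℂ) ^ q) * ∫ y, a y * hh l q (zt x y) = ∫ y, a y * hh l q ((s:ℂ) * zt x y) := fun q => by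
        rw [← integral_const_mul]
        refine integral_congr_ae (.of_forall fun y => ?_)
        simp only [hh_smul]; ring
      simp only [e]
      refine hasSum_integral_of_dominated_convergence (bound := fun q y => (1 / 2) ^ q * ((1 - 1 / 2) ^ (-2 * l) * ‖a y‖)) (fun q => (hFi q s).1) (fun q => .of_forall fun y => ?_)
        (.of_forall fun y => (summable_geometric_of_lt_one (by norm_num) (by norm_num)).mul_right _) ?_ (.of_forall fun y => ?_)
      · by_cases hy : Lf y = 0
        · simp [ha, hy]
        have := hh_sum_norm_le hl0.le (hz y hy) (by norm_num) {q}
        rw [Finset.sum_singleton] at this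
        rw [show (s:ℂ) * zt x y = ((1 / 2 : ℝ) : ℂ) * (((2 * s : ℝ) : ℂ) * zt x y) by push_cast; ring, hh_smul, norm_mul, norm_mul, norm_pow, Complex.norm_real, Real.norm_of_nonneg (by norm_num)]
        have : ‖a y‖ * ((1 / 2) ^ q * ‖hh l q (((2 * s : ℝ) : ℂ) * zt x y)‖) ≤ ‖a y‖ * ((1 / 2) ^ q * (1 - 1 / 2) ^ (-2 * l)) := by gcongr
        linarith
      · simp only [tsum_mul_right]
        exact (ai.norm.const_mul _).const_mul _
      · by_cases hy : Lf y = 0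
        · simp [ha, hy, hasSum_zero]
        refine HasSum.mul_left _ (hh_hasSum l ?_)
        have := hz y hy
        rw [Complex.ofReal_mul, mul_assoc, norm_mul] at this
        norm_num at this ⊢
        linarith
    · have h1 := (lt_min_iff.1 hs).2
      rw [lt_div_iff₀ hx0] at h1
      have := H (s • x)
      rw [df _ (by rw [norm_smul, Real.norm_of_nonneg s0.le]; exact h1), mul_zero] at this
      rw [← this]
      refine integral_congr_ae (.of_forall fun y => ?_)
      by_cases hy : Lf y = 0
      · simp [ha, hy]
      have h2 := (hd y hy).2
      have h3 := zt_smul x y s0.le one_pos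
      rw [one_smul, div_one] at h3
      have h4 : 0 < ‖y‖ := norm_pos_iff.2 h2
      simp only [ha]
      rw [← h3, zt_one_sub _ _ h2, show -((n:ℝ) - α) = -2 * l by rw [hl]; ring, mul_right_comm, ← Complex.ofReal_mul, ← Real.mul_rpow (norm_nonneg _) (by positivity), mul_div_cancel₀ _ h4.ne']
  have hE : ∀ y, Kt l t M (x, y) * ((‖y‖ ^ (-2 * l - t) : ℝ) * Lf y) = ((‖x‖ ^ (-t) : ℝ) : ℂ) * (((‖x - y‖ ^ (-(n - α)) : ℝ) : ℂ) * Lf y - ∑ q ∈ Finset.range M, a y * hh l q (zt x y)) := fun y => by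
    by_cases hy : Lf y = 0
    · simp [ha, hy]
    have h2 := (hd y hy).2
    have h4 : 0 < ‖y‖ := norm_pos_iff.2 h2
    rw [Kt, ← Finset.mul_sum]
    simp only [ha]
    rw [zt_one_sub _ _ h2, Real.div_rpow hx0.le h4.le, Real.div_rpow (norm_nonneg _) h4.le, show -((n:ℝ) - α) = -2 * l by rw [hl]; ring, sub_eq_add_neg (-2 * l) t, Real.rpow_add h4]
    have h5 : ((‖y‖ ^ (-t) : ℝ) : ℂ) ≠ 0 := by exact_mod_cast (by positivity : ‖y‖ ^ (-t) ≠ 0)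
    have h6 : ((‖y‖ ^ (-(2 * l)) : ℝ) : ℂ) ≠ 0 := by exact_mod_cast (by positivity : ‖y‖ ^ (-(2 * l)) ≠ 0)
    push_cast
    field_simp
  have i1 := loc_int (show 0 < n - α by linarith) (by linarith) x l1.continuous l2
  have i2 : ∀ q ∈ Finset.range M, Integrable fun y => a y * hh l q (zt x y) := fun q _ => by simpa using hFi q 1
  simp only [hE]
  refine ⟨(i1.sub (integrable_finsetSum _ i2)).const_mul _, ?_⟩
  rw [integral_const_mul, integral_sub i1 (integrable_finsetSum _ i2), integral_finsetSum _ i2, H]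
  simp only [hmz, Finset.sum_const_zero, sub_zero]
  ring

lemma nonint {F G : ℂ → ℂ} (hF : Differentiable ℂ F) (hG : Differentiable ℂ G) {α c : ℝ} (hc : 0 < c) (hα : ∀ k : ℤ, α ≠ k)
    (h : ∀ s : ℝ, 0 < s → G s = ((s ^ α * c : ℝ) : ℂ) * F s) (z : ℂ) : F z = 0 := by
  have fr : ∀ {p : ℂ → Prop}, (∀ᶠ z in nhds 0, p z) → ∀ᶠ s : ℝ in nhdsWithin 0 (Ioi 0), p s := fun hp => by
    have : Tendsto (fun s : ℝ => (s : ℂ)) (nhdsWithin 0 (Ioi 0)) (nhds 0) := by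
      simpa using (Complex.continuous_ofReal.tendsto 0).mono_left nhdsWithin_le_nhds
    exact this.eventually hp
  have aF := hF.analyticAt 0
  have aG := hG.analyticAt 0
  by_contra hz
  have kF : ¬ ∀ᶠ z in nhds 0, F z = 0 := fun h0 => hz <|
    (AnalyticOnNhd.eqOn_zero_of_preconnected_of_eventuallyEq_zero (fun z _ => hF.analyticAt z) isPreconnected_univ (mem_univ 0) h0) (mem_univ z)
  have kG : ¬ ∀ᶠ z in nhds 0, G z = 0 := fun h0 => kF <| aF.frequently_zero_iff_eventually_zero.1 <| by
    have h1 : ∀ᶠ s : ℝ in nhdsWithin 0 (Ioi 0), F s = 0 := by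
      filter_upwards [fr h0, self_mem_nhdsWithin] with s h1 (h2 : 0 < s)
      rw [h s h2, mul_eq_zero] at h1
      exact h1.resolve_left (by norm_cast; positivity)
    have h3 : Tendsto (fun s : ℝ => (s : ℂ)) (nhdsWithin 0 (Ioi 0)) (nhdsWithin 0 {0}ᶜ) := by
      refine tendsto_nhdsWithin_iff.2 ⟨by simpa using (Complex.continuous_ofReal.tendsto 0).mono_left nhdsWithin_le_nhds, ?_⟩
      filter_upwards [self_mem_nhdsWithin] with s (h2 : 0 < s)
      simpa using h2.ne'
    exact h3.frequently h1.frequently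
  obtain ⟨N, φ, φa, φ0, φe⟩ := (aF.exists_eventuallyEq_pow_smul_nonzero_iff).2 kF
  obtain ⟨M, γ, γa, γ0, γe⟩ := (aG.exists_eventuallyEq_pow_smul_nonzero_iff).2 kG
  simp only [sub_zero, smul_eq_mul] at φe γe
  have lim : ∀ {g : ℂ → ℂ}, AnalyticAt ℂ g 0 → Tendsto (fun s : ℝ => ‖g s‖) (nhdsWithin 0 (Ioi 0)) (nhds ‖g 0‖) := fun hg => by
    have := (hg.continuousAt.norm.tendsto.comp ((Complex.continuous_ofReal.tendsto 0)))
    exact this.mono_left nhdsWithin_le_nhds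
  have main : ∀ᶠ s : ℝ in nhdsWithin 0 (Ioi 0), ‖γ s‖ = s ^ (α + N - M) * (c * ‖φ s‖) := by
    filter_upwards [fr φe, fr γe, self_mem_nhdsWithin] with s h1 h2 (h3 : 0 < s)
    have := h s h3
    rw [h1, h2] at this
    have := congrArg norm this
    simp only [norm_mul, norm_pow, Complex.norm_real, Real.norm_of_nonneg h3.le, Real.norm_of_nonneg (show 0 ≤ s ^ α by positivity), Real.norm_of_nonneg hc.le] at this
    rw [Real.rpow_sub h3, Real.rpow_add h3, Real.rpow_natCast, Real.rpow_natCast]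
    field_simp
    linear_combination this
  have pl : ∀ {e : ℝ}, 0 < e → Tendsto (fun s : ℝ => s ^ e) (nhdsWithin 0 (Ioi 0)) (nhds 0) := fun he => by
    have := (Real.continuousAt_rpow_const 0 _ (Or.inr he.le)).tendsto
    rw [Real.zero_rpow he.ne'] at this
    exact this.mono_left nhdsWithin_le_nhds
  rcases lt_trichotomy (α + N - M) 0 with he | he | he
  · have := (pl (neg_pos.2 he)).mul (lim γa)
    rw [zero_mul] at this
    have h2 := tendsto_nhds_unique (this.congr' (f₂ := fun s : ℝ => c * ‖φ s‖) (by
      filter_upwards [main, self_mem_nhdsWithin] with s h1 (h3 : 0 < s)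
      rw [h1, ← mul_assoc, ← Real.rpow_add h3]; simp)) (Filter.Tendsto.const_mul c (lim φa))
    rw [eq_comm, mul_eq_zero, norm_eq_zero] at h2
    exact h2.elim hc.ne' φ0
  · exact hα (M - N) (by push_cast; linarith)
  · have := (pl he).mul (Filter.Tendsto.const_mul c (lim φa))
    rw [zero_mul] at this
    have h2 := tendsto_nhds_unique (this.congr' (by filter_upwards [main] with s h1 using h1.symm)) (lim γa)
    exact γ0 (norm_eq_zero.1 h2.symm)

lemma f_zero {n : ℕ} {α : ℝ} (hα : ∀ k : ℤ, α ≠ k) {f Lf : Euc n → ℂ} (f1 : ContDiff ℝ (⊤ : ℕ∞) f) (f2 : HasCompactSupport f)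
    (l1 : ContDiff ℝ (⊤ : ℕ∞) Lf) (l2 : HasCompactSupport Lf) (hL : ∀ ξ : Euc n, 𝓕 Lf ξ = (‖ξ‖ ^ α : ℝ) • 𝓕 f ξ) (hn : 1 ≤ n) (x : Euc n) : f x = 0 := by
  obtain ⟨fi, -, finv⟩ := schw f1 f2
  obtain ⟨li, -, -⟩ := schw l1 l2
  have hn0 : Nontrivial (Euc n) := by
    have : Nonempty (Fin n) := ⟨⟨0, hn⟩⟩
    infer_instance
  have F0 : ∀ᵐ ω : Euc n, 𝓕 f ω = 0 := by
    filter_upwards [Measure.ae_ne volume (0 : Euc n)] with ω hω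
    have h0 : 0 < ‖ω‖ := norm_pos_iff.2 hω
    have en : ∀ {g : Euc n → ℂ}, Continuous g → HasCompactSupport g → Integrable g → Differentiable ℂ (fun z : ℂ => ∫ x, Complex.exp (-2 * Real.pi * Complex.I * z * (inner ℝ x ω : ℝ)) * g x) := fun {g} g1 g2 g3 => by
      obtain ⟨R, hR⟩ := g2.isCompact.isBounded.subset_ball (0 : Euc n)
      have := entire_int volume (fun x : Euc n => inner ℝ x ω) g (by fun_prop) (R * ‖ω‖) (fun x hx => by
        have h1 : ‖x‖ < R := by simpa using hR (subset_tsupport _ hx)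
        refine (abs_real_inner_le_norm x ω).trans ?_
        gcongr) g3
      exact this.comp (f := fun z : ℂ => -2 * Real.pi * Complex.I * z) (by fun_prop)
    have ev : ∀ (g : Euc n → ℂ) (s : ℝ), 𝓕 g (s • ω) = ∫ x, Complex.exp (-2 * Real.pi * Complex.I * s * (inner ℝ x ω : ℝ)) * g x := fun g s => by
      rw [Real.fourier_eq']
      refine integral_congr_ae (.of_forall fun x => ?_)
      simp only [smul_eq_mul, inner_smul_right]
      congr 2; push_cast; ring
    have := nonint (en f1.continuous f2 fi) (en l1.continuous l2 li) (c := ‖ω‖ ^ α) (by positivity) hα (fun s hs => by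
      rw [← ev, ← ev, hL, Complex.real_smul, norm_smul, Real.norm_of_nonneg hs.le, Real.mul_rpow hs.le h0.le]) 1
    have e1 := ev f 1
    rw [one_smul] at e1
    rw [e1]; exact_mod_cast this
  rw [← congrFun finv x, Real.fourierInv_eq']
  refine integral_eq_zero_of_ae ?_
  filter_upwards [F0] with ω h
  simp [h]

lemma Kt_meas {n : ℕ} (l t : ℝ) (M : ℕ) : Measurable (Kt (n := n) l t M) := by
  unfold Kt
  have h1 : Measurable fun z : Euc n × Euc n => zt z.1 z.2 := zt_meas
  have h2 : ∀ q, Measurable fun z : Euc n × Euc n => hh (l:ℂ) q (zt z.1 z.2) := fun q => (hh_cont _ q).measurable.comp h1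
  refine Measurable.mul (by fun_prop) (Measurable.sub (Complex.measurable_ofReal.comp (by fun_prop)) (Finset.measurable_fun_sum _ fun q _ => h2 q))

lemma Kt_int {n : ℕ} {l : ℝ} (t : ℝ) (M : ℕ) (h0 : 0 < l) (hn : 2 * l < n) {φ ψ : Euc n → ℂ} (hφ : Adm φ) (hψ : Adm ψ) :
    Integrable (fun z : Euc n × Euc n => Kt l t M z * (φ z.1 * ψ z.2)) (volume.prod volume) := by
  obtain ⟨k, hk, hK⟩ := hφ.2
  obtain ⟨k', hk', hK'⟩ := hψ.2
  obtain ⟨B1, b1, B1'⟩ := hφ.pw (-t)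
  obtain ⟨B2, b2, B2'⟩ := hψ.pw t
  obtain ⟨B3, b3, B3'⟩ := hψ.pw (2 * l)
  have h1 : Measurable fun z : Euc n × Euc n => zt z.1 z.2 := zt_meas
  obtain ⟨Mφ, hM⟩ := hφ.1.2
  have hM0 : 0 ≤ Mφ := (norm_nonneg _).trans (hM 0)
  have g1 : Integrable fun y : Euc n => ((‖y‖ ^ (-(2 * l)) : ℝ) : ℂ) * (ball 0 (k + k' + 1)).indicator (fun _ => 1) y := by
    refine ⟨((Complex.measurable_ofReal.comp (by fun_prop)).mul (measurable_const.indicator measurableSet_ball)).aestronglyMeasurable, ?_⟩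
    refine lt_of_le_of_lt ?_ (lt_of_le_of_lt (near_lemma (volume : Measure (Euc n)) (volume (ball (0 : Euc n) 1)) hn (by linarith) 0 (fun R hR => vol_growth 0 R hR) (R := k + k' + 1) (by linarith)) (ENNReal.mul_lt_top measure_ball_lt_top ENNReal.ofReal_lt_top))
    rw [← lintegral_indicator measurableSet_ball]
    refine lintegral_mono fun y => ?_
    by_cases hy : y ∈ ball (0 : Euc n) (k + k' + 1)
    · simp only [indicator_of_mem hy, mul_one]
      rw [← ofReal_norm, Complex.norm_real, Real.norm_of_nonneg (by positivity), dist_zero_right]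
    · simp [indicator_of_notMem hy]
  have i1 := (hψ.fin.convolution_integrand (ContinuousLinearMap.mul ℂ ℂ) g1)
  have hr : ∀ z : Euc n × Euc n, φ z.1 ≠ 0 → ψ z.2 ≠ 0 → ‖(((‖z.1‖ / ‖z.2‖) ^ (-t) : ℝ) : ℂ)‖ ≤ B1 * B2 := fun z hx hy => by
    rw [Complex.norm_real, Real.norm_of_nonneg (by positivity), Real.div_rpow (norm_nonneg _) (norm_nonneg _), Real.rpow_neg (norm_nonneg z.2), div_inv_eq_mul]
    exact mul_le_mul (B1' _ hx) (B2' _ hy) (by positivity) b1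
  have j1 := i1.norm.const_mul (B1 * B2 * B3 * Mφ)
  have j2 := kern_int hφ hψ (fun z => (((‖z.1‖ / ‖z.2‖) ^ (-t) : ℝ) : ℂ) * ∑ q ∈ Finset.range M, hh l q (zt z.1 z.2))
    (Measurable.mul (by fun_prop) (Finset.measurable_fun_sum _ fun q _ => (hh_cont _ q).measurable.comp h1))
  obtain ⟨D, hD⟩ : ∃ D : ℝ, ∀ z : Euc n × Euc n, φ z.1 ≠ 0 → ψ z.2 ≠ 0 → ‖∑ q ∈ Finset.range M, hh l q (zt z.1 z.2)‖ ≤ D := by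
    choose B hB0 hB using hh_bdd l
    refine ⟨∑ q ∈ Finset.range M, B q * (k * k') ^ q, fun z hx hy => (norm_sum_le _ _).trans (Finset.sum_le_sum fun q _ => (hB q _).trans ?_)⟩
    refine mul_le_mul_of_nonneg_left (pow_le_pow_left₀ (norm_nonneg _) ?_ _) (hB0 q)
    have h1 := hK _ hx
    have h2 := hK' _ hy
    have h3 : 0 < ‖z.2‖ := hψ.ne hy
    rw [zt_norm, div_le_iff₀ h3]
    have : 1 ≤ k' * ‖z.2‖ := by have := h2.1; rw [div_le_iff₀ (by linarith)] at this; linarith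
    nlinarith
  have j2 := (j2 (B1 * B2 * D) fun z hx hy => by
    rw [norm_mul]; exact mul_le_mul (hr z hx hy) (hD z hx hy) (norm_nonneg _) (by positivity)).norm
  refine (j1.add j2).mono' (((Kt_meas l t M).mul ((hφ.1.1.comp measurable_fst).mul (hψ.1.1.comp measurable_snd))).aestronglyMeasurable) (.of_forall fun z => ?_)
  by_cases hx : φ z.1 = 0
  · simp only [hx, Pi.add_apply]; simp; positivity
  by_cases hy : ψ z.2 = 0
  · simp only [hy, Pi.add_apply]; simp
  have h3 : 0 < ‖z.2‖ := hψ.ne hy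
  have hm : z.1 - z.2 ∈ ball (0 : Euc n) (k + k' + 1) := by
    rw [mem_ball_zero_iff]
    linarith [norm_sub_le z.1 z.2, (hK _ hx).2, (hK' _ hy).2]
  simp only [Pi.add_apply, Kt, indicator_of_mem hm, ContinuousLinearMap.mul_apply', mul_one]
  rw [mul_sub, sub_mul]
  refine (norm_sub_le _ _).trans (add_le_add ?_ le_rfl)
  rw [norm_mul, norm_mul, norm_mul, norm_mul, zt_one_sub _ _ (norm_pos_iff.1 h3), Complex.norm_real (_ ^ (-2 * l)), Complex.norm_real (_ ^ (-(2 * l))), Real.norm_of_nonneg (by positivity), Real.norm_of_nonneg (by positivity),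
    Real.div_rpow (norm_nonneg (z.1 - z.2)) h3.le, ← neg_mul_eq_neg_mul, Real.rpow_neg h3.le, div_inv_eq_mul]
  have e1 := hr z hx hy
  have e2 := B3' _ hy
  have e3 := hM z.1
  have e4 : 0 ≤ ‖z.1 - z.2‖ ^ (-(2 * l)) := by positivity
  calc _ ≤ (B1 * B2) * (‖z.1 - z.2‖ ^ (-(2 * l)) * B3) * (Mφ * ‖ψ z.2‖) := by gcongr
    _ = _ := by ring

lemma cube_vol {n : ℕ} (a : Fin n → ℝ) (s : ℝ) : MeasurableSet (cube a s) ∧ volume (cube a s) = ENNReal.ofReal s ^ n := by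
  have e : cube a s = (WithLp.ofLp : Euc n → Fin n → ℝ) ⁻¹' Icc a (fun i => a i + s) := by
    ext x; simp only [cube, mem_ofPred_eq, mem_preimage, mem_Icc, Pi.le_def, forall_and]
  have hv := PiLp.volume_preserving_ofLp (Fin n)
  refine ⟨by rw [e]; exact hv.measurable measurableSet_Icc, ?_⟩
  rw [e, hv.measure_preimage measurableSet_Icc.nullMeasurableSet, Real.volume_Icc_pi]
  simp

lemma MB {n : ℕ} (hn : 0 < n) {α p P : ℝ} (h1 : 0 < P) (h2 : P ≤ p) {V : Euc n → ℝ} (hV : Measurable V) (h0 : ∀ x, 0 ≤ V x) (x : Euc n) {R : ℝ} (hR : 0 < R) :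
    ∫⁻ y in ball x R, ENNReal.ofReal (V y ^ P) ≤ morrey n α p V ^ P * ENNReal.ofReal ((2 * R) ^ (n - α * P)) := by
  have hn' : (0:ℝ) < n := by exact_mod_cast hn
  obtain ⟨Q, hQ⟩ : ∃ Q, Q = cube (fun i => x i - R) (2 * R) := ⟨_, rfl⟩
  have hp : 0 < p := by linarith
  obtain ⟨m1, v1⟩ := cube_vol (fun i => x i - R) (2 * R)
  rw [← hQ] at m1 v1
  have hs : ball x R ⊆ Q := fun y hy => by
    rw [hQ]; intro i
    have h := (PiLp.norm_apply_le (y - x) i).trans_lt (by simpa [dist_eq_norm] using hy)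
    rw [PiLp.sub_apply, Real.norm_eq_abs, abs_lt] at h
    constructor <;> linarith
  have v2 : volume Q ≠ 0 := by rw [v1]; exact pow_ne_zero _ (by simpa using hR)
  have v3 : volume Q ≠ ⊤ := by rw [v1]; finiteness
  have hm : volume Q ^ (α / n) * ((volume Q)⁻¹ * ∫⁻ y in Q, ENNReal.ofReal (V y ^ p)) ^ (1 / p) ≤ morrey n α p V := by
    rw [hQ]; exact le_iSup_of_le _ (le_iSup_of_le _ (le_iSup_of_le (show 0 < 2 * R by linarith) le_rfl))
  have he : ∀ q : ℝ, 0 < q → eLpNorm' V q (volume.restrict Q) = (∫⁻ y in Q, ENNReal.ofReal (V y ^ q)) ^ (1 / q) := fun q hq => by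
    rw [eLpNorm']; congr 1
    refine lintegral_congr fun y => ?_
    rw [← ofReal_norm, Real.norm_of_nonneg (h0 y), ENNReal.ofReal_rpow_of_nonneg (h0 y) hq.le]
  have hH := eLpNorm'_le_eLpNorm'_mul_rpow_measure_univ h1 h2 (μ := volume.restrict Q) hV.aestronglyMeasurable
  rw [he _ h1, he _ hp, Measure.restrict_apply_univ] at hH
  have hpp := hp.ne'
  have hPP := h1.ne'
  have k1 : (∫⁻ y in Q, ENNReal.ofReal (V y ^ p)) ^ (1 / p) * volume Q ^ (1 / P - 1 / p) ≤ morrey n α p V * volume Q ^ (1 / P - α / n) := by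
    rw [ENNReal.mul_rpow_of_nonneg _ _ (by positivity), ENNReal.inv_rpow, ← ENNReal.rpow_neg, ← mul_assoc, ← ENNReal.rpow_add _ _ v2 v3, mul_comm] at hm
    refine le_trans (le_of_eq ?_) (mul_le_mul_left hm _)
    rw [mul_assoc, ← ENNReal.rpow_add _ _ v2 v3]
    congr 2; ring
  have k2 := ENNReal.rpow_le_rpow (hH.trans k1) h1.le
  rw [← ENNReal.rpow_mul, one_div_mul_cancel hPP, ENNReal.rpow_one, ENNReal.mul_rpow_of_nonneg _ _ h1.le, ← ENNReal.rpow_mul, v1, ← ENNReal.rpow_natCast, ← ENNReal.rpow_mul, ENNReal.ofReal_rpow_of_pos (by linarith)] at k2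
  refine (lintegral_mono_set hs).trans (k2.trans (le_of_eq ?_))
  congr 4
  field_simp

lemma FB2 {n : ℕ} (hn : 3 ≤ n) {γ P l : ℝ} (h0 : 1/2 ≤ γ) (h1 : γ < 1) (hP : 1 < P) (hl : l = n/2 - 1/P * ((n - γ)/2)) :
    ∃ C : ℝ≥0∞, C ≠ ⊤ ∧ ∀ (u : Euc n → ℝ), Measurable u →
    (∀ (x : Euc n) (R : ℝ), 0 < R → ∫⁻ y in ball x R, ENNReal.ofReal (u y) ≤ ENNReal.ofReal (R ^ γ)) →
    ∀ (N : ℝ) (φ ψ : Euc n → ℂ), 1 ≤ N → Adm φ → Adm ψ → (∀ x, φ x ≠ 0 → 1 / N ≤ u x ∧ u x ≤ N) → (∀ x, ψ x ≠ 0 → 1 / N ≤ u x ∧ u x ≤ N) →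
    ∀ k : ℕ, l ≤ 2 ^ (k+1) - 3/2 →
    ‖∫ p : Euc n × Euc n, Kt l (2 ^ (k+1) - 3/2) (2 ^ (k+1) - 1) p *
      ((((‖p.1‖ ^ (-l) : ℝ) : ℂ) * φ p.1) * (((‖p.2‖ ^ (-l) : ℝ) : ℂ) * ψ p.2)) ∂(volume.prod volume)‖ₑ ≤
      C * (L2n (fun x => ((u x ^ (-(1 / P / 2)) : ℝ) : ℂ) * φ x) * L2n (fun x => ((u x ^ (-(1 / P / 2)) : ℝ) : ℂ) * ψ x)) := by
  obtain ⟨C, hC, H⟩ := FB hn h0 h1 hP hl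
  have hn3 : (3:ℝ) ≤ n := by exact_mod_cast hn
  refine ⟨C, hC, fun u hu hg N φ ψ hN hφ hψ hφN hψN k hk => ?_⟩
  have hN0 : 0 < N := by linarith
  obtain ⟨ω, hω⟩ : ∃ ω : Euc n → ℝ, ω = fun x => ((n - γ) * Real.log ‖x‖ + Real.log (u x)) / 2 := ⟨_, rfl⟩
  have lg : ∀ {K y : ℝ}, 0 < K → 1 / K ≤ y → y ≤ K → |Real.log y| ≤ K := fun {K y} hK h h' => by
    have hy : 0 < y := lt_of_lt_of_le (by positivity) h
    have := Real.log_le_log (by positivity) h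
    rw [Real.log_div one_ne_zero hK.ne', Real.log_one] at this
    rw [abs_le]
    constructor <;> linarith [Real.log_le_log hy h', Real.log_le_self hK.le]
  obtain ⟨K, hK1, hK⟩ := hφ.2
  obtain ⟨K', hK1', hK'⟩ := hψ.2
  have bd : ∀ {g : Euc n → ℂ} {k : ℝ}, 1 ≤ k → k ≤ K + K' → (∀ x, g x ≠ 0 → 1 / k ≤ ‖x‖ ∧ ‖x‖ ≤ k) → (∀ x, g x ≠ 0 → 1 / N ≤ u x ∧ u x ≤ N) →
      ∀ x, g x ≠ 0 → |ω x| ≤ n * (K + K') + N ∧ ENNReal.ofReal (u x) ≤ ENNReal.ofReal (n * (K + K') + N) := fun {g k} k1 k2 h1' h2 x hx => by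
    have a := lg (by linarith) (h1' x hx).1 (h1' x hx).2
    have b := lg hN0 (h2 x hx).1 (h2 x hx).2
    have c : 0 ≤ n * (K + K') := by positivity
    refine ⟨?_, ENNReal.ofReal_le_ofReal (by linarith [(h2 x hx).2])⟩
    simp only [hω]
    rw [abs_div, abs_two]
    have d := abs_add_le ((n - γ) * Real.log ‖x‖) (Real.log (u x))
    rw [abs_mul, abs_of_nonneg (show 0 ≤ n - γ by linarith)] at d
    have : (n - γ) * |Real.log ‖x‖| ≤ n * (K + K') := mul_le_mul (by linarith) (by linarith) (abs_nonneg _) (by positivity)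
    linarith
  have ex : ∀ {g : Euc n → ℂ}, Adm g → (∀ x, g x ≠ 0 → 1 / N ≤ u x ∧ u x ≤ N) → ∀ x, g x ≠ 0 →
      ENNReal.ofReal (Real.exp (ω x) * ‖x‖ ^ (-(n/2:ℝ))) ^ (2:ℝ) ≤ ENNReal.ofReal (‖x‖ ^ (-γ)) * ENNReal.ofReal (u x) := fun {g} hg h2 x hx => by
    have a := hg.ne hx
    have b : 0 < u x := lt_of_lt_of_le (by positivity) (h2 x hx).1
    rw [ENNReal.ofReal_rpow_of_nonneg (by positivity) (by norm_num), ← ENNReal.ofReal_mul (by positivity)]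
    refine ENNReal.ofReal_le_ofReal (le_of_eq ?_)
    rw [← Real.exp_log b, Real.rpow_def_of_pos a, Real.rpow_def_of_pos a, ← Real.exp_add, ← Real.exp_mul, ← Real.exp_add]
    simp only [hω]; congr 1; ring
  have tw : ∀ {g : Euc n → ℂ}, Adm g → (∀ x, g x ≠ 0 → 1 / N ≤ u x ∧ u x ≤ N) →
      Adm (fun x => ((u x ^ (-(1 / P / 2)) : ℝ) : ℂ) * g x) ∧ ∀ x, ((‖x‖ ^ (-(n/2:ℝ)) : ℝ) : ℂ) * (Complex.exp ((1/P:ℝ) * ω x) * (((u x ^ (-(1 / P / 2)) : ℝ) : ℂ) * g x)) = ((‖x‖ ^ (-l) : ℝ) : ℂ) * g x := fun {g} hg h2 => by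
    refine ⟨hg.twist (Complex.measurable_ofReal.comp (by fun_prop)) (M := (1 / N) ^ (-(1 / P / 2))) fun x hx => ?_, fun x => ?_⟩
    · have b : 0 < u x := lt_of_lt_of_le (by positivity) (h2 x hx).1
      rw [Complex.norm_real, Real.norm_of_nonneg (by positivity)]
      exact Real.rpow_le_rpow_of_nonpos (by positivity) (h2 x hx).1 (neg_nonpos.2 (by positivity))
    · by_cases hx : g x = 0
      · simp [hx]
      have a := hg.ne hx
      have b : 0 < u x := lt_of_lt_of_le (by positivity) (h2 x hx).1
      rw [← mul_assoc, ← mul_assoc]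
      congr 1
      rw [← Complex.ofReal_mul, ← Complex.ofReal_exp, ← Complex.ofReal_mul, ← Complex.ofReal_mul]
      congr 1
      rw [Real.rpow_def_of_pos a, Real.rpow_def_of_pos b, Real.rpow_def_of_pos a, ← Real.exp_add, ← Real.exp_add, hl]
      simp only [hω]; congr 1; ring
  obtain ⟨a1, t1⟩ := tw hφ hφN
  obtain ⟨a2, t2⟩ := tw hψ hψN
  have := H (fun x => ENNReal.ofReal (u x)) (by fun_prop) hg ω (n * (K + K') + N) _ _ (by rw [hω]; fun_prop) a1 a2
    (fun x hx => bd hK1 (by linarith) hK hφN x (right_ne_zero_of_mul hx)) (fun x hx => bd hK1' (by linarith) hK' hψN x (right_ne_zero_of_mul hx))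
    (fun x hx => ex hφ hφN x (right_ne_zero_of_mul hx)) (fun x hx => ex hψ hψN x (right_ne_zero_of_mul hx)) k hk
  refine le_of_eq_of_le ?_ this
  congr 1
  refine integral_congr_ae (.of_forall fun p => ?_)
  simp only [wt]
  rw [← t1, ← t2, Complex.ofReal_mul]; ring

lemma adm_cs {n : ℕ} {g : Euc n → ℂ} (h1 : Continuous g) (h2 : HasCompactSupport g) (h3 : tsupport g ⊆ {x | x ≠ 0}) : Adm g := by
  obtain ⟨δ, d0, d⟩ := far0 h3
  obtain ⟨R, hR⟩ := h2.isCompact.isBounded.subset_ball (0 : Euc n)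
  obtain ⟨B, hB⟩ := h2.exists_bound_of_continuous h1
  refine ⟨⟨h1.measurable, B, hB⟩, max 1 (max R (1 / δ)), le_max_left _ _, fun x hx => ⟨?_, ?_⟩⟩
  · have : δ ≤ ‖x‖ := by by_contra h; exact hx (d x (not_le.1 h))
    refine le_trans ?_ this
    rw [one_div_le (by positivity) d0]
    exact (le_max_right _ _).trans (le_max_right _ _)
  · have : ‖x‖ < R := by simpa using hR (subset_tsupport _ hx)
    exact this.le.trans ((le_max_left _ _).trans (le_max_right _ _))

lemma ub {P a b M : ℝ} (hP : 1 < P) (ha : 0 ≤ a) (hb : 0 ≤ b) (hM : 0 < M) : a ≤ 4 * M * (1 / 4 * ((a / M) ^ P + b)) ^ (1 / P) := by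
  have h1 : (a / M / 4) ^ P ≤ 1 / 4 * ((a / M) ^ P + b) := by
    rw [Real.div_rpow (by positivity) (by norm_num)]
    have : (4:ℝ) ≤ 4 ^ P := by simpa using Real.rpow_le_rpow_of_exponent_le (show (1:ℝ) ≤ 4 by norm_num) hP.le
    have h3 : (a / M) ^ P / 4 ^ P ≤ (a / M) ^ P / 4 := by gcongr
    linarith
  have h2 := Real.rpow_le_rpow (by positivity) h1 (show 0 ≤ 1 / P by positivity)
  rw [← Real.rpow_mul (by positivity), mul_one_div_cancel (by linarith), Real.rpow_one, div_div, div_le_iff₀ (by positivity)] at h2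
  linarith

lemma dct {n : ℕ} {l : ℝ} (t : ℝ) (M : ℕ) (l0 : 0 < l) (ln : 2 * l < n) {φ ψ : Euc n → ℂ} (hφ : Adm φ) (hψ : Adm ψ) {S : ℕ → Set (Euc n)}
    (Sm : ∀ j, MeasurableSet (S j)) (hae : ∀ᵐ y, ψ y ≠ 0 → ∀ᶠ j in atTop, y ∈ S j) {D : ℝ≥0∞}
    (hD : ∀ j, ‖∫ z, Kt l t M z * (φ z.1 * (S j).indicator ψ z.2) ∂(volume.prod volume)‖ₑ ≤ D) :
    ‖∫ z, Kt l t M z * (φ z.1 * ψ z.2) ∂(volume.prod volume)‖ₑ ≤ D := by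
  have hi := Kt_int t M l0 ln hφ hψ
  have mK := Kt_meas (n := n) l t M
  have m1 := hφ.1.1
  have m2 := hψ.1.1
  refine le_of_tendsto' (Filter.Tendsto.enorm (tendsto_integral_of_dominated_convergence (fun z => ‖Kt l t M z * (φ z.1 * ψ z.2)‖) (F := fun (j : ℕ) z => Kt l t M z * (φ z.1 * (S j).indicator ψ z.2)) (fun j => ?_) hi.norm (fun j => ?_) ?_)) hD
  · have := m2.indicator (Sm j)
    exact (mK.mul ((m1.comp measurable_fst).mul (this.comp measurable_snd))).aestronglyMeasurable
  · refine Filter.Eventually.of_forall fun z => ?_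
    simp only [norm_mul]
    gcongr
    exact norm_indicator_le_norm_self _ _
  · have h2 := (Measure.quasiMeasurePreserving_snd (μ := (volume : Measure (Euc n))) (ν := (volume : Measure (Euc n)))).ae hae
    filter_upwards [h2] with z hz
    refine tendsto_const_nhds.congr' ?_
    by_cases h : ψ z.2 = 0
    · refine Filter.Eventually.of_forall fun j => ?_
      have : (S j).indicator ψ z.2 = 0 := by classical rw [indicator_apply]; split_ifs <;> simp [h]
      simp only [this, h]
    · filter_upwards [hz h] with j hj
      simp only [indicator_of_mem hj]

lemma fub {n : ℕ} {l : ℝ} (t : ℝ) (M : ℕ) (hn : 3 ≤ n) (l0 : 0 < l) (ln : 2 * l < n) {φ ψ F : Euc n → ℂ} (hφ : Adm φ) (hψ : Adm ψ)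
    (hF : ∀ x, x ≠ 0 → ∫ y, Kt l t M (x, y) * ψ y = F x) :
    ∫ z, Kt l t M z * (φ z.1 * ψ z.2) ∂(volume.prod volume) = ∫ x, φ x * F x := by
  rw [integral_prod _ (Kt_int t M l0 ln hφ hψ)]
  refine integral_congr_ae (Filter.Eventually.of_forall fun x => ?_)
  simp only
  by_cases h : φ x = 0
  · simp [h]
  · rw [← hF x (norm_pos_iff.1 (hφ.ne h)), ← integral_const_mul]
    congr 1; ext y; ring

lemma canc {A a b B c C : ℝ≥0∞} (hA : A ≠ ⊤) (c0 : c ≠ 0) (ct : c ≠ ⊤) (h : c * A ≤ C * ((a * A) ^ (1/2:ℝ) * (b * B) ^ (1/2:ℝ))) :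
    A ^ (1/2:ℝ) ≤ c⁻¹ * (C * (a * b) ^ (1/2:ℝ)) * B ^ (1/2:ℝ) := by
  by_cases h0 : A = 0
  · simp [h0]
  have e1 : A = A ^ (1/2:ℝ) * A ^ (1/2:ℝ) := by rw [← ENNReal.rpow_add_of_nonneg _ _ (by norm_num) (by norm_num)]; norm_num
  have p0 : A ^ (1/2:ℝ) ≠ 0 := by simp [h0]
  have pt : A ^ (1/2:ℝ) ≠ ⊤ := by simp [hA]
  rw [ENNReal.mul_rpow_of_nonneg _ _ (by norm_num), ENNReal.mul_rpow_of_nonneg _ _ (by norm_num)] at h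
  rw [ENNReal.mul_rpow_of_nonneg _ _ (by norm_num)]
  generalize A ^ (1/2:ℝ) = s at *
  rw [e1] at h
  have h2 : s * (c * s) ≤ s * (C * (a ^ (1/2:ℝ) * b ^ (1/2:ℝ)) * B ^ (1/2:ℝ)) := by
    calc _ = c * (s * s) := by ring
      _ ≤ _ := h
      _ = _ := by ring
  have h3 := (ENNReal.mul_le_mul_iff_right p0 pt).1 h2
  calc s = c⁻¹ * (c * s) := by rw [← mul_assoc, ENNReal.inv_mul_cancel c0 ct, one_mul]
    _ ≤ c⁻¹ * _ := mul_le_mul_right h3 _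
    _ = _ := by ring

lemma Adm.pwt {n : ℕ} {φ : Euc n → ℂ} (h : Adm φ) (e : ℝ) : Adm fun x => ((‖x‖ ^ e : ℝ) : ℂ) * φ x := by
  obtain ⟨B, b0, hB⟩ := h.pw e
  refine h.twist (Complex.measurable_ofReal.comp (by fun_prop)) (M := B) fun x hx => ?_
  rw [Complex.norm_real, Real.norm_of_nonneg (by positivity)]; exact hB x hx

lemma Adm.ind {n : ℕ} {φ : Euc n → ℂ} (h : Adm φ) {S : Set (Euc n)} (hS : MeasurableSet S) : Adm (S.indicator φ) := by
  have := h.twist (c := S.indicator fun _ => (1:ℂ)) (measurable_const.indicator hS) (M := 1) fun x hx => by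
    refine (norm_indicator_le_norm_self _ _).trans (by simp)
  convert this using 2 with x
  by_cases hx : x ∈ S <;> simp [hx]

lemma ssq {u P : ℝ} (hu : 0 < u) : (u ^ (-(1/P/2))) ^ 2 * u ^ (1/P) = 1 := by
  rw [← Real.rpow_natCast, ← Real.rpow_mul hu.le, ← Real.rpow_add hu]
  norm_num

lemma pt1 {u P V M w : ℝ} {z : ℂ} (hu : 0 < u) (hV : 0 ≤ V) (hw : 0 ≤ w) (h : V ≤ 4 * M * u ^ (1/P)) :
    ‖((u ^ (-(1/P/2)) : ℝ) : ℂ) * (((w * V : ℝ) : ℂ) * starRingEnd ℂ z)‖ₑ ^ (2:ℝ) ≤ ENNReal.ofReal (4 * M) * (ENNReal.ofReal w ^ (2:ℝ) * ‖z‖ₑ ^ (2:ℝ) * ENNReal.ofReal V) := by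
  have e1 : (u ^ (-(1/P/2))) ^ 2 * V ≤ 4 * M := by
    calc _ ≤ (u ^ (-(1/P/2))) ^ 2 * (4 * M * u ^ (1/P)) := mul_le_mul_of_nonneg_left h (by positivity)
      _ = 4 * M * ((u ^ (-(1/P/2))) ^ 2 * u ^ (1/P)) := by ring
      _ = _ := by rw [ssq hu, mul_one]
  have e2 : ‖starRingEnd ℂ z‖ₑ = ‖z‖ₑ := by rw [← ofReal_norm, RCLike.norm_conj, ofReal_norm]
  have e3 : ∀ r : ℝ, 0 ≤ r → ‖(r : ℂ)‖ₑ = ENNReal.ofReal r := fun r hr => by rw [← ofReal_norm, Complex.norm_real, Real.norm_of_nonneg hr]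
  have hs : 0 ≤ u ^ (-(1/P/2)) := by positivity
  simp only [ENNReal.rpow_two, enorm_mul, e2]
  rw [e3 _ hs, e3 _ (by positivity), ENNReal.ofReal_mul hw]
  calc _ = (ENNReal.ofReal (u ^ (-(1/P/2))) ^ 2 * ENNReal.ofReal V) * (ENNReal.ofReal w ^ 2 * ‖z‖ₑ ^ 2 * ENNReal.ofReal V) := by ring
    _ ≤ _ := by
      refine mul_le_mul_left ?_ _
      rw [← ENNReal.ofReal_pow hs, ← ENNReal.ofReal_mul (by positivity)]
      exact ENNReal.ofReal_le_ofReal e1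

lemma pt2 {u P V M w : ℝ} {z : ℂ} (hu : 0 < u) (hV : 0 ≤ V) (hM : 0 < M) (hw : 0 ≤ w) (h : V ≤ 4 * M * u ^ (1/P)) :
    ‖((u ^ (-(1/P/2)) : ℝ) : ℂ) * ((w : ℂ) * z)‖ₑ ^ (2:ℝ) ≤ ENNReal.ofReal (4 * M) * (ENNReal.ofReal w ^ (2:ℝ) * ‖z‖ₑ ^ (2:ℝ) * (ENNReal.ofReal V)⁻¹) := by
  have e1 : (u ^ (-(1/P/2))) ^ 2 * V ≤ 4 * M := by
    calc _ ≤ (u ^ (-(1/P/2))) ^ 2 * (4 * M * u ^ (1/P)) := mul_le_mul_of_nonneg_left h (by positivity)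
      _ = 4 * M * ((u ^ (-(1/P/2))) ^ 2 * u ^ (1/P)) := by ring
      _ = _ := by rw [ssq hu, mul_one]
  have e3 : ∀ r : ℝ, 0 ≤ r → ‖(r : ℂ)‖ₑ = ENNReal.ofReal r := fun r hr => by rw [← ofReal_norm, Complex.norm_real, Real.norm_of_nonneg hr]
  have hs : 0 ≤ u ^ (-(1/P/2)) := by positivity
  simp only [ENNReal.rpow_two, enorm_mul]
  rw [e3 _ hs, e3 _ hw]
  calc _ = (ENNReal.ofReal (u ^ (-(1/P/2))) ^ 2) * (ENNReal.ofReal w ^ 2 * ‖z‖ₑ ^ 2) := by ring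
    _ ≤ (ENNReal.ofReal (4 * M) * (ENNReal.ofReal V)⁻¹) * (ENNReal.ofReal w ^ 2 * ‖z‖ₑ ^ 2) := by
      refine mul_le_mul_left ?_ _
      rw [← ENNReal.ofReal_pow hs, ← div_eq_mul_inv]
      refine (ENNReal.le_div_iff_mul_le (Or.inr (by simpa using hM)) (Or.inl (by simp))).2 ?_
      rw [← ENNReal.ofReal_mul (by positivity)]
      exact ENNReal.ofReal_le_ofReal e1
    _ = _ := by ring

lemma core {n : ℕ} (hn : 3 ≤ n) {α γ P l : ℝ} (g0 : 1/2 ≤ γ) (g1 : γ < 1) (hP : 1 < P) (a0 : 0 < α) (an : α < n) (hl : l = (n - α) / 2) (hγ : γ = n - α * P) :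
    ∃ C : ℝ≥0∞, C ≠ ⊤ ∧ ∀ (V1 V : Euc n → ℝ) (M1 Mv : ℝ), Measurable V1 → Measurable V → (∀ x, 0 ≤ V1 x) → (∀ x, 0 ≤ V x) → 0 < M1 → 0 < Mv →
    (∀ (x : Euc n) R, 0 < R → ∫⁻ y in ball x R, ENNReal.ofReal (V1 y ^ P) ≤ ENNReal.ofReal (M1 ^ P * (2 * R) ^ γ)) →
    (∀ (x : Euc n) R, 0 < R → ∫⁻ y in ball x R, ENNReal.ofReal (V y ^ P) ≤ ENNReal.ofReal (Mv ^ P * (2 * R) ^ γ)) →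
    ∀ (m : ℕ) (t e : ℝ), t = 2 ^ (m+1) - 3/2 → e = -t - l → l ≤ t → ∀ f Lf : Euc n → ℂ, ContDiff ℝ (⊤ : ℕ∞) f → HasCompactSupport f →
    tsupport f ⊆ {x | x ≠ 0} → ContDiff ℝ (⊤ : ℕ∞) Lf → HasCompactSupport Lf → tsupport Lf ⊆ {x | x ≠ 0} → (∀ ξ : Euc n, 𝓕 Lf ξ = (‖ξ‖ ^ α : ℝ) • 𝓕 f ξ) →
    (∀ᵐ y, Lf y ≠ 0 → 0 < V y) → (∫⁻ x, ENNReal.ofReal (‖x‖ ^ e) ^ (2:ℝ) * ‖f x‖ₑ ^ (2:ℝ) * ENNReal.ofReal (V1 x)) ^ (1/2:ℝ) ≤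
      C * (ENNReal.ofReal M1 * ENNReal.ofReal Mv) ^ (1/2:ℝ) * (∫⁻ x, ENNReal.ofReal (‖x‖ ^ e) ^ (2:ℝ) * ‖Lf x‖ₑ ^ (2:ℝ) * (ENNReal.ofReal (V x))⁻¹) ^ (1/2:ℝ) := by
  have hP0 : 0 < P := by linarith
  obtain ⟨C0, hC0, H⟩ := FB2 hn g0 g1 hP (l := l) (by rw [hl, hγ]; field_simp; ring)
  obtain ⟨c, c0, Hr⟩ := rep a0 an hl
  have ce : ‖c‖ₑ ≠ 0 := by simpa using c0
  refine ⟨‖c‖ₑ⁻¹ * (C0 * 4), ENNReal.mul_ne_top (ENNReal.inv_ne_top.2 ce) (by finiteness), fun V1 V M1 Mv m1 m2 p1 p2 q1 q2 b1 b2 m t e ht he hlt f Lf f1 f2 f3 l1 l2 l3 hL hae => ?_⟩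
  obtain ⟨u, hu⟩ : ∃ u : Euc n → ℝ, u = fun x => 1 / 4 * ((V1 x / M1) ^ P + (V x / Mv) ^ P) := ⟨_, rfl⟩
  have um : Measurable u := by rw [hu]; fun_prop
  have u1 : ∀ x, V1 x ≤ 4 * M1 * u x ^ (1 / P) := fun x => by
    have := p1 x; have := p2 x; simp only [hu]; exact ub hP (p1 x) (by positivity) q1
  have u2 : ∀ x, V x ≤ 4 * Mv * u x ^ (1 / P) := fun x => by
    have := p1 x; have := p2 x; simp only [hu]; rw [add_comm]; exact ub hP (p2 x) (by positivity) q2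
  have up : ∀ x, 0 < V1 x ∨ 0 < V x → 0 < u x := fun x h => by
    have := p1 x; have := p2 x; simp only [hu]
    rcases h with h | h <;> positivity
  have ug : ∀ (x : Euc n) (R : ℝ), 0 < R → ∫⁻ y in ball x R, ENNReal.ofReal (u y) ≤ ENNReal.ofReal (R ^ γ) := fun x R hR => by
    have e1 : ∀ y, ENNReal.ofReal (u y) = ENNReal.ofReal (1 / 4 * (M1 ^ P)⁻¹) * ENNReal.ofReal (V1 y ^ P) + ENNReal.ofReal (1 / 4 * (Mv ^ P)⁻¹) * ENNReal.ofReal (V y ^ P) := fun y => by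
      have := p1 y; have := p2 y
      rw [← ENNReal.ofReal_mul (by positivity), ← ENNReal.ofReal_mul (by positivity), ← ENNReal.ofReal_add (by positivity) (by positivity)]
      simp only [hu]; rw [Real.div_rpow (p1 y) q1.le, Real.div_rpow (p2 y) q2.le]; congr 1; ring
    simp only [e1]
    rw [lintegral_add_left (by fun_prop), lintegral_const_mul _ (by fun_prop), lintegral_const_mul _ (by fun_prop)]
    refine (add_le_add (mul_le_mul_right (b1 x R hR) _) (mul_le_mul_right (b2 x R hR) _)).trans ?_
    rw [← ENNReal.ofReal_mul (by positivity), ← ENNReal.ofReal_mul (by positivity), ← ENNReal.ofReal_add (by positivity) (by positivity)]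
    refine ENNReal.ofReal_le_ofReal ?_
    rw [Real.mul_rpow (by norm_num) hR.le]
    have : (2:ℝ) ^ γ ≤ 2 := by simpa using Real.rpow_le_rpow_of_exponent_le (show (1:ℝ) ≤ 2 by norm_num) g1.le
    have h3 : (0:ℝ) < R ^ γ := by positivity
    field_simp
    nlinarith
  obtain ⟨S, hS⟩ : ∃ S : ℕ → Set (Euc n), S = fun (j : ℕ) => {x : Euc n | 1 / ((j:ℝ) + 1) ≤ u x ∧ u x ≤ j + 1} := ⟨_, rfl⟩
  have Sm : ∀ j, MeasurableSet (S j) := fun j => by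
    rw [hS]; exact (measurableSet_le measurable_const um).inter (measurableSet_le um measurable_const)
  have Smono : ∀ {i j : ℕ}, i ≤ j → S i ⊆ S j := fun {i j} hij x hx => by
    rw [hS] at hx ⊢
    have : (i:ℝ) ≤ j := by exact_mod_cast hij
    exact ⟨le_trans (one_div_le_one_div_of_le (by positivity) (by linarith)) hx.1, by linarith [hx.2]⟩
  have Sev : ∀ x, 0 < u x → ∀ᶠ j in atTop, x ∈ S j := fun x hx => by
    obtain ⟨j, hj⟩ := exists_nat_ge (max (u x) (1 / u x))
    filter_upwards [eventually_ge_atTop j] with i hi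
    have : (j:ℝ) ≤ i := by exact_mod_cast hi
    rw [hS]
    refine ⟨?_, by linarith [le_max_left (u x) (1 / u x)]⟩
    rw [one_div_le (by positivity) hx]; linarith [le_max_right (u x) (1 / u x)]
  have l0 : 0 < l := by rw [hl]; linarith
  have ln : 2 * l < n := by rw [hl]; linarith
  have Sp : ∀ {j : ℕ} {x : Euc n}, x ∈ S j → 0 < u x := fun {j x} hx => by
    rw [hS] at hx
    exact lt_of_lt_of_le (by positivity) hx.1
  have af := adm_cs f1.continuous f2 f3
  have aL := adm_cs l1.continuous l2 l3
  have acf : Adm fun x => starRingEnd ℂ (f x) := ⟨af.1.conj, by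
    obtain ⟨k, hk, h⟩ := af.2
    exact ⟨k, hk, fun x hx => h x (by simpa using hx)⟩⟩
  obtain ⟨q, hq⟩ : ∃ q : Euc n → ℝ≥0∞, q = fun x => ENNReal.ofReal (‖x‖ ^ e) ^ (2:ℝ) * ‖f x‖ₑ ^ (2:ℝ) * ENNReal.ofReal (V1 x) := ⟨_, rfl⟩
  have qm : Measurable q := by
    have := af.1.1
    rw [hq]; fun_prop
  obtain ⟨B, hB⟩ : ∃ B : ℝ≥0∞, B = ∫⁻ x, ENNReal.ofReal (‖x‖ ^ e) ^ (2:ℝ) * ‖Lf x‖ₑ ^ (2:ℝ) * (ENNReal.ofReal (V x))⁻¹ := ⟨_, rfl⟩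
  have key : ∀ k : ℕ, (∫⁻ x, (S k).indicator q x) ^ (1/2:ℝ) ≤ ‖c‖ₑ⁻¹ * (C0 * (ENNReal.ofReal (4 * M1) * ENNReal.ofReal (4 * Mv)) ^ (1/2:ℝ)) * B ^ (1/2:ℝ) := fun k => by
    obtain ⟨h1, hh1⟩ : ∃ h1 : Euc n → ℂ, h1 = fun x => (S k).indicator (fun x => ((‖x‖ ^ e * V1 x : ℝ) : ℂ)) x * starRingEnd ℂ (f x) := ⟨_, rfl⟩
    have ah1 : Adm h1 := by
      obtain ⟨B1, b10, hB1⟩ := acf.pw e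
      rw [hh1]
      refine acf.twist ((Complex.measurable_ofReal.comp (by fun_prop)).indicator (Sm k)) (M := B1 * (4 * M1 * (k + 1) ^ (1/P))) fun x hx => ?_
      by_cases hxS : x ∈ S k
      · rw [indicator_of_mem hxS, Complex.norm_real, Real.norm_of_nonneg (mul_nonneg (by positivity) (p1 x))]
        refine mul_le_mul (hB1 x hx) ((u1 x).trans ?_) (p1 x) b10
        have h3 := Sp hxS
        rw [hS] at hxS
        have := Real.rpow_le_rpow h3.le hxS.2 (show 0 ≤ 1/P by positivity)
        gcongr
      · rw [indicator_of_notMem hxS, norm_zero]; positivity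
    have ah1' := ah1.pwt (-l)
    have aG := aL.pwt e
    have aG' := aG.pwt (-l)
    have hD : ‖∫ z, Kt l t (2 ^ (m+1) - 1) z * ((((‖z.1‖ ^ (-l) : ℝ) : ℂ) * h1 z.1) * (((‖z.2‖ ^ (-l) : ℝ) : ℂ) * (((‖z.2‖ ^ e : ℝ) : ℂ) * Lf z.2))) ∂(volume.prod volume)‖ₑ
        ≤ C0 * ((ENNReal.ofReal (4 * M1) * ∫⁻ x, (S k).indicator q x) ^ (1/2:ℝ) * (ENNReal.ofReal (4 * Mv) * B) ^ (1/2:ℝ)) := by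
      refine dct t (2 ^ (m+1) - 1) l0 ln ah1' aG' Sm ?_ fun j => ?_
      · filter_upwards [hae] with y hy hy2
        exact Sev y (up y (Or.inr (hy (right_ne_zero_of_mul (right_ne_zero_of_mul hy2)))))
      obtain ⟨h2, hh2⟩ : ∃ h2 : Euc n → ℂ, h2 = (S j).indicator fun x => ((‖x‖ ^ e : ℝ) : ℂ) * Lf x := ⟨_, rfl⟩
      have ah2 : Adm h2 := by rw [hh2]; exact aG.ind (Sm j)
      have hN := H u um ug ((k + 1 : ℝ) + (j + 1)) h1 h2 (by have := Nat.cast_nonneg (α := ℝ) k; have := Nat.cast_nonneg (α := ℝ) j; linarith) ah1 ah2 (fun x hx => ?_) (fun x hx => ?_) m (ht ▸ hlt)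
      · rw [← ht] at hN
        have e1 : ∀ z : Euc n × Euc n, (S j).indicator (fun x => ((‖x‖ ^ (-l) : ℝ) : ℂ) * (((‖x‖ ^ e : ℝ) : ℂ) * Lf x)) z.2 = ((‖z.2‖ ^ (-l) : ℝ) : ℂ) * h2 z.2 := fun z => by
          rw [hh2]; by_cases hz : z.2 ∈ S j <;> simp [hz]
        simp only [e1]
        refine hN.trans (mul_le_mul_right (mul_le_mul' ?_ ?_) _)
        · refine ENNReal.rpow_le_rpow ?_ (by norm_num)
          rw [← lintegral_const_mul' _ _ ENNReal.ofReal_ne_top]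
          refine lintegral_mono fun x => ?_
          simp only [hh1, hq]
          by_cases hx : x ∈ S k
          · rw [indicator_of_mem hx, indicator_of_mem hx]
            exact pt1 (Sp hx) (p1 x) (by positivity) (u1 x)
          · simp [hx]
        · refine ENNReal.rpow_le_rpow ?_ (by norm_num)
          rw [hB, ← lintegral_const_mul' _ _ ENNReal.ofReal_ne_top]
          refine lintegral_mono fun x => ?_
          simp only [hh2]
          by_cases hx : x ∈ S j
          · rw [indicator_of_mem hx]
            exact pt2 (Sp hx) (p2 x) q2 (by positivity) (u2 x)
          · simp [hx]
      · have hx : x ∈ S k := by by_contra h; exact hx (by simp [hh1, h])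
        rw [hS] at hx
        have hj := Nat.cast_nonneg (α := ℝ) j
        exact ⟨le_trans (one_div_le_one_div_of_le (by positivity) (by linarith)) hx.1, by linarith [hx.2]⟩
      · have hx : x ∈ S j := by by_contra h; exact hx (by simp [hh2, h])
        rw [hS] at hx
        have hj := Nat.cast_nonneg (α := ℝ) k
        exact ⟨le_trans (one_div_le_one_div_of_le (by positivity) (by linarith)) hx.1, by linarith [hx.2]⟩
    rw [fub t (2 ^ (m+1) - 1) hn l0 ln ah1' aG' (F := fun x => c * (((‖x‖ ^ (-t) : ℝ) : ℂ) * f x)) fun x hx => ?_] at hD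
    · obtain ⟨Q, hQ⟩ : ∃ Q : Euc n → ℝ, Q = (S k).indicator fun x => (‖x‖ ^ e) ^ 2 * ‖f x‖ ^ 2 * V1 x := ⟨_, rfl⟩
      have Q0 : ∀ x, 0 ≤ Q x := fun x => by
        rw [hQ]; exact indicator_nonneg (fun x _ => mul_nonneg (by positivity) (p1 x)) x
      have e1 : ∀ x, (((‖x‖ ^ (-l) : ℝ) : ℂ) * h1 x) * (c * (((‖x‖ ^ (-t) : ℝ) : ℂ) * f x)) = c * ((Q x : ℝ) : ℂ) := fun x => by
        rw [hh1, hQ]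
        by_cases hx : x ∈ S k
        · by_cases h0 : f x = 0
          · simp [h0]
          have e2 : ‖x‖ ^ e = ‖x‖ ^ (-l) * ‖x‖ ^ (-t) := by rw [← Real.rpow_add (af.ne h0), he]; congr 1; ring
          have e3 : starRingEnd ℂ (f x) * f x = ((‖f x‖ ^ 2 : ℝ) : ℂ) := by rw [Complex.conj_mul']; push_cast; rfl
          simp only [indicator_of_mem hx]
          calc _ = c * (((‖x‖ ^ e * V1 x : ℝ) : ℂ) * (((‖x‖ ^ (-l) : ℝ) : ℂ) * ((‖x‖ ^ (-t) : ℝ) : ℂ)) * (starRingEnd ℂ (f x) * f x)) := by ring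
            _ = _ := by rw [e3, ← Complex.ofReal_mul, ← e2]; push_cast; ring
        · simp [hx]
      simp only [e1] at hD
      have iQ : Integrable fun x => ((Q x : ℝ) : ℂ) := by
        obtain ⟨B1, hB1⟩ := af.1.2
        have : Adm fun x => (((‖x‖ ^ (-t) : ℝ) : ℂ) * f x) * (((‖x‖ ^ (-l) : ℝ) : ℂ) * h1 x) := by
          have hh := (af.pwt (-t)).1
          obtain ⟨B2, hB2⟩ := hh.2
          exact ah1'.twist hh.1 (M := B2) fun x _ => hB2 x
        have := this.fin.const_mul c
        have e4 : (fun x => c * ((((‖x‖ ^ (-t) : ℝ) : ℂ) * f x) * (((‖x‖ ^ (-l) : ℝ) : ℂ) * h1 x))) = fun x => c * ((Q x : ℝ) : ℂ) := by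
          ext x; rw [← e1]; ring
        rw [e4] at this
        have h5 := this.const_mul c⁻¹
        simpa only [inv_mul_cancel_left₀ c0] using h5
      have iQ' : Integrable Q := by simpa using iQ.re
      have e5 : ∫⁻ x, ENNReal.ofReal (Q x) = ∫⁻ x, (S k).indicator q x := by
        congr 1; ext x
        rw [hQ, hq]
        by_cases hx : x ∈ S k
        · rw [indicator_of_mem hx, indicator_of_mem hx, ENNReal.ofReal_mul (by positivity), ENNReal.ofReal_mul (by positivity), ENNReal.ofReal_pow (by positivity), ENNReal.ofReal_pow (by positivity), ofReal_norm, ENNReal.rpow_two, ENNReal.rpow_two]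
        · simp [hx]
      have e6 := ofReal_integral_eq_lintegral_ofReal iQ' (Filter.Eventually.of_forall Q0)
      rw [e5] at e6
      refine canc (by rw [← e6]; exact ENNReal.ofReal_ne_top) ce enorm_ne_top ?_
      rw [integral_const_mul, enorm_mul, integral_complex_ofReal, ← ofReal_norm (((∫ x, Q x : ℝ)) : ℂ), Complex.norm_real, Real.norm_of_nonneg (integral_nonneg Q0), e6] at hD
      exact hD
    · rw [← (Hr f Lf f1 f2 f3 l1 l2 l3 hL t (2 ^ (m+1) - 1) x hx).2]
      congr 1; ext y
      by_cases h0 : Lf y = 0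
      · simp [h0]
      have e2 : ‖y‖ ^ (-2 * l - t) = ‖y‖ ^ (-l) * ‖y‖ ^ e := by rw [← Real.rpow_add (aL.ne h0), he]; congr 1; ring
      rw [e2]; push_cast; ring
  have lim : Tendsto (fun k : ℕ => ∫⁻ x, (S k).indicator q x) atTop (nhds (∫⁻ x, q x)) := by
    refine lintegral_tendsto_of_tendsto_of_monotone (fun k => (qm.indicator (Sm k)).aemeasurable) (Filter.Eventually.of_forall fun x i j hij => ?_) (Filter.Eventually.of_forall fun x => ?_)
    · exact indicator_le_indicator_of_subset (Smono hij) (fun _ => bot_le) x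
    · refine tendsto_const_nhds.congr' ?_
      rcases (p1 x).eq_or_lt with h | h
      · refine Filter.Eventually.of_forall fun j => ?_
        have hq0 : q x = 0 := by simp [hq, ← h]
        by_cases hx : x ∈ S j <;> simp [hx, hq0]
      · filter_upwards [Sev x (up x (Or.inl h))] with j hj
        simp [hj]
  have fin := le_of_tendsto' (((ENNReal.continuous_rpow_const (y := (1/2:ℝ))).tendsto _).comp lim) key
  rw [hq, hB] at fin
  refine fin.trans (le_of_eq ?_)
  congr 1
  rw [mul_assoc, mul_assoc]
  congr 2
  rw [ENNReal.ofReal_mul (by norm_num), ENNReal.ofReal_mul (by norm_num)]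
  have e9 : ENNReal.ofReal 4 = 4 := by norm_num
  rw [e9, show (4 : ℝ≥0∞) * ENNReal.ofReal M1 * (4 * ENNReal.ofReal Mv) = 4 * 4 * (ENNReal.ofReal M1 * ENNReal.ofReal Mv) by ring, ENNReal.mul_rpow_of_nonneg _ _ (by norm_num)]
  congr 1
  rw [← pow_two, ← ENNReal.rpow_two, ← ENNReal.rpow_mul]; norm_num

lemma morrey_ind {n : ℕ} {α p : ℝ} (hp : 0 < p) {V : Euc n → ℝ} (h0 : ∀ x, 0 ≤ V x) (S : Set (Euc n)) : morrey n α p (S.indicator V) ≤ morrey n α p V := by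
  unfold morrey
  refine iSup_mono fun a => iSup_mono fun s => iSup_mono fun hs => ?_
  refine mul_le_mul_right (ENNReal.rpow_le_rpow (mul_le_mul_right (lintegral_mono fun y => ENNReal.ofReal_le_ofReal ?_) _) (by positivity)) _
  exact Real.rpow_le_rpow (indicator_nonneg (fun x _ => h0 x) y) (indicator_le_self' (fun x _ => h0 x) y) hp.le

/-- Carleman inequalities for fractional Laplacians (Proposition 1). The fractional
Laplacian `(-Δ)^{α/2} f = Lf` is encoded via the Fourier transform identity
`𝓕 Lf ξ = ‖ξ‖^α • 𝓕 f ξ`. -/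
theorem carleman_fractional (n : ℕ) (hn : 3 ≤ n) (α p : ℝ) (hα0 : 0 < α) (hαn : α < n)
    (hp : ((n : ℝ) - 1) / α < p) (V : Euc n → ℝ) (hV0 : 0 ≤ V) (hVm : Measurable V)
    (hVM : morrey n α p V ≠ ⊤) :
    ∃ (t : ℕ → ℝ) (C : ℝ≥0∞) (β : ℝ), Tendsto t atTop atTop ∧ 0 < C ∧ C < ⊤ ∧ 0 < β ∧
      ∀ (m : ℕ) (r : ℝ), 0 < r → ∀ f Lf : Euc n → ℂ,
        ContDiff ℝ (⊤ : ℕ∞) f → HasCompactSupport f → tsupport f ⊆ {x | x ≠ 0} →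
        ContDiff ℝ (⊤ : ℕ∞) Lf → HasCompactSupport Lf → tsupport Lf ⊆ {x | x ≠ 0} →
        (∀ ξ : Euc n, 𝓕 Lf ξ = (‖ξ‖ ^ α : ℝ) • 𝓕 f ξ) →
        (∫⁻ x in ball (0 : Euc n) r,
            ENNReal.ofReal (‖x‖ ^ (-(t m) - ((n : ℝ) - α) / 2)) ^ (2 : ℝ) *
              (‖f x‖₊ : ℝ≥0∞) ^ (2 : ℝ) * ENNReal.ofReal (V x)) ^ (1 / 2 : ℝ) ≤
          C * morrey n α p (Set.indicator (ball (0 : Euc n) r) V) ^ β *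
            (∫⁻ x, ENNReal.ofReal (‖x‖ ^ (-(t m) - ((n : ℝ) - α) / 2)) ^ (2 : ℝ) *
              (‖Lf x‖₊ : ℝ≥0∞) ^ (2 : ℝ) * (ENNReal.ofReal (V x))⁻¹) ^ (1 / 2 : ℝ) := by
  rcases lt_or_ge ((n:ℝ) - 1) α with hc | hc
  · refine ⟨fun m => m, 1, 1, tendsto_natCast_atTop_atTop, by simp, by simp, by simp, fun m r hr f Lf f1 f2 f3 l1 l2 l3 hL => ?_⟩
    have hf : ∀ x, f x = 0 := fun x => f_zero (fun k hk => by
      rw [hk] at hc hαn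
      have h1 : ((n:ℤ) - 1 : ℤ) < k := by exact_mod_cast hc
      have h2 : k < n := by exact_mod_cast hαn
      omega) f1 f2 l1 l2 hL (by omega) x
    simp [hf]
  have hp' : (n:ℝ) - 1 < p * α := (div_lt_iff₀ hα0).1 hp
  obtain ⟨κ, hκ⟩ : ∃ κ : ℝ, κ = min (1/4) ((p * α - (n - 1)) / 2) := ⟨_, rfl⟩
  have k0 : 0 < κ := by rw [hκ]; exact lt_min (by norm_num) (by linarith)
  have k1 : κ ≤ 1/4 := by rw [hκ]; exact min_le_left _ _
  have k2 : κ ≤ (p * α - (n - 1)) / 2 := by rw [hκ]; exact min_le_right _ _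
  obtain ⟨P, hP⟩ : ∃ P : ℝ, P = (n - 1 + 2 * κ) / α := ⟨_, rfl⟩
  have P1 : 1 < P := by rw [hP, one_lt_div hα0]; linarith
  have Pp : P ≤ p := by rw [hP, div_le_iff₀ hα0]; linarith
  have Pα : α * P = n - 1 + 2 * κ := by rw [hP]; field_simp
  have P0 : 0 < P := by linarith
  have V0 : ∀ x, 0 ≤ V x := hV0
  obtain ⟨l, hl⟩ : ∃ l : ℝ, l = (n - α) / 2 := ⟨_, rfl⟩
  obtain ⟨C, hC, H⟩ := core hn (α := α) (γ := n - α * P) (P := P) (l := l) (by rw [Pα]; linarith) (by rw [Pα]; linarith) P1 hα0 hαn hl rfl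
  obtain ⟨Mv, hMv⟩ : ∃ Mv : ℝ, Mv = (morrey n α p V).toReal + 1 := ⟨_, rfl⟩
  have Mv0 : 0 < Mv := by rw [hMv]; positivity
  have MvM : morrey n α p V ≤ ENNReal.ofReal Mv := (ENNReal.le_ofReal_iff_toReal_le hVM Mv0.le).2 (by linarith)
  obtain ⟨K, hK⟩ := exists_nat_ge l
  have two : ∀ j : ℕ, (j:ℝ) ≤ 2 ^ (j+1) - 3/2 := fun j => by
    have h : (j:ℝ) + 1 ≤ 2 ^ j := by exact_mod_cast Nat.lt_two_pow_self (n := j)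
    have : (0:ℝ) ≤ j := Nat.cast_nonneg j
    rw [pow_succ]; linarith
  refine ⟨fun m => 2 ^ (m + K + 1) - 3/2, C * ENNReal.ofReal Mv ^ (1/2:ℝ) + 1, 1/2, ?_, by simp, ?_, by norm_num, fun m r hr f Lf f1 f2 f3 l1 l2 l3 hL => ?_⟩
  · refine tendsto_atTop_mono (fun m => ?_) tendsto_natCast_atTop_atTop
    refine le_trans ?_ (two (m + K))
    push_cast; linarith [Nat.cast_nonneg (α := ℝ) K]
  · exact ENNReal.add_lt_top.2 ⟨ENNReal.mul_lt_top hC.lt_top (ENNReal.rpow_lt_top_of_nonneg (by norm_num) ENNReal.ofReal_ne_top), by simp⟩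
  simp only [← hl]
  obtain ⟨t, ht⟩ : ∃ t : ℝ, t = 2 ^ (m + K + 1) - 3/2 := ⟨_, rfl⟩
  rw [← ht]
  have lt : l ≤ t := by
    have := two (m + K)
    rw [ht]; push_cast at this; linarith [Nat.cast_nonneg (α := ℝ) m]
  obtain ⟨V1, hV1⟩ : ∃ V1 : Euc n → ℝ, V1 = indicator (ball (0 : Euc n) r) V := ⟨_, rfl⟩
  have V1m : Measurable V1 := by rw [hV1]; exact hVm.indicator measurableSet_ball
  have V10 : ∀ x, 0 ≤ V1 x := fun x => by rw [hV1]; exact indicator_nonneg (fun x _ => V0 x) x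
  have mle : morrey n α p V1 ≤ morrey n α p V := by rw [hV1]; exact morrey_ind (by linarith) V0 _
  have mt : morrey n α p V1 ≠ ⊤ := ne_top_of_le_ne_top hVM mle
  rw [← hV1]
  have lhs : ∫⁻ x in ball (0 : Euc n) r, ENNReal.ofReal (‖x‖ ^ (-t - l)) ^ (2 : ℝ) * (‖f x‖₊ : ℝ≥0∞) ^ (2 : ℝ) * ENNReal.ofReal (V x)
      = ∫⁻ x, ENNReal.ofReal (‖x‖ ^ (-t - l)) ^ (2 : ℝ) * ‖f x‖ₑ ^ (2 : ℝ) * ENNReal.ofReal (V1 x) := by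
    rw [← lintegral_indicator measurableSet_ball]
    congr 1; ext x
    rw [hV1]
    by_cases hx : x ∈ ball (0 : Euc n) r
    · rw [indicator_of_mem hx, indicator_of_mem hx]; rfl
    · rw [indicator_of_notMem hx, indicator_of_notMem hx]; simp
  rw [lhs]
  have hB1 := fun (x : Euc n) (R : ℝ) (hR : 0 < R) => MB (n := n) (by omega) (α := α) P0 Pp V1m V10 x hR
  by_cases m0 : morrey n α p V1 = 0
  · have h1 := hB1 0 r hr
    rw [m0, ENNReal.zero_rpow_of_pos P0, zero_mul, nonpos_iff_eq_zero, lintegral_eq_zero_iff (by fun_prop), Filter.EventuallyEq, ae_restrict_iff' measurableSet_ball] at h1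
    have h2 : ∫⁻ x, ENNReal.ofReal (‖x‖ ^ (-t - l)) ^ (2 : ℝ) * ‖f x‖ₑ ^ (2 : ℝ) * ENNReal.ofReal (V1 x) = 0 := by
      rw [← lintegral_zero (μ := (volume : Measure (Euc n)))]
      refine lintegral_congr_ae ?_
      filter_upwards [h1] with x hx
      have : V1 x = 0 := by
        by_cases hxb : x ∈ ball (0 : Euc n) r
        · have h3 := hx hxb
          simp only [Pi.zero_apply, ENNReal.ofReal_eq_zero] at h3
          by_contra hne
          have : 0 < V1 x := lt_of_le_of_ne (V10 x) (Ne.symm hne)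
          have : 0 < V1 x ^ P := by positivity
          linarith
        · rw [hV1, indicator_of_notMem hxb]
      simp [this]
    rw [h2]; simp
  obtain ⟨M1, hM1⟩ : ∃ M1 : ℝ, M1 = (morrey n α p V1).toReal := ⟨_, rfl⟩
  have M10 : 0 < M1 := by rw [hM1]; exact ENNReal.toReal_pos m0 mt
  have M1e : morrey n α p V1 = ENNReal.ofReal M1 := by rw [hM1, ENNReal.ofReal_toReal mt]
  by_cases hT : ∫⁻ x, ENNReal.ofReal (‖x‖ ^ (-t - l)) ^ (2 : ℝ) * ‖Lf x‖ₑ ^ (2 : ℝ) * (ENNReal.ofReal (V x))⁻¹ = ⊤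
  · have hT' : ∫⁻ x, ENNReal.ofReal (‖x‖ ^ (-t - l)) ^ (2 : ℝ) * (‖Lf x‖₊ : ℝ≥0∞) ^ (2 : ℝ) * (ENNReal.ofReal (V x))⁻¹ = ⊤ := hT
    rw [hT', ENNReal.top_rpow_of_pos (by norm_num), ENNReal.mul_top]
    · exact le_top
    · refine mul_ne_zero (by simp) ?_
      rw [Ne, ENNReal.rpow_eq_zero_iff]
      simp [m0, mt]
  have hae : ∀ᵐ y, Lf y ≠ 0 → 0 < V y := by
    have mL := l1.continuous.measurable
    filter_upwards [ae_lt_top (by fun_prop) hT] with y hy h0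
    by_contra hv
    have hv0 : ENNReal.ofReal (V y) = 0 := ENNReal.ofReal_eq_zero.2 (not_lt.1 hv)
    have hy0 : y ≠ 0 := by
      rintro rfl
      exact l3 (subset_tsupport _ h0) rfl
    have hyn := norm_pos_iff.2 hy0
    rw [hv0, ENNReal.inv_zero, ENNReal.mul_top] at hy
    · exact absurd hy (by simp)
    · refine mul_ne_zero ?_ ?_
      · have : 0 < ‖y‖ ^ (-t - l) := by positivity
        rw [Ne, ENNReal.rpow_eq_zero_iff]; simp [this]
      · rw [Ne, ENNReal.rpow_eq_zero_iff]; simp [h0]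
  have b1 : ∀ (x : Euc n) R, 0 < R → ∫⁻ y in ball x R, ENNReal.ofReal (V1 y ^ P) ≤ ENNReal.ofReal (M1 ^ P * (2 * R) ^ (n - α * P)) := fun x R hR => by
    have := hB1 x R hR
    rwa [M1e, ENNReal.ofReal_rpow_of_nonneg M10.le P0.le, ← ENNReal.ofReal_mul (by positivity)] at this
  have b2 : ∀ (x : Euc n) R, 0 < R → ∫⁻ y in ball x R, ENNReal.ofReal (V y ^ P) ≤ ENNReal.ofReal (Mv ^ P * (2 * R) ^ (n - α * P)) := fun x R hR => by
    refine (MB (n := n) (by omega) (α := α) P0 Pp hVm V0 x hR).trans ?_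
    rw [ENNReal.ofReal_mul (by positivity), ← ENNReal.ofReal_rpow_of_nonneg Mv0.le P0.le]
    exact mul_le_mul_left (ENNReal.rpow_le_rpow MvM P0.le) _
  refine (H V1 V M1 Mv V1m hVm V10 V0 M10 Mv0 b1 b2 (m + K) t _ ht rfl lt f Lf f1 f2 f3 l1 l2 l3 hL hae).trans ?_
  refine mul_le_mul_left ?_ _
  rw [M1e, ENNReal.mul_rpow_of_nonneg _ _ (by norm_num)]
  calc _ = C * ENNReal.ofReal Mv ^ (1/2:ℝ) * ENNReal.ofReal M1 ^ (1/2:ℝ) := by ring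
    _ ≤ _ := mul_le_mul_left le_self_add _
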